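/- Any two finite groups G and H, each of order 2^11 · 3 · 5 · 7^2 · 19 · 31^3 and each having prime graph degrees deg(2) = 3, deg(3) = 2, deg(5) = 2, deg(7) = 1, deg(19) = 1, deg(31) = 1, are isomorphic. -/

import Mathlib

/-- The degree of the prime `p` in the prime graph (Gruenberg–Kegel graph) `GK(G)` of the
group `G`: the number of primes `q ≠ p` such that `G` contains an element of order `p * q`
(two distinct primes being adjacent in `GK(G)` iff `G` has an element of order their
product). -/
noncomputable def gkDegree (G : Type*) [Group G] (p : ℕ) : ℕ :=
  Nat.card {q : ℕ // p ≠ q ∧ p.Prime ∧ q.Prime ∧ ∃ g : G, orderOf g = p * q}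

open scoped Pointwise
set_option linter.unusedSectionVars false
set_option linter.style.haveILetI false

namespace OD

open Subgroup

section Basic
variable {G : Type*} [Group G] [Finite G]

theorem mem_conj_smul {g x : G} {A : Subgroup G} :
    x ∈ MulAut.conj g • A ↔ g⁻¹ * x * g ∈ A := by
  rw [Subgroup.mem_pointwise_smul_iff_inv_smul_mem, ← map_inv, MulAut.smul_def, MulAut.conj_apply,
    inv_inv]

theorem conj_mem_conj_smul {g x : G} {A : Subgroup G} (hx : x ∈ A) :
    g * x * g⁻¹ ∈ MulAut.conj g • A := by
  rw [mem_conj_smul]; simpa [mul_assoc] using hx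

theorem card_conj_smul (g : G) (A : Subgroup G) :
    Nat.card (MulAut.conj g • A : Subgroup G) = Nat.card A :=
  (Nat.card_congr (Subgroup.equivSMul (MulAut.conj g) A).toEquiv).symm

theorem mem_normalizer_of_forall {A : Subgroup G} {g : G} (h : ∀ a ∈ A, g * a * g⁻¹ ∈ A) :
    g ∈ normalizer (A : Set G) := by
  have hle : MulAut.conj g • A ≤ A := by
    intro x hx
    rw [mem_conj_smul] at hx
    have := h _ hx
    simpa [mul_assoc] using this
  have heq : MulAut.conj g • A = A :=
    Subgroup.eq_of_le_of_card_ge hle (card_conj_smul g A).ge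
  rw [Subgroup.mem_normalizer_iff]
  refine fun x => ⟨h x, fun hx => ?_⟩
  rw [← heq, mem_conj_smul] at hx
  simpa [mul_assoc] using hx

theorem conj_smul_eq_iff {A : Subgroup G} {g : G} :
    MulAut.conj g • A = A ↔ g ∈ normalizer (A : Set G) := by
  constructor
  · intro h
    refine mem_normalizer_of_forall fun a ha => ?_
    have := conj_mem_conj_smul (g := g) ha
    rwa [h] at this
  · intro h
    ext x
    rw [mem_conj_smul]
    have := (Subgroup.mem_normalizer_iff.mp h (g⁻¹ * x * g))
    rw [this]
    simp [mul_assoc]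

theorem centralizer_conj_smul (g : G) (A : Subgroup G) :
    centralizer ((MulAut.conj g • A : Subgroup G) : Set G)
      = MulAut.conj g • centralizer (A : Set G) := by
  ext x
  rw [mem_conj_smul, mem_centralizer_iff, mem_centralizer_iff]
  constructor
  · intro h a ha
    have := h _ (conj_mem_conj_smul (g := g) ha)
    calc a * (g⁻¹ * x * g) = g⁻¹ * ((g * a * g⁻¹) * x) * g := by group
      _ = _ := by rw [this]; group
  · intro h a ha
    have ha' : a ∈ MulAut.conj g • A := ha
    rw [mem_conj_smul] at ha'
    have := h _ ha'
    calc a * x = g * ((g⁻¹ * a * g) * (g⁻¹ * x * g)) * g⁻¹ := by group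
      _ = _ := by rw [this]; group

/-- Fixed points of a permutation of prime power order on an invariant set. -/
theorem card_fixed_modEq {α : Type*} [Finite α] [MulAction G α] {r k : ℕ} (hr : r.Prime)
    {g : G} (hg : g ^ r ^ k = 1) {S : Set α} (hS : ∀ x ∈ S, g • x ∈ S) :
    Nat.card S ≡ Nat.card {x : α | x ∈ S ∧ g • x = x} [MOD r] := by
  classical
  haveI := Fact.mk hr
  haveI := Fintype.ofFinite α
  let f : Function.End S := fun x => ⟨g • x.1, hS _ x.2⟩
  have hpow : ∀ n : ℕ, ∀ x : S, ((f ^ n) x : S).1 = g ^ n • x.1 := by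
    intro n
    induction n with
    | zero => intro x; rw [pow_zero, pow_zero, one_smul]; rfl
    | succ n ih =>
      intro x
      rw [pow_succ, pow_succ, mul_smul]
      exact ih (f x)
  have hf : f ^ r ^ k = 1 := by
    funext x
    apply Subtype.ext
    rw [hpow, hg, one_smul]; rfl
  have := Equiv.Perm.card_fixedPoints_modEq hf
  rw [← Nat.card_eq_fintype_card, ← Nat.card_eq_fintype_card] at this
  refine this.trans (congrArg (· % r) ?_)
  refine Nat.card_congr ⟨fun x => ⟨x.1.1, x.1.2, congrArg Subtype.val x.2⟩,
    fun x => ⟨⟨x.1, x.2.1⟩, Subtype.ext x.2.2⟩, fun _ => rfl, fun _ => rfl⟩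

/-- Fixed points of conjugation by an element of prime power order on an invariant subset. -/
theorem card_conj_fixed_modEq {r k : ℕ} (hr : r.Prime)
    {g : G} (hg : g ^ r ^ k = 1) {S : Set G} (hS : ∀ x ∈ S, g * x * g⁻¹ ∈ S) :
    Nat.card S ≡ Nat.card {x : G | x ∈ S ∧ g * x = x * g} [MOD r] := by
  haveI : Finite (ConjAct G) := ‹Finite G›
  have := card_fixed_modEq (G := ConjAct G) (α := G) hr (g := ConjAct.toConjAct g) (k := k)
    (by rw [← map_pow, hg, map_one]) (S := S) (fun x hx => by
      rw [ConjAct.smul_def]; exact hS x hx)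
  refine this.trans (congrArg (· % r) ?_)
  congr! 4 with x
  rw [ConjAct.smul_def, ConjAct.ofConjAct_toConjAct, mul_inv_eq_iff_eq_mul]

theorem card_inf_centralizer_modEq {r k : ℕ} (hr : r.Prime)
    {g : G} (hg : g ^ r ^ k = 1) {A : Subgroup G} (hA : g ∈ normalizer (A : Set G)) :
    Nat.card A ≡ Nat.card (A ⊓ centralizer {g} : Subgroup G) [MOD r] := by
  refine (card_conj_fixed_modEq hr hg (S := (A : Set G)) fun x hx =>
    (Subgroup.mem_normalizer_iff.mp hA x).mp hx).trans (congrArg (· % r) ?_)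
  refine Nat.card_congr (Equiv.subtypeEquivRight fun x => ?_)
  simp only [Set.mem_ofPred_eq, SetLike.mem_coe, Subgroup.mem_inf, mem_centralizer_singleton_iff]
  exact and_congr_right fun _ => eq_comm

/-- `A` is a Sylow `p`-subgroup of the subgroup `C`. -/
def IsSyl (p : ℕ) (A C : Subgroup G) : Prop :=
  A ≤ C ∧ Nat.card A = p ^ (Nat.card C).factorization p

theorem IsSyl.isPGroup {p : ℕ} {A C : Subgroup G} (h : IsSyl p A C) : IsPGroup p A :=
  IsPGroup.of_card h.2

theorem IsSyl.not_dvd {p : ℕ} (hp : p.Prime) {A C : Subgroup G} (h : IsSyl p A C) :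
    ¬ p ∣ Nat.card C / Nat.card A := by
  rw [h.2]; exact Nat.not_dvd_ordCompl hp Nat.card_pos.ne'

theorem isSyl_of_card {p a c : ℕ} (hp : p.Prime) {A C : Subgroup G} (hAC : A ≤ C)
    (hA : Nat.card A = p ^ a) (hC : Nat.card C = p ^ a * c) (hc : ¬ p ∣ c) : IsSyl p A C := by
  refine ⟨hAC, ?_⟩
  have hc0 : c ≠ 0 := by rintro rfl; exact hc (dvd_zero _)
  rw [hA, hC, Nat.factorization_mul (pow_ne_zero _ hp.ne_zero) hc0]
  simp [hp.factorization_self, Nat.factorization_eq_zero_of_not_dvd hc]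

theorem IsSyl.mono {p : ℕ} (hp : p.Prime) {A C D : Subgroup G} (h : IsSyl p A C) (hA : A ≤ D)
    (hD : D ≤ C) : IsSyl p A D := by
  refine ⟨hA, ?_⟩
  apply Nat.dvd_antisymm
  · have h1 := Subgroup.card_dvd_of_le hA
    rw [h.2] at h1 ⊢
    exact pow_dvd_pow p ((hp.pow_dvd_iff_le_factorization Nat.card_pos.ne').mp h1)
  · rw [h.2]
    exact pow_dvd_pow p ((Nat.factorization_le_iff_dvd Nat.card_pos.ne' Nat.card_pos.ne').mpr
      (Subgroup.card_dvd_of_le hD) p)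

theorem IsSyl.of_sylow {p : ℕ} [Fact p.Prime] {C : Subgroup G} (P : Sylow p C) :
    IsSyl p ((P : Subgroup C).map C.subtype) C := by
  refine ⟨Subgroup.map_subtype_le _, ?_⟩
  rw [Nat.card_congr ((P : Subgroup C).equivMapOfInjective _ C.subtype_injective).symm.toEquiv]
  exact P.card_eq_multiplicity

theorem IsSyl.exists_sylow {p : ℕ} [Fact p.Prime] {A C : Subgroup G} (h : IsSyl p A C) :
    ∃ P : Sylow p C, (P : Subgroup C).map C.subtype = A := by
  have hc : Nat.card (A.subgroupOf C) = p ^ (Nat.card C).factorization p := by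
    rw [← h.2]; exact Nat.card_congr (Subgroup.subgroupOfEquivOfLe h.1).toEquiv
  refine ⟨Sylow.ofCard (A.subgroupOf C) hc, ?_⟩
  rw [Sylow.coe_ofCard]
  exact Subgroup.map_subgroupOf_eq_of_le h.1

theorem exists_isSyl_ge {p : ℕ} (hp : p.Prime) {B C : Subgroup G} (hBC : B ≤ C)
    (hB : IsPGroup p B) : ∃ A, B ≤ A ∧ IsSyl p A C := by
  haveI := Fact.mk hp
  have hB' : IsPGroup p (B.subgroupOf C) :=
    hB.of_equiv (Subgroup.subgroupOfEquivOfLe hBC).symm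
  obtain ⟨P, hP⟩ := hB'.exists_le_sylow
  refine ⟨_, ?_, IsSyl.of_sylow P⟩
  have := Subgroup.map_mono (f := C.subtype) hP
  rwa [Subgroup.map_subgroupOf_eq_of_le hBC] at this

theorem exists_isSyl {p : ℕ} (hp : p.Prime) (C : Subgroup G) : ∃ A, IsSyl p A C := by
  obtain ⟨A, -, h⟩ := exists_isSyl_ge hp (bot_le (a := C)) IsPGroup.of_bot
  exact ⟨A, h⟩

theorem IsSyl.conj {p : ℕ} {A C : Subgroup G} (h : IsSyl p A C) {g : G} (hg : g ∈ C) :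
    IsSyl p (MulAut.conj g • A) C := by
  refine ⟨fun x hx => ?_, by rw [card_conj_smul]; exact h.2⟩
  rw [mem_conj_smul] at hx
  have := C.mul_mem (C.mul_mem hg (h.1 hx)) (C.inv_mem hg)
  simpa [mul_assoc] using this

theorem map_subtype_smul {C : Subgroup G} (c : C) (P : Subgroup C) :
    (MulAut.conj c • P).map C.subtype = MulAut.conj (c : G) • P.map C.subtype := by
  ext x
  rw [mem_conj_smul, Subgroup.mem_map, Subgroup.mem_map]
  constructor
  · rintro ⟨y, hy, rfl⟩
    rw [mem_conj_smul] at hy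
    exact ⟨_, hy, by simp⟩
  · rintro ⟨y, hy, he⟩
    refine ⟨c * y * c⁻¹, conj_mem_conj_smul hy, ?_⟩
    simp only [Subgroup.coe_subtype] at he
    simp [he, mul_assoc]

theorem IsSyl.exists_conj {p : ℕ} (hp : p.Prime) {A B C : Subgroup G} (hA : IsSyl p A C)
    (hB : IsSyl p B C) : ∃ g ∈ C, MulAut.conj g • A = B := by
  haveI := Fact.mk hp
  obtain ⟨P, rfl⟩ := hA.exists_sylow
  obtain ⟨Q, rfl⟩ := hB.exists_sylow
  obtain ⟨c, hc⟩ := MulAction.exists_smul_eq C P Q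
  refine ⟨c, c.2, ?_⟩
  rw [← map_subtype_smul, ← hc]; rfl

theorem subgroupOf_normalizer_map {C : Subgroup G} (P : Subgroup C) :
    (normalizer ((P.map C.subtype : Subgroup G) : Set G)).subgroupOf C
      = normalizer (P : Set C) := by
  ext c
  rw [Subgroup.mem_subgroupOf, ← conj_smul_eq_iff, ← conj_smul_eq_iff, ← map_subtype_smul]
  exact (Subgroup.map_injective C.subtype_injective).eq_iff

/-- The number of conjugates of a Sylow subgroup. -/
theorem IsSyl.relIndex_modEq {p : ℕ} (hp : p.Prime) {A C : Subgroup G} (h : IsSyl p A C) :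
    (normalizer (A : Set G)).relIndex C ≡ 1 [MOD p] := by
  haveI := Fact.mk hp
  obtain ⟨P, rfl⟩ := h.exists_sylow
  rw [Subgroup.relIndex, subgroupOf_normalizer_map]
  have := card_sylow_modEq_one p C
  rwa [P.card_eq_index_normalizer] at this

theorem card_eq_relIndex_mul (A C : Subgroup G) :
    Nat.card C = A.relIndex C * Nat.card (A ⊓ C : Subgroup G) := by
  have := Subgroup.card_mul_index (A.subgroupOf C)
  rw [← this, mul_comm, Subgroup.relIndex, ← Subgroup.subgroupOf_map_subtype,
    Nat.card_congr ((A.subgroupOf C).equivMapOfInjective _ C.subtype_injective).symm.toEquiv]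

theorem IsSyl.relIndex_dvd {p : ℕ} {A C : Subgroup G} (h : IsSyl p A C) :
    (normalizer (A : Set G)).relIndex C ∣ Nat.card C / Nat.card A := by
  have h1 : A ≤ normalizer (A : Set G) ⊓ C := le_inf Subgroup.le_normalizer h.1
  obtain ⟨k, hk⟩ := Subgroup.card_dvd_of_le h1
  have h2 := card_eq_relIndex_mul (normalizer (A : Set G)) C
  rw [h2, hk]
  refine ⟨k, ?_⟩
  rw [mul_left_comm, Nat.mul_div_cancel_left _ Nat.card_pos]

theorem relIndex_normalizer_eq_one_iff {A C : Subgroup G} :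
    (normalizer (A : Set G)).relIndex C = 1 ↔ C ≤ normalizer (A : Set G) :=
  Subgroup.relIndex_eq_one

theorem IsSyl.le_of_normal {p : ℕ} (hp : p.Prime) {A B C : Subgroup G} (h : IsSyl p A C)
    (hn : C ≤ normalizer (A : Set G)) (hBC : B ≤ C) (hB : IsPGroup p B) : B ≤ A := by
  obtain ⟨A', hBA, hA'⟩ := exists_isSyl_ge hp hBC hB
  obtain ⟨g, hg, rfl⟩ := h.exists_conj hp hA'
  rwa [conj_smul_eq_iff.mpr (hn hg)] at hBA

theorem IsSyl.eq_of_normal {p : ℕ} (hp : p.Prime) {A B C : Subgroup G} (h : IsSyl p A C)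
    (hn : C ≤ normalizer (A : Set G)) (hB : IsSyl p B C) : B = A := by
  obtain ⟨g, hg, rfl⟩ := h.exists_conj hp hB
  exact conj_smul_eq_iff.mpr (hn hg)

/-- Anything normalizing `C` normalizes the unique Sylow subgroup of `C`. -/
theorem IsSyl.normalizer_le {p : ℕ} (hp : p.Prime) {A C : Subgroup G} (h : IsSyl p A C)
    (hn : C ≤ normalizer (A : Set G)) : normalizer (C : Set G) ≤ normalizer (A : Set G) := by
  intro g hg
  rw [← conj_smul_eq_iff]
  refine h.eq_of_normal hp hn ⟨?_, by rw [card_conj_smul]; exact h.2⟩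
  rw [← conj_smul_eq_iff] at hg
  conv_rhs => rw [← hg]
  intro x hx
  rw [mem_conj_smul] at hx ⊢
  exact h.1 hx

theorem IsSyl.normal_of_forall {p : ℕ} (hp : p.Prime) {A C : Subgroup G} (h : IsSyl p A C)
    (hd : ∀ d, d ∣ Nat.card C / Nat.card A → d % p = 1 → d = 1) : C ≤ normalizer (A : Set G) := by
  rw [← relIndex_normalizer_eq_one_iff]
  refine hd _ h.relIndex_dvd ?_
  have := h.relIndex_modEq hp
  rwa [Nat.ModEq, Nat.one_mod_eq_one.mpr hp.one_lt.ne'] at this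

theorem dvd_card_of_dvd_orbit {α : Type*} [Finite α] [MulAction G α] {q : ℕ} {S : Set α}
    (hS : ∀ (g : G), ∀ x ∈ S, g • x ∈ S)
    (h : ∀ x ∈ S, q ∣ (MulAction.stabilizer G x).index) : q ∣ Nat.card S := by
  classical
  letI : MulAction G S :=
    { smul := fun g x => ⟨g • x.1, hS g _ x.2⟩
      one_smul := fun x => Subtype.ext (one_smul G x.1)
      mul_smul := fun a b x => Subtype.ext (mul_smul a b x.1) }
  have hsm : ∀ (g : G) (x : S), ((g • x : S) : α) = g • (x : α) := fun _ _ => rfl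
  rw [Nat.card_congr (MulAction.selfEquivSigmaOrbitsQuotientStabilizer G S)]
  haveI := Fintype.ofFinite (MulAction.orbitRel.Quotient G S)
  rw [Nat.card_sigma]
  refine Finset.dvd_sum fun ω _ => ?_
  have h2 := h ω.out.1 ω.out.2
  rw [Subgroup.index_eq_card] at h2
  have h3 : MulAction.stabilizer G (Quotient.out ω) = MulAction.stabilizer G (ω.out : S).1 := by
    ext g
    rw [MulAction.mem_stabilizer_iff, MulAction.mem_stabilizer_iff, ← hsm, Subtype.ext_iff]
  rwa [h3]

/-- If `A ∩ A^g` has index divisible by `q` in `A` for all `A^g ≠ A`, `g ∈ C`, the number of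
conjugates of `A` in `C` is `1` modulo `q`. -/
theorem IsSyl.relIndex_modEq_of_forall {p q : ℕ} (hp : p.Prime) {A C : Subgroup G}
    (h : IsSyl p A C)
    (hq : ∀ g ∈ C, MulAut.conj g • A ≠ A → q ∣ (MulAut.conj g • A).relIndex A) :
    (normalizer (A : Set G)).relIndex C ≡ 1 [MOD q] := by
  haveI := Fact.mk hp
  obtain ⟨P, rfl⟩ := h.exists_sylow
  rw [Subgroup.relIndex, subgroupOf_normalizer_map]
  have hcard := P.card_eq_index_normalizer
  set S : Set (Sylow p C) := {Q | Q ≠ P} with hS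
  have hPs : ∀ u : (P : Subgroup C), (u : C) • P = P := fun u =>
    Sylow.smul_eq_iff_mem_normalizer.mpr (Subgroup.le_normalizer u.2)
  have hd : q ∣ Nat.card S := by
    refine dvd_card_of_dvd_orbit (G := (P : Subgroup C)) (fun u Q hQ => ?_) (fun Q hQ => ?_)
    · intro hc
      apply hQ
      have h1 : (u : C) • Q = (u : C) • P := by rw [hPs u]; exact hc
      exact smul_left_cancel _ h1
    · obtain ⟨c, rfl⟩ := MulAction.exists_smul_eq C P Q
      have hne : MulAut.conj (c : G) • (P : Subgroup C).map C.subtype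
          ≠ (P : Subgroup C).map C.subtype := by
        rw [← map_subtype_smul]
        intro he
        exact hQ (Sylow.ext (Subgroup.map_injective C.subtype_injective he))
      have := hq c c.2 hne
      rw [← map_subtype_smul] at this
      have h2 : MulAction.stabilizer (P : Subgroup C) (c • P)
          = (MulAut.conj c • (P : Subgroup C)).subgroupOf (P : Subgroup C) := by
        ext u
        rw [MulAction.mem_stabilizer_iff, Subgroup.mem_subgroupOf, Subgroup.smul_def,
          Sylow.smul_eq_iff_mem_normalizer]
        constructor
        · intro hu
          have hle : zpowers (u : C) ≤ (P : Subgroup C) := by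
            rw [Subgroup.zpowers_le]; exact u.2
          have hpg : IsPGroup p (zpowers (u : C)) := P.isPGroup'.to_le hle
          have := hpg.inf_normalizer_sylow (c • P)
          have hm : (u : C) ∈ zpowers (u : C) ⊓ normalizer ((c • P : Sylow p C) : Set C) :=
            ⟨Subgroup.mem_zpowers _, hu⟩
          rw [this] at hm
          exact hm.2
        · intro hu
          exact Subgroup.le_normalizer hu
      rw [h2]
      have h3 : ((MulAut.conj c • (P : Subgroup C)).map C.subtype).relIndex
          ((P : Subgroup C).map C.subtype) = (MulAut.conj c • (P : Subgroup C)).relIndex P :=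
        Subgroup.relIndex_map_map_of_injective _ _ C.subtype_injective
      rw [h3] at this
      exact this
  have hsum : Nat.card (Sylow p C) = Nat.card S + 1 := by
    classical
    rw [← Nat.card_unique (α := ({P} : Set (Sylow p C))), add_comm]
    have := Set.ncard_add_ncard_compl ({P} : Set (Sylow p C))
    exact this.symm
  have hm : Nat.card S + 1 ≡ 1 [MOD q] := (Nat.modEq_zero_iff_dvd.mpr hd).add_right 1
  rw [← hsum, hcard] at hm
  exact hm

/-- There are commuting elements of orders `p` and `q`. -/
def PAdj (G : Type*) [Group G] (p q : ℕ) : Prop :=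
  ∃ x y : G, orderOf x = p ∧ orderOf y = q ∧ x * y = y * x

theorem PAdj.symm {p q : ℕ} (h : PAdj G p q) : PAdj G q p := by
  obtain ⟨x, y, hx, hy, h⟩ := h
  exact ⟨y, x, hy, hx, h.symm⟩

theorem padj_comm {p q : ℕ} : PAdj G p q ↔ PAdj G q p := ⟨PAdj.symm, PAdj.symm⟩

theorem padj_iff {p q : ℕ} (hp : p.Prime) (hq : q.Prime) (hpq : p ≠ q) :
    (∃ g : G, orderOf g = p * q) ↔ PAdj G p q := by
  constructor
  · rintro ⟨g, hg⟩
    refine ⟨g ^ q, g ^ p, ?_, ?_, by rw [← pow_add, ← pow_add, add_comm]⟩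
    · rw [orderOf_pow_of_dvd hq.ne_zero (hg ▸ dvd_mul_left _ _), hg,
        Nat.mul_div_cancel _ hq.pos]
    · rw [orderOf_pow_of_dvd hp.ne_zero (hg ▸ dvd_mul_right _ _), hg,
        Nat.mul_div_cancel_left _ hp.pos]
  · rintro ⟨x, y, hx, hy, h⟩
    refine ⟨x * y, ?_⟩
    rw [Commute.orderOf_mul_eq_mul_orderOf_of_coprime h, hx, hy]
    rw [hx, hy]
    exact (Nat.coprime_primes hp hq).mpr hpq

theorem padj_of_dvd_centralizer {p q : ℕ} (hq : q.Prime) {x : G} (hx : orderOf x = p)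
    {C : Subgroup G} (hC : C ≤ centralizer {x}) (h : q ∣ Nat.card C) : PAdj G p q := by
  haveI := Fact.mk hq
  obtain ⟨y, hy⟩ := exists_prime_orderOf_dvd_card' q h
  refine ⟨x, y, hx, by rw [Subgroup.orderOf_coe, hy], ?_⟩
  exact (mem_centralizer_singleton_iff.mp (hC y.2)).symm

theorem exists_mem_orderOf {q : ℕ} (hq : q.Prime) {C : Subgroup G} (h : q ∣ Nat.card C) :
    ∃ y ∈ C, orderOf y = q := by
  haveI := Fact.mk hq
  obtain ⟨y, hy⟩ := exists_prime_orderOf_dvd_card' q h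
  exact ⟨y, y.2, by rw [Subgroup.orderOf_coe, hy]⟩

theorem padj_of_normalizes {r p a : ℕ} (hr : r.Prime) (hp : p.Prime) {g : G}
    (hg : orderOf g = r) {A : Subgroup G} (hA : g ∈ normalizer (A : Set G))
    (hc : Nat.card A = p ^ a) (hne : p ^ a % r ≠ 1) : PAdj G r p := by
  have h1 := card_inf_centralizer_modEq hr (g := g) (k := 1)
    (by rw [pow_one, ← hg, pow_orderOf_eq_one]) hA
  have h2 : Nat.card (A ⊓ centralizer {g} : Subgroup G) ∣ p ^ a :=
    hc ▸ Subgroup.card_dvd_of_le inf_le_left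
  obtain ⟨b, hb, hb'⟩ := (Nat.dvd_prime_pow hp).mp h2
  rcases Nat.eq_zero_or_pos b with rfl | hb0
  · rw [hc, hb', pow_zero, Nat.ModEq, Nat.one_mod_eq_one.mpr hr.one_lt.ne'] at h1
    exact absurd h1 hne
  · exact padj_of_dvd_centralizer hp hg (C := A ⊓ centralizer {g}) inf_le_right
      (hb' ▸ dvd_pow_self p hb0.ne')

theorem not_dvd_normalizer {r p a : ℕ} (hr : r.Prime) (hp : p.Prime) {A : Subgroup G}
    (hc : Nat.card A = p ^ a) (hne : p ^ a % r ≠ 1) (hadj : ¬ PAdj G r p) :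
    ¬ r ∣ Nat.card (normalizer (A : Set G)) := by
  intro h
  obtain ⟨g, hg, ho⟩ := exists_mem_orderOf hr h
  exact hadj (padj_of_normalizes hr hp ho hg hc hne)

theorem centralizes_of_normalizes {r p a k : ℕ} (hr : r.Prime) (hp : p.Prime) {g : G}
    (hg : g ^ r ^ k = 1) {A : Subgroup G} (hA : g ∈ normalizer (A : Set G))
    (hc : Nat.card A = p ^ a) (hinj : ∀ b ≤ a, p ^ a % r = p ^ b % r → b = a) :
    A ≤ centralizer {g} := by
  have h1 := card_inf_centralizer_modEq hr (g := g) (k := k) hg hA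
  have h2 : Nat.card (A ⊓ centralizer {g} : Subgroup G) ∣ p ^ a :=
    hc ▸ Subgroup.card_dvd_of_le inf_le_left
  obtain ⟨b, hb, hb'⟩ := (Nat.dvd_prime_pow hp).mp h2
  rw [hc, hb'] at h1
  have := hinj b hb h1
  subst this
  have h3 : A ⊓ centralizer {g} = A :=
    Subgroup.eq_of_le_of_card_ge inf_le_left (by rw [hc, hb'])
  rw [← h3]; exact inf_le_right

theorem card_normalizer_of_prime {r : ℕ} (hr : r.Prime) {A : Subgroup G} (hA : Nat.card A = r) :
    ∃ e, e ∣ r - 1 ∧ Nat.card (normalizer (A : Set G)) = e * Nat.card (centralizer (A : Set G)) := by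
  haveI := Fact.mk hr
  haveI : IsCyclic A := isCyclic_of_prime_card hA
  refine ⟨Nat.card A.normalizerMonoidHom.range, ?_, ?_⟩
  · have := Subgroup.card_subgroup_dvd_card A.normalizerMonoidHom.range
    rwa [IsCyclic.card_mulAut, hA, Nat.totient_prime hr] at this
  · have h1 := Subgroup.card_mul_index A.normalizerMonoidHom.ker
    rw [Subgroup.index_ker, Subgroup.normalizerMonoidHom_ker] at h1
    rw [← h1, mul_comm, Nat.card_congr (Subgroup.subgroupOfEquivOfLe _).toEquiv]
    intro x hx
    refine mem_normalizer_of_forall fun a ha => ?_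
    rw [← Subgroup.mem_centralizer_iff.mp hx a ha]
    simpa using ha

theorem centralizer_le_normalizer' (A : Subgroup G) :
    centralizer (A : Set G) ≤ normalizer (A : Set G) := by
  intro x hx
  refine mem_normalizer_of_forall fun a ha => ?_
  rw [← Subgroup.mem_centralizer_iff.mp hx a ha]
  simpa using ha

theorem IsSyl.card_eq {p a c : ℕ} (hp : p.Prime) {A C : Subgroup G} (h : IsSyl p A C)
    (hC : Nat.card C = p ^ a * c) (hc : ¬ p ∣ c) : Nat.card A = p ^ a := by
  have hc0 : c ≠ 0 := by rintro rfl; exact hc (dvd_zero _)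
  rw [h.2, hC, Nat.factorization_mul (pow_ne_zero _ hp.ne_zero) hc0]
  simp [hp.factorization_self, Nat.factorization_eq_zero_of_not_dvd hc]

theorem IsSyl.index_modEq {p : ℕ} (hp : p.Prime) {A : Subgroup G} (h : IsSyl p A ⊤) :
    (normalizer (A : Set G)).index ≡ 1 [MOD p] := by
  have := h.relIndex_modEq hp
  rwa [Subgroup.relIndex_top_right] at this

theorem card_eq_index_mul (A : Subgroup G) : Nat.card G = A.index * Nat.card A :=
  (A.index_mul_card).symm

theorem mem_primes {q : ℕ} (hq : q.Prime) (h : q ∣ 2^11 * 3 * 5 * 7^2 * 19 * 31^3) :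
    q = 2 ∨ q = 3 ∨ q = 5 ∨ q = 7 ∨ q = 19 ∨ q = 31 := by
  have p2 : Nat.Prime 2 := by norm_num
  have p3 : Nat.Prime 3 := by norm_num
  have p5 : Nat.Prime 5 := by norm_num
  have p7 : Nat.Prime 7 := by norm_num
  have p19 : Nat.Prime 19 := by norm_num
  have p31 : Nat.Prime 31 := by norm_num
  simp only [hq.dvd_mul] at h
  rcases h with ((((h | h) | h) | h) | h) | h
  · exact Or.inl ((Nat.prime_dvd_prime_iff_eq hq p2).mp (hq.dvd_of_dvd_pow h))
  · simp [(Nat.prime_dvd_prime_iff_eq hq p3).mp h]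
  · simp [(Nat.prime_dvd_prime_iff_eq hq p5).mp h]
  · simp [(Nat.prime_dvd_prime_iff_eq hq p7).mp (hq.dvd_of_dvd_pow h)]
  · simp [(Nat.prime_dvd_prime_iff_eq hq p19).mp h]
  · simp [(Nat.prime_dvd_prime_iff_eq hq p31).mp (hq.dvd_of_dvd_pow h)]

open Classical in
theorem gkDegree_eq {p : ℕ} (hp : p.Prime) (hG : Nat.card G = 2^11 * 3 * 5 * 7^2 * 19 * 31^3) :
    gkDegree G p = ∑ q ∈ ({2, 3, 5, 7, 19, 31} : Finset ℕ).erase p,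
      if PAdj G p q then 1 else 0 := by
  rw [gkDegree, Finset.sum_boole, Nat.cast_id]
  refine Nat.subtype_card _ fun q => ?_
  rw [Finset.mem_filter, Finset.mem_erase]
  constructor
  · rintro ⟨⟨h1, h2⟩, h3⟩
    have hq : q.Prime := by
      fin_cases h2 <;> norm_num
    exact ⟨h1.symm, hp, hq, (padj_iff hp hq h1.symm).mpr h3⟩
  · rintro ⟨h1, -, hq, h3⟩
    have h4 := (padj_iff hp hq h1).mp h3
    refine ⟨⟨h1.symm, ?_⟩, h4⟩
    obtain ⟨x, y, hx, hy, -⟩ := h4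
    have := mem_primes hq (hG ▸ hy ▸ orderOf_dvd_natCard y)
    simp only [Finset.mem_insert, Finset.mem_singleton]
    exact this

theorem p2 : Nat.Prime 2 := Nat.prime_two
theorem p3 : Nat.Prime 3 := Nat.prime_three
theorem p5 : Nat.Prime 5 := Nat.prime_five
theorem p7 : Nat.Prime 7 := by norm_num
theorem p19 : Nat.Prime 19 := by norm_num
theorem p31 : Nat.Prime 31 := by norm_num

/-- The hypotheses on the order and on the prime graph. -/
structure Hyp (G : Type*) [Group G] : Prop where
  card : Nat.card G = 2^11 * 3 * 5 * 7^2 * 19 * 31^3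
  d2 : gkDegree G 2 = 3
  d3 : gkDegree G 3 = 2
  d5 : gkDegree G 5 = 2
  d7 : gkDegree G 7 = 1
  d19 : gkDegree G 19 = 1
  d31 : gkDegree G 31 = 1

open Classical in
/-- The adjacency indicator. -/
noncomputable def adjN (G : Type*) [Group G] (p q : ℕ) : ℕ := if PAdj G p q then 1 else 0

theorem adjN_le (p q : ℕ) : adjN G p q ≤ 1 := by unfold adjN; split_ifs <;> simp
theorem adjN_comm (p q : ℕ) : adjN G p q = adjN G q p := by unfold adjN; rw [padj_comm]
theorem adjN_one {p q : ℕ} (h : PAdj G p q) : adjN G p q = 1 := if_pos h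
theorem not_padj {p q : ℕ} (h : adjN G p q = 0) : ¬ PAdj G p q := fun hc => by
  rw [adjN_one hc] at h; exact one_ne_zero h
theorem padj_of_adjN {p q : ℕ} (h : adjN G p q = 1) : PAdj G p q := by
  by_contra hc
  rw [adjN, if_neg hc] at h; exact zero_ne_one h

theorem gkDegree_eq_sum {p : ℕ} (hp : p.Prime)
    (hG : Nat.card G = 2^11 * 3 * 5 * 7^2 * 19 * 31^3) :
    gkDegree G p = ∑ q ∈ ({2, 3, 5, 7, 19, 31} : Finset ℕ).erase p, adjN G p q :=
  gkDegree_eq hp hG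

theorem Hyp.eqs (h : Hyp G) :
    adjN G 2 3 + adjN G 2 5 + adjN G 2 7 + adjN G 2 19 + adjN G 2 31 = 3 ∧
    adjN G 2 3 + adjN G 3 5 + adjN G 3 7 + adjN G 3 19 + adjN G 3 31 = 2 ∧
    adjN G 2 5 + adjN G 3 5 + adjN G 5 7 + adjN G 5 19 + adjN G 5 31 = 2 ∧
    adjN G 2 7 + adjN G 3 7 + adjN G 5 7 + adjN G 7 19 + adjN G 7 31 = 1 ∧
    adjN G 2 19 + adjN G 3 19 + adjN G 5 19 + adjN G 7 19 + adjN G 19 31 = 1 ∧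
    adjN G 2 31 + adjN G 3 31 + adjN G 5 31 + adjN G 7 31 + adjN G 19 31 = 1 := by
  have e2 : ({2, 3, 5, 7, 19, 31} : Finset ℕ).erase 2 = {3, 5, 7, 19, 31} := by decide
  have e3 : ({2, 3, 5, 7, 19, 31} : Finset ℕ).erase 3 = {2, 5, 7, 19, 31} := by decide
  have e5 : ({2, 3, 5, 7, 19, 31} : Finset ℕ).erase 5 = {2, 3, 7, 19, 31} := by decide
  have e7 : ({2, 3, 5, 7, 19, 31} : Finset ℕ).erase 7 = {2, 3, 5, 19, 31} := by decide
  have e19 : ({2, 3, 5, 7, 19, 31} : Finset ℕ).erase 19 = {2, 3, 5, 7, 31} := by decide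
  have e31 : ({2, 3, 5, 7, 19, 31} : Finset ℕ).erase 31 = {2, 3, 5, 7, 19} := by decide
  have h2 := gkDegree_eq_sum p2 h.card
  have h3 := gkDegree_eq_sum p3 h.card
  have h5 := gkDegree_eq_sum p5 h.card
  have h7 := gkDegree_eq_sum p7 h.card
  have h19 := gkDegree_eq_sum p19 h.card
  have h31 := gkDegree_eq_sum p31 h.card
  rw [h.d2, e2] at h2
  rw [h.d3, e3] at h3
  rw [h.d5, e5] at h5
  rw [h.d7, e7] at h7
  rw [h.d19, e19] at h19
  rw [h.d31, e31] at h31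
  simp at h2 h3 h5 h7 h19 h31
  rw [adjN_comm 3 2] at h3
  rw [adjN_comm 5 2, adjN_comm 5 3] at h5
  rw [adjN_comm 7 2, adjN_comm 7 3, adjN_comm 7 5] at h7
  rw [adjN_comm 19 2, adjN_comm 19 3, adjN_comm 19 5, adjN_comm 19 7] at h19
  rw [adjN_comm 31 2, adjN_comm 31 3, adjN_comm 31 5, adjN_comm 31 7, adjN_comm 31 19] at h31
  omega

theorem strip {p c N : ℕ} (hp : p.Prime) (h : c ∣ N) (hc : ¬ p ∣ c) (k m : ℕ)
    (hN : N = p ^ k * m) : c ∣ m := by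
  rw [hN] at h
  exact Nat.Coprime.dvd_of_dvd_mul_left
    (((Nat.Prime.coprime_iff_not_dvd hp).mpr hc).symm.pow_right k) h

theorem not_dvd_centralizer {p q : ℕ} (hq : q.Prime) {x : G} (hx : orderOf x = p)
    {C : Subgroup G} (hC : C ≤ centralizer {x}) (h : adjN G p q = 0) : ¬ q ∣ Nat.card C :=
  fun hd => not_padj h (padj_of_dvd_centralizer hq hx hC hd)

theorem card_dvd (h : Hyp G) (C : Subgroup G) :
    Nat.card C ∣ 2^11 * 3 * 5 * 7^2 * 19 * 31^3 := h.card ▸ C.card_subgroup_dvd_card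

theorem Hyp.card_syl {p a c : ℕ} (h : Hyp G) (hp : p.Prime)
    (hn : 2^11 * 3 * 5 * 7^2 * 19 * 31^3 = p ^ a * c) (hc : ¬ p ∣ c)
    {A : Subgroup G} (hA : IsSyl p A ⊤) : Nat.card A = p ^ a :=
  hA.card_eq hp (by rw [Subgroup.card_top, h.card, hn]) hc

theorem Hyp.card_syl31 (h : Hyp G) {A : Subgroup G} (hA : IsSyl 31 A ⊤) : Nat.card A = 31 ^ 3 :=
  h.card_syl p31 (c := 2^11 * 3 * 5 * 7^2 * 19) (by norm_num) (by norm_num) hA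

theorem Hyp.card_syl19 (h : Hyp G) {A : Subgroup G} (hA : IsSyl 19 A ⊤) : Nat.card A = 19 := by
  have := h.card_syl p19 (a := 1) (c := 2^11 * 3 * 5 * 7^2 * 31 ^ 3) (by norm_num) (by norm_num) hA
  simpa using this

theorem Hyp.card_syl7 (h : Hyp G) {A : Subgroup G} (hA : IsSyl 7 A ⊤) : Nat.card A = 7 ^ 2 :=
  h.card_syl p7 (c := 2^11 * 3 * 5 * 19 * 31 ^ 3) (by norm_num) (by norm_num) hA

theorem exists_orderOf_of_card {p : ℕ} (hp : p.Prime) {A : Subgroup G} (hA : Nat.card A = p) :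
    ∃ x ∈ A, orderOf x = p ∧ A = zpowers x := by
  obtain ⟨x, hx, ho⟩ := exists_mem_orderOf hp (C := A) (hA ▸ dvd_rfl)
  refine ⟨x, hx, ho, (Subgroup.eq_of_le_of_card_ge ?_ ?_).symm⟩
  · rwa [Subgroup.zpowers_le]
  · rw [Nat.card_zpowers, ho, hA]

theorem centralizer_zpowers (x : G) :
    centralizer (zpowers x : Set G) = centralizer {x} := by
  rw [Subgroup.zpowers_eq_closure, Subgroup.centralizer_closure]

theorem Hyp.syl19 (h : Hyp G) : ∃ x : G, orderOf x = 19 ∧ ∃ e c, e ∈ Nat.divisors 6 ∧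
    Nat.card (centralizer {x}) = 19 * c ∧ (e * c) % 19 = 14 ∧
    c ∣ 2^11 * 3 * 5 * 7^2 * 31^3 ∧ ∀ q, q.Prime → adjN G q 19 = 0 → ¬ q ∣ c := by
  obtain ⟨P, hP⟩ := exists_isSyl p19 (⊤ : Subgroup G)
  have hc := h.card_syl19 hP
  obtain ⟨x, hx, ho, rfl⟩ := exists_orderOf_of_card p19 hc
  obtain ⟨e, he, hN⟩ := card_normalizer_of_prime p19 hc
  have hle : zpowers x ≤ centralizer {x} := by
    rw [Subgroup.zpowers_le]; exact mem_centralizer_singleton_iff.mpr rfl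
  obtain ⟨c, hcc⟩ := Subgroup.card_dvd_of_le hle
  rw [hc] at hcc
  have hi := hP.index_modEq p19
  have hm := card_eq_index_mul (normalizer (zpowers x : Set G))
  rw [hN, centralizer_zpowers, hcc, h.card] at hm
  set i := (normalizer (zpowers x : Set G)).index
  have hm' : 2^11 * 3 * 5 * 7^2 * 31^3 = i * (e * c) := by
    apply Nat.eq_of_mul_eq_mul_left (show 0 < 19 by norm_num)
    linarith
  have he6 : e ∈ Nat.divisors 6 := by
    have h9 : ¬ 9 ∣ e := fun h9 => by
      have : 9 ∣ 2^11 * 3 * 5 * 7^2 * 31^3 := hm' ▸ (h9.mul_right c).mul_left i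
      norm_num at this
    have h18 : e ∈ Nat.divisors 18 := Nat.mem_divisors.mpr ⟨he, by norm_num⟩
    have key : ∀ e ∈ Nat.divisors 18, ¬ 9 ∣ e → e ∈ Nat.divisors 6 := by decide
    exact key e h18 h9
  refine ⟨x, ho, e, c, he6, hcc, ?_, ?_, fun q hq h0 hd => ?_⟩
  · have : i * (e * c) ≡ 1 * (e * c) [MOD 19] := hi.mul_right _
    rw [← hm', one_mul] at this
    have h2 : 2^11 * 3 * 5 * 7^2 * 31^3 % 19 = 14 := by norm_num
    rw [← h2]; exact this.symm
  · rw [hm', ← mul_assoc]; exact dvd_mul_left _ _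
  · rw [adjN_comm] at h0
    exact not_dvd_centralizer hq ho le_rfl h0 (hcc ▸ hd.mul_left 19)

theorem Hyp.adj_3_19 (h : Hyp G) : adjN G 3 19 = 0 := by
  by_contra hne
  obtain ⟨x, ho, e, c, he, hc, hm, hd, hq⟩ := h.syl19
  have hx := h.eqs
  have h1 := strip p2 hd (hq 2 p2 (by omega)) 11 (3 * 5 * 7^2 * 31^3) (by norm_num)
  have h2 := strip p5 h1 (hq 5 p5 (by omega)) 1 (3 * 7^2 * 31^3) (by norm_num)
  have h3 := strip p7 h2 (hq 7 p7 (by omega)) 2 (3 * 31^3) (by norm_num)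
  have h4 := strip p31 h3 (hq 31 p31 (by rw [adjN_comm]; omega)) 3 3 (by norm_num)
  have key : ∀ e ∈ Nat.divisors 6, ∀ c ∈ Nat.divisors 3, (e * c) % 19 ≠ 14 := by decide
  exact key e he c (Nat.mem_divisors.mpr ⟨h4, by norm_num⟩) hm

theorem Hyp.adj_5_19 (h : Hyp G) : adjN G 5 19 = 0 := by
  by_contra hne
  obtain ⟨x, ho, e, c, he, hc, hm, hd, hq⟩ := h.syl19
  have hx := h.eqs
  have h1 := strip p2 hd (hq 2 p2 (by omega)) 11 (3 * 5 * 7^2 * 31^3) (by norm_num)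
  have h2 := strip p3 h1 (hq 3 p3 (by omega)) 1 (5 * 7^2 * 31^3) (by norm_num)
  have h3 := strip p7 h2 (hq 7 p7 (by omega)) 2 (5 * 31^3) (by norm_num)
  have h4 := strip p31 h3 (hq 31 p31 (by rw [adjN_comm]; omega)) 3 5 (by norm_num)
  have key : ∀ e ∈ Nat.divisors 6, ∀ c ∈ Nat.divisors 5, (e * c) % 19 ≠ 14 := by decide
  exact key e he c (Nat.mem_divisors.mpr ⟨h4, by norm_num⟩) hm

theorem exists_center_orderOf {p : ℕ} (hp : p.Prime) {A : Subgroup G} (hA : IsPGroup p A)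
    (hne : A ≠ ⊥) : ∃ z ∈ A, orderOf z = p ∧ A ≤ centralizer {z} := by
  haveI := Fact.mk hp
  haveI : Nontrivial A := (Subgroup.nontrivial_iff_ne_bot A).mpr hne
  haveI := hA.center_nontrivial
  have hpg : IsPGroup p (Subgroup.center A) := hA.to_subgroup _
  obtain ⟨n, hn⟩ := IsPGroup.iff_card.mp hpg
  have hn0 : n ≠ 0 := by
    rintro rfl
    rw [pow_zero] at hn
    exact absurd hn (Finite.one_lt_card (α := Subgroup.center A)).ne'
  obtain ⟨z, hz⟩ := exists_prime_orderOf_dvd_card' p (hn ▸ dvd_pow_self p hn0)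
  refine ⟨z.1.1, z.1.2, by rw [Subgroup.orderOf_coe, Subgroup.orderOf_coe, hz], fun a ha => ?_⟩
  rw [mem_centralizer_singleton_iff]
  exact congrArg Subtype.val (Subgroup.mem_center_iff.mp z.2 ⟨a, ha⟩)

theorem isPGroup_zpowers {p : ℕ} {x : G} (hx : orderOf x = p) : IsPGroup p (zpowers x) :=
  IsPGroup.of_card (n := 1) (by rw [Nat.card_zpowers, hx, pow_one])

theorem mem_centralizer_self (x : G) : zpowers x ≤ centralizer {x} := by
  rw [Subgroup.zpowers_le]; exact mem_centralizer_singleton_iff.mpr rfl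

theorem le_centralizer_comm {A : Subgroup G} {g : G} (h : A ≤ centralizer {g}) :
    g ∈ centralizer (A : Set G) := by
  rw [mem_centralizer_iff]
  intro a ha
  exact mem_centralizer_singleton_iff.mp (h ha)

/-- If `g` commutes with an element of order `31` and the Sylow `31`-subgroups of
centralizers of elements of order `31` are normal there, then `g` centralizes a
Sylow `31`-subgroup. -/
theorem Hyp.centralizes_syl31 (h : Hyp G) {r k : ℕ} (hr : r.Prime) {g u : G} (hg : g ^ r ^ k = 1)
    (hu : orderOf u = 31) (hgu : g * u = u * g)
    (hcl : ∀ v : G, orderOf v = 31 → ∀ A, IsSyl 31 A (centralizer {v}) →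
      centralizer {v} ≤ normalizer (A : Set G))
    (hinj : ∀ a ≤ 3, ∀ b ≤ a, 31 ^ a % r = 31 ^ b % r → b = a) :
    ∃ U, IsSyl 31 U ⊤ ∧ U ≤ centralizer {g} := by
  obtain ⟨U, huU, hU⟩ := exists_isSyl_ge p31 (le_top (a := zpowers u)) (isPGroup_zpowers hu)
  have hUc := h.card_syl31 hU
  obtain ⟨z, hzU, hz, hUz⟩ := exists_center_orderOf p31 hU.isPGroup (by
    rintro rfl; rw [Subgroup.card_bot] at hUc; norm_num at hUc)
  obtain ⟨A, hA⟩ := exists_isSyl p31 (centralizer {u})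
  have hAn := hcl u hu A hA
  have hzA : zpowers z ≤ A := by
    refine hA.le_of_normal p31 hAn ?_ (isPGroup_zpowers hz)
    rw [Subgroup.zpowers_le]
    have := mem_centralizer_singleton_iff.mp (hUz (huU (Subgroup.mem_zpowers u)))
    exact mem_centralizer_singleton_iff.mpr this.symm
  have hgA : g ∈ normalizer (A : Set G) := hAn (mem_centralizer_singleton_iff.mpr hgu)
  have hsmall : ∀ B : Subgroup G, IsPGroup 31 B → ∃ a ≤ 3, Nat.card B = 31 ^ a := by
    intro B hB
    obtain ⟨B', hBB, hB'⟩ := exists_isSyl_ge p31 (le_top (a := B)) hB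
    have := Subgroup.card_dvd_of_le hBB
    rw [h.card_syl31 hB'] at this
    exact (Nat.dvd_prime_pow p31).mp this
  obtain ⟨a, ha, hAc⟩ := hsmall A hA.isPGroup
  have hAg := centralizes_of_normalizes hr p31 hg hgA hAc (hinj a ha)
  have hgz : g ∈ centralizer {z} := by
    have := mem_centralizer_singleton_iff.mp (hAg (hzA (Subgroup.mem_zpowers z)))
    exact mem_centralizer_singleton_iff.mpr this.symm
  have hU' := hU.mono p31 hUz le_top
  exact ⟨U, hU, centralizes_of_normalizes hr p31 hg (hcl z hz U hU' hgz) hUc (hinj 3 le_rfl)⟩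

/-- If `31` has the unique neighbour `r`, the order of the centralizer of an element of
order `31` divides `31 ^ 3` times the `r`-part. -/
theorem centralizer31_normal {r a : ℕ}
    (hdvd : ∀ C : Subgroup G, ∀ v : G, orderOf v = 31 → C ≤ centralizer {v} →
      Nat.card C ∣ 31 ^ 3 * r ^ a) (hr : ¬ 31 ∣ r ^ a)
    (hdiv : ∀ d ∈ Nat.divisors (r ^ a), d % 31 = 1 → d = 1)
    {C : Subgroup G} {v : G} (hv : orderOf v = 31) (hC : C ≤ centralizer {v})
    {A : Subgroup G} (hA : IsSyl 31 A C) : C ≤ normalizer (A : Set G) := by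
  refine hA.normal_of_forall p31 fun d hd h1 => hdiv d ?_ h1
  refine Nat.mem_divisors.mpr ⟨hd.trans ?_, fun h0 => hr (h0 ▸ dvd_zero _)⟩
  have h2 : Nat.card C / Nat.card A ∣ 31 ^ 3 * r ^ a :=
    (Nat.div_dvd_of_dvd (Subgroup.card_dvd_of_le hA.1)).trans (hdvd C v hv hC)
  exact strip p31 h2 (hA.not_dvd p31) 3 _ rfl

theorem Hyp.adj_19_31 (h : Hyp G) : adjN G 19 31 = 0 := by
  by_contra hne
  have hx := h.eqs
  have hdvd : ∀ C : Subgroup G, ∀ v : G, orderOf v = 31 → C ≤ centralizer {v} →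
      Nat.card C ∣ 31 ^ 3 * 19 ^ 1 := by
    intro C v hv hC
    have h1 := strip p2 (card_dvd h C) (not_dvd_centralizer p2 hv hC (by rw [adjN_comm]; omega))
      11 (3 * 5 * 7^2 * 19 * 31^3) (by norm_num)
    have h2 := strip p3 h1 (not_dvd_centralizer p3 hv hC (by rw [adjN_comm]; omega))
      1 (5 * 7^2 * 19 * 31^3) (by norm_num)
    have h3 := strip p5 h2 (not_dvd_centralizer p5 hv hC (by rw [adjN_comm]; omega))
      1 (7^2 * 19 * 31^3) (by norm_num)
    exact strip p7 h3 (not_dvd_centralizer p7 hv hC (by rw [adjN_comm]; omega))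
      2 _ (by norm_num)
  obtain ⟨x, ho, e, c, he, hc, hm, hd, hq⟩ := h.syl19
  obtain ⟨u, hux, hu⟩ := exists_mem_orderOf p31 (C := centralizer {x}) (by
    by_contra hcon
    have h1 := strip p2 hd (hq 2 p2 (by omega)) 11 (3 * 5 * 7^2 * 31^3) (by norm_num)
    have h2 := strip p3 h1 (hq 3 p3 (by omega)) 1 (5 * 7^2 * 31^3) (by norm_num)
    have h3 := strip p5 h2 (hq 5 p5 (by omega)) 1 (7^2 * 31^3) (by norm_num)
    have h4 := strip p7 h3 (hq 7 p7 (by omega)) 2 (31^3) (by norm_num)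
    have h5 := strip p31 h4 (fun hh => hcon (hc ▸ hh.mul_left 19)) 3 1 (by norm_num)
    rw [Nat.dvd_one.mp h5] at hm
    have key : ∀ e ∈ Nat.divisors 6, (e * 1) % 19 ≠ 14 := by decide
    exact key e he hm)
  obtain ⟨U, hU, hUx⟩ := h.centralizes_syl31 p19 (k := 1) (g := x) (u := u)
    (by rw [pow_one, ← ho, pow_orderOf_eq_one]) hu
    (mem_centralizer_singleton_iff.mp hux).symm
    (fun v hv A hA => centralizer31_normal hdvd (by norm_num) (by decide) hv le_rfl hA)
    (by decide)
  have h31 := Subgroup.card_dvd_of_le hUx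
  rw [h.card_syl31 hU, hc] at h31
  have h1 := strip p2 hd (hq 2 p2 (by omega)) 11 (3 * 5 * 7^2 * 31^3) (by norm_num)
  have h2 := strip p3 h1 (hq 3 p3 (by omega)) 1 (5 * 7^2 * 31^3) (by norm_num)
  have h3 := strip p5 h2 (hq 5 p5 (by omega)) 1 (7^2 * 31^3) (by norm_num)
  have h4 := strip p7 h3 (hq 7 p7 (by omega)) 2 (31^3) (by norm_num)
  have h5 : 31 ^ 3 ∣ c := Nat.Coprime.dvd_of_dvd_mul_left (by norm_num) h31
  rw [Nat.dvd_antisymm h4 h5] at hm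
  have key : ∀ e ∈ Nat.divisors 6, (e * 31^3) % 19 ≠ 14 := by decide
  exact key e he hm

/-- The divisors of a product of prime powers. -/
def divs : List (ℕ × ℕ) → List ℕ
  | [] => [1]
  | (p, a) :: l => (List.range (a + 1)).flatMap fun i => (divs l).map fun e => p ^ i * e

theorem mem_divs {l : List (ℕ × ℕ)} (hl : ∀ x ∈ l, x.1.Prime) {d : ℕ}
    (hd : d ∣ (l.map fun x => x.1 ^ x.2).prod) : d ∈ divs l := by
  induction l generalizing d with
  | nil => simpa [divs] using hd
  | cons x l ih =>
    obtain ⟨p, a⟩ := x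
    rw [List.map_cons, List.prod_cons] at hd
    obtain ⟨b, e, hb, he, rfl⟩ := exists_dvd_and_dvd_of_dvd_mul hd
    obtain ⟨i, hi, rfl⟩ := (Nat.dvd_prime_pow (hl (p, a) List.mem_cons_self)).mp hb
    simp only [divs, List.mem_flatMap, List.mem_map, List.mem_range]
    exact ⟨i, by omega, e, ih (fun x hx => hl x (List.mem_cons_of_mem _ hx)) he, rfl⟩

/-- Checking a property of all divisors of `N`. -/
theorem forall_dvd (l : List (ℕ × ℕ)) (hl : ∀ x ∈ l, x.1.Prime) {N : ℕ}
    (hN : N = (l.map fun x => x.1 ^ x.2).prod) {P : ℕ → Prop} (h : ∀ d ∈ divs l, P d) :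
    ∀ d, d ∣ N → P d := fun d hd => h d (mem_divs hl (hN ▸ hd))

theorem pow_natCard_of_mem {A : Subgroup G} {v : G} (hv : v ∈ A) : v ^ Nat.card A = 1 :=
  congrArg Subtype.val (pow_card_eq_one' (x := (⟨v, hv⟩ : A)))

theorem exists_orderOf_of_ne_bot {p : ℕ} (hp : p.Prime) {A : Subgroup G} (hA : IsPGroup p A)
    (hne : A ≠ ⊥) : ∃ z ∈ A, orderOf z = p := by
  obtain ⟨z, hz, ho, -⟩ := exists_center_orderOf hp hA hne
  exact ⟨z, hz, ho⟩

/-- A trivial intersection Sylow subgroup has index `1` modulo its order. -/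
theorem IsSyl.relIndex_modEq_of_ti {p : ℕ} (hp : p.Prime) {A C : Subgroup G} (h : IsSyl p A C)
    (hti : ∀ u ∈ A, orderOf u = p → ∀ g ∈ C, u ∈ MulAut.conj g • A → MulAut.conj g • A = A) :
    (normalizer (A : Set G)).relIndex C ≡ 1 [MOD Nat.card A] := by
  refine h.relIndex_modEq_of_forall hp fun g hg hne => ?_
  have hbot : MulAut.conj g • A ⊓ A = ⊥ := by
    by_contra hb
    obtain ⟨z, hz, ho⟩ := exists_orderOf_of_ne_bot hp (h.isPGroup.to_le inf_le_right) hb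
    exact hne (hti z hz.2 ho g hg hz.1)
  have := card_eq_relIndex_mul (MulAut.conj g • A) A
  rw [hbot, Subgroup.card_bot, mul_one] at this
  rw [this]

theorem dvd_of_strips {c N M R : ℕ} (h : c ∣ N) (hN : N = M * R)
    (hR : ∀ q, q.Prime → q ∣ R → ¬ q ∣ c) : c ∣ M := by
  rw [hN] at h
  exact Nat.Coprime.dvd_of_dvd_mul_right
    (Nat.coprime_of_dvd fun q hq hc hr => hR q hq hr hc) h

theorem forall_prime_of {R : ℕ} (hR : R ∣ 2^11 * 3 * 5 * 7^2 * 19 * 31^3) {P : ℕ → Prop}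
    (h2 : 2 ∣ R → P 2) (h3 : 3 ∣ R → P 3) (h5 : 5 ∣ R → P 5) (h7 : 7 ∣ R → P 7)
    (h19 : 19 ∣ R → P 19) (h31 : 31 ∣ R → P 31) : ∀ q, q.Prime → q ∣ R → P q := by
  intro q hq hd
  rcases mem_primes hq (hd.trans hR) with rfl | rfl | rfl | rfl | rfl | rfl
  exacts [h2 hd, h3 hd, h5 hd, h7 hd, h19 hd, h31 hd]

/-- The order of a subgroup divides `M`, where the complementary factor `R` of the group order
only involves primes not dividing the order of the subgroup. -/
theorem Hyp.card_dvd_of (h : Hyp G) {C : Subgroup G} (M R : ℕ)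
    (hN : 2^11 * 3 * 5 * 7^2 * 19 * 31^3 = M * R)
    (h2 : 2 ∣ R → ¬ 2 ∣ Nat.card C) (h3 : 3 ∣ R → ¬ 3 ∣ Nat.card C)
    (h5 : 5 ∣ R → ¬ 5 ∣ Nat.card C) (h7 : 7 ∣ R → ¬ 7 ∣ Nat.card C)
    (h19 : 19 ∣ R → ¬ 19 ∣ Nat.card C) (h31 : 31 ∣ R → ¬ 31 ∣ Nat.card C) :
    Nat.card C ∣ M :=
  dvd_of_strips (card_dvd h C) hN
    (forall_prime_of (P := fun q => ¬ q ∣ Nat.card C) (hN ▸ dvd_mul_left _ _) h2 h3 h5 h7 h19 h31)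

/-- Bound on the order of a centralizer of an element of prime order, from the prime graph. -/
theorem Hyp.card_centralizer_dvd (h : Hyp G) {p : ℕ} {x : G} (hx : orderOf x = p)
    {C : Subgroup G} (hC : C ≤ centralizer {x}) (M R : ℕ)
    (hN : 2^11 * 3 * 5 * 7^2 * 19 * 31^3 = M * R)
    (h2 : 2 ∣ R → adjN G p 2 = 0) (h3 : 3 ∣ R → adjN G p 3 = 0)
    (h5 : 5 ∣ R → adjN G p 5 = 0) (h7 : 7 ∣ R → adjN G p 7 = 0)
    (h19 : 19 ∣ R → adjN G p 19 = 0) (h31 : 31 ∣ R → adjN G p 31 = 0) :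
    Nat.card C ∣ M :=
  h.card_dvd_of M R hN
    (fun hd => not_dvd_centralizer p2 hx hC (h2 hd))
    (fun hd => not_dvd_centralizer p3 hx hC (h3 hd))
    (fun hd => not_dvd_centralizer p5 hx hC (h5 hd))
    (fun hd => not_dvd_centralizer p7 hx hC (h7 hd))
    (fun hd => not_dvd_centralizer p19 hx hC (h19 hd))
    (fun hd => not_dvd_centralizer p31 hx hC (h31 hd))

theorem adjN_cases (p q : ℕ) : adjN G p q = 0 ∨ adjN G p q = 1 := by
  have := adjN_le (G := G) p q; omega

theorem exists_pair_of_adjN {p q : ℕ} (h : adjN G p q = 1) :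
    ∃ x y : G, orderOf x = p ∧ orderOf y = q ∧ x * y = y * x := padj_of_adjN h

theorem le_centralizer_of_card_sq {p : ℕ} (hp : p.Prime) {A : Subgroup G}
    (hA : Nat.card A = p ^ 2) {x : G} (hx : x ∈ A) : A ≤ centralizer {x} := by
  haveI := Fact.mk hp
  intro a ha
  rw [mem_centralizer_singleton_iff]
  have := IsPGroup.isMulCommutative_of_card_eq_prime_sq hA
  exact congrArg Subtype.val (mul_comm' (⟨a, ha⟩ : A) ⟨x, hx⟩)

/-- The order of the normalizer of a Sylow subgroup modulo `p`. -/
theorem Hyp.normalizer_modEq (h : Hyp G) {p a c : ℕ} (hp : p.Prime)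
    (hn : 2^11 * 3 * 5 * 7^2 * 19 * 31^3 = p ^ a * c) (hc : ¬ p ∣ c)
    {A : Subgroup G} (hA : IsSyl p A ⊤) :
    ∃ m, Nat.card (normalizer (A : Set G)) = p ^ a * m ∧
      c = (normalizer (A : Set G)).index * m ∧ c % p = m % p := by
  have hcard := h.card_syl hp hn hc hA
  obtain ⟨m, hm⟩ := Subgroup.card_dvd_of_le (Subgroup.le_normalizer (H := A))
  rw [hcard] at hm
  have h1 := card_eq_index_mul (normalizer (A : Set G))
  rw [hm, h.card, hn] at h1
  have h2 : c = (normalizer (A : Set G)).index * m := by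
    apply Nat.eq_of_mul_eq_mul_left (Nat.pow_pos (n := a) hp.pos)
    rw [h1]; ring
  refine ⟨m, hm, h2, ?_⟩
  have := (hA.index_modEq hp).mul_right m
  rw [one_mul, ← h2] at this
  exact this

theorem Hyp.normalizer7 (h : Hyp G) {W : Subgroup G} (hW : IsSyl 7 W ⊤) :
    ∃ m, Nat.card (normalizer (W : Set G)) = 7 ^ 2 * m ∧
      2^11 * 3 * 5 * 19 * 31^3 = (normalizer (W : Set G)).index * m ∧ m % 7 = 1 := by
  obtain ⟨m, h1, h2, h3⟩ := h.normalizer_modEq p7 (a := 2) (c := 2^11 * 3 * 5 * 19 * 31^3)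
    (by norm_num) (by norm_num) hW
  exact ⟨m, h1, h2, by rw [← h3]; norm_num⟩

theorem Hyp.adj_3_7 (h : Hyp G) (h0 : adjN G 7 19 = 0) : adjN G 3 7 = 0 := by
  by_contra hne
  have hx := h.eqs
  obtain ⟨x, w, ho, hw, hxw⟩ := exists_pair_of_adjN (G := G) (p := 3) (q := 7)
    ((adjN_cases 3 7).resolve_left hne)
  obtain ⟨W, hwW, hW⟩ := exists_isSyl_ge p7 (le_top (a := zpowers w)) (isPGroup_zpowers hw)
  have hWc := h.card_syl7 hW
  have hwW' : w ∈ W := hwW (mem_zpowers w)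
  have hC := h.card_centralizer_dvd hw le_rfl (7 ^ 2 * 3) (2^11 * 5 * 19 * 31^3) (by norm_num)
    (by rw [adjN_comm]; omega) (by norm_num) (by rw [adjN_comm]; omega) (by norm_num)
    (by omega) (by omega)
  have hWC := le_centralizer_of_card_sq p7 hWc hwW'
  have hW' := hW.mono p7 hWC le_top
  have hn := hW'.normal_of_forall p7 fun d hd h1 => by
    have hd' : d ∣ 3 := by
      have := strip p7 ((Nat.div_dvd_of_dvd (Subgroup.card_dvd_of_le hWC)).trans hC)
        (hW'.not_dvd p7) 2 3 rfl
      exact hd.trans this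
    have key : ∀ d ∈ Nat.divisors 3, d % 7 = 1 → d = 1 := by decide
    exact key d (Nat.mem_divisors.mpr ⟨hd', by norm_num⟩) h1
  have hxN : x ∈ normalizer (W : Set G) := hn (mem_centralizer_singleton_iff.mpr hxw)
  have h3 : 3 ∣ Nat.card (normalizer (W : Set G)) := by
    rw [← ho]; exact Subgroup.orderOf_dvd_natCard _ hxN
  obtain ⟨m, hm, hm2, hm3⟩ := h.normalizer7 hW
  have h5 := not_dvd_normalizer p5 p7 hWc (by norm_num) (not_padj (by omega))
  have h19 := not_dvd_normalizer p19 p7 hWc (by norm_num) (not_padj (by rw [adjN_comm]; omega))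
  have h31 := not_dvd_normalizer p31 p7 hWc (by norm_num) (not_padj (by rw [adjN_comm]; omega))
  have hmd : m ∣ 2 ^ 11 * 3 := by
    have h1 := h.card_dvd_of (7 ^ 2 * (2 ^ 11 * 3)) (5 * 19 * 31 ^ 3) (by norm_num) (by norm_num)
      (by norm_num) (fun _ => h5) (by norm_num) (fun _ => h19) (fun _ => h31)
    rw [hm] at h1
    exact Nat.dvd_of_mul_dvd_mul_left (by norm_num) h1
  rw [hm] at h3
  have h3' : 3 ∣ m := Nat.Coprime.dvd_of_dvd_mul_left (by norm_num) h3
  obtain ⟨e, rfl⟩ := h3'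
  have he : e ∣ 2 ^ 11 := by
    rw [mul_comm] at hmd; exact Nat.dvd_of_mul_dvd_mul_right (by norm_num) hmd
  exact forall_dvd [(2, 11)] (by norm_num) (by norm_num) (P := fun e => (3 * e) % 7 ≠ 1)
    (by decide) e he hm3

theorem Hyp.adj_5_7 (h : Hyp G) (h0 : adjN G 7 19 = 0) : adjN G 5 7 = 0 := by
  by_contra hne
  have hx := h.eqs
  obtain ⟨x, w, ho, hw, hxw⟩ := exists_pair_of_adjN (G := G) (p := 5) (q := 7)
    ((adjN_cases 5 7).resolve_left hne)
  obtain ⟨W, hwW, hW⟩ := exists_isSyl_ge p7 (le_top (a := zpowers w)) (isPGroup_zpowers hw)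
  have hWc := h.card_syl7 hW
  have hwW' : w ∈ W := hwW (mem_zpowers w)
  have hnorm : ∀ w ∈ W, orderOf w = 7 → centralizer {w} ≤ normalizer (W : Set G) := by
    intro w hwW hw
    have hC := h.card_centralizer_dvd hw le_rfl (7 ^ 2 * 5) (2^11 * 3 * 19 * 31^3) (by norm_num)
      (by rw [adjN_comm]; omega) (by rw [adjN_comm]; omega) (by norm_num) (by norm_num)
      (by omega) (by omega)
    have hWC := le_centralizer_of_card_sq p7 hWc hwW
    have hW' := hW.mono p7 hWC le_top
    refine hW'.normal_of_forall p7 fun d hd h1 => ?_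
    have hd' : d ∣ 5 := by
      have := strip p7 ((Nat.div_dvd_of_dvd (Subgroup.card_dvd_of_le hWC)).trans hC)
        (hW'.not_dvd p7) 2 5 rfl
      exact hd.trans this
    have key : ∀ d ∈ Nat.divisors 5, d % 7 = 1 → d = 1 := by decide
    exact key d (Nat.mem_divisors.mpr ⟨hd', by norm_num⟩) h1
  have hxN : x ∈ normalizer (W : Set G) :=
    hnorm w hwW' hw (mem_centralizer_singleton_iff.mpr hxw)
  have h5 : 5 ∣ Nat.card (normalizer (W : Set G)) := by
    rw [← ho]; exact Subgroup.orderOf_dvd_natCard _ hxN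
  have hti := hW.relIndex_modEq_of_ti p7 fun u hu ho g _ hug => by
    have hWg : IsSyl 7 (MulAut.conj g • W) (centralizer {u}) :=
      (hW.conj (mem_top g)).mono p7
        (le_centralizer_of_card_sq p7 (by rw [card_conj_smul, hWc]) hug) le_top
    exact (hW.mono p7 (le_centralizer_of_card_sq p7 hWc hu) le_top).eq_of_normal p7
      (hnorm u hu ho) hWg
  rw [Subgroup.relIndex_top_right, hWc] at hti
  obtain ⟨m, hm, hm2, hm3⟩ := h.normalizer7 hW
  have h19 := not_dvd_normalizer p19 p7 hWc (by norm_num) (not_padj (by rw [adjN_comm]; omega))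
  have h31 := not_dvd_normalizer p31 p7 hWc (by norm_num) (not_padj (by rw [adjN_comm]; omega))
  have hmd : m ∣ 2 ^ 11 * 3 * 5 := by
    have h1 := h.card_dvd_of (7 ^ 2 * (2 ^ 11 * 3 * 5)) (19 * 31 ^ 3) (by norm_num) (by norm_num)
      (by norm_num) (by norm_num) (by norm_num) (fun _ => h19) (fun _ => h31)
    rw [hm] at h1
    exact Nat.dvd_of_mul_dvd_mul_left (by norm_num) h1
  rw [hm] at h5
  have h5' : 5 ∣ m := Nat.Coprime.dvd_of_dvd_mul_left (by norm_num) h5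
  obtain ⟨e, rfl⟩ := h5'
  have he : e ∣ 2 ^ 11 * 3 := by
    rw [mul_comm] at hmd; exact Nat.dvd_of_mul_dvd_mul_right (by norm_num) hmd
  have h6 := hti.mul_right (5 * e)
  rw [← hm2, one_mul] at h6
  exact forall_dvd [(2, 11), (3, 1)] (by norm_num) (by norm_num)
    (P := fun e => (2^11 * 3 * 5 * 19 * 31^3) % 7 ^ 2 ≠ (5 * e) % 7 ^ 2) (by decide) e he h6

theorem Hyp.adj_7_31 (h : Hyp G) (h0 : adjN G 7 19 = 0) : adjN G 7 31 = 0 := by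
  by_contra hne
  have hx := h.eqs
  obtain ⟨w, u, hw, hu, hwu⟩ := exists_pair_of_adjN (G := G) (p := 7) (q := 31)
    ((adjN_cases 7 31).resolve_left hne)
  have hdvd : ∀ C : Subgroup G, ∀ v : G, orderOf v = 31 → C ≤ centralizer {v} →
      Nat.card C ∣ 31 ^ 3 * 7 ^ 2 := fun C v hv hC =>
    h.card_centralizer_dvd hv hC _ (2^11 * 3 * 5 * 19) (by norm_num)
      (by rw [adjN_comm]; omega) (by rw [adjN_comm]; omega) (by rw [adjN_comm]; omega)
      (by norm_num) (by rw [adjN_comm]; omega) (by norm_num)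
  obtain ⟨U, hU, hUw⟩ := h.centralizes_syl31 p7 (k := 1) (g := w) (u := u)
    (by rw [pow_one, ← hw, pow_orderOf_eq_one]) hu hwu
    (fun v hv A hA => centralizer31_normal hdvd (by norm_num) (by decide) hv le_rfl hA)
    (by decide)
  have hUc := h.card_syl31 hU
  obtain ⟨W, hwW, hW⟩ := exists_isSyl_ge p7 (le_top (a := zpowers w)) (isPGroup_zpowers hw)
  have hWc := h.card_syl7 hW
  have hwW' : w ∈ W := hwW (mem_zpowers w)
  have key7 : ∀ d, d ∣ 31 ^ 3 → d % 7 = 1 → d = 1 :=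
    forall_dvd [(31, 3)] (by norm_num) (by norm_num) (by decide)
  -- `W` is normal in every `{7, 31}`-subgroup containing it
  have hnorm : ∀ C : Subgroup G, W ≤ C → Nat.card C ∣ 7 ^ 2 * 31 ^ 3 →
      C ≤ normalizer (W : Set G) := by
    intro C hWC hC
    have hW' := hW.mono p7 hWC le_top
    refine hW'.normal_of_forall p7 fun d hd h1 => key7 d ?_ h1
    exact hd.trans (strip p7 ((Nat.div_dvd_of_dvd (Subgroup.card_dvd_of_le hWC)).trans hC)
        (hW'.not_dvd p7) 2 _ rfl)
  have hCw := h.card_centralizer_dvd hw le_rfl (7 ^ 2 * 31 ^ 3) (2^11 * 3 * 5 * 19) (by norm_num)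
      (by rw [adjN_comm]; omega) (by rw [adjN_comm]; omega) (by rw [adjN_comm]; omega)
      (by norm_num) (by omega) (by norm_num)
  have hnw := hnorm _ (le_centralizer_of_card_sq p7 hWc hwW') hCw
  have hUW : ∀ v ∈ U, W ≤ centralizer {v} := fun v hv =>
    centralizes_of_normalizes p31 p7 (k := 3) (by
      rw [← hUc]; exact pow_natCard_of_mem hv) (hnw (hUw hv)) hWc (by decide)
  have hnU : normalizer (W : Set G) ≤ normalizer (U : Set G) := by
    have hle : U ≤ centralizer (W : Set G) := fun v hv => le_centralizer_comm (hUW v hv)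
    have hU' := hU.mono p31 hle le_top
    refine le_trans ?_ (hU'.normalizer_le p31 ?_)
    · intro g hg
      rw [← conj_smul_eq_iff] at hg ⊢
      rw [← centralizer_conj_smul, hg]
    · refine hU'.normal_of_forall p31 fun d hd h1 => ?_
      have h1' : Nat.card (centralizer (W : Set G)) ∣ 31 ^ 3 * 7 ^ 2 := by
        rw [mul_comm]
        exact (Subgroup.card_dvd_of_le
          (Subgroup.centralizer_le (Set.singleton_subset_iff.mpr hwW'))).trans hCw
      have key : ∀ d ∈ Nat.divisors (7 ^ 2), d % 31 = 1 → d = 1 := by decide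
      exact key d (Nat.mem_divisors.mpr ⟨hd.trans (strip p31
        ((Nat.div_dvd_of_dvd (Subgroup.card_dvd_of_le hle)).trans h1') (hU'.not_dvd p31) 3 _ rfl),
        by norm_num⟩) h1
  have hti := hU.relIndex_modEq_of_ti p31 fun v hv ho g _ hvg => by
    rw [conj_smul_eq_iff]
    have hWn := hnorm (centralizer {v}) (hUW v hv) (by rw [mul_comm]; exact hdvd _ v ho le_rfl)
    -- `g⁻¹ v g` is centralized by `W` too
    have hWg : MulAut.conj g • W ≤ centralizer {v} := by
      intro a ha
      rw [mem_conj_smul] at ha hvg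
      have := mem_centralizer_singleton_iff.mp (hUW _ hvg ha)
      rw [mem_centralizer_singleton_iff]
      have h3 : g * (g⁻¹ * a * g * (g⁻¹ * v * g)) * g⁻¹
        = g * (g⁻¹ * v * g * (g⁻¹ * a * g)) * g⁻¹ := by rw [this]
      simpa [mul_assoc] using h3
    have hWg' := (hW.mono p7 (hUW v hv) le_top).eq_of_normal p7 hWn
      ((hW.conj (mem_top g)).mono p7 hWg le_top)
    exact hnU (conj_smul_eq_iff.mp hWg')
  rw [Subgroup.relIndex_top_right, hUc] at hti
  obtain ⟨m, hm, hm2, -⟩ := h.normalizer_modEq p31 (a := 3) (c := 2^11 * 3 * 5 * 7^2 * 19)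
      (by norm_num) (by norm_num) hU
  have h7 : 7 ^ 2 ∣ m := by
    have h1 : Nat.card W ∣ Nat.card (normalizer (U : Set G)) :=
      Subgroup.card_dvd_of_le (Subgroup.le_normalizer.trans hnU)
    rw [hWc, hm] at h1
    exact Nat.Coprime.dvd_of_dvd_mul_left (by norm_num) h1
  obtain ⟨e, rfl⟩ := h7
  have hi : (normalizer (U : Set G)).index ∣ 2 ^ 11 * 3 * 5 * 19 := by
    refine ⟨e, ?_⟩
    apply Nat.eq_of_mul_eq_mul_left (show 0 < 7 ^ 2 by norm_num)
    linarith
  have h1 := forall_dvd [(2, 11), (3, 1), (5, 1), (19, 1)] (by norm_num) (by norm_num)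
    (P := fun d => d % 31 ^ 3 = 1 % 31 ^ 3 → d = 1) (by decide) _ hi hti
  rw [Subgroup.index_eq_one] at h1
  have h19 := not_dvd_normalizer p19 p31 hUc (by norm_num)
    (not_padj h.adj_19_31)
  rw [h1, Subgroup.card_top, h.card] at h19
  exact h19 (by norm_num)

theorem Hyp.syl_prime (h : Hyp G) {p c₀ : ℕ} (hp : p.Prime)
    (hn : 2^11 * 3 * 5 * 7^2 * 19 * 31^3 = p * c₀) (hc : ¬ p ∣ c₀) {x : G} (hx : orderOf x = p) :
    ∃ i e c, e ∣ p - 1 ∧ Nat.card (centralizer {x}) = p * c ∧ c₀ = i * (e * c) ∧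
      c₀ % p = (e * c) % p ∧ Nat.card (normalizer (zpowers x : Set G)) = e * (p * c) := by
  have hP : IsSyl p (zpowers x) ⊤ := isSyl_of_card hp (a := 1) (c := c₀) le_top
    (by rw [Nat.card_zpowers, hx, pow_one]) (by rw [Subgroup.card_top, h.card, pow_one, hn]) hc
  have hcx : Nat.card (zpowers x) = p := by rw [Nat.card_zpowers, hx]
  obtain ⟨e, he, hN⟩ := card_normalizer_of_prime hp hcx
  obtain ⟨c, hcc⟩ := Subgroup.card_dvd_of_le (mem_centralizer_self x)
  rw [hcx] at hcc
  have hi := hP.index_modEq hp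
  rw [centralizer_zpowers, hcc] at hN
  have hm := card_eq_index_mul (normalizer (zpowers x : Set G))
  rw [hN, h.card, hn] at hm
  set i := (normalizer (zpowers x : Set G)).index
  have hm' : c₀ = i * (e * c) := by
    apply Nat.eq_of_mul_eq_mul_left hp.pos
    rw [hm]; ring
  refine ⟨i, e, c, he, hcc, hm', ?_, hN⟩
  have := hi.mul_right (e * c)
  rw [← hm', one_mul] at this
  exact this

theorem Hyp.not_adj_5_31 (h : Hyp G) (h35 : adjN G 3 5 = 1) (h531 : adjN G 5 31 = 1) : False := by
  have hx := h.eqs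
  obtain ⟨y, x, ho, hx5, hxy⟩ := exists_pair_of_adjN h35
  obtain ⟨i, e, c, he, hC, h1, h2, -⟩ := h.syl_prime p5 (c₀ := 2^11 * 3 * 7^2 * 19 * 31^3)
    (by norm_num) (by norm_num) hx5
  have hd := h.card_centralizer_dvd hx5 le_rfl (5 * (3 * 31 ^ 3)) (2 ^ 11 * 7 ^ 2 * 19)
    (by norm_num) (by rw [adjN_comm]; omega) (by norm_num) (by norm_num) (by omega)
    (by omega) (by norm_num)
  have h3 : 3 ∣ Nat.card (centralizer {x}) := by
    rw [← ho]; exact Subgroup.orderOf_dvd_natCard _ (mem_centralizer_singleton_iff.mpr hxy)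
  rw [hC] at hd h3
  obtain ⟨c, rfl⟩ := Nat.Coprime.dvd_of_dvd_mul_left (by norm_num) h3
  have hc : c ∣ 31 ^ 3 := Nat.dvd_of_mul_dvd_mul_left (by norm_num)
    (Nat.dvd_of_mul_dvd_mul_left (by norm_num) hd)
  have he' : e ∈ Nat.divisors 4 := Nat.mem_divisors.mpr ⟨he, by norm_num⟩
  exact forall_dvd [(31, 3)] (by norm_num) (by norm_num)
    (P := fun c => ∀ e ∈ Nat.divisors 4, 2^11 * 3 * 7^2 * 19 * 31^3 % 5 ≠ (e * (3 * c)) % 5)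
    (by decide) c hc e he' h2

/-- An element of order `2` without fixed points inverts. -/
theorem inverts_of_fpf {A : Subgroup G} {t : G} (ht : t * t = 1)
    (hA : t ∈ normalizer (A : Set G)) (hf : ∀ a ∈ A, t * a = a * t → a = 1) :
    ∀ a ∈ A, t * a * t = a⁻¹ := by
  have htinv : t⁻¹ = t := inv_eq_of_mul_eq_one_left ht
  have hconj : ∀ a ∈ A, t * a * t ∈ A := fun a ha => by
    have := (Subgroup.mem_normalizer_iff.mp hA a).mp ha
    rwa [htinv] at this
  have htt : ∀ x : G, t * (t * x) = x := fun x => by rw [← mul_assoc, ht, one_mul]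
  let f : A → A := fun a => ⟨a.1⁻¹ * (t * a.1 * t), A.mul_mem (A.inv_mem a.2) (hconj _ a.2)⟩
  have hinj : Function.Injective f := by
    intro a b hab
    have h1 : a.1⁻¹ * (t * a.1 * t) = b.1⁻¹ * (t * b.1 * t) := congrArg Subtype.val hab
    have h2 : b.1 * a.1⁻¹ = 1 := by
      apply hf _ (A.mul_mem b.2 (A.inv_mem a.2))
      have h3 : b.1 * (a.1⁻¹ * (t * a.1 * t)) * (t * a.1⁻¹) =
        b.1 * (b.1⁻¹ * (t * b.1 * t)) * (t * a.1⁻¹) := by rw [h1]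
      simp only [mul_assoc, htt, mul_inv_cancel_left] at h3
      simpa [mul_assoc, htt, ht] using h3.symm
    exact Subtype.ext (mul_inv_eq_one.mp h2).symm
  have hsurj := Finite.surjective_of_injective hinj
  intro a ha
  obtain ⟨b, hb⟩ := hsurj ⟨a, ha⟩
  have hb' : b.1⁻¹ * (t * b.1 * t) = a := congrArg Subtype.val hb
  rw [← hb']
  simp [mul_assoc, htinv, ht]

theorem comm_of_inverts {A : Subgroup G} {t : G} (ht : t * t = 1)
    (h : ∀ a ∈ A, t * a * t = a⁻¹) : ∀ a ∈ A, ∀ b ∈ A, a * b = b * a := by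
  intro a ha b hb
  have htt : ∀ x : G, t * (t * x) = x := fun x => by rw [← mul_assoc, ht, one_mul]
  have h1 := h _ (A.mul_mem ha hb)
  have h2 : t * (a * b) * t = (t * a * t) * (t * b * t) := by simp [mul_assoc, htt]
  rw [h2, h a ha, h b hb, ← mul_inv_rev] at h1
  exact (inv_injective h1).symm

theorem eq_one_of_comm {A : Subgroup G} {p q : ℕ} (hq : q.Prime) (hA : IsPGroup q A) {t : G}
    (ht : orderOf t = p) (hadj : ¬ PAdj G p q) : ∀ a ∈ A, t * a = a * t → a = 1 := by
  intro a ha hc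
  by_contra hne
  have hpg : IsPGroup q (zpowers a) := hA.to_le (by rwa [zpowers_le])
  obtain ⟨z, hz, ho⟩ := exists_orderOf_of_ne_bot hq hpg (by rwa [Ne, zpowers_eq_bot])
  refine hadj ⟨t, z, ht, ho, ?_⟩
  obtain ⟨k, rfl⟩ := Subgroup.mem_zpowers_iff.mp hz
  exact (Commute.zpow_right (show Commute t a from hc) k)

theorem Hyp.not_adj_3_31 (h : Hyp G) (h0 : adjN G 7 19 = 0) (h23 : adjN G 2 3 = 0)
    (h331 : adjN G 3 31 = 1) : False := by
  have hx := h.eqs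
  have h57 := h.adj_5_7 h0
  have h731 := h.adj_7_31 h0
  have h1931 := h.adj_19_31
  obtain ⟨U, hU⟩ := exists_isSyl p31 (⊤ : Subgroup G)
  have hUc := h.card_syl31 hU
  obtain ⟨m, hm, hm2, hm3⟩ := h.normalizer_modEq p31 (a := 3) (c := 2^11 * 3 * 5 * 7^2 * 19)
      (by norm_num) (by norm_num) hU
  have h7 := not_dvd_normalizer p7 p31 hUc (by norm_num) (not_padj h731)
  have h19 := not_dvd_normalizer p19 p31 hUc (by norm_num) (not_padj h1931)
  have hmd : m ∣ 2 ^ 11 * 3 * 5 := by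
    have h1 := h.card_dvd_of (31 ^ 3 * (2 ^ 11 * 3 * 5)) (7 ^ 2 * 19) (by norm_num) (by norm_num)
      (by norm_num) (by norm_num) (fun _ => h7) (fun _ => h19) (by norm_num)
    rw [hm] at h1
    exact Nat.dvd_of_mul_dvd_mul_left (by norm_num) h1
  have hm2' : 2 ∣ m := forall_dvd [(2, 11), (3, 1), (5, 1)] (by norm_num) (by norm_num)
    (P := fun m => 2^11 * 3 * 5 * 7^2 * 19 % 31 = m % 31 → 2 ∣ m) (by decide) m hmd hm3
  obtain ⟨t, htN, ht⟩ := exists_mem_orderOf p2 (C := normalizer (U : Set G))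
    (hm ▸ hm2'.mul_left _)
  have htt : t * t = 1 := by rw [← pow_two, ← ht, pow_orderOf_eq_one]
  have hinv := inverts_of_fpf htt htN (eq_one_of_comm p31 hU.isPGroup ht (not_padj (by omega)))
  have hab := comm_of_inverts htt hinv
  have hUC : ∀ u ∈ U, U ≤ centralizer {u} := fun u hu a ha =>
    mem_centralizer_singleton_iff.mpr (hab a ha u hu)
  have hCd : ∀ u, orderOf u = 31 → Nat.card (centralizer {u}) ∣ 31 ^ 3 * 3 := fun u hu =>
    h.card_centralizer_dvd hu le_rfl _ (2 ^ 11 * 5 * 7 ^ 2 * 19)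
      (by norm_num) (by rw [adjN_comm]; omega) (by norm_num) (by rw [adjN_comm]; omega)
      (by rw [adjN_comm]; omega) (by rw [adjN_comm]; omega) (by norm_num)
  have hCn : ∀ u ∈ U, orderOf u = 31 → centralizer {u} ≤ normalizer (U : Set G) := by
    intro u hu ho
    have hU' := hU.mono p31 (hUC u hu) le_top
    refine hU'.normal_of_forall p31 fun d hd h1 => ?_
    refine forall_dvd [(3, 1)] (by norm_num) (N := 3) (by norm_num)
      (P := fun d => d % 31 = 1 → d = 1) (by decide) d (hd.trans ?_) h1
    exact strip p31 ((Nat.div_dvd_of_dvd (Subgroup.card_dvd_of_le (hUC u hu))).trans (hCd u ho))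
        (hU'.not_dvd p31) 3 3 rfl
  have hti := hU.relIndex_modEq_of_ti p31 fun u hu ho g _ hug => by
    refine (hU.mono p31 (hUC u hu) le_top).eq_of_normal p31 (hCn u hu ho)
      ((hU.conj (mem_top g)).mono p31 ?_ le_top)
    intro a ha
    rw [mem_conj_smul] at ha hug
    have h1 := hab _ ha _ hug
    rw [mem_centralizer_singleton_iff]
    have h3 : g * (g⁻¹ * a * g * (g⁻¹ * u * g)) * g⁻¹
        = g * (g⁻¹ * u * g * (g⁻¹ * a * g)) * g⁻¹ := by rw [h1]
    simpa [mul_assoc] using h3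
  rw [Subgroup.relIndex_top_right, hUc] at hti
  have hm960 : m = 960 := by
    have h1 := hti.mul_right m
    rw [← hm2, one_mul] at h1
    exact forall_dvd [(2, 11), (3, 1), (5, 1)] (by norm_num) (by norm_num)
      (P := fun m => 2^11 * 3 * 5 * 7^2 * 19 % 31 ^ 3 = m % 31 ^ 3 → m = 960) (by decide) m hmd h1
  subst hm960
  have hUC' : U ≤ centralizer (U : Set G) := fun a ha =>
    Subgroup.mem_centralizer_iff.mpr fun b hb => hab b hb a ha
  obtain ⟨u₀, hu₀, hou₀⟩ := exists_mem_orderOf p31 (C := U) (hUc ▸ by norm_num)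
  have hCUd : Nat.card (centralizer (U : Set G)) ∣ 31 ^ 3 * 3 :=
    (Subgroup.card_dvd_of_le (Subgroup.centralizer_le
      (Set.singleton_subset_iff.mpr hu₀))).trans (hCd u₀ hou₀)
  obtain ⟨c, hc⟩ := Subgroup.card_dvd_of_le hUC'
  rw [hUc] at hc
  rw [hc] at hCUd
  have hc3 : c ∣ 3 := Nat.dvd_of_mul_dvd_mul_left (by norm_num) hCUd
  rcases (Nat.dvd_prime p3).mp hc3 with rfl | rfl
  · -- `C(U) = U`
    obtain ⟨y, hyN, hy⟩ := exists_mem_orderOf p3 (C := normalizer (U : Set G))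
      (hm ▸ by norm_num)
    have hCU : ∀ a, a ∈ centralizer (U : Set G) → a ∈ U := by
      have := Subgroup.eq_of_le_of_card_ge hUC' (by rw [hc, hUc, mul_one])
      intro a ha; rwa [this]
    set S : Set G := {x | ∃ a ∈ U, x = t * a} with hS
    have hyinv : ∀ a ∈ U, y * a * y⁻¹ ∈ U := fun a ha =>
      (Subgroup.mem_normalizer_iff.mp hyN a).mp ha
    have hyS : ∀ x ∈ S, y * x * y⁻¹ ∈ S := by
      rintro _ ⟨a, ha, rfl⟩
      refine ⟨t⁻¹ * (y * (t * a) * y⁻¹), ?_, by simp⟩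
      have h1 : t⁻¹ * (y * t * y⁻¹) ∈ U := by
        apply hCU
        rw [Subgroup.mem_centralizer_iff]
        intro b hb
        have hb' : y⁻¹ * b * y ∈ U := by
          have := (Subgroup.mem_normalizer_iff.mp ((normalizer (U : Set G)).inv_mem hyN) b).mp hb
          rwa [inv_inv] at this
        have htinv : t⁻¹ = t := inv_eq_of_mul_eq_one_left htt
        have hbt : ∀ b ∈ U, b * t = t * b⁻¹ := fun b hb => by
          rw [← hinv b hb, ← mul_assoc, ← mul_assoc, htt, one_mul]
        rw [htinv]
        calc b * (t * (y * t * y⁻¹)) = b * t * (y * t * y⁻¹) := by simp only [mul_assoc]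
          _ = t * y * ((y⁻¹ * b * y)⁻¹ * t) * y⁻¹ := by rw [hbt b hb]; simp [mul_assoc]
          _ = t * (y * t * y⁻¹) * b := by
            rw [hbt _ (U.inv_mem hb'), inv_inv]; simp [mul_assoc]
      have h2 := hyinv a ha
      have h3 : t⁻¹ * (y * (t * a) * y⁻¹) = t⁻¹ * (y * t * y⁻¹) * (y * a * y⁻¹) := by
        simp [mul_assoc]
      rw [h3]; exact U.mul_mem h1 h2
    have hScard : Nat.card S = 31 ^ 3 := by
      rw [← hUc]
      exact Nat.card_congr ⟨fun x => ⟨t⁻¹ * x.1, by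
          obtain ⟨x, a, ha, rfl⟩ := x; simpa using ha⟩,
        fun a => ⟨t * a.1, a.1, a.2, rfl⟩, fun x => Subtype.ext (by simp),
        fun x => Subtype.ext (by simp)⟩
    have hfix := card_conj_fixed_modEq p3 (g := y) (k := 1)
      (by rw [pow_one, ← hy, pow_orderOf_eq_one]) hyS
    rw [hScard] at hfix
    have hne : Nat.card {x : G | x ∈ S ∧ y * x = x * y} ≠ 0 := by
      intro h0
      rw [h0] at hfix
      exact absurd hfix (by decide)
    obtain ⟨⟨x, ⟨a, ha, rfl⟩, hxy⟩⟩ := (Nat.card_ne_zero.mp hne).1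
    refine not_padj h23 ⟨t * a, y, ?_, hy, hxy.symm⟩
    refine orderOf_eq_prime ?_ ?_
    · rw [pow_two]
      have := hinv a ha
      have h2 : t * a * (t * a) = (t * a * t) * a := by simp [mul_assoc]
      rw [h2, this, inv_mul_cancel]
    · intro h1
      have h2 : t = a⁻¹ := eq_inv_of_mul_eq_one_left h1
      have h3 : orderOf t ∣ Nat.card U := by
        rw [h2]; exact Subgroup.orderOf_dvd_natCard _ (U.inv_mem ha)
      rw [ht, hUc] at h3
      norm_num at h3
  · -- a normal subgroup of order `3`
    obtain ⟨Q, hQ⟩ := exists_isSyl p3 (centralizer (U : Set G))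
    have hQc : Nat.card Q = 3 := by
      have := hQ.card_eq p3 (a := 1) (c := 31 ^ 3) (by rw [hc]; norm_num) (by norm_num)
      simpa using this
    have hUp : centralizer (U : Set G) ≤ normalizer (Q : Set G) := by
      have h1 : U ≤ normalizer (Q : Set G) := fun a ha => centralizer_le_normalizer' Q
        (Subgroup.mem_centralizer_iff.mpr fun q hq =>
          (Subgroup.mem_centralizer_iff.mp (hQ.1 hq) a ha).symm)
      have h2 : Nat.card (normalizer (Q : Set G) ⊓ centralizer (U : Set G) : Subgroup G)
          = 31 ^ 3 * 3 := by
        apply Nat.dvd_antisymm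
        · rw [← hc]; exact Subgroup.card_dvd_of_le inf_le_right
        · apply Nat.Coprime.mul_dvd_of_dvd_of_dvd (by norm_num)
          · rw [← hUc]; exact Subgroup.card_dvd_of_le (le_inf h1 hUC')
          · conv_lhs => rw [← hQc]
            exact Subgroup.card_dvd_of_le (le_inf Subgroup.le_normalizer hQ.1)
      have := Subgroup.eq_of_le_of_card_ge
        (inf_le_right : normalizer (Q : Set G) ⊓ centralizer (U : Set G) ≤ _) (by rw [h2, hc])
      rw [← this]; exact inf_le_left
    have hNN : normalizer (U : Set G) ≤ normalizer (Q : Set G) := by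
      refine le_trans ?_ (hQ.normalizer_le p3 hUp)
      intro g hg
      rw [← conj_smul_eq_iff] at hg ⊢
      rw [← centralizer_conj_smul, hg]
    obtain ⟨e, he, hN⟩ := card_normalizer_of_prime p3 hQc
    obtain ⟨q, hq, hqo, rfl⟩ := exists_orderOf_of_card p3 hQc
    have h4 : 4 ∣ Nat.card (normalizer (zpowers q : Set G)) :=
      (show 4 ∣ 31 ^ 3 * 960 by norm_num).trans (hm ▸ Subgroup.card_dvd_of_le hNN)
    have hodd : ¬ 2 ∣ Nat.card (centralizer {q}) :=
      not_dvd_centralizer p2 hqo le_rfl (by rw [adjN_comm]; exact h23)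
    rw [hN, centralizer_zpowers] at h4
    have h4' : 4 ∣ e := Nat.Coprime.dvd_of_dvd_mul_right
      (Nat.Coprime.pow_left 2 ((Nat.Prime.coprime_iff_not_dvd p2).mpr hodd)) h4
    have := Nat.le_of_dvd (by norm_num) (h4'.trans he)
    omega

theorem Hyp.adj_7_19 (h : Hyp G) : adjN G 7 19 = 1 := by
  refine (adjN_cases 7 19).resolve_left fun h0 => ?_
  have hx := h.eqs
  have h37 := h.adj_3_7 h0
  have h57 := h.adj_5_7 h0
  have h731 := h.adj_7_31 h0
  have h319 := h.adj_3_19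
  have h519 := h.adj_5_19
  have h1931 := h.adj_19_31
  have := adjN_le (G := G) 2 3
  have := adjN_le (G := G) 3 5
  rcases adjN_cases (G := G) 5 31 with h531 | h531
  · exact h.not_adj_3_31 h0 (by omega) (by omega)
  · exact h.not_adj_5_31 (by omega) h531

/-- The whole prime graph. -/
theorem Hyp.graph (h : Hyp G) :
    adjN G 7 19 = 1 ∧ adjN G 2 31 = 1 ∧ adjN G 2 3 = 1 ∧ adjN G 2 5 = 1 ∧ adjN G 3 5 = 1 ∧
    adjN G 2 7 = 0 ∧ adjN G 2 19 = 0 ∧ adjN G 3 7 = 0 ∧ adjN G 3 19 = 0 ∧ adjN G 3 31 = 0 ∧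
    adjN G 5 7 = 0 ∧ adjN G 5 19 = 0 ∧ adjN G 5 31 = 0 ∧ adjN G 7 31 = 0 ∧
    adjN G 19 31 = 0 := by
  have hx := h.eqs
  have h1 := h.adj_7_19
  have := adjN_le (G := G) 2 3
  have := adjN_le (G := G) 3 5
  have := adjN_le (G := G) 2 5
  have := adjN_le (G := G) 2 31
  omega

end Basic

section Star

/-- The Gaussian period of the element `r` with respect to the subgroup of order five of
`(ZMod 31)ˣ`. -/
def per {R : Type*} [Ring R] (r : R) : R := r + r ^ 2 + r ^ 4 + r ^ 8 + r ^ 16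

theorem per_mul_self {R : Type*} [CommRing R] {r : R} (h2 : (2 : R) = 0) (h31 : r ^ 31 = 1) :
    per r * per r = per r := by
  simp only [per]
  linear_combination (r * (r ^ 2 + r ^ 4 + r ^ 8 + r ^ 16) + r ^ 2 * (r ^ 4 + r ^ 8 + r ^ 16)
    + r ^ 4 * (r ^ 8 + r ^ 16) + r ^ 8 * r ^ 16) * h2 + r * h31

theorem per_pow_eq {R : Type*} [Ring R] {r : R} (h31 : r ^ 31 = 1) (n : ℕ) :
    per (r ^ n) = r ^ (n % 31) + r ^ (n * 2 % 31) + r ^ (n * 4 % 31) + r ^ (n * 8 % 31)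
      + r ^ (n * 16 % 31) := by
  simp only [per, ← pow_mul, ← pow_eq_pow_mod _ h31]

theorem per_mul_per {R : Type*} [CommRing R] {r : R} (h2 : (2 : R) = 0) (h31 : r ^ 31 = 1) :
    per r * per (r ^ 5) = per (r ^ 3) + per (r ^ 5) + per (r ^ 25) := by
  rw [per_pow_eq h31, per_pow_eq h31, per_pow_eq h31]
  norm_num [per]
  linear_combination (r ^ 5 + r ^ 3) * h31
    + (r ^ 11 + r ^ 21 + r ^ 22 + r ^ 13 + r ^ 26) * h2

theorem per_sum {R : Type*} [CommRing R] {r : R} (h2 : (2 : R) = 0) (h31 : r ^ 31 = 1)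
    (h : ∑ i ∈ Finset.range 31, r ^ i = 0) :
    per r * (1 + per (r ^ 5)) + per (r ^ 5) * (1 + per (r ^ 25)) + per (r ^ 25) * (1 + per r)
      = 1 := by
  have p1 := per_mul_per h2 h31
  have p2 := per_mul_per h2 (show (r ^ 5) ^ 31 = 1 by rw [pow_right_comm, h31, one_pow])
  have p3 := per_mul_per h2 (show (r ^ 25) ^ 31 = 1 by rw [pow_right_comm, h31, one_pow])
  simp only [← pow_mul] at p2 p3
  rw [pow_eq_pow_mod (25 * 5) h31] at p2 p3
  norm_num at p2 p3
  have hs : 1 + per r + per (r ^ 5) + per (r ^ 25) + per (r ^ 3) + per (r ^ 15) + per (r ^ 75)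
      = 0 := by
    simp only [per_pow_eq h31]
    norm_num [per]
    simp only [Finset.sum_range_succ, Finset.sum_range_zero] at h
    linear_combination h
  have e : r ^ 625 = r ^ 5 := pow_eq_pow_mod _ h31
  rw [e] at p3
  linear_combination p1 + p2 + p3 + hs + (per r + per (r ^ 5) + per (r ^ 25) - 1) * h2

/-- The orthogonal idempotent attached to `r`. -/
def idem {R : Type*} [Ring R] (r : R) : R := per r * (1 + per (r ^ 5))

theorem idem_spec {R : Type*} [CommRing R] {r : R} (h2 : (2 : R) = 0) (h31 : r ^ 31 = 1)
    (h : ∑ i ∈ Finset.range 31, r ^ i = 0) :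
    idem r + idem (r ^ 5) + idem (r ^ 25) = 1 ∧ idem r * idem (r ^ 5) = 0 ∧
      idem r * idem (r ^ 25) = 0 ∧ idem (r ^ 5) * idem (r ^ 25) = 0 := by
  have e : r ^ 125 = r := (pow_eq_pow_mod _ h31).trans (pow_one r)
  simp only [idem, ← pow_mul]
  norm_num [e]
  have s1 := per_mul_self h2 h31
  have s2 := per_mul_self h2 (show (r ^ 5) ^ 31 = 1 by rw [pow_right_comm, h31, one_pow])
  have s3 := per_mul_self h2 (show (r ^ 25) ^ 31 = 1 by rw [pow_right_comm, h31, one_pow])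
  refine ⟨per_sum h2 h31 h, ?_, ?_, ?_⟩
  · linear_combination per r * (1 + per (r ^ 25)) * (s2 + per (r ^ 5) * h2)
  · linear_combination per (r ^ 25) * (1 + per (r ^ 5)) * (s1 + per r * h2)
  · linear_combination per (r ^ 5) * (1 + per r) * (s3 + per (r ^ 25) * h2)

theorem idem_spec' {S : Type*} [Ring S] {a : S} (h2 : (2 : S) = 0) (h31 : a ^ 31 = 1)
    (h : ∑ i ∈ Finset.range 31, a ^ i = 0) :
    idem a + idem (a ^ 5) + idem (a ^ 25) = 1 ∧ idem a * idem (a ^ 5) = 0 ∧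
      idem a * idem (a ^ 25) = 0 ∧ idem (a ^ 5) * idem (a ^ 25) = 0 ∧
      idem (a ^ 5) * idem a = 0 ∧ idem (a ^ 25) * idem a = 0 ∧
      idem (a ^ 25) * idem (a ^ 5) = 0 ∧ Commute a (idem a) := by
  let f : Polynomial ℤ →+* S := (Polynomial.aeval a).toRingHom
  let R := Polynomial ℤ ⧸ RingHom.ker f
  let F : R →+* S := RingHom.kerLift f
  have hF : Function.Injective F := RingHom.kerLift_injective f
  let r : R := Ideal.Quotient.mk _ Polynomial.X
  have hr : F r = a := by
    change f Polynomial.X = a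
    simp [f]
  have hper (x : R) : F (per x) = per (F x) := by simp [per]
  have hid (x : R) : F (idem x) = idem (F x) := by simp [idem, hper]
  obtain ⟨i1, i2, i3, i4⟩ := idem_spec (r := r) (hF (by rw [map_ofNat, h2, map_zero]))
    (hF (by simpa [hr] using h31)) (hF (by simpa [hr] using h))
  have c (x y : R) : Commute (F x) (F y) := by
    rw [commute_iff_eq, ← map_mul, ← map_mul, mul_comm]
  refine ⟨?_, ?_, ?_, ?_, ?_, ?_, ?_, ?_⟩
  · simpa [hid, hr] using congrArg F i1
  · simpa [hid, hr] using congrArg F i2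
  · simpa [hid, hr] using congrArg F i3
  · simpa [hid, hr] using congrArg F i4
  · simpa [hid, hr] using congrArg F ((mul_comm _ _).trans i2)
  · simpa [hid, hr] using congrArg F ((mul_comm _ _).trans i3)
  · simpa [hid, hr] using congrArg F ((mul_comm _ _).trans i4)
  · simpa [hid, hr] using c r (idem r)

theorem subsingleton_of_fixedPointFree {V : Type*} [AddCommGroup V] [Finite V]
    (hV2 : ∀ v : V, 2 • v = 0) (hV : Nat.card V ≤ 2 ^ 11) (a b : AddMonoid.End V)
    (ha : a ^ 31 = 1) (hb : Function.Injective b) (hab : b * a = a ^ 5 * b)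
    (hf : ∀ v, a v = v → v = 0) : Subsingleton V := by
  have h2 : (2 : AddMonoid.End V) = 0 := by
    ext v
    exact (two_smul ℕ v).symm.trans (hV2 v) |> fun h => by rw [← one_add_one_eq_two]; exact h
  have hPhi : ∑ i ∈ Finset.range 31, a ^ i = 0 := by
    have := mul_geom_sum a 31
    rw [ha, sub_self] at this
    ext v
    have h' := congrArg (fun f : AddMonoid.End V => f v) this
    exact hf _ (sub_eq_zero.mp h')
  obtain ⟨i1, i2, i3, i4, i5, i6, i7, ic⟩ := idem_spec' h2 ha hPhi
  have hbp (n : ℕ) : b * a ^ n = (a ^ 5) ^ n * b := by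
    induction n with
    | zero => simp
    | succ n ih => rw [pow_succ, ← mul_assoc, ih, mul_assoc, hab, pow_succ _ n]; simp [mul_assoc]
  have hbper (n : ℕ) : b * per (a ^ n) = per ((a ^ 5) ^ n) * b := by
    simp only [per, mul_add, add_mul, ← pow_mul, hbp, mul_assoc]
  have hbid (n : ℕ) : b * idem (a ^ n) = idem ((a ^ 5) ^ n) * b := by
    have e1 := hbper n
    have e2 := hbper (n * 5)
    simp only [idem, mul_add, add_mul, ← pow_mul, mul_one] at e1 e2 ⊢
    rw [← mul_assoc, e1, mul_assoc, e2, show 5 * (n * 5) = 5 * n * 5 by ring, mul_assoc, mul_assoc]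
  have hb1 : b * idem a = idem (a ^ 5) * b := by simpa using hbid 1
  have hb2 : b * idem (a ^ 5) = idem (a ^ 25) * b := by simpa [← pow_mul] using hbid 5
  by_contra hne
  rw [not_subsingleton_iff_nontrivial] at hne
  have hW : Function.Injective b := hb
  have hx : ∃ w, idem a w ≠ 0 := by
    by_contra! hall
    have h0 : idem a = 0 := by ext v; exact hall v
    have hinj (f : AddMonoid.End V) (h : b * f = 0) : f = 0 := by
      ext v
      have := congrArg (fun f : AddMonoid.End V => f v) h
      exact hb (by simpa using this)
    have hsurj (f : AddMonoid.End V) (h : f * b = 0) : f = 0 := by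
      ext v
      obtain ⟨w, rfl⟩ := (Finite.injective_iff_surjective.mp hb) v
      exact congrArg (fun f : AddMonoid.End V => f w) h
    have h5 : idem (a ^ 5) = 0 := hsurj _ (by rw [← hb1, h0, mul_zero])
    have h25 : idem (a ^ 25) = 0 := hsurj _ (by rw [← hb2, h5, mul_zero])
    rw [h0, h5, h25] at i1
    obtain ⟨v, hv⟩ := exists_ne (0 : V)
    exact hv (by simpa using (congrArg (fun f : AddMonoid.End V => f v) i1).symm)
  obtain ⟨w, hw⟩ := hx
  have hidem {x y z : AddMonoid.End V} (h1 : x + y + z = 1) (h2 : x * y = 0) (h3 : x * z = 0) :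
      x * x = x := by
    have := congrArg (x * ·) h1
    simpa [mul_add, h2, h3] using this
  have happ (f g : AddMonoid.End V) (h : f * g = 0) (v : V) : f (g v) = 0 :=
    congrArg (fun f : AddMonoid.End V => f v) h
  have hsq (f : AddMonoid.End V) (h : f * f = f) (v : V) : f (f v) = f v :=
    congrArg (fun f : AddMonoid.End V => f v) h
  have s1 := hsq _ (hidem i1 i2 i3)
  have s2 := hsq _ (hidem (x := idem (a ^ 5)) (y := idem a) (by rw [← i1]; abel) i5 i4)
  have s3 := hsq _ (hidem (x := idem (a ^ 25)) (y := idem a) (by rw [← i1]; abel) i6 i7)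
  -- the orbit of `idem a w` under `a`, together with `0`
  let φ : Option (Fin 31) → V := fun o => o.elim 0 fun i => (a ^ i.1) w
  have hpow (n : ℕ) (v : V) : (a ^ n) v = a^[n] v := by
    rw [← AddMonoid.End.coe_pow]
  have hcomm (n : ℕ) (v : V) : idem a (a^[n] v) = a^[n] (idem a v) := by
    rw [← hpow, ← hpow]
    exact congrArg (fun f : AddMonoid.End V => f v) (ic.pow_left n).eq.symm
  have hper : Function.minimalPeriod a (idem a w) = 31 := by
    have h1 : Function.minimalPeriod a (idem a w) ∣ 31 := by
      apply Function.IsPeriodicPt.minimalPeriod_dvd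
      rw [Function.IsPeriodicPt, Function.IsFixedPt, ← hpow, ha]
      rfl
    refine ((Nat.dvd_prime (by norm_num)).mp h1).resolve_left fun h => hw (hf _ ?_)
    exact Function.minimalPeriod_eq_one_iff_isFixedPt.mp h
  have hne0 (i : ℕ) : a^[i] (idem a w) ≠ 0 := by
    have hinj : Function.Injective a := by
      intro x y h
      have h1 (v : V) : a^[30] (a v) = v := by
        rw [← Function.iterate_succ_apply, ← hpow, ha]; rfl
      rw [← h1 x, h, h1]
    intro h
    refine hw (hinj.iterate i (h.trans ?_))
    rw [← hpow, map_zero]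
  have hφ : Function.Injective fun o => idem a (φ o) := by
    rintro (_ | i) (_ | j) h
    · rfl
    · exact absurd (by simpa [φ, hcomm, hpow] using h.symm) (hne0 j)
    · exact absurd (by simpa [φ, hcomm, hpow] using h) (hne0 i)
    · have h' : a^[i.1] (idem a w) = a^[j.1] (idem a w) := by
        simpa [φ, hcomm, hpow] using h
      have := Function.iterate_injOn_Iio_minimalPeriod (f := a) (x := idem a w)
        (by simp [hper]) (by simp [hper]) h'
      rw [Fin.ext this]
  have hφ5 : Function.Injective fun o => (idem (a ^ 5) : AddMonoid.End V) (b (φ o)) := by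
    refine Function.Injective.of_comp_iff hb _ |>.mpr hφ |> fun h => ?_
    intro o o' ho
    have e := fun v => congrArg (fun f : AddMonoid.End V => f v) hb1
    exact h ((e (φ o)).trans (ho.trans (e (φ o')).symm))
  have hφ25 : Function.Injective fun o => (idem (a ^ 25) : AddMonoid.End V) (b (b (φ o))) := by
    refine Function.Injective.of_comp_iff hb _ |>.mpr hφ5 |> fun h => ?_
    intro o o' ho
    have e := fun v => congrArg (fun f : AddMonoid.End V => f v) hb2
    exact h ((e (b (φ o))).trans (ho.trans (e (b (φ o'))).symm))
  let F : Option (Fin 31) × Option (Fin 31) × Option (Fin 31) → V := fun p =>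
    idem a (φ p.1) + (idem (a ^ 5) : AddMonoid.End V) (b (φ p.2.1)) + (idem (a ^ 25) : AddMonoid.End V) (b (b (φ p.2.2)))
  have hF : Function.Injective F := by
    rintro ⟨x, y, z⟩ ⟨x', y', z'⟩ h
    have k1 := congrArg (idem a : AddMonoid.End V) h
    have k2 := congrArg (idem (a ^ 5) : AddMonoid.End V) h
    have k3 := congrArg (idem (a ^ 25) : AddMonoid.End V) h
    simp only [F, map_add, happ _ _ i2, happ _ _ i3, happ _ _ i4, happ _ _ i5, happ _ _ i6,
      happ _ _ i7, add_zero, zero_add, s1, s2, s3] at k1 k2 k3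
    rw [hφ k1, hφ5 k2, hφ25 k3]
  have := Nat.card_le_card_of_injective F hF
  simp at this
  omega

theorem fixes_of_fixes_quotient {E : Type*} [Group E] (hE : IsPGroup 2 E) {a : E →* E}
    (ha : ∀ x, a^[31] x = x) {N : Subgroup E} (hN : ∀ x ∈ N, a x = x)
    (hQ : ∀ x, x⁻¹ * a x ∈ N) (x : E) : a x = x := by
  have h (n : ℕ) : a^[n] x = x * (x⁻¹ * a x) ^ n := by
    induction n with
    | zero => simp
    | succ n ih =>
      rw [Function.iterate_succ_apply', ih, map_mul, map_pow, hN _ (hQ x), pow_succ', ← mul_assoc x,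
        mul_inv_cancel_left]
  obtain ⟨k, hk⟩ := hE (x⁻¹ * a x)
  have h31 : (x⁻¹ * a x) ^ 31 = 1 := by simpa [ha] using (h 31).symm
  have h1 := (Nat.Coprime.pow_left k (show Nat.Coprime 2 31 by norm_num))
  have : x⁻¹ * a x = 1 := by
    have := Nat.dvd_gcd (orderOf_dvd_of_pow_eq_one hk) (orderOf_dvd_of_pow_eq_one h31)
    rw [h1] at this
    exact orderOf_eq_one_iff.mp (Nat.dvd_one.mp this)
  rw [inv_mul_eq_one] at this
  exact this.symm

theorem fixes_of_twoGroup_aux (n : ℕ) : ∀ (E : Type*) [Group E] [Finite E], IsPGroup 2 E →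
    Nat.card E ≤ 2 ^ 11 → Nat.card E ≤ n → ∀ (a b : E →* E), (∀ x, a^[31] x = x) →
    Function.Injective b → (∀ x, b (a x) = a^[5] (b x)) → ∀ x, a x = x := by
  induction n with
  | zero => intro E _ _ _ _ h; exact absurd (Nat.card_pos (α := E)) (by omega)
  | succ n ih =>
  intro E _ _ hE hle hn a b ha hb hab
  have key (N : Subgroup E) [N.Normal] (hNa : ∀ x ∈ N, a x ∈ N) (hNb : ∀ x ∈ N, b x ∈ N)
      (h1 : N ≠ ⊥) (h2 : N ≠ ⊤) (x : E) : a x = x := by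
    have hcard := N.card_mul_index
    have hi : 1 < N.index := by
      have := Subgroup.index_eq_one.not.mpr h2
      have := N.index_ne_zero_of_finite
      omega
    have hN1 : 1 < Nat.card N := by
      have := (Subgroup.card_eq_one (H := N)).not.mpr h1
      have := Nat.card_pos (α := N)
      omega
    have hltN : Nat.card N < Nat.card E := by nlinarith
    have hltQ : N.index < Nat.card E := by nlinarith
    let aN : N →* N := (a.comp N.subtype).codRestrict N fun x => hNa _ x.2
    let bN : N →* N := (b.comp N.subtype).codRestrict N fun x => hNb _ x.2
    have haN (k : ℕ) (x : N) : ((aN^[k] x : N) : E) = a^[k] x := by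
      induction k with
      | zero => rfl
      | succ k ih => rw [Function.iterate_succ_apply', Function.iterate_succ_apply', ← ih]; rfl
    let aQ : E ⧸ N →* E ⧸ N := QuotientGroup.map N N a hNa
    let bQ : E ⧸ N →* E ⧸ N := QuotientGroup.map N N b hNb
    have haQ (k : ℕ) (x : E) : aQ^[k] (x : E ⧸ N) = ((a^[k] x : E) : E ⧸ N) := by
      induction k with
      | zero => rfl
      | succ k ih => rw [Function.iterate_succ_apply', Function.iterate_succ_apply', ih]; rfl
    refine fixes_of_fixes_quotient hE ha (N := N) (fun x hx => ?_) (fun x => ?_) x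
    · refine congrArg Subtype.val (ih N (hE.to_subgroup N) (by omega) (by omega) aN bN ?_ ?_ ?_
        ⟨x, hx⟩)
      · intro x; ext; rw [haN, ha]
      · intro x y h; ext; exact hb (congrArg Subtype.val h)
      · intro x; ext; rw [haN]; exact hab x
    · rw [← QuotientGroup.eq]
      refine (ih (E ⧸ N) (hE.to_quotient N) ?_ ?_ aQ bQ ?_ ?_ ?_ (x : E ⧸ N)).symm
      · rw [← Subgroup.index_eq_card]; omega
      · rw [← Subgroup.index_eq_card]; omega
      · rintro ⟨x⟩; exact (haQ 31 x).trans (congrArg _ (ha x))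
      · rw [Finite.injective_iff_surjective]
        rintro ⟨y⟩
        obtain ⟨x, rfl⟩ := Finite.injective_iff_surjective.mp hb y
        exact ⟨x, rfl⟩
      · rintro ⟨x⟩
        exact (congrArg (QuotientGroup.mk (s := N)) (hab x)).trans (haQ 5 (b x)).symm
  have ha' : Function.Bijective a := by
    have h : Function.Injective a := fun x y h => by
      rw [← ha x, ← ha y, Function.iterate_succ_apply, h, ← Function.iterate_succ_apply]
    exact ⟨h, Finite.injective_iff_surjective.mp h⟩
  have hb' : Function.Bijective b := ⟨hb, Finite.injective_iff_surjective.mp hb⟩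
  rcases subsingleton_or_nontrivial E with hs | hs
  · intro x; exact Subsingleton.elim _ _
  haveI : Fact (Nat.Prime 2) := ⟨by norm_num⟩
  have hcen (f : E →* E) (hf : Function.Bijective f) : ∀ x ∈ center E, f x ∈ center E := by
    intro x hx
    rw [Subgroup.mem_center_iff] at hx ⊢
    intro g
    obtain ⟨g, rfl⟩ := hf.2 g
    rw [← map_mul, ← map_mul, hx]
  by_cases hc : center E = ⊤
  · letI : CommGroup E := Group.commGroupOfCenterEqTop hc
    by_cases hfix : a.eqLocus (MonoidHom.id E) = ⊤
    · intro x
      exact (hfix ▸ Subgroup.mem_top x : x ∈ a.eqLocus (MonoidHom.id E))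
    by_cases hbot : a.eqLocus (MonoidHom.id E) = ⊥
    · by_cases htor : (powMonoidHom 2 : E →* E).ker = ⊤
      · have : Subsingleton (Additive E) := by
          let A : AddMonoid.End (Additive E) := MonoidHom.toAdditive a
          let B : AddMonoid.End (Additive E) := MonoidHom.toAdditive b
          refine subsingleton_of_fixedPointFree (V := Additive E) ?_ hle A B ?_ hb ?_ ?_
          · intro v
            have : (Additive.toMul v) ∈ (powMonoidHom 2 : E →* E).ker := by rw [htor]; trivial
            exact this
          · ext v
            exact (congrFun (AddMonoid.End.coe_pow _ A 31) v).trans (ha v)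
          · ext v
            refine (hab v).trans ?_
            have h5 : (⇑(A ^ 5) : Additive E → Additive E) = A^[5] := AddMonoid.End.coe_pow _ A 5
            exact (congrFun h5 (B v)).symm
          · intro v hv
            have : (Additive.toMul v) ∈ a.eqLocus (MonoidHom.id E) := hv
            rw [hbot] at this
            exact this
        exact absurd this (not_subsingleton_iff_nontrivial.mpr
          (inferInstanceAs (Nontrivial (Additive E))))
      · refine key (powMonoidHom 2 : E →* E).ker ?_ ?_ ?_ htor
        · intro x hx
          rw [MonoidHom.mem_ker] at hx ⊢
          simp only [powMonoidHom_apply] at hx ⊢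
          rw [← map_pow, hx, map_one]
        · intro x hx
          rw [MonoidHom.mem_ker] at hx ⊢
          simp only [powMonoidHom_apply] at hx ⊢
          rw [← map_pow, hx, map_one]
        · intro hker
          obtain ⟨k, hk⟩ := IsPGroup.iff_card.mp hE
          have hk0 : k ≠ 0 := by
            rintro rfl
            have := Finite.one_lt_card (α := E)
            omega
          obtain ⟨x, hx⟩ := exists_prime_orderOf_dvd_card' (G := E) 2
            (hk ▸ dvd_pow_self 2 hk0)
          have : x ∈ (powMonoidHom 2 : E →* E).ker := by
            rw [MonoidHom.mem_ker, powMonoidHom_apply, ← hx, pow_orderOf_eq_one]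
          rw [hker, Subgroup.mem_bot] at this
          rw [this, orderOf_one] at hx
          omega
    · refine key (a.eqLocus (MonoidHom.id E)) ?_ ?_ hbot hfix
      · intro x hx
        have hx' : a x = x := hx
        change a (a x) = a x
        rw [hx', hx']
      · intro x hx
        have hx' : a x = x := hx
        have h5 := hab x
        rw [hx'] at h5
        have h25 : a^[30] (b x) = b x := by
          have := Function.IsFixedPt.iterate (f := a^[5]) (x := b x) h5.symm 6
          rwa [← Function.iterate_mul] at this
        change a (b x) = b x
        conv_lhs => rw [← h25]
        rw [← Function.iterate_succ_apply' a, ha]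
  · exact key (center E) (hcen a ha') (hcen b hb') hE.bot_lt_center.ne' hc

theorem fixes_of_twoGroup {E : Type*} [Group E] [Finite E] (hE : IsPGroup 2 E)
    (hle : Nat.card E ≤ 2 ^ 11) {a b : E →* E} (ha : ∀ x, a^[31] x = x)
    (hb : Function.Injective b) (hab : ∀ x, b (a x) = a^[5] (b x)) (x : E) : a x = x :=
  fixes_of_twoGroup_aux _ E hE hle le_rfl a b ha hb hab x

end Star

section L31

theorem exists_pow_two_pow_eq_neg_one {F : Type*} [Field F] {k : F} :
    ∀ a : ℕ, k ^ 2 ^ a = 1 → k ≠ 1 → ∃ j, k ^ 2 ^ j = -1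
  | 0, h, hk => absurd (by simpa using h) hk
  | a + 1, h, hk => by
    rw [pow_succ, pow_mul, sq] at h
    rcases mul_self_eq_one_iff.mp h with h | h
    · exact exists_pow_two_pow_eq_neg_one a h hk
    · exact ⟨a, h⟩

theorem pow_eq_pow_of_cast {X : Type*} [Group X] {u : X} {p : ℕ} (hu : orderOf u = p) {i j : ℤ}
    (h : (i : ZMod p) = j) : u ^ i = u ^ j := by
  rw [zpow_eq_zpow_iff_modEq, hu]
  exact (ZMod.intCast_eq_intCast_iff _ _ _).mp h

theorem conj_pow_of_conj {X : Type*} [Group X] {g u : X} {k : ℤ} (h : g * u * g⁻¹ = u ^ k) (n : ℕ) :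
    g ^ n * u * (g ^ n)⁻¹ = u ^ (k ^ n) := by
  induction n with
  | zero => simp
  | succ n ih =>
    rw [pow_succ' g, mul_inv_rev, show g * g ^ n * u * ((g ^ n)⁻¹ * g⁻¹) =
      g * (g ^ n * u * (g ^ n)⁻¹) * g⁻¹ by group, ih, ← conj_zpow, h, ← zpow_mul, pow_succ']

variable {X : Type*} [Group X] [Finite X]

/-- In a group of order `31 * 2 ^ a`, an element inverting an element of order `31` acts as an odd
permutation on the `31` cosets of a Sylow `2`-subgroup. -/
theorem normalClosure_ne_top_of_inverts {a : ℕ} (hX : Nat.card X = 31 * 2 ^ a) {g u : X}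
    (hu : orderOf u = 31) (hg : g * u * g⁻¹ = u⁻¹) : normalClosure {u} ≠ ⊤ := by
  classical
  obtain ⟨T, hT⟩ := exists_isSyl p2 (⊤ : Subgroup X)
  have hTc : Nat.card T = 2 ^ a :=
    hT.card_eq p2 (c := 31) (by rw [Subgroup.card_top, hX, mul_comm]) (by norm_num)
  have hP : Nat.card (zpowers u) = 31 := by rw [Nat.card_zpowers, hu]
  have hcop : Nat.Coprime (Nat.card (zpowers u)) (Nat.card T) := by
    rw [hP, hTc]; exact Nat.Coprime.pow_right _ (by norm_num)
  have hcompl : IsComplement' (zpowers u) T := isComplement'_of_coprime (by rw [hP, hTc, hX]) hcop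
  letI : Fintype (X ⧸ T) := Fintype.ofFinite _
  have hcard : Fintype.card (X ⧸ T) = 31 := by
    rw [← Nat.card_eq_fintype_card, ← Subgroup.index_eq_card]
    have := T.card_mul_index
    rw [hTc, hX, mul_comm 31] at this
    exact Nat.eq_of_mul_eq_mul_left (by positivity) this
  have hsurj (x : X) : ∃ i : ℤ, (x : X ⧸ T) = (u ^ i : X) := by
    obtain ⟨⟨⟨p, i, rfl⟩, t⟩, h⟩ := hcompl.2 x
    refine ⟨i, ?_⟩
    rw [← h]
    exact QuotientGroup.mk_mul_of_mem _ t.2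
  have hmove (i : ℤ) : g * u ^ i = u ^ (-i) * g := by
    have := congrArg (· ^ i) hg
    simp only [conj_zpow, inv_zpow'] at this
    rw [← this]; group
  obtain ⟨j, hj⟩ := hsurj g
  have hact (i : ℤ) : g • ((u ^ i : X) : X ⧸ T) = ((u ^ (j - i) : X) : X ⧸ T) := by
    rw [MulAction.Quotient.smul_coe, smul_eq_mul, hmove, ← smul_eq_mul, ← MulAction.Quotient.smul_coe, hj,
      MulAction.Quotient.smul_coe, smul_eq_mul, ← zpow_add]
    congr 2; ring
  have hinj {i i' : ℤ} (h : ((u ^ i : X) : X ⧸ T) = (u ^ i' : X)) : u ^ i = u ^ i' := by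
    rw [QuotientGroup.eq] at h
    have h1 : (u ^ i)⁻¹ * u ^ i' ∈ zpowers u :=
      mul_mem (inv_mem (zpow_mem_zpowers u i)) (zpow_mem_zpowers u i')
    have := Subgroup.disjoint_def.mp hcompl.disjoint h1 h
    exact inv_mul_eq_one.mp this
  let φ : X →* ℤˣ := Equiv.Perm.sign.comp (MulAction.toPermHom X (X ⧸ T))
  have hφu : φ u = 1 := by
    have h1 : φ u ^ 31 = 1 := by rw [← map_pow, ← hu, pow_orderOf_eq_one, map_one]
    rcases Int.units_eq_one_or (φ u) with h | h
    · exact h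
    · rw [h] at h1; norm_num at h1
  have hφg : φ g = -1 := by
    have hsq : (MulAction.toPermHom X (X ⧸ T) g) ^ 2 = 1 := by
      ext q
      induction q using QuotientGroup.induction_on with | _ x
      obtain ⟨i, hi⟩ := hsurj x
      rw [hi, sq, Equiv.Perm.mul_apply, MulAction.toPermHom_apply, MulAction.toPerm_apply,
        MulAction.toPerm_apply, hact, hact, sub_sub_cancel]
      rfl
    have hfix : Fintype.card (Function.fixedPoints (MulAction.toPermHom X (X ⧸ T) g)) = 1 := by
      rw [Fintype.card_eq_one_iff]
      refine ⟨⟨((u ^ (16 * j) : X) : X ⧸ T), ?_⟩, ?_⟩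
      · rw [Function.mem_fixedPoints, Function.IsFixedPt, MulAction.toPermHom_apply,
          MulAction.toPerm_apply, hact]
        congr 1
        refine pow_eq_pow_of_cast hu ?_
        push_cast
        linear_combination (-(j : ZMod 31)) * (by decide : (31 : ZMod 31) = 0)
      · rintro ⟨q, hq⟩
        ext
        induction q using QuotientGroup.induction_on with | _ x
        obtain ⟨i, hi⟩ := hsurj x
        rw [Function.mem_fixedPoints, Function.IsFixedPt, MulAction.toPermHom_apply,
          MulAction.toPerm_apply, hi, hact] at hq
        have := hinj hq
        rw [zpow_eq_zpow_iff_modEq, hu, ← ZMod.intCast_eq_intCast_iff] at this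
        simp only
        rw [hi]
        congr 1
        refine pow_eq_pow_of_cast hu ?_
        push_cast at this ⊢
        linear_combination (-16) * this + (-(i : ZMod 31)) * (by decide : (31 : ZMod 31) = 0)
    change Equiv.Perm.sign (MulAction.toPermHom X (X ⧸ T) g) = -1
    rw [Equiv.Perm.sign_of_pow_two_eq_one hsq, hcard, hfix]
    decide
  intro htop
  have : normalClosure {u} ≤ φ.ker :=
    normalClosure_le_normal (Set.singleton_subset_iff.mpr hφu)
  have hg' : φ g = 1 := this (htop ▸ mem_top g)
  rw [hg'] at hφg
  exact absurd hφg (by decide)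

theorem conj_eq_of_complement {a : ℕ} (ha : a ≤ 11) {E : Subgroup X} [E.Normal]
    (hE : Nat.card E = 2 ^ a) (hEi : E.index = 31) {b : X →* X} (hb : Function.Injective b)
    {u : X} (hu : orderOf u = 31) (hbu : b u = u ^ 5) : ∀ x ∈ E, u * x * u⁻¹ = x := by
  have hchar (x : X) : x ∈ E ↔ x ^ 2 ^ a = 1 := by
    refine ⟨fun h => hE ▸ pow_natCard_of_mem h, fun h => ?_⟩
    rw [← QuotientGroup.eq_one_iff]
    have h1 : (x : X ⧸ E) ^ 2 ^ a = 1 := by rw [← QuotientGroup.mk_pow, h]; rfl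
    have h2 : (x : X ⧸ E) ^ 31 = 1 := by rw [← hEi, Subgroup.index_eq_card]; exact pow_card_eq_one'
    have := Nat.dvd_gcd (orderOf_dvd_of_pow_eq_one h1) (orderOf_dvd_of_pow_eq_one h2)
    rw [Nat.Coprime.pow_left a (show Nat.Coprime 2 31 by norm_num)] at this
    exact orderOf_eq_one_iff.mp (Nat.dvd_one.mp this)
  let A : E →* E := ((MulAut.conj u).toMonoidHom.comp E.subtype).codRestrict E fun x =>
    Normal.conj_mem ‹_› _ x.2 u
  let B : E →* E := (b.comp E.subtype).codRestrict E fun x => by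
    rw [hchar]
    have := (hchar _).mp x.2
    simp [← map_pow, this]
  have hA (k : ℕ) (x : E) : ((A^[k] x : E) : X) = u ^ k * x * (u ^ k)⁻¹ := by
    induction k with
    | zero => simp
    | succ k ih =>
      rw [Function.iterate_succ_apply']
      change u * ((A^[k] x : E) : X) * u⁻¹ = _
      rw [ih]; group
  intro x hx
  refine congrArg Subtype.val (fixes_of_twoGroup (E := E) (IsPGroup.of_card hE)
    (hE ▸ Nat.pow_le_pow_right (by norm_num) ha) (a := A) (b := B) ?_ ?_ ?_ ⟨x, hx⟩)
  · intro x
    ext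
    rw [hA, ← hu, pow_orderOf_eq_one]; simp
  · intro x y h
    ext
    exact hb (congrArg Subtype.val h)
  · intro x
    ext
    rw [hA]
    change b (u * x * u⁻¹) = u ^ 5 * b x * (u ^ 5)⁻¹
    rw [map_mul, map_mul, map_inv, hbu]

theorem zpowers_normal_aux (a : ℕ) : ∀ (X : Type*) [Group X] [Finite X], a ≤ 11 →
    Nat.card X = 31 * 2 ^ a → ∀ (b : X →* X) (u : X), Function.Injective b → orderOf u = 31 →
    b u = u ^ 5 → (zpowers u).Normal := by
  induction a using Nat.strong_induction_on with | _ a ih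
  intro X _ _ ha hX b u hb hu hbu
  haveI : Fact (Nat.Prime 31) := ⟨p31⟩
  have hP : Nat.card (zpowers u) = 31 := by rw [Nat.card_zpowers, hu]
  by_cases hN : ∀ g ∈ normalizer (zpowers u : Set X), g * u * g⁻¹ = u
  · have hle : normalizer (zpowers u : Set X) ≤ centralizer (zpowers u : Set X) := by
      intro g hg
      rw [centralizer_zpowers, mem_centralizer_singleton_iff, ← mul_inv_eq_iff_eq_mul]
      exact hN g hg
    let P : Sylow 31 X := Sylow.ofCard (zpowers u) (by
      rw [hP, hX, Nat.factorization_mul (by norm_num) (by positivity)]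
      simp [p31.factorization_self, Nat.factorization_eq_zero_of_not_dvd])
    have hc := MonoidHom.ker_transferSylow_isComplement' P hle
    set E := (MonoidHom.transferSylow P hle).ker
    have hEi : E.index = 31 := by rw [hc.symm.index_eq_card]; exact hP
    have hE : Nat.card E = 2 ^ a := by
      have := E.card_mul_index
      rw [hEi, hX, mul_comm] at this
      exact Nat.eq_of_mul_eq_mul_left (by norm_num) this
    have hfix := conj_eq_of_complement ha hE hEi hb hu hbu
    refine ⟨fun n hn x => ?_⟩
    obtain ⟨⟨⟨e, he⟩, p⟩, rfl⟩ := hc.2 x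
    obtain ⟨i, rfl⟩ := hn
    obtain ⟨j, hj⟩ : (p : X) ∈ zpowers u := p.2
    have he' : e * u ^ i * e⁻¹ = u ^ i := by
      have h1 : Commute u e := mul_inv_eq_iff_eq_mul.mp (hfix e he)
      rw [← (h1.zpow_left i).eq]; group
    simp only at hj ⊢
    rw [← hj, show e * u ^ j * u ^ i * (e * u ^ j)⁻¹ = e * u ^ i * e⁻¹ by group, he']
    exact zpow_mem_zpowers u i
  · push Not at hN
    obtain ⟨g, hg, hgu⟩ := hN
    obtain ⟨k, hk⟩ : g * u * g⁻¹ ∈ zpowers u :=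
      (mem_normalizer_iff.mp hg u).mp (mem_zpowers u)
    simp only at hk
    have h1 : (k : ZMod 31) ^ 2 ^ a = 1 := by
      have := conj_pow_of_conj hk.symm (31 * 2 ^ a)
      rw [← hX, pow_card_eq_one', hX] at this
      have h2 : u ^ (1 : ℤ) = u ^ k ^ (31 * 2 ^ a) := by simpa using this
      rw [zpow_eq_zpow_iff_modEq, hu, ← ZMod.intCast_eq_intCast_iff] at h2
      push_cast at h2
      rw [pow_mul, ZMod.pow_card] at h2
      exact h2.symm
    have h2 : (k : ZMod 31) ≠ 1 := fun h => hgu (by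
      rw [← hk]
      exact (pow_eq_pow_of_cast hu (j := 1) (by simpa using h)).trans (zpow_one u))
    obtain ⟨j, hj⟩ := exists_pow_two_pow_eq_neg_one a h1 h2
    have hinv : g ^ 2 ^ j * u * (g ^ 2 ^ j)⁻¹ = u⁻¹ := by
      rw [conj_pow_of_conj hk.symm, ← zpow_neg_one]
      exact pow_eq_pow_of_cast hu (by push_cast; exact hj)
    have htop := normalClosure_ne_top_of_inverts hX hu hinv
    set Y := normalClosure {u}
    have huY : u ∈ Y := subset_normalClosure rfl
    have hbY : ∀ x ∈ Y, b x ∈ Y := by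
      have hs : Function.Surjective b := Finite.injective_iff_surjective.mp hb
      have : (Y.comap b).Normal := inferInstance
      have h3 : Y ≤ Y.comap b := normalClosure_le_normal (Set.singleton_subset_iff.mpr (by
        rw [SetLike.mem_coe, mem_comap, hbu]; exact pow_mem huY 5))
      exact fun x hx => h3 hx
    obtain ⟨c, hc⟩ : 31 ∣ Nat.card Y := by
      rw [← hP]; exact card_dvd_of_le (zpowers_le.mpr huY)
    have hYd : Nat.card Y ∣ 31 * 2 ^ a := hX ▸ Y.card_subgroup_dvd_card
    obtain ⟨a', ha', rfl⟩ : ∃ a' ≤ a, c = 2 ^ a' := by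
      rw [hc] at hYd
      exact (Nat.dvd_prime_pow p2).mp (Nat.dvd_of_mul_dvd_mul_left (by norm_num) hYd)
    have hlt : a' < a := by
      refine lt_of_le_of_ne ha' ?_
      rintro rfl
      exact htop (Subgroup.eq_top_of_card_eq Y (hc.trans hX.symm))
    let bY : Y →* Y := (b.comp Y.subtype).codRestrict Y fun x => hbY _ x.2
    have hnY := ih a' hlt Y (by omega) hc bY ⟨u, huY⟩ (fun x y h => by
      ext; exact hb (congrArg Subtype.val h)) (by rw [Subgroup.orderOf_mk]; exact hu)
      (by ext; exact hbu)
    have hsyl : IsSyl 31 (zpowers u) Y := isSyl_of_card p31 (a := 1) (c := 2 ^ a')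
      (zpowers_le.mpr huY) (by rw [hP]; rfl) (by rw [hc]; rfl)
      (fun h => absurd (p31.dvd_of_dvd_pow h) (by norm_num))
    have hYn : Y ≤ normalizer (zpowers u : Set X) := by
      intro y hy
      refine mem_normalizer_of_forall ?_
      rintro _ ⟨i, rfl⟩
      obtain ⟨m, hm⟩ := hnY.conj_mem (⟨u, huY⟩ ^ i) (zpow_mem_zpowers _ i) ⟨y, hy⟩
      have := congrArg Subtype.val hm
      simp at this
      exact ⟨m, this⟩
    have := hsyl.normalizer_le p31 hYn
    rw [normalizer_eq_top] at this
    exact normalizer_eq_top_iff.mp (top_le_iff.mp this)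

end L31

theorem zmod_cube_root : ∀ k : ZMod 31, k * k * k = 1 → k ≠ 1 → k = 5 ∨ k * k = 5 := by
  decide

section Local31

variable {G : Type*} [Group G] [Finite G]

theorem normal_of_mul_mem {D A C : Subgroup G} (hDA : D ≤ A) (hAC : A ≤ C)
    {a : ℕ} (ha : a ≤ 11) (hA : Nat.card A = 31 * Nat.card D)
    (hC : Nat.card C = 2 ^ a * Nat.card A) (hCD : C ≤ normalizer (D : Set G)) {y : G}
    (hy : y ^ 3 = 1) (hyD : y ∈ normalizer (D : Set G)) (hyA : y ∈ normalizer (A : Set G))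
    (hyC : y ∈ normalizer (C : Set G)) (hf : ∀ u ∈ A, u⁻¹ * (y * u * y⁻¹) ∈ D → u ∈ D) :
    C ≤ normalizer (A : Set G) := by
  haveI : Fact (Nat.Prime 31) := ⟨p31⟩
  let N := D.subgroupOf C
  haveI : N.Normal := normal_subgroupOf_of_le_normalizer hCD
  let B : C →* C := ((MulAut.conj y).toMonoidHom.comp C.subtype).codRestrict C fun x =>
    (mem_normalizer_iff.mp hyC x).mp x.2
  have hBN : N ≤ N.comap B := fun x hx => (mem_normalizer_iff.mp hyD x).mp hx
  let β : C ⧸ N →* C ⧸ N := QuotientGroup.map N N B hBN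
  have hβ : Function.Injective β := by
    rw [injective_iff_map_eq_one]
    rintro ⟨x⟩ hx
    exact (QuotientGroup.eq_one_iff x).mpr ((mem_normalizer_iff.mp hyD x).mpr
      ((QuotientGroup.eq_one_iff (B x)).mp hx))
  have hD0 : 0 < Nat.card D := Nat.card_pos
  have hX : Nat.card (C ⧸ N) = 31 * 2 ^ a := by
    have h1 := N.card_mul_index
    rw [show Nat.card N = Nat.card D from
      Nat.card_congr (subgroupOfEquivOfLe (hDA.trans hAC)).toEquiv, hC, hA,
      Subgroup.index_eq_card] at h1
    exact Nat.eq_of_mul_eq_mul_left hD0 (by rw [h1]; ring)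
  let f : A →* C ⧸ N := (QuotientGroup.mk' N).comp (inclusion hAC)
  have hf1 (x : A) : f x = 1 ↔ (x : G) ∈ D := QuotientGroup.eq_one_iff _
  have hker : f.ker = D.subgroupOf A := by ext x; exact hf1 x
  have hrange : Nat.card f.range = 31 := by
    rw [← Subgroup.index_ker]
    have h1 := f.ker.card_mul_index
    rw [show Nat.card f.ker = Nat.card D by
      rw [hker]; exact Nat.card_congr (subgroupOfEquivOfLe hDA).toEquiv, hA] at h1
    exact Nat.eq_of_mul_eq_mul_left hD0 (by rw [h1]; ring)
  obtain ⟨⟨q, hq⟩, hw⟩ := exists_prime_orderOf_dvd_card' (G := f.range) 31 (hrange ▸ dvd_rfl)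
  rw [Subgroup.orderOf_mk] at hw
  obtain ⟨w, rfl⟩ := hq
  have hz : zpowers (f w) = f.range := by
    refine Subgroup.eq_of_le_of_card_ge (zpowers_le.mpr ⟨w, rfl⟩) ?_
    rw [hrange, Nat.card_zpowers, hw]
  have hβf (x : A) : ∃ z : A, β (f x) = f z :=
    ⟨⟨y * x * y⁻¹, (mem_normalizer_iff.mp hyA x).mp x.2⟩, rfl⟩
  obtain ⟨k, hk⟩ : β (f w) ∈ zpowers (f w) := by
    obtain ⟨z, hz'⟩ := hβf w
    rw [hz, hz']; exact ⟨z, rfl⟩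
  simp only at hk
  have hβ3 (q : C ⧸ N) : β (β (β q)) = q := by
    obtain ⟨x, rfl⟩ := QuotientGroup.mk_surjective q
    refine congrArg (QuotientGroup.mk (s := N)) (Subtype.ext ?_)
    change y * (y * (y * x * y⁻¹) * y⁻¹) * y⁻¹ = x
    calc _ = (y * y * y) * x * (y * y * y)⁻¹ := by group
      _ = x := by rw [← pow_three', hy]; simp
  have e2 : β (β (f w)) = f w ^ (k * k) := by rw [← hk, map_zpow, ← hk, ← zpow_mul]
  have hk3 : (k : ZMod 31) * k * k = 1 := by
    have h3 := hβ3 (f w)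
    rw [e2, map_zpow, ← hk, ← zpow_mul] at h3
    have h4 : f w ^ (k * (k * k)) = f w ^ (1 : ℤ) := by rw [h3, zpow_one]
    rw [zpow_eq_zpow_iff_modEq, hw, ← ZMod.intCast_eq_intCast_iff] at h4
    push_cast at h4
    rw [← h4]; ring
  have hk1 : (k : ZMod 31) ≠ 1 := by
    intro h1
    have h2 : β (f w) = f w := by
      rw [← hk]
      exact (pow_eq_pow_of_cast hw (j := 1) (by simpa using h1)).trans (zpow_one _)
    have h3 : f w = 1 := by
      rw [hf1]
      refine hf w w.2 ?_
      have h4 : (f w)⁻¹ * β (f w) = 1 := by rw [h2, inv_mul_cancel]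
      exact (QuotientGroup.eq_one_iff (N := N) _).mp h4
    rw [h3, orderOf_one] at hw
    omega
  have hk5 : (k : ZMod 31) = 5 ∨ (k : ZMod 31) * k = 5 := by
    exact zmod_cube_root _ hk3 hk1
  have hnorm : (zpowers (f w)).Normal := by
    rcases hk5 with h5 | h5
    · refine zpowers_normal_aux a _ ha hX β (f w) hβ hw ?_
      rw [← hk]
      exact_mod_cast pow_eq_pow_of_cast hw (j := 5) (by simpa using h5)
    · refine zpowers_normal_aux a _ ha hX (β.comp β) (f w) (hβ.comp hβ) hw ?_
      rw [MonoidHom.comp_apply, e2]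
      exact_mod_cast pow_eq_pow_of_cast hw (j := 5) (by simpa using h5)
  intro c hc
  refine mem_normalizer_of_forall fun x hx => ?_
  have h1 := hnorm.conj_mem (f ⟨x, hx⟩) (hz ▸ ⟨_, rfl⟩) (⟨c, hc⟩ : C)
  rw [hz] at h1
  obtain ⟨z, h2⟩ := h1
  have h3 := QuotientGroup.eq.mp h2
  have h4 : (z : G)⁻¹ * (c * x * c⁻¹) ∈ D := h3
  have := mul_mem z.2 (hDA h4)
  rwa [mul_inv_cancel_left] at this

/-- The normalizer of a subgroup. -/
notation "nz(" A ")" => Subgroup.normalizer (SetLike.coe A)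
/-- The centralizer of a subgroup. -/
notation "cz(" A ")" => Subgroup.centralizer (SetLike.coe A)

theorem conj_mem_of_mem_normalizer {A : Subgroup G} {y x : G} (hy : y ∈ nz(A)) (hx : x ∈ A) :
    y * x * y⁻¹ ∈ A := (mem_normalizer_iff.mp hy x).mp hx

/-- A fixed-point-free conjugation is given by commutators. -/
theorem exists_commutator_of_fpf {U : Subgroup G} {y : G} (hy : y ∈ nz(U))
    (hf : ∀ a ∈ U, y * a = a * y → a = 1) {x : G} (hx : x ∈ U) :
    ∃ d ∈ U, x = d⁻¹ * (y * d * y⁻¹) := by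
  let f : U → U := fun d => ⟨(d : G)⁻¹ * (y * d * y⁻¹),
    mul_mem (inv_mem d.2) (conj_mem_of_mem_normalizer hy d.2)⟩
  have hinj : Function.Injective f := by
    intro d e hde
    have h1 : (d : G)⁻¹ * (y * d * y⁻¹) = (e : G)⁻¹ * (y * e * y⁻¹) := congrArg Subtype.val hde
    have h2 : (e * (d : G)⁻¹) = 1 := by
      refine hf _ (mul_mem e.2 (inv_mem d.2)) ?_
      calc y * (e * (d : G)⁻¹) = e * ((e : G)⁻¹ * (y * e * y⁻¹)) * (y * (d : G)⁻¹ * y⁻¹) * y := by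
            group
        _ = e * ((d : G)⁻¹ * (y * d * y⁻¹)) * (y * (d : G)⁻¹ * y⁻¹) * y := by rw [h1]
        _ = e * (d : G)⁻¹ * y := by group
    exact Subtype.ext (mul_inv_eq_one.mp h2).symm
  obtain ⟨d, hd⟩ := (Finite.injective_iff_surjective.mp hinj) ⟨x, hx⟩
  exact ⟨d, d.2, (congrArg Subtype.val hd).symm⟩

theorem mul_conj_mul_conj {U : Subgroup G} {y : G} (hy : y ∈ nz(U)) (hy3 : y ^ 3 = 1)
    (hf : ∀ a ∈ U, y * a = a * y → a = 1) {x : G} (hx : x ∈ U) :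
    x * (y * x * y⁻¹) * (y ^ 2 * x * (y ^ 2)⁻¹) = 1 := by
  obtain ⟨d, -, rfl⟩ := exists_commutator_of_fpf hy hf hx
  calc _ = d⁻¹ * (y * y * y * d * (y * y * y)⁻¹) := by group
    _ = 1 := by rw [← pow_three', hy3]; simp

theorem comm_conj_of_fpf {U : Subgroup G} {y : G} (hy : y ∈ nz(U)) (hy3 : y ^ 3 = 1)
    (hf : ∀ a ∈ U, y * a = a * y → a = 1) {x : G} (hx : x ∈ U) :
    x * (y * x * y⁻¹) = (y * x * y⁻¹) * x := by
  have h1 := mul_conj_mul_conj hy hy3 hf hx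
  have e1 : y⁻¹ = y ^ 2 := by rw [inv_eq_iff_mul_eq_one, ← hy3]; group
  have h2 := mul_conj_mul_conj (y := y ^ 2) (x := x) (pow_mem hy 2)
    (by rw [← pow_mul, mul_comm, pow_mul, hy3, one_pow]) (fun a ha hc => hf a ha <| by
      rw [← e1] at hc
      calc y * a = y * (a * y⁻¹) * y := by group
        _ = a * y := by rw [← hc]; group) hx
  rw [show (y ^ 2) ^ 2 = y by rw [← pow_mul, show 2 * 2 = 3 + 1 from rfl, pow_succ, hy3, one_mul]]
    at h2
  rw [mul_assoc] at h1 h2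
  have h3 : (y * x * y⁻¹) * (y ^ 2 * x * (y ^ 2)⁻¹) = (y ^ 2 * x * (y ^ 2)⁻¹) * (y * x * y⁻¹) :=
    mul_left_cancel (h1.trans h2.symm)
  calc x * (y * x * y⁻¹) = y⁻¹ * ((y * x * y⁻¹) * (y ^ 2 * x * (y ^ 2)⁻¹)) * y := by group
    _ = y⁻¹ * ((y ^ 2 * x * (y ^ 2)⁻¹) * (y * x * y⁻¹)) * y := by rw [h3]
    _ = _ := by group

theorem Hyp.card_normalizer31_dvd (h : Hyp G) {A : Subgroup G} (hA : IsPGroup 31 A)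
    (hne : A ≠ ⊥) : Nat.card nz(A) ∣ 2 ^ 11 * 3 * 5 * 31 ^ 3 := by
  haveI : Fact (Nat.Prime 31) := ⟨p31⟩
  obtain ⟨a, ha⟩ := IsPGroup.iff_card.mp hA
  have ha0 : a ≠ 0 := by
    rintro rfl
    exact hne (Subgroup.card_eq_one.mp (by simpa using ha))
  have ha3 : a ≤ 3 := by
    by_contra hc
    have h1 := card_dvd h A
    rw [ha] at h1
    exact absurd ((pow_dvd_pow 31 (show 4 ≤ a by omega)).trans h1) (by norm_num)
  obtain ⟨-, -, -, -, -, -, -, -, -, -, -, -, -, h7, h19⟩ := h.graph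
  have key (r : ℕ) (hr : r.Prime) (h0 : adjN G r 31 = 0)
      (hm : 31 % r ≠ 1 ∧ 31 ^ 2 % r ≠ 1 ∧ 31 ^ 3 % r ≠ 1) : ¬ r ∣ Nat.card nz(A) := by
    refine not_dvd_normalizer hr p31 ha ?_ (not_padj h0)
    rcases (show a = 1 ∨ a = 2 ∨ a = 3 by omega) with rfl | rfl | rfl
    · simpa using hm.1
    · exact hm.2.1
    · exact hm.2.2
  have k7 := key 7 p7 h7 (by norm_num)
  have k19 := key 19 p19 h19 (by norm_num)
  exact h.card_dvd_of _ (7 ^ 2 * 19) (by norm_num) (by norm_num) (by norm_num) (by norm_num)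
    (fun _ => k7) (fun _ => k19) (by norm_num)

theorem Hyp.card_centralizer31_dvd (h : Hyp G) {A : Subgroup G} (hA : IsPGroup 31 A)
    (hne : A ≠ ⊥) : Nat.card cz(A) ∣ 2 ^ 11 * 31 ^ 3 := by
  obtain ⟨z, hz, hz31⟩ := exists_orderOf_of_ne_bot p31 hA hne
  obtain ⟨-, -, -, -, -, -, -, -, -, h3, -, -, h5, h7, h19⟩ := h.graph
  rw [adjN_comm] at h3 h5 h7 h19
  exact h.card_centralizer_dvd hz31 (centralizer_le (by simpa using hz)) _ (3 * 5 * 7 ^ 2 * 19)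
    (by norm_num) (by norm_num) (fun _ => h3) (fun _ => h5) (fun _ => h7) (fun _ => h19)
    (by norm_num)

theorem relIndex_syl31 {S C : Subgroup G} (hC : Nat.card C ∣ 2 ^ 11 * 3 * 5 * 31 ^ 3)
    (hS : IsSyl 31 S C) : (nz(S)).relIndex C = 1 ∨ (nz(S)).relIndex C = 32 ∨
      (nz(S)).relIndex C = 1024 := by
  have h1 := hS.relIndex_modEq p31
  have h2 := hS.relIndex_dvd
  have h3 : Nat.card C / Nat.card S ∣ 2 ^ 11 * 3 * 5 :=
    strip p31 ((Nat.div_dvd_of_dvd (Subgroup.card_dvd_of_le hS.1)).trans hC) (hS.not_dvd p31)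
      3 _ (by ring)
  exact forall_dvd [(2, 11), (3, 1), (5, 1)] (by norm_num) (by norm_num)
    (P := fun d => d ≡ 1 [MOD 31] → d = 1 ∨ d = 32 ∨ d = 1024) (by decide) _ (h2.trans h3) h1

theorem Hyp.mem_of_commutator_mem (h : Hyp G) {D A : Subgroup G} (hA : IsPGroup 31 A)
    (hDA : D ≤ A) {y : G} (hy : orderOf y = 3) (hyD : y ∈ nz(D)) {u : G} (hu : u ∈ A)
    (hc : u⁻¹ * (y * u * y⁻¹) ∈ D) : u ∈ D := by
  have h0 : ¬ PAdj G 3 31 := not_padj h.graph.2.2.2.2.2.2.2.2.2.1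
  have hf := eq_one_of_comm p31 hA hy h0
  obtain ⟨d, hd, he⟩ := exists_commutator_of_fpf hyD (fun a ha => hf a (hDA ha)) hc
  have : u * d⁻¹ = 1 := by
    refine hf _ (mul_mem hu (inv_mem (hDA hd))) ?_
    calc y * (u * d⁻¹) = u * (u⁻¹ * (y * u * y⁻¹)) * (y * d⁻¹ * y⁻¹) * y := by group
      _ = u * d⁻¹ * y := by rw [he]; group
  rwa [mul_inv_eq_one.mp this]

/-- A Sylow subgroup of a centralizer-like section of order `31` is normal as soon as an element
of order three acts. -/
theorem Hyp.normal_of_card (h : Hyp G) {D A C : Subgroup G} (hDA : D ≤ A) (hA : IsSyl 31 A C)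
    (hC : Nat.card C ∣ 2 ^ 11 * 31 ^ 3) (hAD : Nat.card A = 31 * Nat.card D)
    (hCD : C ≤ nz(D)) {y : G} (hy : orderOf y = 3) (hyD : y ∈ nz(D)) (hyA : y ∈ nz(A))
    (hyC : y ∈ nz(C)) : C ≤ nz(A) := by
  obtain ⟨c, hc⟩ := Subgroup.card_dvd_of_le hA.1
  have hc' : Nat.card C / Nat.card A = c := by rw [hc]; exact Nat.mul_div_cancel_left _ Nat.card_pos
  have h1 : c ∣ 2 ^ 11 := by
    have := hA.not_dvd p31
    rw [hc'] at this
    exact strip p31 ((Dvd.intro_left _ hc.symm).trans hC) this 3 _ (by ring)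
  obtain ⟨a, ha, rfl⟩ := (Nat.dvd_prime_pow Nat.prime_two).mp h1
  exact normal_of_mul_mem hDA hA.1 ha hAD (by rw [hc, mul_comm]) hCD
    (by rw [← hy, pow_orderOf_eq_one]) hyD hyA hyC
    fun u hu hc => h.mem_of_commutator_mem hA.isPGroup hDA hy hyD hu hc

theorem Hyp.normalizer31 (h : Hyp G) {U : Subgroup G} (hU : IsSyl 31 U ⊤) :
    ∃ m, (m = 30 ∨ m = 960 ∨ m = 30720) ∧ Nat.card nz(U) = 31 ^ 3 * m ∧
      nz(U).index * m = 30720 * 931 := by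
  obtain ⟨m, h1, h2, h3⟩ := h.normalizer_modEq p31 (a := 3) (c := 30720 * 931)
    (by norm_num) (by norm_num) hU
  have hne : U ≠ ⊥ := by
    rintro rfl
    have := h.card_syl31 hU
    simp at this
  have h4 := h.card_normalizer31_dvd hU.isPGroup hne
  rw [h1, mul_comm] at h4
  have h5 : m ∣ 2 ^ 11 * 3 * 5 := Nat.dvd_of_mul_dvd_mul_right (by norm_num) h4
  refine ⟨m, ?_, h1, h2.symm⟩
  exact forall_dvd [(2, 11), (3, 1), (5, 1)] (by norm_num) (by norm_num)
    (P := fun d => 30720 * 931 % 31 = d % 31 → d = 30 ∨ d = 960 ∨ d = 30720) (by decide) _ h5 h3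

theorem Hyp.exists_order_three (h : Hyp G) {U : Subgroup G} (hU : IsSyl 31 U ⊤) :
    ∃ y ∈ nz(U), orderOf y = 3 := by
  obtain ⟨m, hm, h1, -⟩ := h.normalizer31 hU
  refine exists_mem_orderOf p3 ?_
  rw [h1]
  rcases hm with rfl | rfl | rfl <;> norm_num

theorem exists_mem_normalizer_of_lt {p : ℕ} [Fact p.Prime] {D U : Subgroup G}
    (hU : IsPGroup p U) (hlt : D < U) : ∃ x ∈ U ⊓ nz(D), x ∉ D := by
  haveI := hU.isNilpotent
  have h1 : D.subgroupOf U < ⊤ := by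
    rw [lt_top_iff_ne_top, Ne, subgroupOf_eq_top]; exact not_le_of_gt hlt
  obtain ⟨x, hx, hxD⟩ := SetLike.exists_of_lt (Group.normalizerCondition_of_isNilpotent _ h1)
  refine ⟨x, ⟨x.2, mem_normalizer_of_forall fun a ha => ?_⟩, hxD⟩
  exact (mem_normalizer_iff.mp hx ⟨a, hlt.le ha⟩).mp ha

theorem Hyp.exists_max_inf (h : Hyp G) {C U V₀ : Subgroup G} (hU : IsSyl 31 U C)
    (hV₀ : IsSyl 31 V₀ C) (hne₀ : V₀ ≠ U) (hD₀ : U ⊓ V₀ ≠ ⊥) :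
    ∃ V, IsSyl 31 V C ∧ V ≠ U ∧ U ⊓ V ≠ ⊥ ∧
      IsSyl 31 (U ⊓ nz(U ⊓ V)) (C ⊓ nz(U ⊓ V)) ∧
      Nat.card (U ⊓ nz(U ⊓ V) : Subgroup G) = 31 * Nat.card (U ⊓ V : Subgroup G) ∧
      ¬ C ⊓ nz(U ⊓ V) ≤ nz(U ⊓ nz(U ⊓ V)) := by
  haveI : Fact (Nat.Prime 31) := ⟨p31⟩
  obtain ⟨V, ⟨hV, hne⟩, hmax⟩ := Set.exists_max_image {V | IsSyl 31 V C ∧ V ≠ U}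
    (fun V => Nat.card (U ⊓ V : Subgroup G)) (Set.toFinite _) ⟨V₀, hV₀, hne₀⟩
  set D := U ⊓ V with hD
  have hcard : Nat.card U = Nat.card V := hU.2.trans hV.2.symm
  have hDU : D < U := lt_of_le_of_ne inf_le_left fun he =>
    hne (Subgroup.eq_of_le_of_card_ge (he.symm.le.trans inf_le_right) hcard.ge).symm
  have hDV : D < V := lt_of_le_of_ne inf_le_right fun he =>
    hne (Subgroup.eq_of_le_of_card_ge (he.symm.le.trans inf_le_left) hcard.le)
  have hDb : D ≠ ⊥ := by
    intro hb
    have h1 := hmax V₀ ⟨hV₀, hne₀⟩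
    rw [hb, Subgroup.card_bot] at h1
    exact hD₀ (Subgroup.card_eq_one.mp (le_antisymm h1 Nat.card_pos))
  have hpD : IsPGroup 31 D := hU.isPGroup.to_le inf_le_left
  have hmem (W : Subgroup G) (hW : IsSyl 31 W C) (hlt : Nat.card D < Nat.card (U ⊓ W : Subgroup G)) :
      W = U := by
    by_contra hc
    exact absurd (hmax W ⟨hW, hc⟩) (not_le_of_gt hlt)
  have hDS : D < U ⊓ nz(D) := by
    obtain ⟨x, hx, hxD⟩ := exists_mem_normalizer_of_lt hU.isPGroup hDU
    exact lt_of_le_of_ne (le_inf inf_le_left le_normalizer) fun he => hxD (he ▸ hx)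
  have hcl {A B : Subgroup G} (hAB : A < B) : Nat.card A < Nat.card B := by
    by_contra hc
    exact hAB.ne (Subgroup.eq_of_le_of_card_ge hAB.le (not_lt.mp hc))
  have hpS : IsPGroup 31 (U ⊓ nz(D) : Subgroup G) := hU.isPGroup.to_le inf_le_left
  have hS : IsSyl 31 (U ⊓ nz(D)) (C ⊓ nz(D)) := by
    obtain ⟨T, hST, hT⟩ := exists_isSyl_ge p31 (inf_le_inf_right _ hU.1) hpS
    obtain ⟨W, hTW, hW⟩ := exists_isSyl_ge p31 (hT.1.trans inf_le_left) hT.isPGroup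
    have hWU : W = U := hmem W hW ((hcl hDS).trans_le
      (Subgroup.card_le_of_le (le_inf inf_le_left (hST.trans hTW))))
    have : T = U ⊓ nz(D) := le_antisymm (le_inf (hWU ▸ hTW) (hT.1.trans inf_le_right)) hST
    rwa [← this]
  obtain ⟨d, hd⟩ := IsPGroup.iff_card.mp hpD
  obtain ⟨s, hs⟩ := IsPGroup.iff_card.mp hpS
  have hds : d < s := by
    have := hcl hDS
    rw [hd, hs] at this
    exact (Nat.pow_lt_pow_iff_right (by norm_num)).mp this
  have hmod : (nz(U ⊓ nz(D))).relIndex (C ⊓ nz(D)) ≡ 1 [MOD 31 ^ (s - d)] := by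
    refine hS.relIndex_modEq_of_forall p31 fun g hg hgS => ?_
    have hgU : MulAut.conj g • U ≠ U := by
      intro he
      apply hgS
      have h1 : MulAut.conj g • nz(D) = nz(D) := conj_smul_eq_iff.mpr (le_normalizer hg.2)
      rw [smul_inf, he, h1]
    have h2 : Nat.card (U ⊓ MulAut.conj g • U : Subgroup G) ≤ Nat.card D :=
      not_lt.mp fun hc => hgU (hmem _ (hU.conj hg.1) hc)
    have h3 : MulAut.conj g • D = D := conj_smul_eq_iff.mpr hg.2
    have h4 : D = MulAut.conj g • (U ⊓ nz(D)) ⊓ (U ⊓ nz(D)) := by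
      refine Subgroup.eq_of_le_of_card_ge
        (le_inf (h3.ge.trans (smul_mono_right _ hDS.le)) hDS.le) ?_
      · refine (Subgroup.card_le_of_le ?_).trans h2
        exact le_inf (inf_le_right.trans inf_le_left)
          (inf_le_left.trans (smul_mono_right _ inf_le_left))
    have h5 := card_eq_relIndex_mul (MulAut.conj g • (U ⊓ nz(D))) (U ⊓ nz(D))
    rw [← h4, hs, hd, ← Nat.sub_add_cancel hds.le, pow_add] at h5
    rw [← Nat.eq_of_mul_eq_mul_right (by positivity) h5]
  have hnot : ¬ C ⊓ nz(D) ≤ nz(U ⊓ nz(D)) := by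
    intro hle
    obtain ⟨x, hx, hxD⟩ := exists_mem_normalizer_of_lt hV.isPGroup hDV
    have := hS.le_of_normal p31 hle (inf_le_inf_right _ hV.1) (hV.isPGroup.to_le inf_le_left) hx
    exact hxD ⟨this.1, hx.1⟩
  refine ⟨V, hV, hne, hDb, hS, ?_, hnot⟩
  have hC := (Subgroup.card_dvd_of_le (inf_le_right (a := C))).trans
    (h.card_normalizer31_dvd hpD hDb)
  have hsd : s = d + 1 := by
    have h1 : ¬ 31 ^ 2 ∣ 31 ^ (s - d) := by
      intro h2
      rcases relIndex_syl31 hC hS with h3 | h3 | h3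
      · exact hnot (relIndex_normalizer_eq_one_iff.mp h3)
      all_goals
        rw [h3] at hmod
        exact absurd (hmod.of_dvd h2) (by decide)
    by_contra hc
    exact h1 (pow_dvd_pow 31 (by omega))
  rw [hs, hd, hsd, pow_succ, mul_comm]

/-- A subgroup acts on all subgroups by conjugation. -/
abbrev conjAction (C : Subgroup G) : MulAction C (Subgroup G) :=
  MulAction.compHom _ ((MulAut.conj : G →* MulAut G).comp C.subtype)

theorem conjAction_stabilizer (C V : Subgroup G) :
    letI := conjAction C
    MulAction.stabilizer C V = nz(V).subgroupOf C := by
  letI := conjAction C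
  ext x
  exact conj_smul_eq_iff

theorem IsSyl.card_eq_relIndex {p : ℕ} (hp : p.Prime) {S C : Subgroup G} (h : IsSyl p S C) :
    Nat.card {V | IsSyl p V C} = nz(S).relIndex C := by
  letI := conjAction C
  have h1 := MulAction.index_stabilizer C S
  rw [conjAction_stabilizer] at h1
  rw [Subgroup.relIndex, h1, ← Nat.card_coe_set_eq]
  congr! 2
  ext V
  constructor
  · intro hV
    obtain ⟨g, hg, rfl⟩ := h.exists_conj hp hV
    exact ⟨⟨g, hg⟩, rfl⟩
  · rintro ⟨g, rfl⟩
    exact h.conj g.2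

/-- Sylow subgroups meeting `U` in at most `q` elements come in multiples of `|U| / q`. -/
theorem dvd_card_of_inf_le {p k : ℕ} (hp : p.Prime) {U C : Subgroup G} (hU : IsSyl p U C)
    {S : Set (Subgroup G)} (hS : ∀ V ∈ S, IsSyl p V C)
    (hc : ∀ u ∈ U, ∀ V ∈ S, MulAut.conj u • V ∈ S)
    (hle : ∀ V ∈ S, p ^ k * Nat.card (U ⊓ V : Subgroup G) ≤ Nat.card U) : p ^ k ∣ Nat.card S := by
  letI := conjAction U
  refine dvd_card_of_dvd_orbit (G := U) (fun u V hV => hc u u.2 V hV) fun V hV => ?_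
  rw [conjAction_stabilizer]
  have h1 : nz(V) ⊓ U = U ⊓ V := by
    refine le_antisymm (le_inf inf_le_right ?_) (le_inf (inf_le_right.trans le_normalizer) inf_le_left)
    have hs : IsSyl p V (C ⊓ nz(V)) :=
      (hS V hV).mono hp (le_inf (hS V hV).1 le_normalizer) inf_le_left
    exact hs.le_of_normal hp inf_le_right (le_inf (inf_le_right.trans hU.1) inf_le_left)
      (hU.isPGroup.to_le inf_le_right)
  have h2 := card_eq_relIndex_mul nz(V) U
  rw [h1] at h2
  haveI := Fact.mk hp
  obtain ⟨a, ha⟩ := IsPGroup.iff_card.mp hU.isPGroup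
  obtain ⟨b, hb⟩ := IsPGroup.iff_card.mp (hU.isPGroup.to_le (inf_le_left (b := V)))
  have h3 := hle V hV
  rw [hb, ha, ← pow_add] at h3
  have h4 : k + b ≤ a := (Nat.pow_le_pow_iff_right hp.one_lt).mp h3
  have h5 : nz(V).relIndex U = p ^ (a - b) := by
    apply Nat.eq_of_mul_eq_mul_right (Nat.pow_pos hp.pos : 0 < p ^ b)
    rw [← pow_add, Nat.sub_add_cancel (by omega), ← ha, h2, hb]
  rw [Subgroup.relIndex] at h5
  rw [h5]
  exact pow_dvd_pow p (by omega)

theorem Hyp.card_syl_ge (h : Hyp G) {D U : Subgroup G} (hU : IsSyl 31 U ⊤) (hDU : D ≤ U)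
    (hD : D ≠ ⊥) (hn : ∀ V, IsSyl 31 V ⊤ → D ≤ V → V ≤ nz(D)) :
    Nat.card {V | IsSyl 31 V ⊤ ∧ D ≤ V} = 1 ∨ Nat.card {V | IsSyl 31 V ⊤ ∧ D ≤ V} = 32 ∨
      Nat.card {V | IsSyl 31 V ⊤ ∧ D ≤ V} = 1024 := by
  have hUN : IsSyl 31 U nz(D) := hU.mono p31 (hn U hU hDU) le_top
  have h1 : {V | IsSyl 31 V ⊤ ∧ D ≤ V} = {V | IsSyl 31 V nz(D)} := by
    ext V
    constructor
    · rintro ⟨hV, hDV⟩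
      exact hV.mono p31 (hn V hV hDV) le_top
    · intro hV
      obtain ⟨g, hg, rfl⟩ := hUN.exists_conj p31 hV
      refine ⟨hU.conj (mem_top _), ?_⟩
      rw [← conj_smul_eq_iff.mpr hg]
      exact smul_mono_right _ hDU
  rw [h1, hUN.card_eq_relIndex p31]
  exact relIndex_syl31 (h.card_normalizer31_dvd (hU.isPGroup.to_le hDU) hD) hUN

theorem le_centralizer_of_comm {A B : Subgroup G} (h : ∀ a ∈ A, ∀ b ∈ B, a * b = b * a) :
    A ≤ cz(B) := fun a ha => mem_centralizer_iff.mpr fun b hb => (h a ha b hb).symm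

theorem mem_normalizer_centralizer {D : Subgroup G} {y : G} (hy : y ∈ nz(D)) : y ∈ nz(cz(D)) := by
  rw [← conj_smul_eq_iff, ← centralizer_conj_smul, conj_smul_eq_iff.mpr hy]

/-- Distinct subgroups of order `961` of a group of order `31 ^ 3` meet in order `31`. -/
theorem card_inf_of_card_sq {U D E : Subgroup G} (hU : Nat.card U = 31 ^ 3) (hDU : D ≤ U)
    (hEU : E ≤ U) (hD : Nat.card D = 31 ^ 2) (hE : Nat.card E = 31 ^ 2) (hne : D ≠ E) :
    Nat.card (D ⊓ E : Subgroup G) = 31 := by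
  have h1 := card_eq_relIndex_mul D E
  have h2 := card_eq_relIndex_mul D U
  rw [inf_eq_left.mpr hDU, hU, hD] at h2
  have h3 : D.relIndex U = 31 := by omega
  have h4 : D.relIndex E ≤ D.relIndex U := Subgroup.relIndex_le_of_le_right hEU (by rw [h3]; norm_num)
  rw [hE] at h1
  have h5 : D.relIndex E ∣ 31 ^ 2 := Dvd.intro _ h1.symm
  obtain ⟨i, hi, h6⟩ := (Nat.dvd_prime_pow p31).mp h5
  rw [h6] at h1 h4
  interval_cases i
  · have h7 : E ≤ D := Subgroup.relIndex_eq_one.mp (by rw [h6]; rfl)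
    exact absurd (Subgroup.eq_of_le_of_card_ge h7 (by rw [hD, hE])).symm hne
  · omega
  · omega

/-- Few subgroups of a given order pairwise meet in a given subgroup. -/
theorem card_family_mul_le {U J : Subgroup G} {d : ℕ} {F : Finset (Subgroup G)}
    (hF : ∀ D ∈ F, D ≤ U ∧ J ≤ D ∧ Nat.card D = d)
    (hJ : ∀ D ∈ F, ∀ E ∈ F, D ≠ E → D ⊓ E = J) :
    F.card * (d - Nat.card J) ≤ Nat.card U - Nat.card J := by
  classical
  haveI := Fintype.ofFinite G
  have h1 : (F.biUnion fun D => (D : Set G).toFinset \ (J : Set G).toFinset).card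
      = ∑ D ∈ F, (d - Nat.card J) := by
    rw [Finset.card_biUnion]
    · refine Finset.sum_congr rfl fun D hD => ?_
      obtain ⟨-, h2, h3⟩ := hF D hD
      rw [Finset.card_sdiff_of_subset (by simpa using h2), Set.toFinset_card, Set.toFinset_card,
        ← Nat.card_eq_fintype_card, ← Nat.card_eq_fintype_card]
      change Nat.card D - Nat.card J = _
      rw [h3]
    · intro D hD E hE hne
      have h4 := hJ D hD E hE hne
      refine Finset.disjoint_left.mpr fun x hx hx' => ?_
      simp only [Finset.mem_sdiff, Set.mem_toFinset, SetLike.mem_coe] at hx hx'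
      exact hx.2 (h4 ▸ ⟨hx.1, hx'.1⟩)
  have h2 : (F.biUnion fun D => (D : Set G).toFinset \ (J : Set G).toFinset)
      ⊆ (U : Set G).toFinset \ (J : Set G).toFinset := by
    refine Finset.biUnion_subset.mpr fun D hD => Finset.sdiff_subset_sdiff ?_ le_rfl
    simpa using (hF D hD).1
  have h3 := Finset.card_le_card h2
  rw [h1, Finset.sum_const, smul_eq_mul] at h3
  by_cases hFe : F = ∅
  · simp [hFe]
  obtain ⟨D, hD⟩ := Finset.nonempty_iff_ne_empty.mpr hFe
  have hJU : J ≤ U := (hF D hD).2.1.trans (hF D hD).1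
  rw [Finset.card_sdiff_of_subset (by simpa using hJU), Set.toFinset_card, Set.toFinset_card,
    ← Nat.card_eq_fintype_card, ← Nat.card_eq_fintype_card] at h3
  exact h3

theorem card_family_le {U J : Subgroup G} (hU : Nat.card U = 31 ^ 3) (hJ : Nat.card J = 31)
    {F : Finset (Subgroup G)} (hF : ∀ D ∈ F, D ≤ U ∧ J ≤ D ∧ Nat.card D = 31 ^ 2) :
    F.card ≤ 32 := by
  have h1 := card_family_mul_le hF fun D hD E hE hne => by
    obtain ⟨a1, a2, a3⟩ := hF D hD
    obtain ⟨b1, b2, b3⟩ := hF E hE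
    exact (Subgroup.eq_of_le_of_card_ge (le_inf a2 b2)
      (by rw [hJ, card_inf_of_card_sq hU a1 b1 a3 b3 hne])).symm
  rw [hU, hJ] at h1
  omega

theorem Hyp.ti_of_comm (h : Hyp G) {U : Subgroup G} (hU : IsSyl 31 U ⊤)
    (hab : ∀ a ∈ U, ∀ b ∈ U, a * b = b * a) {V : Subgroup G} (hV : IsSyl 31 V ⊤) (hne : V ≠ U) :
    U ⊓ V = ⊥ := by
  classical
  by_contra hinf
  have hcU := h.card_syl31 hU
  have habV (V : Subgroup G) (hV : IsSyl 31 V ⊤) : ∀ a ∈ V, ∀ b ∈ V, a * b = b * a := by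
    obtain ⟨g, -, rfl⟩ := hU.exists_conj p31 hV
    intro a ha b hb
    rw [mem_conj_smul] at ha hb
    have := hab _ ha _ hb
    calc a * b = g * ((g⁻¹ * a * g) * (g⁻¹ * b * g)) * g⁻¹ := by group
      _ = b * a := by rw [this]; group
  have hle {V D : Subgroup G} (hV : IsSyl 31 V ⊤) (hD : D ≤ V) : V ≤ cz(D) :=
    le_centralizer_of_comm fun a ha b hb => habV V hV a ha b (hD hb)
  have hleN {V D : Subgroup G} (hV : IsSyl 31 V ⊤) (hD : D ≤ V) : V ≤ nz(D) :=
    (hle hV hD).trans (centralizer_le_normalizer' D)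
  obtain ⟨y, hyU, hy⟩ := h.exists_order_three hU
  have hy3 : y ^ 3 = 1 := by rw [← hy, pow_orderOf_eq_one]
  have hf := eq_one_of_comm p31 hU.isPGroup hy (not_padj h.graph.2.2.2.2.2.2.2.2.2.1)
  obtain ⟨V₁, hV₁, hne₁, hD₁, -, hc₁, -⟩ := h.exists_max_inf hU hV hne hinf
  set D := U ⊓ V₁ with hDdef
  rw [inf_eq_left.mpr (hleN hU (inf_le_left : D ≤ U)), hcU] at hc₁
  have hcD : Nat.card D = 31 ^ 2 := by omega
  -- subgroups of order 961 in several Sylow subgroups are not invariant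
  have hbad (E W : Subgroup G) (hEU : E ≤ U) (hE : Nat.card E = 31 ^ 2) (hW : IsSyl 31 W ⊤)
      (hWU : W ≠ U) (hEW : E ≤ W) : y ∉ nz(E) := by
    intro hyE
    have hEb : E ≠ ⊥ := by rintro rfl; simp at hE
    have hs : IsSyl 31 U cz(E) := hU.mono p31 (hle hU hEU) le_top
    have h1 := h.normal_of_card hEU hs
      (h.card_centralizer31_dvd (hU.isPGroup.to_le hEU) hEb) (by rw [hcU, hE]; norm_num)
      (centralizer_le_normalizer' E) hy hyE hyU (mem_normalizer_centralizer hyE)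
    exact hWU (hs.eq_of_normal p31 h1 (hW.mono p31 (hle hW hEW) le_top))
  have hconj (g : G) (hg : g ∈ nz(U)) : MulAut.conj g • D ≤ U ∧
      Nat.card (MulAut.conj g • D : Subgroup G) = 31 ^ 2 ∧ MulAut.conj g • V₁ ≠ U ∧
      MulAut.conj g • D = U ⊓ MulAut.conj g • V₁ := by
    have h1 : MulAut.conj g • U = U := conj_smul_eq_iff.mpr hg
    have h2 : MulAut.conj g • D = U ⊓ MulAut.conj g • V₁ := by rw [hDdef, smul_inf, h1]
    refine ⟨h2 ▸ inf_le_left, by rw [card_conj_smul, hcD], fun hc => hne₁ ?_, h2⟩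
    rwa [← h1, smul_left_cancel_iff] at hc
  have hyD : y ∉ nz(D) := hbad D V₁ inf_le_left hcD hV₁ hne₁ inf_le_right
  obtain ⟨a1, a2, a3, a4⟩ := hconj y hyU
  set D' := MulAut.conj y • D with hD'
  obtain ⟨b1, b2, b3, b4⟩ := hconj (y ^ 2) (pow_mem hyU 2)
  set D'' := MulAut.conj (y ^ 2) • D with hD''
  have e1 : MulAut.conj y • D' = D'' := by rw [hD', hD'', pow_two, map_mul, mul_smul]
  have n1 : D ≠ D' := fun he => hyD (conj_smul_eq_iff.mp he.symm)
  have n2 : D' ≠ D'' := fun he => by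
    rw [← e1, hD', smul_left_cancel_iff] at he
    exact n1 he
  have n3 : D ≠ D'' := by
    intro he
    apply n1
    rw [hD', he, hD'', ← mul_smul, ← map_mul, ← pow_succ', hy3, map_one, one_smul, ← hD'', ← he]
  set J := D ⊓ D' with hJdef
  have hcJ : Nat.card J = 31 := card_inf_of_card_sq hcU inf_le_left a1 hcD a2 n1
  have hJU : J ≤ U := inf_le_left.trans inf_le_left
  have hJb : J ≠ ⊥ := by intro hb; rw [hb] at hcJ; simp at hcJ
  have hJ'' : J ≤ D'' := by
    intro x hx
    have h1 := mul_conj_mul_conj hyU hy3 hf (hJU hx)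
    have h2 : y ^ 2 = y⁻¹ := by rw [eq_inv_iff_mul_eq_one, ← pow_succ, hy3]
    have h3 : y ^ 2 * x * (y ^ 2)⁻¹ ∈ D := by
      have := mem_conj_smul.mp hx.2
      rwa [h2, inv_inv]
    rw [hD'', mem_conj_smul, h2, inv_inv]
    have h4 : y * x * y⁻¹ = x⁻¹ * (y ^ 2 * x * (y ^ 2)⁻¹)⁻¹ := by
      rw [eq_mul_inv_iff_mul_eq]
      exact eq_inv_of_mul_eq_one_right (by rw [← mul_assoc]; exact h1)
    rw [h4]
    exact mul_mem (inv_mem hx.1) (inv_mem h3)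
  have hfin (S : Set (Subgroup G)) : S.Finite := Set.toFinite S
  let 𝒱 : Finset (Subgroup G) := (hfin {V | IsSyl 31 V ⊤ ∧ J ≤ V}).toFinset.erase U
  have mem𝒱 (W : Subgroup G) : W ∈ 𝒱 ↔ W ≠ U ∧ IsSyl 31 W ⊤ ∧ J ≤ W := by
    simp [𝒱]
  have key (E : Subgroup G) (hE : E ≠ ⊥) (hEU : E ≤ U) :
      ((hfin {V | IsSyl 31 V ⊤ ∧ E ≤ V}).toFinset.erase U).card = 0 ∨
      ((hfin {V | IsSyl 31 V ⊤ ∧ E ≤ V}).toFinset.erase U).card = 31 ∨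
      ((hfin {V | IsSyl 31 V ⊤ ∧ E ≤ V}).toFinset.erase U).card = 1023 := by
    have h1 := h.card_syl_ge hU hEU hE fun V hV => hleN hV
    rw [Finset.card_erase_of_mem (by simp [hU, hEU]), ← Set.ncard_eq_toFinset_card,
      ← Nat.card_coe_set_eq]
    omega
  let 𝒱₂ := 𝒱.filter fun W => Nat.card (U ⊓ W : Subgroup G) = 31 ^ 2
  let 𝒟 := 𝒱₂.image (U ⊓ ·)
  have mem𝒟 (W : Subgroup G) (hW : W ≠ U) (hW' : IsSyl 31 W ⊤) (hJW : J ≤ U ⊓ W)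
      (hc : Nat.card (U ⊓ W : Subgroup G) = 31 ^ 2) : U ⊓ W ∈ 𝒟 :=
    Finset.mem_image_of_mem _ (Finset.mem_filter.mpr
      ⟨(mem𝒱 W).mpr ⟨hW, hW', hJW.trans inf_le_right⟩, hc⟩)
  have h𝒟 (E : Subgroup G) (hE : E ∈ 𝒟) : E ≤ U ∧ J ≤ E ∧ Nat.card E = 31 ^ 2 ∧
      ((𝒱₂.filter fun W => U ⊓ W = E).card = 31 ∨
      (𝒱₂.filter fun W => U ⊓ W = E).card = 1023) := by
    obtain ⟨W, hW, rfl⟩ := Finset.mem_image.mp hE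
    obtain ⟨hW1, hW2⟩ := Finset.mem_filter.mp hW
    obtain ⟨hW3, hW4, hW5⟩ := (mem𝒱 W).mp hW1
    have hJW : J ≤ U ⊓ W := le_inf hJU hW5
    refine ⟨inf_le_left, hJW, hW2, ?_⟩
    have h1 : (𝒱₂.filter fun W' => U ⊓ W' = U ⊓ W)
        = (hfin {V | IsSyl 31 V ⊤ ∧ U ⊓ W ≤ V}).toFinset.erase U := by
      ext X
      simp only [𝒱₂, Finset.mem_filter, mem𝒱, Finset.mem_erase, Set.Finite.mem_toFinset,
        Set.mem_ofPred_eq]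
      constructor
      · rintro ⟨⟨⟨x1, x2, x3⟩, x4⟩, x5⟩
        exact ⟨x1, x2, x5 ▸ inf_le_right⟩
      · rintro ⟨x1, x2, x3⟩
        have x4 : U ⊓ X = U ⊓ W := by
          refine (Subgroup.eq_of_le_of_card_ge (le_inf inf_le_left x3) ?_).symm
          have x5 := card_eq_relIndex_mul X U
          rw [inf_comm X U, hcU] at x5
          have x6 : X.relIndex U ≠ 1 := fun hc => x1 (Subgroup.eq_of_le_of_card_ge
            (Subgroup.relIndex_eq_one.mp hc) (by rw [hcU, h.card_syl31 x2])).symm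
          have x7 := (Subgroup.card_dvd_of_le (inf_le_left : U ⊓ X ≤ U))
          rw [hcU] at x7
          obtain ⟨i, hi, x8⟩ := (Nat.dvd_prime_pow p31).mp x7
          rw [hW2, x8]
          refine Nat.pow_le_pow_right (by norm_num) ?_
          by_contra hi'
          have : i = 3 := by omega
          rw [x8, this] at x5
          exact x6 (by omega)
        exact ⟨⟨⟨x1, x2, hJW.trans x3⟩, x4 ▸ hW2⟩, x4⟩
    rw [h1]
    have h2 := key (U ⊓ W) (fun hb => by rw [hb] at hW2; simp at hW2) inf_le_left
    rw [← h1] at h2 ⊢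
    have h3 : 0 < (𝒱₂.filter fun W' => U ⊓ W' = U ⊓ W).card :=
      Finset.card_pos.mpr ⟨W, Finset.mem_filter.mpr ⟨hW, rfl⟩⟩
    omega
  have c1 : 3 ≤ 𝒟.card := by
    rw [← Finset.card_eq_three.mpr ⟨D, D', D'', n1, n3, n2, rfl⟩]
    refine Finset.card_le_card fun E hE => ?_
    simp only [Finset.mem_insert, Finset.mem_singleton] at hE
    rcases hE with rfl | rfl | rfl
    · exact mem𝒟 V₁ hne₁ hV₁ inf_le_left hcD
    · rw [a4]
      exact mem𝒟 _ a3 (hV₁.conj (mem_top _)) (a4 ▸ inf_le_right) (a4 ▸ a2)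
    · rw [b4]
      exact mem𝒟 _ b3 (hV₁.conj (mem_top _)) (b4 ▸ hJ'') (b4 ▸ b2)
  have c2 : 𝒟.card ≤ 32 := card_family_le hcU hcJ fun E hE =>
    ⟨(h𝒟 E hE).1, (h𝒟 E hE).2.1, (h𝒟 E hE).2.2.1⟩
  have c3 : 𝒱₂.card = ∑ E ∈ 𝒟, (𝒱₂.filter fun W => U ⊓ W = E).card :=
    Finset.card_eq_sum_card_fiberwise fun W hW => Finset.mem_image_of_mem _ hW
  have c4 : 𝒱₂.card ≤ 𝒱.card := Finset.card_filter_le _ _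
  have c5 : 𝒱.card = 0 ∨ 𝒱.card = 31 ∨ 𝒱.card = 1023 := key J hJb hJU
  have c6 : 31 * 𝒟.card ≤ 𝒱₂.card := by
    rw [c3, mul_comm, ← smul_eq_mul, ← Finset.sum_const]
    exact Finset.sum_le_sum fun E hE => by have := (h𝒟 E hE).2.2.2; omega
  have c7 : 𝒱₂.card = 31 * 𝒟.card := by
    rw [c3, mul_comm, ← smul_eq_mul, ← Finset.sum_const]
    refine Finset.sum_congr rfl fun E hE => ((h𝒟 E hE).2.2.2).resolve_right fun hE' => ?_
    have h1 := Finset.add_sum_erase 𝒟 (fun E => (𝒱₂.filter fun W => U ⊓ W = E).card) hE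
    have h2 : (𝒟.erase E).card • 31
        ≤ ∑ E ∈ 𝒟.erase E, (𝒱₂.filter fun W => U ⊓ W = E).card :=
      Finset.card_nsmul_le_sum _ _ _ fun F hF => by
        have := (h𝒟 F (Finset.mem_of_mem_erase hF)).2.2.2; omega
    rw [Finset.card_erase_of_mem hE, smul_eq_mul] at h2
    omega
  have c8 : 31 ^ 2 ∣ (𝒱.filter fun W => ¬ Nat.card (U ⊓ W : Subgroup G) = 31 ^ 2).card := by
    have h1 := dvd_card_of_inf_le (p := 31) (k := 2) p31 hU
      (S := ↑(𝒱.filter fun W => ¬ Nat.card (U ⊓ W : Subgroup G) = 31 ^ 2)) ?_ ?_ ?_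
    · rwa [Nat.card_eq_card_toFinset, Finset.toFinset_coe] at h1
    · intro W hW
      exact ((mem𝒱 W).mp (Finset.mem_filter.mp hW).1).2.1
    · intro u hu W hW
      obtain ⟨hW1, hW2⟩ := Finset.mem_filter.mp hW
      obtain ⟨hW3, hW4, hW5⟩ := (mem𝒱 W).mp hW1
      have hu1 : MulAut.conj u • U = U := conj_smul_eq_iff.mpr (le_normalizer hu)
      have hu2 : MulAut.conj u • J = J := conj_smul_eq_iff.mpr (hleN hU hJU hu)
      refine Finset.mem_filter.mpr ⟨(mem𝒱 _).mpr ⟨fun hc => hW3 ?_, hW4.conj (mem_top _), ?_⟩, ?_⟩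
      · rwa [← hu1, smul_left_cancel_iff] at hc
      · rw [← hu2]; exact smul_mono_right _ hW5
      · rw [show U ⊓ MulAut.conj u • W = MulAut.conj u • (U ⊓ W) by rw [smul_inf, hu1],
          card_conj_smul]
        exact hW2
    · intro W hW
      obtain ⟨hW1, hW2⟩ := Finset.mem_filter.mp hW
      obtain ⟨hW3, hW4, hW5⟩ := (mem𝒱 W).mp hW1
      obtain ⟨i, hi, x8⟩ := (Nat.dvd_prime_pow p31).mp
        (hcU ▸ Subgroup.card_dvd_of_le (inf_le_left : U ⊓ W ≤ U))
      rw [x8] at hW2 ⊢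
      rw [hcU, ← pow_add]
      refine Nat.pow_le_pow_right (by norm_num) ?_
      have : i ≠ 2 := fun hc => hW2 (by rw [hc])
      have : i ≠ 3 := fun hc => hW3 (by
        have h1 : U ⊓ W = U := Subgroup.eq_of_le_of_card_ge inf_le_left (by rw [x8, hc, hcU])
        exact (Subgroup.eq_of_le_of_card_ge (inf_eq_left.mp h1)
          (by rw [hcU, h.card_syl31 hW4])).symm)
      omega
  have c9 : 𝒱₂.card + (𝒱.filter fun W => ¬ Nat.card (U ⊓ W : Subgroup G) = 31 ^ 2).card = 𝒱.card :=
    Finset.card_filter_add_card_filter_not _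
  obtain ⟨c, hc⟩ := c8
  omega

theorem card_cases {U D : Subgroup G} (hU : Nat.card U = 31 ^ 3) (hD : D ≤ U) :
    Nat.card D = 1 ∨ Nat.card D = 31 ∨ Nat.card D = 961 ∨ Nat.card D = 29791 := by
  obtain ⟨i, hi, h⟩ := (Nat.dvd_prime_pow p31).mp (hU ▸ Subgroup.card_dvd_of_le hD)
  rw [h]
  interval_cases i <;> simp

theorem eq_of_le_of_card {U D : Subgroup G} {n : ℕ} (hD : D ≤ U) (h : Nat.card D = n)
    (hU : Nat.card U = n) : D = U :=
  Subgroup.eq_of_le_of_card_ge hD (by rw [h, hU])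

/-- The center of a subgroup. -/
def zc (U : Subgroup G) : Subgroup G := U ⊓ cz(U)

/-- Nonabelian subgroups of order `31 ^ 3`. -/
structure Heis (U : Subgroup G) : Prop where
  card : Nat.card U = 31 ^ 3
  ne : ¬ ∀ a ∈ U, ∀ b ∈ U, a * b = b * a

theorem zc_le (U : Subgroup G) : zc U ≤ U := inf_le_left

theorem le_cz_zc (U : Subgroup G) : U ≤ cz(zc U) := le_centralizer_iff.mp inf_le_right

theorem conj_smul_zc (g : G) (U : Subgroup G) : MulAut.conj g • zc U = zc (MulAut.conj g • U) := by
  rw [zc, zc, smul_inf, ← centralizer_conj_smul]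

theorem mem_nz_zc {U : Subgroup G} {g : G} (hg : g ∈ nz(U)) : g ∈ nz(zc U) := by
  rw [← conj_smul_eq_iff, conj_smul_zc, conj_smul_eq_iff.mpr hg]

namespace Heis

variable {U : Subgroup G} (hU : Heis U)
include hU

theorem conj (g : G) : Heis (MulAut.conj g • U) := by
  refine ⟨by rw [card_conj_smul, hU.card], fun hc => hU.ne fun a ha b hb => ?_⟩
  have := hc (g * a * g⁻¹) (by rw [mem_conj_smul]; simpa [mul_assoc] using ha)
    (g * b * g⁻¹) (by rw [mem_conj_smul]; simpa [mul_assoc] using hb)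
  calc a * b = g⁻¹ * (g * a * g⁻¹ * (g * b * g⁻¹)) * g := by group
    _ = b * a := by rw [this]; group

theorem not_le_cz : ¬ U ≤ cz(U) := fun hc =>
  hU.ne fun _ ha _ hb => (mem_centralizer_iff.mp (hc ha) _ hb).symm

theorem isPGroup : IsPGroup 31 U := IsPGroup.of_card hU.card

theorem card_zc_and : Nat.card (zc U) = 31 ∧
    ∀ a ∈ U, ∀ b ∈ U, a * b * a⁻¹ * b⁻¹ ∈ zc U := by
  haveI : Fact (Nat.Prime 31) := ⟨p31⟩
  have h0 : zc U = (center U).map U.subtype := by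
    ext x
    constructor
    · rintro ⟨hx, hx'⟩
      refine ⟨⟨x, hx⟩, mem_center_iff.mpr fun g => Subtype.ext ?_, rfl⟩
      exact mem_centralizer_iff.mp hx' _ g.2
    · rintro ⟨x, hx, rfl⟩
      exact ⟨x.2, mem_centralizer_iff.mpr fun g hg =>
        congrArg Subtype.val (mem_center_iff.mp hx ⟨g, hg⟩)⟩
  have h1 : Nat.card (zc U) = Nat.card (center U) := by
    rw [h0]; exact Nat.card_congr ((center U).equivMapOfInjective _ U.subtype_injective).symm.toEquiv
  have h2 : Nat.card (zc U) ≠ 1 := by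
    obtain ⟨k, hk, h2⟩ := IsPGroup.card_center_eq_prime_pow hU.card (by norm_num)
    rw [h1, h2]
    exact (Nat.one_lt_pow hk.ne' (by norm_num)).ne'
  have h3 : Nat.card (zc U) ≠ 29791 := fun hc => hU.not_le_cz (by
    exact (eq_of_le_of_card (zc_le U) hc hU.card).ge.trans inf_le_right)
  have h4 : Nat.card U = Nat.card (U ⧸ center U) * Nat.card (center U) :=
    card_eq_card_quotient_mul_card_subgroup _
  have h5 : Nat.card (zc U) ≠ 961 := by
    intro hc
    rw [hU.card, ← h1, hc] at h4
    haveI : IsCyclic (U ⧸ center U) := isCyclic_of_prime_card (p := 31) (by omega)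
    refine hU.ne fun a ha b hb => ?_
    have := MonoidHom.isMulCommutative_of_isCyclic_of_ker_le_center
      (QuotientGroup.mk' (center U)) (by simp)
    exact congrArg Subtype.val (mul_comm' (⟨a, ha⟩ : U) ⟨b, hb⟩)
  have h6 : Nat.card (zc U) = 31 := by
    rcases card_cases hU.card (zc_le U) with h | h | h | h <;> tauto
  refine ⟨h6, fun a ha b hb => ?_⟩
  rw [hU.card, ← h1, h6] at h4
  have h7 := IsPGroup.isMulCommutative_of_card_eq_prime_sq (p := 31) (G := U ⧸ center U) (by omega)
  rw [h0]
  refine ⟨⟨a, ha⟩ * ⟨b, hb⟩ * ⟨a, ha⟩⁻¹ * ⟨b, hb⟩⁻¹, ?_, rfl⟩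
  rw [SetLike.mem_coe, ← QuotientGroup.eq_one_iff]
  simp only [QuotientGroup.mk_mul, QuotientGroup.mk_inv]
  rw [mul_comm' (QuotientGroup.mk (⟨a, ha⟩ : U) : U ⧸ center U)]
  group

theorem card_zc : Nat.card (zc U) = 31 := hU.card_zc_and.1

theorem zc_ne_bot : zc U ≠ ⊥ := fun hc => by
  have := hU.card_zc
  rw [hc] at this
  simp at this

theorem zc_le_of_card {D : Subgroup G} (hD : D ≤ U) (hc : Nat.card D = 961) : zc U ≤ D := by
  by_contra hn
  have h1 : D ⊔ zc U ≤ U := sup_le hD (zc_le U)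
  have h2 : D < D ⊔ zc U := lt_of_le_of_ne le_sup_left fun he => hn (he ▸ le_sup_right)
  have h3 : D ⊔ zc U = U := by
    have := Set.ncard_lt_ncard (SetLike.coe_ssubset_coe.mpr h2) (Set.toFinite _)
    rw [← Nat.card_coe_set_eq, ← Nat.card_coe_set_eq] at this
    change Nat.card D < Nat.card (D ⊔ zc U : Subgroup G) at this
    rw [hc] at this
    rcases card_cases hU.card h1 with h | h | h | h
    · omega
    · omega
    · omega
    · exact eq_of_le_of_card h1 h hU.card
  have h4 : U ≤ cz(D) := by
    conv_lhs => rw [← h3]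
    refine sup_le (fun a ha => mem_centralizer_iff.mpr fun b hb => ?_)
      (inf_le_right.trans (centralizer_le hD))
    exact (mem_centralizer_singleton_iff.mp
      (le_centralizer_of_card_sq p31 (A := D) (by rw [hc]; rfl) ha hb))
  have h5 : Nat.card D ∣ Nat.card (zc U) :=
    Subgroup.card_dvd_of_le (le_inf hD (le_centralizer_iff.mp h4))
  rw [hc, hU.card_zc] at h5
  norm_num at h5

theorem card_cz {x : G} (hx : x ∈ U) (hxz : x ∉ zc U) :
    Nat.card (U ⊓ cz(zpowers x) : Subgroup G) = 961 := by
  have h1 : zc U < U ⊓ cz(zpowers x) := by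
    refine lt_of_le_of_ne (le_inf (zc_le U) (inf_le_right.trans (centralizer_le ?_))) fun he => hxz ?_
    · exact (zpowers_le.mpr hx)
    · rw [he, centralizer_zpowers]
      exact ⟨hx, mem_centralizer_singleton_iff.mpr rfl⟩
  have := Set.ncard_lt_ncard (SetLike.coe_ssubset_coe.mpr h1) (Set.toFinite _)
  rw [← Nat.card_coe_set_eq, ← Nat.card_coe_set_eq] at this
  change Nat.card (zc U) < Nat.card (U ⊓ cz(zpowers x) : Subgroup G) at this
  rw [hU.card_zc] at this
  rcases card_cases hU.card (inf_le_left : U ⊓ cz(zpowers x) ≤ U) with h | h | h | h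
  · omega
  · omega
  · exact h
  · have h2 := eq_of_le_of_card inf_le_left h hU.card
    exact absurd ⟨hx, mem_centralizer_iff.mpr fun a ha => by
      rw [SetLike.mem_coe, ← h2, centralizer_zpowers] at ha
      exact mem_centralizer_singleton_iff.mp ha.2⟩ hxz

theorem eq_inf_cz {D : Subgroup G} (hD : D ≤ U) (hc : Nat.card D = 961) {x : G} (hx : x ∈ D)
    (hxz : x ∉ zc U) : D = U ⊓ cz(zpowers x) :=
  eq_of_le_of_card (le_inf hD (by
    rw [centralizer_zpowers]; exact le_centralizer_of_card_sq p31 (by rw [hc]; rfl) hx)) hc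
    (hU.card_cz (hD hx) hxz)

theorem exists_notMem_zc {D : Subgroup G} (hc : Nat.card D = 961) : ∃ x ∈ D, x ∉ zc U := by
  by_contra! hcon
  have := Subgroup.card_dvd_of_le (show D ≤ zc U from hcon)
  rw [hc, hU.card_zc] at this
  norm_num at this

theorem le_nz {D : Subgroup G} (hD : D ≤ U) (hz : zc U ≤ D) : U ≤ nz(D) := fun u hu =>
  mem_normalizer_of_forall fun a ha => by
    have := mul_mem (hz (hU.card_zc_and.2 u hu a (hD ha))) ha
    simpa [mul_assoc] using this

/-- Every central element is a commutator with a given noncentral one. -/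
theorem exists_conj_eq {w c : G} (hw : w ∈ U) (hwz : w ∉ zc U) (hc : c ∈ zc U) :
    ∃ u ∈ U, u * w * u⁻¹ = c * w := by
  have h1 : ∃ u ∈ U, u * w ≠ w * u := by
    by_contra! hcon
    exact hwz ⟨hw, mem_centralizer_iff.mpr fun a ha => hcon a ha⟩
  obtain ⟨u, hu, hne⟩ := h1
  have h2 := hU.card_zc_and.2 u hu w hw
  set d := u * w * u⁻¹ * w⁻¹ with hd
  have hd1 : d ≠ 1 := fun h => hne (by
    rw [hd, mul_inv_eq_one, mul_inv_eq_iff_eq_mul] at h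
    exact h)
  have h3 : zc U = zpowers d := by
    refine (eq_of_le_of_card (zpowers_le.mpr h2) ?_ hU.card_zc).symm
    have := Subgroup.card_dvd_of_le (zpowers_le.mpr h2)
    rw [hU.card_zc, Nat.dvd_prime p31] at this
    refine this.resolve_left fun h => hd1 ?_
    rwa [Nat.card_zpowers, orderOf_eq_one_iff] at h
  rw [h3] at hc
  obtain ⟨k, rfl⟩ := mem_powers_iff_mem_zpowers.mpr hc
  refine ⟨u ^ k, pow_mem hu k, ?_⟩
  have h4 : ∀ k : ℕ, u ^ k * w * (u ^ k)⁻¹ = d ^ k * w := by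
    intro k
    induction k with
    | zero => simp
    | succ k ih =>
      have h5 : u * d ^ k = d ^ k * u :=
        (mem_centralizer_iff.mp (pow_mem h2 k).2 u hu)
      calc u ^ (k + 1) * w * (u ^ (k + 1))⁻¹ = u * (u ^ k * w * (u ^ k)⁻¹) * u⁻¹ := by
            rw [pow_succ']; group
        _ = u * d ^ k * w * u⁻¹ := by rw [ih]; group
        _ = d ^ k * (u * w * u⁻¹ * w⁻¹) * w := by rw [h5]; group
        _ = d ^ (k + 1) * w := by rw [← hd, pow_succ]
  exact h4 k

end Heis

theorem mem_normalizer_normalizer {D : Subgroup G} {y : G} (hy : y ∈ nz(D)) : y ∈ nz(nz(D)) :=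
  le_normalizer hy

theorem mem_nz_inf {A B : Subgroup G} {y : G} (hA : y ∈ nz(A)) (hB : y ∈ nz(B)) :
    y ∈ nz(A ⊓ B) := by
  rw [← conj_smul_eq_iff] at *
  rw [smul_inf, hA, hB]

theorem conj_smul_zpowers (y x : G) :
    MulAut.conj y • zpowers x = zpowers (y * x * y⁻¹) :=
  MonoidHom.map_zpowers (MulAut.conj y).toMonoidHom x

theorem Heis.mem_nz_of_card {U D : Subgroup G} (hU : Heis U) {y : G} (hy : y ∈ nz(U))
    (hy3 : y ^ 3 = 1) (hf : ∀ a ∈ U, y * a = a * y → a = 1) (hD : D ≤ U)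
    (hc : Nat.card D = 961) : y ∈ nz(D) := by
  obtain ⟨x, hx, hxz⟩ := hU.exists_notMem_zc hc
  have h1 := comm_conj_of_fpf hy hy3 hf (hD hx)
  have h2 := hU.eq_inf_cz hD hc hx hxz
  have h3 : y * x * y⁻¹ ∈ D := by
    rw [h2, centralizer_zpowers]
    exact ⟨conj_mem_of_mem_normalizer hy (hD hx), mem_centralizer_singleton_iff.mpr h1.symm⟩
  have h4 : y * x * y⁻¹ ∉ zc U := fun hc =>
    hxz ((mem_normalizer_iff.mp (mem_nz_zc hy) x).mpr hc)
  rw [← conj_smul_eq_iff]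
  nth_rw 1 [h2]
  rw [smul_inf, conj_smul_eq_iff.mpr hy, ← centralizer_conj_smul, hU.eq_inf_cz hD hc h3 h4]
  rw [conj_smul_zpowers]

theorem Hyp.centralizer_zc_le (h : Hyp G) {U : Subgroup G} (hU : IsSyl 31 U ⊤) (hn : Heis U) :
    cz(zc U) ≤ nz(U) := by
  obtain ⟨y, hyU, hy⟩ := h.exists_order_three hU
  have hy3 : y ^ 3 = 1 := by rw [← hy, pow_orderOf_eq_one]
  have hf := eq_one_of_comm p31 hU.isPGroup hy (not_padj h.graph.2.2.2.2.2.2.2.2.2.1)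
  have hUC : IsSyl 31 U cz(zc U) := hU.mono p31 (le_cz_zc U) le_top
  have hle {V : Subgroup G} (hV : IsSyl 31 V cz(zc U)) : zc U ≤ V := by
    obtain ⟨g, hg, rfl⟩ := hUC.exists_conj p31 hV
    rw [← conj_smul_eq_iff.mpr (centralizer_le_normalizer' _ hg)]
    exact smul_mono_right _ (zc_le U)
  by_contra hcon
  obtain ⟨V₀, hV₀, hne₀⟩ : ∃ V, IsSyl 31 V cz(zc U) ∧ V ≠ U := by
    obtain ⟨g, hg, hg'⟩ := SetLike.not_le_iff_exists.mp hcon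
    exact ⟨_, hUC.conj hg, fun hc => hg' (conj_smul_eq_iff.mp hc)⟩
  obtain ⟨V, hV, hne, -, hS, hcS, hnn⟩ := h.exists_max_inf hUC hV₀ hne₀
    (fun hb => hn.zc_ne_bot (le_bot_iff.mp (hb ▸ le_inf (zc_le U) (hle hV₀))))
  set D := U ⊓ V with hD
  have hZD : zc U ≤ D := le_inf (zc_le U) (hle hV)
  have hUD : U ≤ nz(D) := hn.le_nz inf_le_left hZD
  rw [inf_eq_left.mpr hUD] at hS hcS hnn
  rw [hn.card] at hcS
  have hcD : Nat.card D = 961 := by omega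
  have hyD := hn.mem_nz_of_card hyU hy3 hf inf_le_left hcD
  refine hnn (h.normal_of_card inf_le_left hS
    ((Subgroup.card_dvd_of_le inf_le_left).trans
      (h.card_centralizer31_dvd (hn.isPGroup.to_le (zc_le U)) hn.zc_ne_bot))
    (by rw [hn.card, hcD]; rfl) inf_le_right hy hyD hyU
    (mem_nz_inf (mem_normalizer_centralizer (mem_nz_zc hyU)) (mem_normalizer_normalizer hyD)))

theorem Hyp.eq_of_zc_le (h : Hyp G) {U V : Subgroup G} (hU : IsSyl 31 U ⊤) (hn : Heis U)
    (hV : IsSyl 31 V ⊤) (hle : V ≤ cz(zc U)) : V = U :=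
  (hU.mono p31 (le_cz_zc U) le_top).eq_of_normal p31 (h.centralizer_zc_le hU hn)
    (hV.mono p31 hle le_top)

theorem Hyp.centralizer_le_of_isSyl (h : Hyp G) {U A : Subgroup G} (hU : IsSyl 31 U ⊤)
    (hn : Heis U) (hAU : A ≤ U) (hA : Nat.card A = 31) (hAZ : A ≠ zc U)
    (hS : IsSyl 31 (U ⊓ cz(A)) cz(A)) : cz(A) ≤ nz(U ⊓ cz(A)) := by
  obtain ⟨y, hyU, hy⟩ := h.exists_order_three hU
  have hy3 : y ^ 3 = 1 := by rw [← hy, pow_orderOf_eq_one]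
  have hf := eq_one_of_comm p31 hU.isPGroup hy (not_padj h.graph.2.2.2.2.2.2.2.2.2.1)
  obtain ⟨x, hx, hxo, rfl⟩ := exists_orderOf_of_card p31 hA
  have hxU := hAU hx
  have hxz : x ∉ zc U := fun hc => hAZ (eq_of_le_of_card (zpowers_le.mpr hc) hA hn.card_zc)
  have hcS := hn.card_cz hxU hxz
  set S := U ⊓ cz(zpowers x) with hSdef
  have hZS : zc U ≤ S := hn.zc_le_of_card inf_le_left hcS
  have hyS := hn.mem_nz_of_card hyU hy3 hf inf_le_left hcS
  have hxS : x ∈ S := ⟨hxU, by rw [centralizer_zpowers]; exact mem_centralizer_singleton_iff.mpr rfl⟩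
  -- the conjugate of `x` by `y` is conjugate in `U` to a power of `x`
  have h1 : zpowers x ⊔ zc U = S := by
    have h2 : zpowers x ⊔ zc U ≤ S := sup_le (zpowers_le.mpr hxS) hZS
    have h3 : zc U < zpowers x ⊔ zc U := lt_of_le_of_ne le_sup_right fun he =>
      hxz (he ▸ (le_sup_left : zpowers x ≤ _) (mem_zpowers x))
    have := Set.ncard_lt_ncard (SetLike.coe_ssubset_coe.mpr h3) (Set.toFinite _)
    rw [← Nat.card_coe_set_eq, ← Nat.card_coe_set_eq] at this
    change Nat.card (zc U) < Nat.card (zpowers x ⊔ zc U : Subgroup G) at this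
    have h4 := Subgroup.card_dvd_of_le h2
    rw [hn.card_zc] at this
    rw [hcS] at h4
    rcases card_cases hn.card (h2.trans inf_le_left) with h | h | h | h
    · omega
    · omega
    · exact eq_of_le_of_card h2 h hcS
    · rw [h] at h4; norm_num at h4
  have h2 : y * x * y⁻¹ ∈ S := conj_mem_of_mem_normalizer hyS hxS
  rw [← h1, ← SetLike.mem_coe, coe_mul_of_left_le_normalizer_right _ _
    ((zpowers_le.mpr hxU).trans (hn.le_nz (zc_le U) le_rfl))] at h2
  obtain ⟨w, hw, c, hc, hwc⟩ := Set.mem_mul.mp h2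
  have hwz : w ∉ zc U := fun hwz => hxz ((mem_normalizer_iff.mp (mem_nz_zc hyU) x).mpr
    (hwc ▸ mul_mem hwz hc))
  obtain ⟨u, hu, huw⟩ := hn.exists_conj_eq (zpowers_le.mpr hxU hw) hwz hc
  have hcw : c * w = w * c := (mem_centralizer_iff.mp hc.2 w (zpowers_le.mpr hxU hw)).symm
  have h3 : (u⁻¹ * y) * x * (u⁻¹ * y)⁻¹ = w := by
    calc _ = u⁻¹ * (y * x * y⁻¹) * u := by group
      _ = u⁻¹ * (u * w * u⁻¹) * u := by rw [← hwc, huw, hcw]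
      _ = w := by group
  have h4 : u⁻¹ * y ∈ nz(zpowers x) := by
    rw [← conj_smul_eq_iff]
    rw [conj_smul_zpowers, h3]
    refine eq_of_le_of_card (n := 31) (zpowers_le.mpr hw) ?_ hA
    rw [← h3, ← conj_smul_zpowers, card_conj_smul, hA]
  have h5 : u⁻¹ * y ∈ nz(U) := mul_mem (le_normalizer (inv_mem hu)) hyU
  -- an element of order three
  let π := QuotientGroup.mk' (U.subgroupOf nz(U))
  have h6 (n : ℕ) : π (⟨u⁻¹ * y, h5⟩ ^ n) = π (⟨y, hyU⟩ ^ n) := by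
    have e1 : π ⟨u⁻¹, le_normalizer (inv_mem hu)⟩ = 1 :=
      (QuotientGroup.eq_one_iff _).mpr (inv_mem hu)
    rw [map_pow, map_pow, show (⟨u⁻¹ * y, h5⟩ : nz(U)) =
      ⟨u⁻¹, le_normalizer (inv_mem hu)⟩ * ⟨y, hyU⟩ from rfl, map_mul, e1, one_mul]
  have h7 : (u⁻¹ * y) ^ 3 ∈ U := by
    have h8 : π (⟨u⁻¹ * y, h5⟩ ^ 3) = 1 := by
      rw [h6, show (⟨y, hyU⟩ : nz(U)) ^ 3 = 1 from Subtype.ext hy3, map_one]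
    have h9 : (⟨u⁻¹ * y, h5⟩ : nz(U)) ^ 3 ∈ U.subgroupOf nz(U) :=
      (QuotientGroup.eq_one_iff _).mp h8
    exact h9
  have h8 : orderOf ((u⁻¹ * y) ^ 29791) = 3 := by
    refine orderOf_eq_prime (hp := ⟨p3⟩) ?_ fun h9 => ?_
    · rw [← pow_mul, mul_comm, pow_mul]
      have h9 := pow_natCard_of_mem h7
      rwa [hn.card] at h9
    · have h10 := h6 29791
      rw [show (⟨u⁻¹ * y, h5⟩ : nz(U)) ^ 29791 = 1 from Subtype.ext h9, map_one,
        show (⟨y, hyU⟩ : nz(U)) ^ 29791 = ⟨y, hyU⟩ from Subtype.ext (by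
          change y ^ 29791 = y
          rw [← Nat.div_add_mod 29791 3, pow_add, pow_mul, hy3]; simp)] at h10
      have h12 : (⟨y, hyU⟩ : nz(U)) ∈ U.subgroupOf nz(U) := (QuotientGroup.eq_one_iff _).mp h10.symm
      have h11 : y = 1 := hf y h12 rfl
      rw [h11, orderOf_one] at hy
      omega
  have h9 := pow_mem h4 29791
  exact h.normal_of_card (y := (u⁻¹ * y) ^ 29791) (le_inf hAU (by
    rw [centralizer_zpowers]; exact mem_centralizer_self x)) hS
    (h.card_centralizer31_dvd (hn.isPGroup.to_le hAU) (by rintro hb; simp [hb] at hA))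
    (by rw [hcS, hA]) (centralizer_le_normalizer' _) h8 h9
    (mem_nz_inf (pow_mem h5 29791) (mem_normalizer_centralizer h9)) (mem_normalizer_centralizer h9)

/-- All Sylow `31`-subgroups are nonabelian. -/
def AllHeis (G : Type*) [Group G] : Prop := ∀ V : Subgroup G, IsSyl 31 V ⊤ → Heis V

/-- Two Sylow subgroups meeting in a subgroup of order `961`. -/
def Near (U V : Subgroup G) : Prop :=
  IsSyl 31 U ⊤ ∧ IsSyl 31 V ⊤ ∧ Nat.card (U ⊓ V : Subgroup G) = 961

theorem Near.symm {U V : Subgroup G} (h : Near U V) : Near V U := ⟨h.2.1, h.1, inf_comm U V ▸ h.2.2⟩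

theorem Near.conj {U V : Subgroup G} (h : Near U V) (g : G) :
    Near (MulAut.conj g • U) (MulAut.conj g • V) :=
  ⟨h.1.conj (mem_top _), h.2.1.conj (mem_top _), by rw [← smul_inf, card_conj_smul, h.2.2]⟩

theorem Near.ne {U V : Subgroup G} (h : Near U V) (hH : AllHeis G) : V ≠ U := by
  rintro rfl
  have := h.2.2
  rw [inf_idem, (hH _ h.1).card] at this
  omega

theorem AllHeis.card_inf (hH : AllHeis G) {U V : Subgroup G} (hU : IsSyl 31 U ⊤)
    (hV : IsSyl 31 V ⊤) (hne : V ≠ U) : Nat.card (U ⊓ V : Subgroup G) = 1 ∨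
      Nat.card (U ⊓ V : Subgroup G) = 31 ∨ Near U V := by
  rcases card_cases (hH U hU).card (inf_le_left : U ⊓ V ≤ U) with h1 | h1 | h1 | h1
  · exact Or.inl h1
  · exact Or.inr (Or.inl h1)
  · exact Or.inr (Or.inr ⟨hU, hV, h1⟩)
  · exact absurd ((eq_of_le_of_card inf_le_right h1 (hH V hV).card).symm.trans
      (eq_of_le_of_card inf_le_left h1 (hH U hU).card)) hne

theorem Heis.card_cz_of_card {U A : Subgroup G} (hU : Heis U) (hA : A ≤ U)
    (hc : Nat.card A = 31) (hne : A ≠ zc U) : Nat.card (U ⊓ cz(A) : Subgroup G) = 961 := by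
  obtain ⟨x, hx, -, rfl⟩ := exists_orderOf_of_card p31 hc
  exact hU.card_cz (hA hx) fun hz =>
    hne (eq_of_le_of_card (zpowers_le.mpr hz) hc hU.card_zc)

theorem le_inf_cz {U A : Subgroup G} (hA : A ≤ U) (hc : Nat.card A = 31) : A ≤ U ⊓ cz(A) := by
  obtain ⟨x, hx, -, rfl⟩ := exists_orderOf_of_card p31 hc
  exact le_inf hA (by rw [centralizer_zpowers]; exact mem_centralizer_self x)

theorem Hyp.exists_near (h : Hyp G) (hH : AllHeis G) {U V : Subgroup G} (hU : IsSyl 31 U ⊤)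
    (hV : IsSyl 31 V ⊤) (hne : V ≠ U) (hb : U ⊓ V ≠ ⊥) : ∃ V, Near U V := by
  obtain ⟨W, hW, hneW, hD, hS, hcS, hnn⟩ := h.exists_max_inf hU hV hne hb
  rw [top_inf_eq] at hS hnn
  rcases hH.card_inf hU hW hneW with hc | hc | hc
  · exact absurd (Subgroup.card_eq_one.mp hc) hD
  · exfalso
    set D := U ⊓ W with hDdef
    have hDU : D ≤ U := inf_le_left
    have hZ : D ≠ zc U := by
      intro hZ
      rw [inf_eq_left.mpr ((hH U hU).le_nz hDU hZ.ge), (hH U hU).card, hc] at hcS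
      omega
    have h1 := (hH U hU).card_cz_of_card hDU hc hZ
    rw [hc] at hcS
    have h2 : U ⊓ cz(D) = U ⊓ nz(D) := eq_of_le_of_card
      (inf_le_inf_left U (centralizer_le_normalizer' D)) h1 hcS
    have h3 : IsSyl 31 (U ⊓ cz(D)) cz(D) :=
      (h2 ▸ hS).mono p31 inf_le_right (centralizer_le_normalizer' D)
    have h4 := h.centralizer_le_of_isSyl hU (hH U hU) hDU hc hZ h3
    refine hnn ?_
    rw [← h2]
    exact fun g hg => h3.normalizer_le p31 h4 (mem_normalizer_centralizer hg)
  · exact ⟨W, hc⟩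

theorem Hyp.zc_inj (h : Hyp G) (hH : AllHeis G) {U V : Subgroup G} (hU : IsSyl 31 U ⊤)
    (hV : IsSyl 31 V ⊤) (he : zc V = zc U) : V = U :=
  h.eq_of_zc_le hU (hH U hU) hV (he ▸ le_cz_zc V)

theorem AllHeis.le_nz (hH : AllHeis G) {D V : Subgroup G} (hc : Nat.card D = 961)
    (hV : IsSyl 31 V ⊤) (hD : D ≤ V) : V ≤ nz(D) :=
  (hH V hV).le_nz hD ((hH V hV).zc_le_of_card hD hc)

theorem inf_eq_bot_of_card {A B : Subgroup G} (hA : Nat.card A = 31) (hB : Nat.card B = 31)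
    (hne : A ≠ B) : A ⊓ B = ⊥ := by
  have h1 := Subgroup.card_dvd_of_le (inf_le_left : A ⊓ B ≤ A)
  rw [hA, Nat.dvd_prime p31] at h1
  rcases h1 with h1 | h1
  · exact Subgroup.card_eq_one.mp h1
  · exact absurd ((eq_of_le_of_card inf_le_left h1 hA).symm.trans
      (eq_of_le_of_card inf_le_right h1 hB)) hne

theorem Hyp.card_over (h : Hyp G) (hH : AllHeis G) {U V : Subgroup G} (hN : Near U V) :
    Nat.card {W | IsSyl 31 W ⊤ ∧ U ⊓ V ≤ W} = 32 := by
  classical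
  set D := U ⊓ V with hD
  have hcD : Nat.card D = 961 := hN.2.2
  have h1 := h.card_syl_ge hN.1 (inf_le_left : D ≤ U) (fun hb => by rw [hD, hb] at hcD; simp at hcD)
    fun W hW hle => hH.le_nz hcD hW hle
  have hfin : {W | IsSyl 31 W ⊤ ∧ D ≤ W}.Finite := Set.toFinite _
  have mem (W : Subgroup G) : W ∈ hfin.toFinset ↔ IsSyl 31 W ⊤ ∧ D ≤ W := by simp
  have e1 : Nat.card {W | IsSyl 31 W ⊤ ∧ D ≤ W} = hfin.toFinset.card := by
    rw [Nat.card_coe_set_eq, Set.ncard_eq_toFinset_card]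
  have h2 : 1 < hfin.toFinset.card := Finset.one_lt_card.mpr
    ⟨U, (mem U).mpr ⟨hN.1, inf_le_left⟩, V, (mem V).mpr ⟨hN.2.1, inf_le_right⟩, (hN.ne hH).symm⟩
  have h3 : (hfin.toFinset.image zc).card * 30 ≤ 960 := by
    have := card_family_mul_le (U := D) (J := ⊥) (d := 31) (F := hfin.toFinset.image zc)
      (fun E hE => ?_) fun E hE E' hE' hne => ?_
    · rw [hcD] at this; simpa using this
    · obtain ⟨W, hW, rfl⟩ := Finset.mem_image.mp hE
      obtain ⟨hW, hDW⟩ := (mem W).mp hW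
      exact ⟨(hH W hW).zc_le_of_card hDW hcD, bot_le, (hH W hW).card_zc⟩
    · obtain ⟨W, hW, rfl⟩ := Finset.mem_image.mp hE
      obtain ⟨W', hW', rfl⟩ := Finset.mem_image.mp hE'
      exact inf_eq_bot_of_card (hH W ((mem W).mp hW).1).card_zc
        (hH W' ((mem W').mp hW').1).card_zc hne
  rw [Finset.card_image_of_injOn fun W hW W' hW' he =>
    h.zc_inj hH ((mem W').mp hW').1 ((mem W).mp hW).1 he] at h3
  rw [← hD, e1] at h1
  rw [e1]
  omega

open Classical in
/-- The Sylow subgroups meeting `U` in order `961`. -/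
noncomputable def nears (U : Subgroup G) : Finset (Subgroup G) := (Set.toFinite {V | Near U V}).toFinset

theorem mem_nears {U V : Subgroup G} : V ∈ nears U ↔ Near U V := by simp [nears]

open Classical in
/-- The intersections of order `961` with `U`. -/
noncomputable def goods (U : Subgroup G) : Finset (Subgroup G) := (nears U).image (U ⊓ ·)

open Classical in
theorem Hyp.card_fiber (h : Hyp G) (hH : AllHeis G) {U V : Subgroup G} (hN : Near U V) :
    ((nears U).filter fun W => U ⊓ W = U ⊓ V).card = 31 := by
  have hfin : {W | IsSyl 31 W ⊤ ∧ U ⊓ V ≤ W}.Finite := Set.toFinite _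
  have h1 : ((nears U).filter fun W => U ⊓ W = U ⊓ V) = hfin.toFinset.erase U := by
    ext W
    simp only [Finset.mem_filter, mem_nears, Finset.mem_erase, Set.Finite.mem_toFinset,
      Set.mem_ofPred_eq]
    constructor
    · rintro ⟨h1, h2⟩
      exact ⟨h1.ne hH, h1.2.1, h2 ▸ inf_le_right⟩
    · rintro ⟨h1, h2, h3⟩
      have h4 : U ⊓ V ≤ U ⊓ W := le_inf inf_le_left h3
      have h5 := Subgroup.card_dvd_of_le h4
      rw [hN.2.2] at h5
      rcases hH.card_inf hN.1 h2 h1 with h6 | h6 | h6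
      · rw [h6] at h5; norm_num at h5
      · rw [h6] at h5; norm_num at h5
      · exact ⟨h6, (eq_of_le_of_card h4 hN.2.2 h6.2.2).symm⟩
  have h2 := h.card_over hH hN
  rw [Nat.card_coe_set_eq, Set.ncard_eq_toFinset_card _ hfin] at h2
  rw [h1, Finset.card_erase_of_mem (by simp [hN.1]), h2]

theorem Hyp.card_nears (h : Hyp G) (hH : AllHeis G) (U : Subgroup G) :
    (nears U).card = 31 * (goods U).card := by
  classical
  rw [goods, mul_comm, ← smul_eq_mul, ← Finset.sum_const,
    Finset.card_eq_sum_card_fiberwise (f := (U ⊓ ·)) (t := (nears U).image (U ⊓ ·))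
    fun W hW => Finset.mem_image_of_mem _ hW]
  refine Finset.sum_congr rfl fun D hD => ?_
  obtain ⟨V, hV, rfl⟩ := Finset.mem_image.mp hD
  convert h.card_fiber hH (mem_nears.mp hV)

theorem card_nears_eq {U V : Subgroup G} (hU : IsSyl 31 U ⊤) (hV : IsSyl 31 V ⊤) :
    (nears V).card = (nears U).card := by
  classical
  obtain ⟨g, -, rfl⟩ := hU.exists_conj p31 hV
  have : nears (MulAut.conj g • U) = (nears U).image (MulAut.conj g • ·) := by
    ext W
    simp only [mem_nears, Finset.mem_image]
    constructor
    · intro hW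
      refine ⟨MulAut.conj g⁻¹ • W, ?_, by rw [← mul_smul, ← map_mul, mul_inv_cancel, map_one, one_smul]⟩
      have := hW.conj g⁻¹
      rwa [← mul_smul, ← map_mul, inv_mul_cancel, map_one, one_smul] at this
    · rintro ⟨W, hW, rfl⟩
      exact hW.conj g
  rw [this, Finset.card_image_of_injective _ (MulAction.injective _)]

theorem Hyp.inf_eq_zc (h : Hyp G) (hH : AllHeis G) {U V W : Subgroup G} (hUV : Near U V)
    (hVW : Near V W) (hne : V ⊓ W ≠ V ⊓ U) : W ≠ U ∧ U ⊓ W = zc V ∧ ¬ Near U W := by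
  have h1 : zc V ≤ V ⊓ W := (hH V hUV.2.1).zc_le_of_card inf_le_left hVW.2.2
  have h2 : zc V ≤ V ⊓ U := (hH V hUV.2.1).zc_le_of_card inf_le_left hUV.symm.2.2
  have h3 : zc V ≤ U ⊓ W := le_inf (h2.trans inf_le_right) (h1.trans inf_le_right)
  have h4 : Nat.card (zc V) = 31 := (hH V hUV.2.1).card_zc
  have h5 : W ≠ U := fun he => hne (by rw [he])
  have h6 : ¬ Near U W := by
    intro hN
    have h7 : zc V ≠ zc U := fun he => hUV.ne hH (h.zc_inj hH hUV.1 hUV.2.1 he)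
    obtain ⟨x, hx, -, hxz⟩ := exists_orderOf_of_card p31 h4
    have h8 : x ∉ zc U := fun hxU => h7 (eq_of_le_of_card
      (hxz ▸ zpowers_le.mpr hxU) h4 (hH U hUV.1).card_zc)
    have h9 : U ⊓ V = U ⊓ W :=
      ((hH U hUV.1).eq_inf_cz inf_le_left hUV.2.2 (inf_comm V U ▸ h2 hx) h8).trans
      ((hH U hUV.1).eq_inf_cz inf_le_left hN.2.2 (h3 hx) h8).symm
    apply hne
    rw [inf_comm V U]
    exact (eq_of_le_of_card (le_inf inf_le_right (h9 ▸ inf_le_right)) hUV.2.2 hVW.2.2).symm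
  refine ⟨h5, ?_, h6⟩
  rcases hH.card_inf hUV.1 hVW.2.1 h5 with h7 | h7 | h7
  · have := Subgroup.card_dvd_of_le h3
    rw [h7, h4] at this; norm_num at this
  · exact (eq_of_le_of_card h3 h4 h7).symm
  · exact absurd h7 h6

theorem Hyp.card_goods (h : Hyp G) (hH : AllHeis G) {U V : Subgroup G} (hN : Near U V) :
    Nat.card nz(U) = 31 ^ 3 * 30 ∧ (goods U).card = 1 := by
  classical
  set k := (goods U).card with hk
  have hk1 : 1 ≤ k := Finset.card_pos.mpr ⟨U ⊓ V, Finset.mem_image_of_mem _ (mem_nears.mpr hN)⟩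
  have hfin : {W : Subgroup G | IsSyl 31 W ⊤}.Finite := Set.toFinite _
  let 𝒞 : Finset (Subgroup G) := (hfin.toFinset.erase U).filter fun W => ¬ Near U W
  have mem𝒞 (W : Subgroup G) : W ∈ 𝒞 ↔ (W ≠ U ∧ IsSyl 31 W ⊤) ∧ ¬ Near U W := by simp [𝒞]
  have c1 : (nears U).card + 𝒞.card + 1 = nz(U).index := by
    have h1 := hN.1.card_eq_relIndex p31
    rw [relIndex_top_right, Nat.card_coe_set_eq, Set.ncard_eq_toFinset_card _ hfin] at h1
    rw [← h1, ← Finset.card_erase_add_one (s := hfin.toFinset) (a := U) (by simp [hN.1]),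
      ← Finset.card_filter_add_card_filter_not (s := hfin.toFinset.erase U) (Near U)]
    congr 3
    ext W
    simp only [mem_nears, Finset.mem_filter, Finset.mem_erase, Set.Finite.mem_toFinset,
      Set.mem_ofPred_eq]
    exact ⟨fun hW => ⟨⟨hW.ne hH, hW.2.1⟩, hW⟩, fun hW => hW.2⟩
  have c2 : 31 ^ 2 ∣ 𝒞.card := by
    have h1 := dvd_card_of_inf_le (p := 31) (k := 2) p31 hN.1 (S := ↑𝒞)
      (fun W hW => ((mem𝒞 W).mp hW).1.2) (fun u hu W hW => ?_) fun W hW => ?_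
    · rwa [Nat.card_eq_card_toFinset, Finset.toFinset_coe] at h1
    · obtain ⟨⟨hW1, hW2⟩, hW3⟩ := (mem𝒞 W).mp hW
      have hu1 : MulAut.conj u • U = U := conj_smul_eq_iff.mpr (le_normalizer hu)
      refine (mem𝒞 _).mpr ⟨⟨fun hc => hW1 ?_, hW2.conj (mem_top _)⟩, fun hc => hW3 ?_⟩
      · rwa [← hu1, smul_left_cancel_iff] at hc
      · have := hc.conj u⁻¹
        nth_rw 1 [← hu1] at this
        rwa [← mul_smul, ← mul_smul, ← map_mul, inv_mul_cancel, map_one, one_smul, one_smul] at this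
    · obtain ⟨⟨hW1, hW2⟩, hW3⟩ := (mem𝒞 W).mp hW
      rw [(hH U hN.1).card]
      rcases hH.card_inf hN.1 hW2 hW1 with h2 | h2 | h2
      · rw [h2]; norm_num
      · rw [h2]; norm_num
      · exact absurd h2 hW3
  have c3 : (31 * k) * (31 * k - 31) ≤ 𝒞.card := by
    have h1 : ((nears U).sigma fun X => (nears X).filter fun W => ¬ X ⊓ W = X ⊓ U).card
        = (31 * k) * (31 * k - 31) := by
      rw [Finset.card_sigma, ← h.card_nears hH U, ← smul_eq_mul, ← Finset.sum_const]
      refine Finset.sum_congr rfl fun X hX => ?_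
      have hX' := mem_nears.mp hX
      have h2 := Finset.card_filter_add_card_filter_not (s := nears X) (fun W => X ⊓ W = X ⊓ U)
      rw [h.card_fiber hH hX'.symm, card_nears_eq hX'.1 hX'.2.1, h.card_nears hH U] at h2
      rw [h.card_nears hH U]
      omega
    rw [← h1]
    refine Finset.card_le_card_of_injOn (fun p => p.2) ?_ ?_
    · rintro ⟨X, W⟩ hp
      simp only [Finset.coe_sigma, Set.mem_sigma_iff, Finset.mem_coe, Finset.mem_filter,
        mem_nears] at hp
      obtain ⟨h2, -, h3⟩ := h.inf_eq_zc hH hp.1 hp.2.1 hp.2.2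
      exact (mem𝒞 W).mpr ⟨⟨h2, hp.2.1.2.1⟩, h3⟩
    · rintro ⟨X, W⟩ hp ⟨X', W'⟩ hp' he
      simp only [Finset.coe_sigma, Set.mem_sigma_iff, Finset.mem_coe, Finset.mem_filter,
        mem_nears] at hp hp' he
      subst he
      obtain ⟨-, h2, -⟩ := h.inf_eq_zc hH hp.1 hp.2.1 hp.2.2
      obtain ⟨-, h3, -⟩ := h.inf_eq_zc hH hp'.1 hp'.2.1 hp'.2.2
      have := h.zc_inj hH hp.1.2.1 hp'.1.2.1 (h3.symm.trans h2)
      rw [this]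
  rw [h.card_nears hH U, ← hk] at c1
  obtain ⟨m, hm, hcN, hidx⟩ := h.normalizer31 hN.1
  obtain ⟨c, hc⟩ := c2
  rw [hc] at c1 c3
  have c4 : k * (k - 1) ≤ c := by
    obtain ⟨j, hj⟩ := Nat.exists_eq_add_of_le hk1
    rw [hj] at c3 ⊢
    rw [show 31 * (1 + j) - 31 = 31 * j by omega] at c3
    rw [show 1 + j - 1 = j by omega]
    nlinarith
  rcases hm with rfl | rfl | rfl
  · refine ⟨hcN, ?_⟩
    have h2 : k ≤ 32 := by
      by_contra hk2
      have : 33 * 32 ≤ k * (k - 1) := Nat.mul_le_mul (by omega) (by omega)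
      omega
    interval_cases k <;> omega
  · have h2 : k ≤ 30 := by
      by_contra hk2
      have : 31 * 30 ≤ k * (k - 1) := Nat.mul_le_mul (by omega) (by omega)
      omega
    interval_cases k <;> omega
  · have h2 : k ≤ 30 := by omega
    interval_cases k <;> omega

theorem Hyp.inf_unique (h : Hyp G) (hH : AllHeis G) {U V W : Subgroup G} (hV : Near U V)
    (hW : Near U W) : U ⊓ V = U ⊓ W := by
  classical
  exact Finset.card_le_one.mp (h.card_goods hH hV).2.le _
    (Finset.mem_image_of_mem _ (mem_nears.mpr hV)) _ (Finset.mem_image_of_mem _ (mem_nears.mpr hW))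

theorem Hyp.inf_ne_zc (h : Hyp G) (hH : AllHeis G) {U V : Subgroup G} (hU : IsSyl 31 U ⊤)
    (hV : IsSyl 31 V ⊤) (hne : V ≠ U) (hc : Nat.card (U ⊓ V : Subgroup G) = 31) :
    U ⊓ V ≠ zc U := by
  intro he
  have h1 : V ⊓ cz(zc U) ≤ U := (hU.mono p31 le_normalizer le_top).le_of_normal p31 le_rfl
    (inf_le_right.trans (h.centralizer_zc_le hU (hH U hU))) (hV.isPGroup.to_le inf_le_left)
  have h2 : V ⊓ cz(U ⊓ V) ≤ U ⊓ V := le_inf (by rw [he]; exact h1) inf_le_left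
  by_cases h3 : U ⊓ V = zc V
  · exact hne (h.zc_inj hH hU hV (h3.symm.trans he))
  · have h4 := Subgroup.card_dvd_of_le h2
    rw [(hH V hV).card_cz_of_card inf_le_right hc h3, hc] at h4
    norm_num at h4

theorem Hyp.near_of_inf (h : Hyp G) (hH : AllHeis G) {U V : Subgroup G} (hU : IsSyl 31 U ⊤)
    (hV : IsSyl 31 V ⊤) (hne : V ≠ U) (hb : U ⊓ V ≠ ⊥) : Near U V := by
  rcases hH.card_inf hU hV hne with hc | hc | hc
  · exact absurd (Subgroup.card_eq_one.mp hc) hb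
  · exfalso
    have h1 := h.inf_ne_zc hH hU hV hne hc
    have h2 := h.inf_ne_zc hH hV hU hne.symm (inf_comm U V ▸ hc)
    rw [inf_comm] at h2
    set A := U ⊓ V with hA
    have hAU : A ≤ U := inf_le_left
    have hAV : A ≤ V := inf_le_right
    have c1 := (hH U hU).card_cz_of_card hAU hc h1
    have c2 := (hH V hV).card_cz_of_card hAV hc h2
    have hne' : ¬ V ⊓ cz(A) ≤ U := fun hle => by
      have := Subgroup.card_dvd_of_le (le_inf hle inf_le_left : V ⊓ cz(A) ≤ A)
      rw [c2, hc] at this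
      norm_num at this
    obtain ⟨T, hST, hT⟩ := exists_isSyl_ge p31 (inf_le_right : U ⊓ cz(A) ≤ cz(A))
      (hU.isPGroup.to_le inf_le_left)
    obtain ⟨T', hTT, hT'⟩ := exists_isSyl_ge p31 (le_top : T ≤ ⊤) hT.isPGroup
    have c3 := Subgroup.card_dvd_of_le hST
    rw [c1] at c3
    rcases card_cases (hH T' hT').card hTT with c4 | c4 | c4 | c4
    · rw [c4] at c3; norm_num at c3
    · rw [c4] at c3; norm_num at c3
    · obtain rfl := eq_of_le_of_card hST c1 c4
      exact hne' ((hT.le_of_normal p31 (h.centralizer_le_of_isSyl hU (hH U hU) hAU hc h1 hT)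
        inf_le_right (hV.isPGroup.to_le inf_le_left)).trans inf_le_left)
    · obtain rfl := eq_of_le_of_card hTT c4 (hH T' hT').card
      have hAT : A ≤ T := (le_inf_cz hAU hc).trans hST
      have hAz : A = zc T := eq_of_le_of_card
        (le_inf hAT (le_centralizer_iff.mp hT.1)) hc (hH T hT').card_zc
      have hTn : cz(A) ≤ nz(T) := hAz ▸ h.centralizer_zc_le hT' (hH T hT')
      have hS' : V ⊓ cz(A) ≤ T := hT.le_of_normal p31 hTn inf_le_right
        (hV.isPGroup.to_le inf_le_left)
      have key (X : Subgroup G) (hX : IsSyl 31 X ⊤) (hXT : X ⊓ cz(A) ≤ T) (hXz : A ≠ zc X)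
          (cX : Nat.card (X ⊓ cz(A) : Subgroup G) = 961) : Near T X ∧ X ⊓ cz(A) = T ⊓ X := by
        have hne : X ≠ T := fun he => hXz (he ▸ hAz)
        have hle : X ⊓ cz(A) ≤ T ⊓ X := le_inf hXT inf_le_left
        have hd := Subgroup.card_dvd_of_le hle
        rw [cX] at hd
        rcases hH.card_inf hT' hX hne with h5 | h5 | h5
        · rw [h5] at hd; norm_num at hd
        · rw [h5] at hd; norm_num at hd
        · exact ⟨h5, eq_of_le_of_card hle cX h5.2.2⟩
      obtain ⟨n1, e1⟩ := key U hU hST h1 c1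
      obtain ⟨n2, e2⟩ := key V hV hS' h2 c2
      refine hne' ?_
      rw [e2, ← h.inf_unique hH n1 n2]
      exact inf_le_right
  · exact hc

theorem Hyp.normalizer_le_nz_inf (h : Hyp G) (hH : AllHeis G) {U V : Subgroup G} (hN : Near U V) :
    nz(U) ≤ nz(U ⊓ V) := fun g hg => by
  have h1 := hN.conj g
  rw [conj_smul_eq_iff.mpr hg] at h1
  rw [← conj_smul_eq_iff, smul_inf, conj_smul_eq_iff.mpr hg, h.inf_unique hH hN h1]

theorem AllHeis.isSyl_nz_iff (hH : AllHeis G) {U V W : Subgroup G} (hN : Near U V) :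
    IsSyl 31 W nz(U ⊓ V) ↔ IsSyl 31 W ⊤ ∧ U ⊓ V ≤ W := by
  have hUN : IsSyl 31 U nz(U ⊓ V) := hN.1.mono p31 (hH.le_nz hN.2.2 hN.1 inf_le_left) le_top
  constructor
  · intro hV
    obtain ⟨g, hg, rfl⟩ := hUN.exists_conj p31 hV
    refine ⟨hN.1.conj (mem_top _), ?_⟩
    rw [← conj_smul_eq_iff.mpr hg]
    exact smul_mono_right _ inf_le_left
  · rintro ⟨hV, hDV⟩
    exact hV.mono p31 (hH.le_nz hN.2.2 hV hDV) le_top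

theorem Hyp.card_nz_inf (h : Hyp G) (hH : AllHeis G) {U V : Subgroup G} (hN : Near U V) :
    Nat.card nz(U ⊓ V) = 31 ^ 3 * 960 := by
  have h1 := (hN.1.mono p31 (hH.le_nz hN.2.2 hN.1 inf_le_left) le_top :
    IsSyl 31 U nz(U ⊓ V)).card_eq_relIndex p31
  simp only [hH.isSyl_nz_iff hN] at h1
  rw [h.card_over hH hN] at h1
  have h2 := card_eq_relIndex_mul nz(U) nz(U ⊓ V)
  rw [inf_eq_left.mpr (h.normalizer_le_nz_inf hH hN), ← h1, (h.card_goods hH hN).1] at h2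
  exact h2

theorem Hyp.inf_conj_eq_bot (h : Hyp G) (hH : AllHeis G) {U V : Subgroup G} (hN : Near U V)
    {g : G} (hg : MulAut.conj g • (U ⊓ V) ≠ U ⊓ V) : U ⊓ nz(MulAut.conj g • (U ⊓ V)) = ⊥ := by
  have hN' := hN.conj g
  rw [smul_inf] at *
  obtain ⟨T, hBT, hT⟩ := exists_isSyl_ge p31
    (inf_le_right : U ⊓ nz(MulAut.conj g • U ⊓ MulAut.conj g • V) ≤ _)
    (hN.1.isPGroup.to_le inf_le_left)
  obtain ⟨hT1, hT2⟩ := (hH.isSyl_nz_iff hN').mp hT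
  have hX : ∃ X, Near T X ∧ T ⊓ X = MulAut.conj g • U ⊓ MulAut.conj g • V := by
    have key (X : Subgroup G) (hX : IsSyl 31 X ⊤) (hne : X ≠ T)
        (hle : MulAut.conj g • U ⊓ MulAut.conj g • V ≤ X) : Near T X := by
      refine h.near_of_inf hH hT1 hX hne fun hb => ?_
      have := hN'.2.2
      have hb' := le_inf hT2 hle
      rw [hb, le_bot_iff] at hb'
      rw [hb'] at this
      simp at this
    by_cases hUT : MulAut.conj g • U = T
    · exact ⟨_, hUT ▸ hN', by rw [hUT]⟩
    · have := key _ hN'.1 hUT inf_le_left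
      exact ⟨_, this, (eq_of_le_of_card (le_inf hT2 inf_le_left) hN'.2.2 this.2.2).symm⟩
  obtain ⟨X, hTX, hTX'⟩ := hX
  by_contra hb
  have hb' : U ⊓ T ≠ ⊥ := fun hb' => hb (le_bot_iff.mp (hb' ▸ le_inf inf_le_left hBT))
  apply hg
  rw [← hTX']
  by_cases hTU : T = U
  · subst hTU
    exact h.inf_unique hH hTX hN
  · have h1 := h.near_of_inf hH hN.1 hT1 hTU hb'
    rw [h.inf_unique hH hTX h1.symm, inf_comm, h.inf_unique hH h1 hN]

theorem ncard_conj (C A : Subgroup G) :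
    Set.ncard {X | ∃ x ∈ C, MulAut.conj x • A = X} = nz(A).relIndex C := by
  letI := conjAction C
  have h1 := MulAction.index_stabilizer C A
  rw [conjAction_stabilizer] at h1
  rw [Subgroup.relIndex, h1]
  congr! 1
  ext V
  exact ⟨fun ⟨x, hx, he⟩ => ⟨⟨x, hx⟩, he⟩, fun ⟨x, he⟩ => ⟨x, x.2, he⟩⟩

theorem Hyp.exists_complement (h : Hyp G) (hH : AllHeis G) {U V : Subgroup G} (hN : Near U V) :
    ∃ K ≤ nz(U ⊓ V), Nat.card K = 960 := by
  have hc := h.card_nz_inf hH hN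
  obtain ⟨g, hg⟩ : ∃ g : G, g ∉ nz(U ⊓ V) := by
    by_contra! hall
    rw [(eq_top_iff' _).mpr hall, card_top, h.card] at hc
    norm_num at hc
  have hg' : MulAut.conj g • (U ⊓ V) ≠ U ⊓ V := fun he => hg (conj_smul_eq_iff.mp he)
  have hb := h.inf_conj_eq_bot hH hN hg'
  set D := U ⊓ V with hD
  set E := MulAut.conj g • D with hE
  refine ⟨nz(E) ⊓ nz(D), inf_le_right, ?_⟩
  have h1 := card_eq_relIndex_mul nz(E) nz(D)
  have h2 := card_eq_relIndex_mul nz(E) U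
  rw [inf_comm, hb, card_bot, mul_one, (hH U hN.1).card] at h2
  have h0 : nz(E).relIndex nz(D) ≠ 0 := fun h0 => by rw [h0, hc] at h1; norm_num at h1
  have h3 : nz(E).relIndex U ≤ nz(E).relIndex nz(D) :=
    relIndex_le_of_le_right (hH.le_nz hN.2.2 hN.1 inf_le_left) h0
  have h4 : nz(E).relIndex nz(D) ≤ 29791 := by
    have h5 := ncard_conj ⊤ D
    rw [relIndex_top_right] at h5
    have h6 := card_eq_index_mul nz(D)
    rw [h.card, hc] at h6
    have h7 : {X | ∃ x ∈ nz(D), MulAut.conj x • E = X} ⊆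
        {X | ∃ x ∈ (⊤ : Subgroup G), MulAut.conj x • D = X} \ {D} := by
      rintro _ ⟨x, hx, rfl⟩
      refine ⟨⟨x * g, mem_top _, by rw [map_mul, mul_smul]⟩, fun he => hg' ?_⟩
      rw [Set.mem_singleton_iff] at he
      exact (smul_left_cancel_iff _).mp (he.trans (conj_smul_eq_iff.mpr hx).symm)
    have h8 := Set.ncard_le_ncard h7 (Set.toFinite _)
    have h9 : D ∈ {X | ∃ x ∈ (⊤ : Subgroup G), MulAut.conj x • D = X} := ⟨1, mem_top _, by simp⟩
    rw [ncard_conj, Set.ncard_sdiff_singleton_of_mem h9, h5] at h8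
    omega
  rw [hc] at h1
  have h5 : nz(E).relIndex nz(D) = 29791 := by omega
  rw [h5] at h1
  omega

end Local31

section SpecialLinear

instance fact_prime_31 : Fact (Nat.Prime 31) := ⟨p31⟩

local notation "SL31" => Matrix.SpecialLinearGroup (Fin 2) (ZMod 31)

theorem det_eq_one (g : SL31) : g 0 0 * g 1 1 - g 0 1 * g 1 0 = 1 := by
  rw [← Matrix.det_fin_two, g.det_coe]

theorem pow_31_of_trace (g : SL31) (h : g 0 0 + g 1 1 = 2) : g ^ 31 = 1 := by
  have h1 := det_eq_one g
  have h2 : ((g : Matrix (Fin 2) (Fin 2) (ZMod 31)) - 1) ^ 2 = 0 := by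
    have e : g 1 1 = 2 - g 0 0 := by rw [← h]; ring
    rw [e] at h1
    ext i j
    fin_cases i <;> fin_cases j <;>
      simp [pow_two, Matrix.mul_apply, Fin.sum_univ_two, e] <;>
      first | ring1 | linear_combination -h1
  have h3 : (g : Matrix (Fin 2) (Fin 2) (ZMod 31)) ^ 31 = 1 := by
    have h4 := add_pow_char_of_commute 31
      (Commute.one_right ((g : Matrix (Fin 2) (Fin 2) (ZMod 31)) - 1))
    rwa [sub_add_cancel, one_pow, pow_eq_zero_of_le (by norm_num) h2, zero_add] at h4
  exact Subtype.ext (by rw [Matrix.SpecialLinearGroup.coe_pow, h3]; rfl)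

theorem sl_ext {g h : SL31} (h00 : g 0 0 = h 0 0) (h01 : g 0 1 = h 0 1) (h10 : g 1 0 = h 1 0)
    (h11 : g 1 1 = h 1 1) : g = h := by
  ext i j
  fin_cases i <;> fin_cases j <;> assumption

theorem sl_mul (g h : SL31) (i j : Fin 2) : (g * h) i j = g i 0 * h 0 j + g i 1 * h 1 j := by
  rw [Matrix.SpecialLinearGroup.coe_mul, Matrix.mul_apply, Fin.sum_univ_two]

theorem exists_traces : ∀ b e : ZMod 31, b ≠ 0 → ∃ t : ZMod 31, t ≠ 0 ∧
    (t ^ 2 + b) * (b * t ^ 2 + (1 + b) ^ 2) ≠ 0 ∧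
    (t ^ 2 + b) * (b * t ^ 2 + (1 + b) ^ 2) ≠ t ^ 2 ∧
    (t ^ 2 + b) * (b * t ^ 2 + (1 + b) ^ 2) ≠ (1 + b) * t ^ 2 ∧
    (t ^ 2 + b) * (b * t ^ 2 + (1 + b) ^ 2) ≠ e * t ^ 2 := by
  decide +kernel

theorem exists_sq_or : ∀ x : ZMod 31, ∃ t, t ^ 2 = x ∨ t ^ 2 = -x := by decide +kernel

theorem exists_shear : ∀ b : ZMod 31, ∃ s : ZMod 31, 18 * s = -b := by decide +kernel

theorem eq_one_of_trace {K : Subgroup SL31} (hK : Nat.card K = 960) {g : SL31} (hg : g ∈ K)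
    (ht : g 0 0 + g 1 1 = 2) : g = 1 := by
  have h1 := pow_natCard_of_mem hg
  rw [hK] at h1
  have h2 : g ^ 961 = 1 := by
    rw [show 961 = 31 * 31 from rfl, pow_mul, pow_31_of_trace g ht, one_pow]
  rwa [pow_succ, h1, one_mul] at h2

theorem eq_of_column {K : Subgroup SL31} (hK : Nat.card K = 960) {g k : SL31} (hg : g ∈ K)
    (hk : k ∈ K) (h0 : g 0 0 = k 0 0) (h1 : g 1 0 = k 1 0) : g = k := by
  have h2 := eq_one_of_trace hK (mul_mem (inv_mem hk) hg) (by
    rw [sl_mul, sl_mul, Matrix.SpecialLinearGroup.SL2_inv_expl]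
    have d1 := det_eq_one g
    have d2 := det_eq_one k
    simp
    rw [h0, h1] at *
    linear_combination d1 + d2)
  exact (inv_mul_eq_one.mp h2).symm

theorem exists_column {K : Subgroup SL31} (hK : Nat.card K = 960) (a c : ZMod 31)
    (hac : ¬ (a = 0 ∧ c = 0)) : ∃ g ∈ K, g 0 0 = a ∧ g 1 0 = c := by
  let f : K → ({0}ᶜ : Set (ZMod 31 × ZMod 31)) := fun g => ⟨((g : SL31) 0 0, (g : SL31) 1 0),
    fun h0 => by
      have := det_eq_one (g : SL31)
      have e := Prod.mk.inj h0
      rw [e.1, e.2] at this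
      simp at this⟩
  have hf : Function.Injective f := fun g k he => by
    have e := Prod.mk.inj (Subtype.mk.inj he)
    exact Subtype.ext (eq_of_column hK g.2 k.2 e.1 e.2)
  have hb := hf.bijective_of_nat_card_le (by
    rw [hK, Nat.card_coe_set_eq, Set.ncard_compl, Nat.card_prod, Nat.card_zmod, Set.ncard_singleton])
  obtain ⟨g, hg⟩ := hb.2 ⟨(a, c), fun h0 => hac (Prod.mk.inj h0)⟩
  have e := Prod.mk.inj (Subtype.mk.inj hg)
  exact ⟨g, g.2, e.1, e.2⟩

/-- The diagonal matrix with entries `t` and `t⁻¹`. -/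
def dg (t : ZMod 31) (ht : t ≠ 0) : SL31 :=
  ⟨!![t, 0; 0, t⁻¹], by simp [Matrix.det_fin_two, ht]⟩

theorem not_card_960_of_diag (K : Subgroup SL31) {d : SL31} (hd : d ∈ K) (hd0 : d 0 0 = 3)
    (hd1 : d 1 0 = 0) (hd2 : d 0 1 = 0) : Nat.card K ≠ 960 := by
  intro hK
  have c0 : (3 : ZMod 31) ≠ 0 := by decide
  have hd3 : d 1 1 = 21 := by
    have hdet := det_eq_one d
    have h2 : (63 : ZMod 31) = 1 := by decide
    rw [hd0, hd1, mul_zero, sub_zero] at hdet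
    linear_combination 21 * hdet - d 1 1 * h2
  have hdg (t : ZMod 31) (ht : t ≠ 0) : dg t ht ∈ K := by
    obtain ⟨g, hg, h0, h1⟩ := exists_column hK t 0 (fun h => ht h.1)
    have h2 := eq_of_column hK (mul_mem hg hd) (mul_mem hd hg)
      (by simp only [sl_mul, hd0, hd1, hd2, h0, h1]; ring)
      (by simp only [sl_mul, hd0, hd1, h0, h1]; ring)
    have h3 : (g * d) 0 1 = (d * g) 0 1 := by rw [h2]
    simp only [sl_mul, hd0, hd2, hd3, h0] at h3
    have c18 : (18 : ZMod 31) ≠ 0 := by decide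
    have h4 : g 0 1 = 0 := (mul_eq_zero.mp (by linear_combination h3 : 18 * g 0 1 = 0)).resolve_left c18
    have hdet := det_eq_one g
    rw [h0, h1, mul_zero, sub_zero] at hdet
    convert hg using 1
    exact sl_ext (by simp [dg, h0]) (by simp [dg, h4]) (by simp [dg, h1])
      (by simp [dg, eq_inv_of_mul_eq_one_right hdet])
  have key (g k : SL31) (hg : g ∈ K) (hk : k ∈ K) (t : ZMod 31) (ht : t ≠ 0) (ha : g 0 0 ≠ 0)
      (hk0 : k 0 0 = 1) (hkt : k 1 0 * t ^ 2 = g 0 0 * g 1 0) : g 0 0 * g 1 1 = k 1 1 := by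
    have hs : g 0 0 / t ≠ 0 := div_ne_zero ha ht
    have := eq_of_column hK hg (mul_mem (mul_mem (hdg _ hs) hk) (hdg t ht))
      (by simp only [sl_mul]; simp [dg, hk0]; field_simp)
      (by simp only [sl_mul]; simp [dg]; field_simp; linear_combination -hkt)
    rw [this]
    simp only [sl_mul]
    simp [dg, hk0]
    field_simp
  obtain ⟨g, hg, hg0, hg1⟩ := exists_column hK 1 1 (by decide)
  obtain ⟨k, hk, hk0, hk1⟩ := exists_column hK 1 (-1) (by decide)
  have hdet := det_eq_one g
  have hg3 : g 1 1 = 1 + g 0 1 := by rw [hg0, hg1] at hdet; linear_combination hdet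
  have hall (x : SL31) (hx : x ∈ K) : x 0 0 * x 1 1 = 0 ∨ x 0 0 * x 1 1 = 1 ∨
      x 0 0 * x 1 1 = 1 + g 0 1 ∨ x 0 0 * x 1 1 = k 1 1 := by
    by_cases ha : x 0 0 = 0
    · simp [ha]
    by_cases hc : x 1 0 = 0
    · have := det_eq_one x
      rw [hc, mul_zero, sub_zero] at this
      simp [this]
    obtain ⟨t, ht⟩ := exists_sq_or (x 0 0 * x 1 0)
    have ht0 : t ≠ 0 := by rintro rfl; simp [ha, hc] at ht
    obtain ht | ht := ht
    · exact Or.inr (Or.inr (Or.inl (hg3 ▸ key x g hx hg t ht0 ha hg0 (by rw [hg1, ht, one_mul]))))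
    · exact Or.inr (Or.inr (Or.inr (key x k hx hk t ht0 ha hk0 (by rw [hk1, ht]; ring))))
  have hb : g 0 1 ≠ 0 := fun hb => by
    have := eq_one_of_trace hK hg (by rw [hg3, hg0, hb]; norm_num)
    rw [this] at hg1
    simp at hg1
  obtain ⟨t, ht, t0, t1, t2, t3⟩ := exists_traces (g 0 1) (k 1 1) hb
  have e : (g * dg t ht * g) 0 0 * (g * dg t ht * g) 1 1 * t ^ 2 =
      (t ^ 2 + g 0 1) * (g 0 1 * t ^ 2 + (1 + g 0 1) ^ 2) := by
    simp only [sl_mul]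
    simp [dg, hg0, hg1, hg3]
    field_simp
  rw [← e] at t0 t1 t2 t3
  obtain h | h | h | h := hall _ (mul_mem (mul_mem hg (hdg t ht)) hg) <;> rw [h] at t0 t1 t2 t3 <;>
    simp at t0 t1 t2 t3

theorem not_card_960 (K : Subgroup SL31) : Nat.card K ≠ 960 := by
  intro hK
  obtain ⟨g, hg, h0, h1⟩ := exists_column hK 3 0 (by decide)
  obtain ⟨s, hs⟩ := exists_shear (g 0 1)
  let x : SL31 := ⟨!![1, s; 0, 1], by simp [Matrix.det_fin_two]⟩
  let x' : SL31 := ⟨!![1, -s; 0, 1], by simp [Matrix.det_fin_two]⟩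
  have hx : x⁻¹ = x' := inv_eq_of_mul_eq_one_right (sl_ext (by simp only [sl_mul]; simp [x, x'])
    (by simp only [sl_mul]; simp [x, x']) (by simp only [sl_mul]; simp [x, x'])
    (by simp only [sl_mul]; simp [x, x']))
  have hdet := det_eq_one g
  rw [h0, h1, mul_zero, sub_zero] at hdet
  have e : g 1 1 = 21 := by
    have h2 : (63 : ZMod 31) = 1 := by decide
    have h3 : (31 : ZMod 31) = 0 := by decide
    linear_combination 21 * hdet - g 1 1 * h2
  refine not_card_960_of_diag (MulAut.conj x • K)
    (Subgroup.smul_mem_pointwise_smul _ (MulAut.conj x) _ hg) ?_ ?_ ?_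
    (by rw [card_conj_smul, hK]) <;>
  · rw [MulAut.smul_def, MulAut.conj_apply]
    simp only [sl_mul, hx]
    simp [x, x', h0, h1, e]
    try linear_combination hs

end SpecialLinear

/-- An elementary abelian group of order `31 ^ 2` is a plane over `ZMod 31`. -/
theorem exists_coord {V : Type*} [Group V] [Finite V] (hc : ∀ a b : V, a * b = b * a)
    (hexp : ∀ a : V, a ^ 31 = 1) (hcard : Nat.card V = 961) :
    ∃ (E : V ≃ (Fin 2 → ZMod 31)) (ρ : MulAut V →* Matrix (Fin 2) (Fin 2) (ZMod 31)),
      (∀ x y, E (x * y) = E x + E y) ∧ ∀ φ x, E (φ x) = (ρ φ).mulVec (E x) := by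
  letI : CommGroup V := { ‹Group V› with mul_comm := hc }
  letI : Module (ZMod 31) (Additive V) := AddCommGroup.zmodModule hexp
  letI := Fintype.ofFinite (Additive V)
  have hf : Module.finrank (ZMod 31) (Additive V) = 2 := by
    have h1 := Module.card_eq_pow_finrank (K := ZMod 31) (V := Additive V)
    rw [← Nat.card_eq_fintype_card, Nat.card_congr Additive.toMul, hcard, ZMod.card,
      show 961 = 31 ^ 2 from rfl] at h1
    exact (Nat.pow_right_injective (by norm_num) h1).symm
  let b := Module.finBasisOfFinrankEq (ZMod 31) (Additive V) hf
  let L (φ : MulAut V) : Additive V →ₗ[ZMod 31] Additive V :=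
    (MonoidHom.toAdditive φ.toMonoidHom).toZModLinearMap 31
  refine ⟨Additive.ofMul.trans b.equivFun.toEquiv,
    { toFun := fun φ => LinearMap.toMatrix b b (L φ)
      map_one' := LinearMap.toMatrix_one b
      map_mul' := fun φ ψ => LinearMap.toMatrix_mul b (L φ) (L ψ) }, fun x y => ?_, fun φ x => ?_⟩
  · exact map_add b.equivFun (Additive.ofMul x) (Additive.ofMul y)
  · exact (LinearMap.toMatrix_mulVec_repr b b (L φ) (Additive.ofMul x)).symm

section Plane

variable {G : Type*} [Group G] [Finite G]

theorem ncard_conj_elem (C : Subgroup G) (z : G) :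
    Set.ncard {x | ∃ c ∈ C, c * z * c⁻¹ = x} = (centralizer {z}).relIndex C := by
  letI : MulAction C G := MulAction.compHom G ((MulAut.conj (G := G)).comp C.subtype)
  have h1 := MulAction.index_stabilizer C z
  have h2 : MulAction.stabilizer C z = (centralizer {z}).subgroupOf C := by
    ext c
    rw [MulAction.mem_stabilizer_iff, mem_subgroupOf, mem_centralizer_singleton_iff]
    exact mul_inv_eq_iff_eq_mul
  rw [Subgroup.relIndex, ← h2, h1]
  congr! 1
  ext V
  exact ⟨fun ⟨x, hx, he⟩ => ⟨⟨x, hx⟩, he⟩, fun ⟨x, he⟩ => ⟨x, x.2, he⟩⟩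

variable {U V : Subgroup G}

theorem Hyp.zc_ne (h : Hyp G) (hH : AllHeis G) (hN : Near U V) : zc V ≠ zc U := fun he =>
  hN.ne hH (h.zc_inj hH hN.1 hN.2.1 he)

theorem Hyp.inf_mem_mul (h : Hyp G) (hH : AllHeis G) (hN : Near U V) {w : G} (hw : w ∈ U ⊓ V) :
    ∃ c ∈ zc U, ∃ c' ∈ zc V, c * c' = w := by
  have hU := hH U hN.1
  have hV := hH V hN.2.1
  have hZ : zc U ≤ U ⊓ V := hU.zc_le_of_card inf_le_left hN.2.2
  have hZ' : zc V ≤ U ⊓ V := hV.zc_le_of_card inf_le_right hN.2.2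
  have h1 : zc U ⊔ zc V = U ⊓ V := by
    have hle : zc U ⊔ zc V ≤ U ⊓ V := sup_le hZ hZ'
    have h31 : Nat.card (zc U ⊔ zc V : Subgroup G) ≠ 31 := fun hc => h.zc_ne hH hN
      ((eq_of_le_of_card le_sup_right hV.card_zc hc).trans
        (eq_of_le_of_card le_sup_left hU.card_zc hc).symm)
    have h2 := Subgroup.card_dvd_of_le (le_sup_left : zc U ≤ zc U ⊔ zc V)
    have h3 := Subgroup.card_le_of_le hle
    rw [hU.card_zc] at h2
    rw [hN.2.2] at h3
    refine eq_of_le_of_card hle ?_ hN.2.2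
    rcases card_cases hU.card (hle.trans inf_le_left) with hc | hc | hc | hc <;> rw [hc] at h2 h3 <;>
      first | exact hc | exact absurd hc h31 | omega
  rw [← h1, ← SetLike.mem_coe, sup_comm, coe_mul_of_left_le_normalizer_right _ _
    ((hZ'.trans inf_le_left).trans (hU.le_nz (zc_le U) le_rfl))] at hw
  obtain ⟨c', hc', c, hc, rfl⟩ := Set.mem_mul.mp hw
  exact ⟨c, hc, c', hc', (mem_centralizer_iff.mp hc.2 c' (hZ' hc').1).symm⟩

theorem zc_disj (hne : zc V ≠ zc U) (hU : Heis U) (hV : Heis V) {c : G} (hc : c ∈ zc U)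
    (hc' : c ∈ zc V) : c = 1 := by
  have := inf_eq_bot_of_card hU.card_zc hV.card_zc hne.symm
  exact mem_bot.mp (this ▸ ⟨hc, hc'⟩)

/-- The subgroup generated by `U` and `V` is transitive on the nonidentity elements of `U ⊓ V`. -/
theorem Hyp.conj_inf (h : Hyp G) (hH : AllHeis G) (hN : Near U V) {z w : G} (hz : z ∈ zc U)
    (hz1 : z ≠ 1) (hw : w ∈ U ⊓ V) (hw1 : w ≠ 1) : ∃ g ∈ U ⊔ V, g * w * g⁻¹ = z := by
  have hU := hH U hN.1
  have hV := hH V hN.2.1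
  have hd {c : G} (hc : c ∈ zc U) (hc' : c ∈ zc V) : c = 1 := zc_disj (h.zc_ne hH hN) hU hV hc hc'
  have hZ' : zc V ≤ U ⊓ V := hV.zc_le_of_card inf_le_right hN.2.2
  have hZ : zc U ≤ U ⊓ V := hU.zc_le_of_card inf_le_left hN.2.2
  have hlU : U ≤ U ⊔ V := le_sup_left
  have hlV : V ≤ U ⊔ V := le_sup_right
  have key (w : G) (hw : w ∈ U ⊓ V) (hwz : w ∉ zc U) : ∃ g ∈ U ⊔ V, g * w * g⁻¹ = z := by
    obtain ⟨c, hc, c', hc', rfl⟩ := h.inf_mem_mul hH hN hw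
    have h1 : c' ∉ zc U := fun hcu => hwz (mul_mem hc hcu)
    obtain ⟨u, hu, hue⟩ := hU.exists_conj_eq hw.1 hwz (mul_mem hz (inv_mem hc))
    obtain ⟨v, hv, hve⟩ := hV.exists_conj_eq (w := z * c') (mul_mem (hZ hz).2 (hZ' hc').2)
      (fun hcv => hz1 (hd hz ((mul_mem_cancel_right hc').mp hcv))) (inv_mem hc')
    refine ⟨v * u, mul_mem (hlV hv) (hlU hu), ?_⟩
    calc v * u * (c * c') * (v * u)⁻¹ = v * (u * (c * c') * u⁻¹) * v⁻¹ := by group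
      _ = v * (z * c') * v⁻¹ := by rw [hue]; group
      _ = z := by
        rw [hve, mem_centralizer_iff.mp hz.2 c' (hZ' hc').1 |>.symm, inv_mul_cancel_left]
  by_cases hwz : w ∈ zc U
  · obtain ⟨⟨z', hz'⟩, hz1'⟩ := (zc V).ne_bot_iff_exists_ne_one.mp hV.zc_ne_bot
    obtain ⟨v, hv, hve⟩ := hV.exists_conj_eq hw.2 (fun hcv => hw1 (hd hwz hcv)) hz'
    obtain ⟨g, hg, hge⟩ := key (z' * w) (mul_mem (hZ' hz') hw) fun hcu =>
      hz1' (Subtype.ext (hd ((mul_mem_cancel_right hwz).mp hcu) hz'))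
    refine ⟨g * v, mul_mem hg (hlV hv), ?_⟩
    calc g * v * w * (g * v)⁻¹ = g * (v * w * v⁻¹) * g⁻¹ := by group
      _ = z := by rw [hve, hge]
  · exact key w hw hwz

theorem Hyp.centralizer_inf (h : Hyp G) (hH : AllHeis G) (hN : Near U V) {z : G} (hz : z ∈ zc U)
    (hz1 : z ≠ 1) : centralizer {z} ⊓ nz(U ⊓ V) = U := by
  have hU := hH U hN.1
  have hDU := hH.le_nz hN.2.2 hN.1 inf_le_left
  have hDV := hH.le_nz hN.2.2 hN.2.1 inf_le_right
  have hZ : zc U ≤ U ⊓ V := hU.zc_le_of_card inf_le_left hN.2.2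
  have hle : U ≤ centralizer {z} ⊓ nz(U ⊓ V) := le_inf (fun u hu =>
    mem_centralizer_singleton_iff.mpr (mem_centralizer_iff.mp hz.2 u hu)) hDU
  have h1 := card_eq_relIndex_mul (centralizer {z}) nz(U ⊓ V)
  have h2 : Set.ncard (((U ⊓ V : Subgroup G) : Set G) \ {1}) ≤
      Set.ncard {x | ∃ c ∈ nz(U ⊓ V), c * z * c⁻¹ = x} := by
    refine Set.ncard_le_ncard (fun w hw => ?_) (Set.toFinite _)
    obtain ⟨g, hg, hge⟩ := h.conj_inf hH hN hz hz1 hw.1 hw.2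
    exact ⟨g⁻¹, inv_mem (sup_le hDU hDV hg), by rw [← hge]; group⟩
  rw [ncard_conj_elem, Set.ncard_sdiff_singleton_of_mem (one_mem _), ← Nat.card_coe_set_eq] at h2
  erw [hN.2.2] at h2
  rw [h.card_nz_inf hH hN] at h1
  refine (Subgroup.eq_of_le_of_card_ge hle ?_).symm
  rw [hU.card]
  by_contra! hlt
  have := Nat.mul_le_mul h2 (Nat.succ_le_of_lt hlt)
  rw [← h1] at this
  norm_num at this

theorem Hyp.nz_inf_le (h : Hyp G) (hH : AllHeis G) (hN : Near U V) : nz(U ⊓ V) ≤ U ⊔ V := by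
  intro n hn
  have hU := hH U hN.1
  have hDU := hH.le_nz hN.2.2 hN.1 inf_le_left
  have hDV := hH.le_nz hN.2.2 hN.2.1 inf_le_right
  have hZ : zc U ≤ U ⊓ V := hU.zc_le_of_card inf_le_left hN.2.2
  obtain ⟨z, hz1⟩ := (zc U).ne_bot_iff_exists_ne_one.mp hU.zc_ne_bot
  have hz1' : (z : G) ≠ 1 := fun he => hz1 (Subtype.ext he)
  obtain ⟨g, hg, hge⟩ := h.conj_inf hH hN z.2 hz1'
    ((mem_normalizer_iff.mp hn z).mp (hZ z.2)) (by simpa using hz1)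
  have h1 : g * n ∈ centralizer {(z : G)} ⊓ nz(U ⊓ V) := by
    refine ⟨mem_centralizer_singleton_iff.mpr ?_, mul_mem (sup_le hDU hDV hg) hn⟩
    refine mul_inv_eq_iff_eq_mul.mp ?_
    simpa [mul_assoc] using hge
  rw [h.centralizer_inf hH hN z.2 hz1'] at h1
  exact (mul_mem_cancel_left hg).mp ((le_sup_left : U ≤ U ⊔ V) h1)

theorem pow_char_zmod (x : ZMod 31) : x ^ 31 ^ 3 = x := by
  have h := ZMod.pow_card x
  rw [show 31 ^ 3 = 31 * 31 * 31 from rfl, pow_mul, pow_mul, h, h, h]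

theorem Hyp.not_near (h : Hyp G) (hH : AllHeis G) : ¬ Near U V := by
  intro hN
  have hU := hH U hN.1
  have hV := hH V hN.2.1
  have hDU := hH.le_nz hN.2.2 hN.1 inf_le_left
  have hDV := hH.le_nz hN.2.2 hN.2.1 inf_le_right
  have hZ : zc U ≤ U ⊓ V := hU.zc_le_of_card inf_le_left hN.2.2
  obtain ⟨K, hKN, hK⟩ := h.exists_complement hH hN
  have hcomm : ∀ a b : (U ⊓ V : Subgroup G), a * b = b * a := by
    haveI : IsMulCommutative (U ⊓ V : Subgroup G) :=
      IsPGroup.isMulCommutative_of_card_eq_prime_sq (p := 31) hN.2.2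
    exact mul_comm'
  obtain ⟨E, ρ, -, hρ⟩ := exists_coord (V := (U ⊓ V : Subgroup G)) hcomm (fun ⟨w, hw⟩ => by
    obtain ⟨c, hc, c', hc', rfl⟩ := h.inf_mem_mul hH hN hw
    have h1 := pow_natCard_of_mem hc
    have h2 := pow_natCard_of_mem hc'
    rw [hU.card_zc] at h1
    rw [hV.card_zc] at h2
    have h3 : Commute c c' := (mem_centralizer_iff.mp hc.2 c'
      (hV.zc_le_of_card inf_le_right hN.2.2 hc').1).symm
    exact Subtype.ext (by rw [SubgroupClass.coe_pow, h3.mul_pow, h1, h2, one_mul]; rfl)) hN.2.2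
  let θ := (U ⊓ V).normalizerMonoidHom
  let δ : nz(U ⊓ V) →* ZMod 31 := Matrix.detMonoidHom.comp (ρ.comp θ)
  have hδ : (δ.toHomUnits.ker).map (nz(U ⊓ V)).subtype = nz(U ⊓ V) := by
    refine le_antisymm (map_subtype_le _) ((h.nz_inf_le hH hN).trans ?_)
    have key (W : Subgroup G) (hW : Heis W) (hWN : W ≤ nz(U ⊓ V)) :
        W ≤ (δ.toHomUnits.ker).map (nz(U ⊓ V)).subtype := fun w hw => by
      refine ⟨⟨w, hWN hw⟩, ?_, rfl⟩
      have h1 := pow_natCard_of_mem hw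
      rw [hW.card] at h1
      rw [SetLike.mem_coe, MonoidHom.mem_ker, Units.ext_iff]
      have h2 : δ ⟨w, hWN hw⟩ ^ 31 ^ 3 = 1 := by
        rw [← map_pow, ← map_one δ]
        exact congrArg δ (Subtype.ext h1)
      rwa [pow_char_zmod] at h2
    exact sup_le (key U hU hDU) (key V hV hDV)
  have hδ1 (n : nz(U ⊓ V)) : (ρ (θ n)).det = 1 := by
    have hn : (n : G) ∈ (δ.toHomUnits.ker).map (nz(U ⊓ V)).subtype := by
      rw [hδ]
      exact n.2
    obtain ⟨n', hn', he⟩ := hn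
    rw [← Subtype.ext he]
    exact congrArg Units.val (MonoidHom.mem_ker.mp hn')
  let σ : K →* Matrix.SpecialLinearGroup (Fin 2) (ZMod 31) :=
    { toFun := fun k => ⟨ρ (θ (inclusion hKN k)), hδ1 _⟩
      map_one' := Subtype.ext (by simp only [map_one]; rfl)
      map_mul' := fun a b => Subtype.ext (by simp only [map_mul]; rfl) }
  obtain ⟨z, hz1⟩ := (zc U).ne_bot_iff_exists_ne_one.mp hU.zc_ne_bot
  have hσ : Function.Injective σ := by
    rw [injective_iff_map_eq_one]
    intro k hk
    have h1 : ρ (θ (inclusion hKN k)) = 1 := congrArg Subtype.val hk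
    have h2 : θ (inclusion hKN k) ⟨z, hZ z.2⟩ = ⟨z, hZ z.2⟩ :=
      E.injective (by rw [hρ, h1, Matrix.one_mulVec])
    have h3 : (k : G) * z * (k : G)⁻¹ = z := congrArg Subtype.val h2
    have h4 : (k : G) ∈ centralizer {(z : G)} ⊓ nz(U ⊓ V) :=
      ⟨mem_centralizer_singleton_iff.mpr (mul_inv_eq_iff_eq_mul.mp h3), hKN k.2⟩
    rw [h.centralizer_inf hH hN z.2 fun he => hz1 (Subtype.ext he)] at h4
    have h5 := (Subgroup.disjoint_of_coprime_natCard (H := K) (K := U)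
      (by rw [hK, hU.card]; norm_num)).eq_bot
    exact Subtype.ext (mem_bot.mp (h5 ▸ ⟨k.2, h4⟩))
  refine not_card_960 σ.range ?_
  rw [← hK]
  exact (Nat.card_congr (MonoidHom.ofInjective hσ).toEquiv).symm

/-- Sylow `31`-subgroups intersect trivially. -/
theorem Hyp.ti (h : Hyp G) (hU : IsSyl 31 U ⊤) (hV : IsSyl 31 V ⊤) (hne : V ≠ U) : U ⊓ V = ⊥ := by
  by_cases hab : ∀ a ∈ U, ∀ b ∈ U, a * b = b * a
  · exact h.ti_of_comm hU hab hV hne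
  · have hHU : Heis U := ⟨h.card_syl31 hU, hab⟩
    have hH : AllHeis G := fun W hW => by
      obtain ⟨g, -, rfl⟩ := hU.exists_conj p31 hW
      exact hHU.conj g
    by_contra hb
    obtain ⟨W, hW⟩ := h.exists_near hH hU hV hne hb
    exact h.not_near hH hW

end Plane

section TwoTransitive

variable {G : Type*} [Group G] [Finite G] {p q r : Sylow 31 G} {g u : G}

theorem isSyl_sylow (p : Sylow 31 G) : IsSyl 31 p.1 ⊤ := by
  obtain ⟨A, hA⟩ := exists_isSyl p31 (⊤ : Subgroup G)
  obtain ⟨P, hP⟩ := hA.exists_sylow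
  refine ⟨le_top, ?_⟩
  rw [Sylow.card_eq_multiplicity, Subgroup.card_top]

theorem Hyp.card_sylow (h : Hyp G) (p : Sylow 31 G) : Nat.card p.1 = 29791 := by
  rw [h.card_syl31 (isSyl_sylow p)]; norm_num

theorem Hyp.inf_eq_bot (h : Hyp G) (hpq : p ≠ q) : p.1 ⊓ q.1 = ⊥ :=
  h.ti (isSyl_sylow p) (isSyl_sylow q) fun e => hpq (Sylow.ext e.symm)

theorem smul_of_mem (hu : u ∈ p.1) : u • p = p :=
  Sylow.smul_eq_iff_mem_normalizer.mpr (le_normalizer hu)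

theorem mem_sylow_of_smul_eq (hg : g ^ 31 ^ 3 = 1) (hp : g • p = p) : g ∈ p.1 := by
  have hn : g ∈ nz(p.1) := Sylow.smul_eq_iff_mem_normalizer.mp hp
  have hs := (isSyl_sylow p).mono p31 le_normalizer le_top
  refine hs.le_of_normal p31 le_rfl (zpowers_le.mpr hn) (B := zpowers g) ?_ (mem_zpowers g)
  refine IsPGroup.of_card (n := (Nat.dvd_prime_pow p31).mp (orderOf_dvd_of_pow_eq_one hg) |>.choose) ?_
  rw [Nat.card_zpowers]
  exact ((Nat.dvd_prime_pow p31).mp (orderOf_dvd_of_pow_eq_one hg)).choose_spec.2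

theorem Hyp.pow_mem (h : Hyp G) (hu : u ∈ p.1) : u ^ 31 ^ 3 = 1 := by
  have := pow_natCard_of_mem hu
  rwa [h.card_sylow] at this

/-- The Sylow subgroup at `p` acts semiregularly on the other points. -/
theorem Hyp.eq_one_of_fix (h : Hyp G) (hpq : p ≠ q) (hu : u ∈ p.1) (hf : u • q = q) : u = 1 := by
  have := mem_sylow_of_smul_eq (h.pow_mem hu) hf
  rw [← Subgroup.mem_bot, ← h.inf_eq_bot hpq]
  exact ⟨hu, this⟩

theorem Hyp.card_points (h : Hyp G) : Nat.card (Sylow 31 G) = 29792 := by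
  obtain ⟨p⟩ : Nonempty (Sylow 31 G) := inferInstance
  have hs := isSyl_sylow p
  have h1 := hs.relIndex_modEq_of_ti p31 fun u hu ho g _ hug => by
    by_contra hne
    have := h.ti hs (hs.conj (mem_top g)) hne
    have hu1 : u ∈ (⊥ : Subgroup G) := this ▸ ⟨hu, hug⟩
    rw [Subgroup.mem_bot.mp hu1, orderOf_one] at ho
    omega
  rw [relIndex_top_right, h.card_sylow] at h1
  obtain ⟨m, hm, -, h3⟩ := h.normalizer31 hs
  have := Sylow.card_eq_index_normalizer p
  rw [this]
  unfold Nat.ModEq at h1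
  change nz(p.1).index = _
  rcases hm with rfl | rfl | rfl <;> omega

theorem Hyp.exists_smul_eq (h : Hyp G) (hq : p ≠ q) (hr : p ≠ r) : ∃ u ∈ p.1, u • q = r := by
  let f : p.1 → ({p}ᶜ : Set (Sylow 31 G)) := fun u => ⟨(u : G) • q, fun e => hq (by
    have e' : (u : G) • q = (u : G) • p := e.trans (smul_of_mem u.2).symm
    exact ((smul_left_cancel_iff (u : G)).mp e').symm)⟩
  have hinj : Function.Injective f := fun a b hab => by
    have e : (a : G) • q = (b : G) • q := congrArg Subtype.val hab
    have := h.eq_one_of_fix hq (p.1.mul_mem (p.1.inv_mem b.2) a.2)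
      (by rw [mul_smul, e, inv_smul_smul])
    exact Subtype.ext (inv_mul_eq_one.mp this).symm
  have hcard : Nat.card p.1 = Nat.card ({p}ᶜ : Set (Sylow 31 G)) := by
    have := Set.ncard_add_ncard_compl ({p} : Set (Sylow 31 G))
    rw [Set.ncard_singleton, h.card_points] at this
    rw [h.card_sylow, Nat.card_coe_set_eq]
    omega
  obtain ⟨u, hu⟩ := ((Nat.bijective_iff_injective_and_card f).mpr ⟨hinj, hcard⟩).2 ⟨r, Ne.symm hr⟩
  exact ⟨u, u.2, congrArg Subtype.val hu⟩

/-- The pointwise stabilizer of two points. -/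
def Hs (p q : Sylow 31 G) : Subgroup G := MulAction.stabilizer G p ⊓ MulAction.stabilizer G q

theorem mem_Hs : g ∈ Hs p q ↔ g • p = p ∧ g • q = q := Iff.rfl

theorem Hs_comm (p q : Sylow 31 G) : Hs p q = Hs q p := inf_comm _ _

theorem smul_mem_Hs {a : G} (ha : a ∈ Hs p q) (g : G) : g * a * g⁻¹ ∈ Hs (g • p) (g • q) := by
  obtain ⟨h1, h2⟩ := mem_Hs.mp ha
  exact mem_Hs.mpr ⟨by simp [mul_smul, h1], by simp [mul_smul, h2]⟩

theorem Hyp.exists_pair (h : Hyp G) {p' q' : Sylow 31 G} (hpq : p ≠ q) (hpq' : p' ≠ q') :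
    ∃ g : G, g • p = p' ∧ g • q = q' := by
  obtain ⟨a, ha⟩ := MulAction.exists_smul_eq G p p'
  have hne : p' ≠ a • q := fun e => hpq (by rw [← ha] at e; exact smul_left_cancel _ e)
  obtain ⟨u, hu, e⟩ := h.exists_smul_eq hne hpq'
  exact ⟨u * a, by rw [mul_smul, ha, smul_of_mem hu], by rw [mul_smul, e]⟩

theorem Hyp.exists_decomp (h : Hyp G) (hpq : p ≠ q) (hg : g • p = p) :
    ∃ u ∈ p.1, u⁻¹ * g ∈ Hs p q := by
  obtain ⟨u, hu, e⟩ := h.exists_smul_eq hpq (r := g • q) fun e => hpq (by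
    rw [← hg] at e; exact smul_left_cancel _ e)
  refine ⟨u, hu, mem_Hs.mpr ⟨?_, ?_⟩⟩
  · rw [mul_smul, hg, inv_smul_eq_iff, smul_of_mem hu]
  · rw [mul_smul, ← e, inv_smul_smul]

theorem Hyp.card_stabilizer (h : Hyp G) (p : Sylow 31 G) :
    Nat.card (MulAction.stabilizer G p) = 29791 * 960 := by
  have h1 := MulAction.index_stabilizer G p
  rw [MulAction.orbit_eq_univ, Set.ncard_univ, h.card_points] at h1
  have := card_eq_index_mul (MulAction.stabilizer G p)
  rw [h1, h.card] at this
  omega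

theorem Hyp.card_Hs (h : Hyp G) (hpq : p ≠ q) : Nat.card (Hs p q) = 960 := by
  have h1 := card_eq_relIndex_mul (MulAction.stabilizer G q) (MulAction.stabilizer G p)
  have h2 : (MulAction.stabilizer G q).relIndex (MulAction.stabilizer G p) = 29791 := by
    rw [Subgroup.relIndex, show (MulAction.stabilizer G q).subgroupOf (MulAction.stabilizer G p)
      = MulAction.stabilizer (MulAction.stabilizer G p) q from rfl, MulAction.index_stabilizer,
      show MulAction.orbit (MulAction.stabilizer G p) q = {p}ᶜ from ?_]
    · have := Set.ncard_add_ncard_compl ({p} : Set (Sylow 31 G))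
      rw [Set.ncard_singleton, h.card_points] at this
      omega
    · ext r
      constructor
      · rintro ⟨g, rfl⟩ e
        have e' : (g : G) • q = (g : G) • p := Eq.trans e g.2.symm
        exact hpq (smul_left_cancel _ e').symm
      · intro hr
        obtain ⟨u, hu, e⟩ := h.exists_smul_eq hpq (Ne.symm hr)
        exact ⟨⟨u, smul_of_mem hu⟩, e⟩
  rw [h2, h.card_stabilizer, inf_comm] at h1
  change _ = 29791 * Nat.card (Hs p q) at h1
  omega

theorem smul_mem_sylow (hg : g • p = p) (hu : u ∈ p.1) : g * u * g⁻¹ ∈ p.1 :=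
  (mem_normalizer_iff.mp (Sylow.smul_eq_iff_mem_normalizer.mp hg) u).mp hu

theorem mem_normalizer_sylow (hg : g ∈ Hs p q) : g ∈ nz(p.1) :=
  Sylow.smul_eq_iff_mem_normalizer.mp hg.1

/-- An element of a two-point stabilizer fixes `u • q` iff it commutes with `u`. -/
theorem Hyp.fix_iff (h : Hyp G) (hpq : p ≠ q) (hg : g ∈ Hs p q) (hu : u ∈ p.1) :
    g • u • q = u • q ↔ g * u = u * g := by
  constructor
  · intro e
    have h2 := h.eq_one_of_fix hpq (p.1.mul_mem (p.1.inv_mem hu) (smul_mem_sylow hg.1 hu)) (by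
      have : g⁻¹ • q = q := by rw [inv_smul_eq_iff]; exact hg.2.symm
      rw [mul_smul, mul_smul, mul_smul, this, e, inv_smul_smul])
    rw [inv_mul_eq_one] at h2
    rw [eq_mul_inv_iff_mul_eq] at h2
    exact h2.symm
  · intro e
    rw [← mul_smul, e, mul_smul, show g • q = q from hg.2]

theorem Hyp.adj_3_31 (h : Hyp G) : adjN G 3 31 = 0 := h.graph.2.2.2.2.2.2.2.2.2.1

theorem Hyp.adj_5_31 (h : Hyp G) : adjN G 5 31 = 0 := h.graph.2.2.2.2.2.2.2.2.2.2.2.2.1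

theorem Hyp.faithful (h : Hyp G) (hg : ∀ r : Sylow 31 G, g • r = r) : g = 1 := by
  obtain ⟨p⟩ : Nonempty (Sylow 31 G) := inferInstance
  obtain ⟨M, hM⟩ : ∃ M : Subgroup G, M = (MulAction.toPermHom G (Sylow 31 G)).ker := ⟨_, rfl⟩
  have hmem : ∀ x, x ∈ M ↔ ∀ r : Sylow 31 G, x • r = r := fun x => by
    rw [hM, MonoidHom.mem_ker]
    exact ⟨fun e r => congrFun (congrArg DFunLike.coe e) r, fun e => Equiv.ext e⟩
  have hMn : M.Normal := hM ▸ inferInstance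
  obtain ⟨q, hq⟩ : ∃ q : Sylow 31 G, p ≠ q := by
    by_contra! hc
    haveI : Subsingleton (Sylow 31 G) := ⟨fun a b => (hc a).symm.trans (hc b)⟩
    have := Finite.card_le_one_iff_subsingleton.mpr this
    rw [h.card_points] at this
    omega
  -- `M` centralizes the Sylow subgroup at `p`
  have hcomm : ∀ x ∈ M, ∀ u ∈ p.1, x * u = u * x := fun x hx u hu =>
    (h.fix_iff hq (mem_Hs.mpr ⟨(hmem x).mp hx p, (hmem x).mp hx q⟩) hu).mp ((hmem x).mp hx _)
  have hle : M ≤ Hs p q := fun x hx => mem_Hs.mpr ⟨(hmem x).mp hx p, (hmem x).mp hx q⟩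
  have hd : Nat.card M ∣ 960 := h.card_Hs hq ▸ card_dvd_of_le hle
  obtain ⟨z, hz, ho⟩ := exists_mem_orderOf p31 (C := p.1) (by rw [h.card_sylow]; norm_num)
  have hMz : M ≤ centralizer {z} := fun x hx => mem_centralizer_singleton_iff.mpr
    (hcomm x hx z hz)
  have h3 : ¬ 3 ∣ Nat.card M := not_dvd_centralizer p3 ho hMz
    (by rw [adjN_comm]; exact h.adj_3_31)
  have h5 : ¬ 5 ∣ Nat.card M := not_dvd_centralizer p5 ho hMz
    (by rw [adjN_comm]; exact h.adj_5_31)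
  have hM2 : Nat.card M ∣ 2 ^ 6 := by
    have := strip p3 hd h3 1 320 (by norm_num)
    exact strip p5 this h5 1 64 (by norm_num)
  by_contra hne
  obtain ⟨k, hk, hkM⟩ := (Nat.dvd_prime_pow p2).mp hM2
  -- an element of order 19 centralizes `M`
  obtain ⟨x, hx, -⟩ := h.syl19
  have hcen := centralizes_of_normalizes p19 p2 (A := M) (g := x) (k := 1)
    (by rw [pow_one, ← hx, pow_orderOf_eq_one]) (normalizer_eq_top_iff.mpr hMn ▸ mem_top x) hkM
    (by interval_cases k <;> decide)
  have hk0 : k ≠ 0 := by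
    rintro rfl
    have : M = ⊥ := Subgroup.eq_bot_of_card_eq M (by simpa using hkM)
    exact hne (Subgroup.mem_bot.mp (this ▸ (hmem g).mpr hg))
  exact not_dvd_centralizer p2 hx hcen (by rw [adjN_comm]; exact h.graph.2.2.2.2.2.2.1)
    (hkM ▸ dvd_pow_self 2 hk0)

theorem Hyp.fpf (h : Hyp G) (hg : orderOf g = 3 ∨ orderOf g = 5) (hu : u ∈ p.1)
    (hc : g * u = u * g) : u = 1 := by
  rcases hg with hg | hg
  · exact eq_one_of_comm p31 (isSyl_sylow p).isPGroup hg (not_padj h.adj_3_31) u hu hc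
  · exact eq_one_of_comm p31 (isSyl_sylow p).isPGroup hg (not_padj h.adj_5_31) u hu hc

theorem Hyp.fix_of_odd (h : Hyp G) (hg : orderOf g = 3 ∨ orderOf g = 5) (hpq : p ≠ q)
    (hm : g ∈ Hs p q) (hr : g • r = r) : r = p ∨ r = q := by
  by_contra! hne
  obtain ⟨u, hu, rfl⟩ := h.exists_smul_eq hpq (Ne.symm hne.1)
  have := h.fpf hg hu ((h.fix_iff hpq hm hu).mp hr)
  exact hne.2 (by rw [this, one_smul])

theorem card_modEq_fixed {s : ℕ} [Fact s.Prime] {X : Type*} [Finite X] [MulAction G X]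
    (hg : orderOf g = s) : Nat.card X ≡ {x : X | g • x = x}.ncard [MOD s] := by
  have := (isPGroup_zpowers hg).card_modEq_card_fixedPoints X
  rwa [show MulAction.fixedPoints (zpowers g) X = {x : X | g • x = x} from ?_,
    Nat.card_coe_set_eq] at this
  ext x
  refine ⟨fun hx => hx ⟨g, mem_zpowers g⟩, fun hx y => ?_⟩
  have : zpowers g ≤ MulAction.stabilizer G x := zpowers_le.mpr hx
  exact this y.2

theorem Hyp.exists_fix (h : Hyp G) (hg : orderOf g = 3 ∨ orderOf g = 5) :
    ∃ p q : Sylow 31 G, p ≠ q ∧ g ∈ Hs p q := by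
  haveI := Fact.mk p3
  haveI := Fact.mk p5
  have h1 : 1 < {x : Sylow 31 G | g • x = x}.ncard := by
    rcases hg with hg | hg
    · have := card_modEq_fixed (X := Sylow 31 G) hg
      rw [h.card_points] at this
      unfold Nat.ModEq at this
      omega
    · have := card_modEq_fixed (X := Sylow 31 G) hg
      rw [h.card_points] at this
      unfold Nat.ModEq at this
      omega
  obtain ⟨a, b, ha, hb, hab⟩ := (Set.one_lt_ncard_iff (Set.toFinite _)).mp h1
  exact ⟨a, b, hab, ha, hb⟩

end TwoTransitive

section DoubleCount

variable {Γ X : Type*} [Group Γ] [Finite Γ] [Finite X] [MulAction Γ X]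

/-- Double counting of triples `(x, p, q)` in a 2-transitive group. -/
theorem double_count (htr : ∀ p q p' q' : X, p ≠ q → p' ≠ q' → ∃ g : Γ, g • p = p' ∧ g • q = q')
    {T : Set Γ} (hT : ∀ x ∈ T, ∀ g : Γ, g * x * g⁻¹ ∈ T) {r : Γ → X → X → Prop}
    (hr : ∀ x p q, ∀ g : Γ, r x p q → r (g * x * g⁻¹) (g • p) (g • q)) {a : ℕ}
    (ha : ∀ x ∈ T, {z : X × X | z.1 ≠ z.2 ∧ r x z.1 z.2}.ncard = a) {p q : X} (hpq : p ≠ q) :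
    T.ncard * a = Nat.card X * (Nat.card X - 1) * {x | x ∈ T ∧ r x p q}.ncard := by
  classical
  haveI := Fintype.ofFinite X
  haveI := Fintype.ofFinite Γ
  have h1 := Finset.card_mul_eq_card_mul (s := T.toFinset) (t := (Finset.univ : Finset X).offDiag)
    (fun x z => r x z.1 z.2) (m := a) (n := {x | x ∈ T ∧ r x p q}.ncard) (fun x hx => by
      rw [← ha x (Set.mem_toFinset.mp hx), Finset.bipartiteAbove, ← Set.ncard_coe_finset]
      congr 1; ext z; simp) (fun z hz => by
      obtain ⟨g, hg1, hg2⟩ := htr p q z.1 z.2 hpq (by simpa using hz)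
      rw [Finset.bipartiteBelow, ← Set.ncard_coe_finset]
      symm
      refine Set.ncard_congr (fun x _ => g * x * g⁻¹) (fun x hx => ?_) (fun x y _ _ e => ?_)
        fun y hy => ?_
      · have := hr x p q g hx.2
        rw [hg1, hg2] at this
        simpa using ⟨hT x hx.1 g, this⟩
      · simpa using e
      · simp only [Finset.coe_filter, Set.mem_toFinset, Set.mem_ofPred_eq] at hy
        have h2 := hr y z.1 z.2 g⁻¹ hy.2
        rw [← hg1, ← hg2, inv_smul_smul, inv_smul_smul, inv_inv] at h2
        have h3 := hT y hy.1 g⁻¹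
        rw [inv_inv] at h3
        exact ⟨g⁻¹ * y * g, ⟨h3, h2⟩, by group⟩)
  rw [Finset.offDiag_card, Finset.card_univ, ← Nat.card_eq_fintype_card, ← Set.ncard_eq_toFinset_card'] at h1
  rw [h1, Nat.mul_sub_one]

theorem ncard_pairs (F : Set X) :
    {z : X × X | z.1 ≠ z.2 ∧ (z.1 ∈ F ∧ z.2 ∈ F)}.ncard = F.ncard * (F.ncard - 1) := by
  classical
  haveI := Fintype.ofFinite X
  rw [show {z : X × X | z.1 ≠ z.2 ∧ (z.1 ∈ F ∧ z.2 ∈ F)} = (F.toFinset.offDiag : Set (X × X)) by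
    ext z; simp; tauto, Set.ncard_coe_finset, Finset.offDiag_card, ← Set.ncard_eq_toFinset_card',
    Nat.mul_sub_one]

theorem ncard_graph (f : X → X) (P : X → Prop) :
    {z : X × X | z.1 ≠ z.2 ∧ (f z.1 = z.2 ∧ P z.1)}.ncard = {x | f x ≠ x ∧ P x}.ncard := by
  refine Set.ncard_congr (fun z _ => z.1) (fun z hz => ⟨hz.2.1 ▸ hz.1.symm, hz.2.2⟩)
    (fun z w hz hw e => Prod.ext e ?_) fun x hx => ⟨(x, f x), ⟨hx.1.symm, rfl, hx.2⟩, rfl⟩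
  have e' : z.1 = w.1 := e
  rw [← hz.2.1, ← hw.2.1, e']

end DoubleCount

section Involutions

variable {G : Type*} [Group G] [Finite G] {p q r : Sylow 31 G} {g u j t : G} {A : Subgroup G}

/-- The fixed points of an element. -/
def Fx (g : G) : Set (Sylow 31 G) := {r | g • r = r}

theorem mem_Fx : r ∈ Fx g ↔ g • r = r := Iff.rfl

theorem mem_Fx_conj (g x : G) : r ∈ Fx (g * x * g⁻¹) ↔ g⁻¹ • r ∈ Fx x := by
  simp only [mem_Fx, mul_smul]
  rw [smul_eq_iff_eq_inv_smul]

theorem Fx_conj (g x : G) : Fx (g * x * g⁻¹) = g • Fx x := by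
  ext r
  rw [mem_Fx_conj, Set.mem_smul_set_iff_inv_smul_mem]

/-- The elements of `p` commuting with `g`. -/
def cn (p : Sylow 31 G) (g : G) : Subgroup G := p.1 ⊓ centralizer {g}

theorem mem_cn : u ∈ cn p g ↔ u ∈ p.1 ∧ g * u = u * g := by
  rw [cn, mem_inf, mem_centralizer_singleton_iff]
  exact and_congr_right fun _ => eq_comm

theorem Hyp.ncard_Fx (h : Hyp G) (hpq : p ≠ q) (hg : g ∈ Hs p q) :
    (Fx g).ncard = Nat.card (cn p g) + 1 := by
  have hp : p ∈ Fx g := hg.1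
  rw [← Set.ncard_sdiff_singleton_add_one hp (Set.toFinite _), add_left_inj,
    ← SetLike.coe_sort_coe, Nat.card_coe_set_eq]
  symm
  refine Set.ncard_congr (fun u _ => u • q) (fun u hu => ?_) (fun u v hu hv e => ?_) fun r hr => ?_
  · have hu' := mem_cn.mp hu
    refine ⟨(h.fix_iff hpq hg hu'.1).mpr hu'.2, fun e => hpq ?_⟩
    have e' : u • q = u • p := Eq.trans e (smul_of_mem hu'.1).symm
    exact (smul_left_cancel _ e').symm
  · have := h.eq_one_of_fix hpq (p.1.mul_mem (p.1.inv_mem (mem_cn.mp hv).1) (mem_cn.mp hu).1)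
      (by rw [mul_smul, show u • q = v • q from e, inv_smul_smul])
    exact (inv_mul_eq_one.mp this).symm
  · obtain ⟨u, hu, rfl⟩ := h.exists_smul_eq hpq (r := r) (fun e => hr.2 e.symm)
    exact ⟨u, mem_cn.mpr ⟨hu, (h.fix_iff hpq hg hu).mp hr.1⟩, rfl⟩

theorem Hyp.card_cn (h : Hyp G) (hpq : p ≠ q) (hg : g ∈ Hs p q) (hne : g ≠ 1) :
    Nat.card (cn p g) = 1 ∨ Nat.card (cn p g) = 31 ∨ Nat.card (cn p g) = 961 := by
  have hd : Nat.card (cn p g) ∣ 31 ^ 3 := by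
    have := card_dvd_of_le (inf_le_left : cn p g ≤ p.1)
    rwa [h.card_sylow] at this
  obtain ⟨k, hk, e⟩ := (Nat.dvd_prime_pow p31).mp hd
  interval_cases k
  · left; simpa using e
  · right; left; simpa using e
  · right; right; simpa using e
  · exfalso
    have h1 := h.ncard_Fx hpq hg
    rw [e] at h1
    have h2 : Fx g = Set.univ := Set.eq_of_subset_of_ncard_le (Set.subset_univ _)
      (by rw [Set.ncard_univ, h.card_points, h1]; norm_num) (Set.toFinite _)
    exact hne (h.faithful fun r => by
      have : r ∈ Fx g := h2 ▸ Set.mem_univ r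
      exact this)

/-- The involutions fixing `p` and `q` with exactly `f` fixed points. -/
def Inv (f : ℕ) : Set G := {j | orderOf j = 2 ∧ (Fx j).ncard = f}

theorem orderOf_conj (g x : G) : orderOf (g * x * g⁻¹) = orderOf x :=
  orderOf_injective (MulAut.conj g).toMonoidHom (MulAut.conj g).injective x

theorem conj_mem_Inv {f : ℕ} : ∀ x ∈ Inv (G := G) f, ∀ g : G, g * x * g⁻¹ ∈ Inv f :=
  fun x hx g => ⟨(orderOf_conj g x).trans hx.1, by
    rw [Fx_conj, Set.ncard_smul_set]; exact hx.2⟩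

theorem Hyp.inv_count (h : Hyp G) (hpq : p ≠ q) (f : ℕ) :
    ∃ l ≤ 960, {j : G | j ∈ Inv f ∧ j ∈ Hs p q}.ncard * (29792 - f) = l * (f * (f - 1)) := by
  have h1 := double_count (X := Sylow 31 G) (fun a b a' b' => h.exists_pair) (conj_mem_Inv (f := f))
    (r := fun x a b => a ∈ Fx x ∧ b ∈ Fx x) (a := f * (f - 1))
    (fun x a b g hx => by simpa [mem_Fx_conj] using hx)
    (fun x hx => by rw [ncard_pairs, hx.2]) hpq
  have h2 := double_count (X := Sylow 31 G) (fun a b a' b' => h.exists_pair) (conj_mem_Inv (f := f))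
    (r := fun x a b => x • a = b ∧ True) (a := 29792 - f)
    (fun x a b g hx => by simpa [mul_smul] using hx)
    (fun x hx => by
      refine (ncard_graph (fun y => x • y) fun _ => True).trans ?_
      have := Set.ncard_add_ncard_compl (Fx x)
      rw [h.card_points, hx.2] at this
      rw [show {y : Sylow 31 G | x • y ≠ y ∧ True} = (Fx x)ᶜ by ext; simp [mem_Fx]]
      omega) hpq
  refine ⟨{x : G | x ∈ Inv f ∧ (x • p = q ∧ True)}.ncard, ?_, ?_⟩
  · rcases Set.eq_empty_or_nonempty {x : G | x ∈ Inv f ∧ (x • p = q ∧ True)} with he | ⟨x₀, hx₀⟩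
    · rw [he]; simp
    · rw [← h.card_Hs hpq, ← SetLike.coe_sort_coe, Nat.card_coe_set_eq]
      have hsw : ∀ x : G, x ∈ Inv f ∧ (x • p = q ∧ True) → x • q = p := fun x hx => by
        rw [← hx.2.1, ← mul_smul, ← sq, ← hx.1.1, pow_orderOf_eq_one, one_smul]
      refine Set.ncard_le_ncard_of_injOn (fun x => x₀ * x) (fun x hx => mem_Hs.mpr ⟨?_, ?_⟩)
        (fun x _ y _ e => mul_left_cancel e) (Set.toFinite _)
      · rw [mul_smul, hx.2.1, hsw x₀ hx₀]
      · rw [mul_smul, hsw x hx, hx₀.2.1]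
  · rw [h.card_points] at h1 h2
    have e : {x : G | x ∈ Inv f ∧ (p ∈ Fx x ∧ q ∈ Fx x)} = {j | j ∈ Inv f ∧ j ∈ Hs p q} := rfl
    rw [e] at h1
    generalize {j : G | j ∈ Inv f ∧ j ∈ Hs p q}.ncard = a at *
    generalize {x : G | x ∈ Inv f ∧ (x • p = q ∧ True)}.ncard = b at *
    generalize (Inv f : Set G).ncard = c at *
    generalize 29792 - f = d at *
    generalize f * (f - 1) = e at *
    refine Nat.eq_of_mul_eq_mul_left (show 0 < 29792 * (29792 - 1) by norm_num) ?_
    rw [← mul_assoc, ← mul_assoc, ← h1, ← h2]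
    ring

theorem inf_ne_bot_of_card {A B C : Subgroup G} (hA : A ≤ C) (hB : B ≤ C)
    (hlt : Nat.card C < Nat.card A * Nat.card B) : A ⊓ B ≠ ⊥ := by
  intro hbot
  have := Nat.card_le_card_of_injective
    (fun z : A × B => (⟨z.1 * z.2, C.mul_mem (hA z.1.2) (hB z.2.2)⟩ : C)) fun z w e =>
      mul_injective_of_disjoint (disjoint_iff.mpr hbot) (congrArg Subtype.val e)
  rw [Nat.card_prod] at this
  omega

theorem cn_le : cn p g ≤ p.1 := inf_le_left

theorem Hyp.card_cn_inv (h : Hyp G) (hpq : p ≠ q) (hj : j ∈ Hs p q) (ho : orderOf j = 2) :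
    Nat.card (cn p j) = 31 := by
  have hF := h.ncard_Fx hpq hj
  have hpos : ∀ f, (Fx j).ncard = f → 0 < {j : G | j ∈ Inv f ∧ j ∈ Hs p q}.ncard := fun f hf =>
    (Set.ncard_pos (Set.toFinite _)).mpr ⟨j, ⟨ho, hf⟩, hj⟩
  rcases h.card_cn hpq hj (by rintro rfl; simp at ho) with e | e | e
  · exfalso
    obtain ⟨l, hl, hc⟩ := h.inv_count hpq 2
    have := hpos 2 (by omega)
    omega
  · exact e
  · exfalso
    obtain ⟨l, hl, hc⟩ := h.inv_count hpq 962
    have h0 := hpos 962 (by omega)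
    obtain ⟨S, hS⟩ : ∃ S : Set G, S = {j : G | j ∈ Inv 962 ∧ j ∈ Hs p q} := ⟨_, rfl⟩
    rw [← hS] at hc h0
    have h481 : 481 ≤ S.ncard := by omega
    obtain ⟨y, hy, hyo⟩ := exists_mem_orderOf p3 (C := Hs p q) (by rw [h.card_Hs hpq]; norm_num)
    have hne : ¬ Disjoint S ((y * ·) '' S) := fun hd => by
      have h1 := Set.ncard_union_eq hd (Set.toFinite _) (Set.toFinite _)
      rw [Set.ncard_image_of_injective _ (mul_right_injective y)] at h1
      have h2 : S ∪ (y * ·) '' S ⊆ (Hs p q : Set G) := by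
        rintro x (hx | ⟨x, hx, rfl⟩)
        · rw [hS] at hx; exact hx.2
        · rw [hS] at hx; exact mul_mem hy hx.2
      have h3 := Set.ncard_le_ncard h2 (Set.toFinite _)
      rw [← Nat.card_coe_set_eq (Hs p q : Set G), SetLike.coe_sort_coe, h.card_Hs hpq] at h3
      omega
    obtain ⟨a, ha, b, hb, e2⟩ := Set.not_disjoint_iff.mp hne
    have hcard : ∀ c ∈ S, Nat.card (cn p c) = 961 := fun c hc => by
      rw [hS] at hc
      have h1 := h.ncard_Fx hpq hc.2
      have h2 : (Fx c).ncard = 962 := hc.1.2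
      omega
    refine inf_ne_bot_of_card (C := p.1) (cn_le (g := a)) (cn_le (g := b))
      (by rw [hcard a ha, hcard b hb, h.card_sylow]; norm_num) ?_
    rw [eq_bot_iff]
    rintro u ⟨hua, hub⟩
    have h1 := (mem_cn.mp hua).2
    have h2 := (mem_cn.mp hub).2
    have e3 : y = a * b⁻¹ := eq_mul_inv_of_mul_eq e2
    refine Subgroup.mem_bot.mpr (h.fpf (Or.inl hyo) (cn_le hua) ?_)
    have h3 : b⁻¹ * u = u * b⁻¹ := by rw [inv_mul_eq_iff_eq_mul, ← mul_assoc, h2, mul_assoc, mul_inv_cancel, mul_one]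
    rw [e3, mul_assoc, h3, ← mul_assoc, h1, mul_assoc]

theorem Hyp.ncard_Fx_inv (h : Hyp G) (hpq : p ≠ q) (hj : j ∈ Hs p q) (ho : orderOf j = 2) :
    (Fx j).ncard = 32 := by
  rw [h.ncard_Fx hpq hj, h.card_cn_inv hpq hj ho]

theorem Hyp.ncard_inv_le (h : Hyp G) (hpq : p ≠ q) :
    {j : G | j ∈ Hs p q ∧ orderOf j = 2}.ncard ≤ 32 := by
  obtain ⟨l, hl, hc⟩ := h.inv_count hpq 32
  have : {j : G | j ∈ Hs p q ∧ orderOf j = 2} = {j : G | j ∈ Inv 32 ∧ j ∈ Hs p q} := by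
    ext x
    exact ⟨fun hx => ⟨⟨hx.2, h.ncard_Fx_inv hpq hx.1 hx.2⟩, hx.1⟩, fun hx => ⟨hx.2, hx.1.1⟩⟩
  rw [this]
  omega

/-- A central subgroup of order 31 of a Sylow subgroup, containing its commutators. -/
structure Ax (p : Sylow 31 G) (A : Subgroup G) : Prop where
  le : A ≤ p.1
  card : Nat.card A = 31
  cen : ∀ a ∈ A, ∀ u ∈ p.1, a * u = u * a
  comm : ∀ u ∈ p.1, ∀ v ∈ p.1, u * v * u⁻¹ * v⁻¹ ∈ A

theorem mul_self_of_orderOf (ho : orderOf j = 2) : j * j = 1 := by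
  rw [← sq, ← ho, pow_orderOf_eq_one]

theorem inv_of_orderOf (ho : orderOf j = 2) : j⁻¹ = j :=
  inv_eq_of_mul_eq_one_left (mul_self_of_orderOf ho)

theorem Ax.eq_one_of_sq (hA : Ax p A) {a : G} (ha : a ∈ A) (h : a * a = 1) : a = 1 := by
  have h1 : a ^ 31 = 1 := by rw [← hA.card]; exact pow_natCard_of_mem ha
  rwa [show 31 = 2 * 15 + 1 from rfl, pow_succ, pow_mul, sq, h, one_pow, one_mul] at h1

/-- An element centralizing `A` and the quotient by `A` is trivial. -/
theorem Hyp.eq_one_of_trivial (h : Hyp G) (hpq : p ≠ q) (hA : Ax p A) (hg : g ∈ Hs p q)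
    (h1 : ∀ a ∈ A, g * a = a * g) (h2 : ∀ u ∈ p.1, g * u * g⁻¹ * u⁻¹ ∈ A) : g = 1 := by
  have hcom : ∀ u ∈ p.1, g ^ 31 * u = u * g ^ 31 := fun u hu => by
    obtain ⟨b, hb⟩ : ∃ b, b = g * u * g⁻¹ * u⁻¹ := ⟨_, rfl⟩
    have hbA : b ∈ A := hb ▸ h2 u hu
    have h3 : ∀ k : ℕ, g ^ k * u = b ^ k * u * g ^ k := fun k => by
      induction k with
      | zero => simp
      | succ k ih =>
        have h4 : g ^ k * b = b * g ^ k := (Commute.pow_left (h1 b hbA) k)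
        have h5 : g * u = b * u * g := by rw [hb]; group
        rw [pow_succ, mul_assoc, h5, ← mul_assoc, ← mul_assoc, h4, mul_assoc b, ih]
        simp only [pow_succ', mul_assoc]
    have := h3 31
    rwa [show b ^ 31 = 1 by rw [← hA.card]; exact pow_natCard_of_mem hbA, one_mul] at this
  have h31 : g ^ 31 = 1 := h.faithful fun r => by
    by_cases hr : p = r
    · exact hr ▸ ((Hs p q).pow_mem hg 31).1
    · obtain ⟨u, hu, rfl⟩ := h.exists_smul_eq hpq hr
      exact (h.fix_iff hpq ((Hs p q).pow_mem hg 31) hu).mpr (hcom u hu)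
  have h960 : g ^ 960 = 1 := by rw [← h.card_Hs hpq]; exact pow_natCard_of_mem hg
  rw [← orderOf_dvd_iff_pow_eq_one] at h31 h960
  exact orderOf_eq_one_iff.mp (Nat.dvd_one.mp (Nat.dvd_gcd h31 h960))

/-- An involution with axis `A` inverts the quotient by `A`. -/
theorem Ax.inverts (hA : Ax p A) (hj : j ∈ Hs p q) (ho : orderOf j = 2) (hc : cn p j = A)
    (hu : u ∈ p.1) : j * u * j * u ∈ A := by
  have hjj := mul_self_of_orderOf ho
  have hji := inv_of_orderOf ho
  have hju : j * u * j ∈ p.1 := by simpa [hji] using smul_mem_sylow hj.1 hu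
  obtain ⟨w, hw⟩ : ∃ w, w = j * u * j * u := ⟨_, rfl⟩
  have hwp : w ∈ p.1 := hw ▸ mul_mem hju hu
  -- `j w j = c w` with `c ∈ A`
  obtain ⟨c, hcA, hcw⟩ : ∃ c ∈ A, j * w * j = c * w := by
    refine ⟨_, hA.comm u hu _ hju, ?_⟩
    rw [hw]
    calc j * (j * u * j * u) * j = (j * j) * u * j * u * j := by group
      _ = u * (j * u * j) * u⁻¹ * (j * u * j)⁻¹ * (j * u * j * u) := by rw [hjj]; group
  have hcj : j * c = c * j := (mem_cn.mp (hc ▸ hcA : c ∈ cn p j)).2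
  have hcc : c * c = 1 := by
    have : w = c * c * w := by
      calc w = (j * j) * w * (j * j) := by rw [hjj]; group
        _ = j * (j * w * j) * j := by group
        _ = (j * c) * w * j := by rw [hcw]; group
        _ = c * (j * w * j) := by rw [hcj]; group
        _ = c * c * w := by rw [hcw]; group
    exact right_eq_mul.mp this
  rw [hA.eq_one_of_sq hcA hcc, one_mul] at hcw
  rw [← hw, ← hc, mem_cn]
  refine ⟨hwp, ?_⟩
  calc j * w = (j * w * j) * j := by rw [mul_assoc (j * w), hjj, mul_one]
    _ = w * j := by rw [hcw]

end Involutions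

section AxisExists

variable {G : Type*} [Group G] [Finite G] {p q r : Sylow 31 G} {g u j t s : G} {A B S : Subgroup G}

theorem relIndex_cz_dvd {r : ℕ} (hr : r.Prime) (hA : Nat.card A = r) (hB : B ≤ nz(A)) :
    cz(A).relIndex B ∣ r - 1 := by
  haveI := Fact.mk hr
  haveI : IsCyclic A := isCyclic_of_prime_card hA
  let f := A.normalizerMonoidHom.comp (inclusion hB)
  have h1 : cz(A).relIndex B = f.ker.index := by
    rw [← MonoidHom.comap_ker, Subgroup.normalizerMonoidHom_ker]
    rfl
  rw [h1, Subgroup.index_ker, ← Nat.totient_prime hr, ← hA, ← IsCyclic.card_mulAut]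
  exact card_subgroup_dvd_card _

theorem Ax.pow (hA : Ax p A) {a : G} (ha : a ∈ A) : a ^ 31 = 1 := by
  rw [← hA.card]; exact pow_natCard_of_mem ha

/-- An involution of a two-point stabilizer is determined by its axis. -/
theorem Hyp.inv_inj (h : Hyp G) (hpq : p ≠ q) (hA : Ax p A) (hj : j ∈ Hs p q) (ho : orderOf j = 2)
    (hc : cn p j = A) (ht : t ∈ Hs p q) (ho' : orderOf t = 2) (hc' : cn p t = A) : j = t := by
  have hti := inv_of_orderOf ho'
  have hcom : ∀ x ∈ A, j * x = x * j ∧ t * x = x * t := fun x hx =>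
    ⟨(mem_cn.mp (hc ▸ hx : x ∈ cn p j)).2, (mem_cn.mp (hc' ▸ hx : x ∈ cn p t)).2⟩
  have := h.eq_one_of_trivial hpq hA (mul_mem hj ht) (fun a ha => by
    rw [mul_assoc, (hcom a ha).2, ← mul_assoc, (hcom a ha).1, mul_assoc]) fun u hu => by
    obtain ⟨v, hv⟩ : ∃ v, v = t * u * t := ⟨_, rfl⟩
    have hvp : v ∈ p.1 := hv ▸ by simpa [hti] using smul_mem_sylow ht.1 hu
    have h1 := hA.inverts hj ho hc hvp
    have h2 : v * u ∈ A := hv ▸ hA.inverts ht ho' hc' hu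
    have h3 : j * v * j * v * (v * u)⁻¹ ∈ A := mul_mem h1 (inv_mem h2)
    have e : j * t * u * (j * t)⁻¹ * u⁻¹ = j * v * j * v * (v * u)⁻¹ := by
      rw [mul_inv_rev, hti, inv_of_orderOf ho]
      have h5 : v * (v * u)⁻¹ = u⁻¹ := by
        rw [← hA.cen _ (inv_mem h2) v hvp, mul_inv_rev, inv_mul_cancel_right]
      rw [mul_assoc _ v, h5, hv]
      group
    rwa [e]
  rw [← hti]
  exact eq_inv_of_mul_eq_one_left this

theorem cn_conj (hg : g • p = p) (j : G) : MulAut.conj g • cn p j = cn p (g * j * g⁻¹) := by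
  ext x
  have hg' : g⁻¹ • p = p := inv_smul_eq_iff.mpr hg.symm
  rw [mem_conj_smul, mem_cn, mem_cn]
  refine and_congr ⟨fun h => by simpa [mul_assoc] using smul_mem_sylow hg h,
    fun h => by simpa using smul_mem_sylow hg' h⟩ ⟨fun h => ?_, fun h => ?_⟩
  · calc g * j * g⁻¹ * x = g * (j * (g⁻¹ * x * g)) * g⁻¹ := by group
      _ = x * (g * j * g⁻¹) := by rw [h]; group
  · calc j * (g⁻¹ * x * g) = g⁻¹ * (g * j * g⁻¹ * x) * g := by group
      _ = g⁻¹ * x * g * j := by rw [h]; group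

theorem Hyp.cn_eq (h : Hyp G) (hpq : p ≠ q) (hA : Ax p A) (hj : j ∈ Hs p q) (ho : orderOf j = 2)
    (hjA : j ∈ cz(A)) : cn p j = A :=
  (Subgroup.eq_of_le_of_card_ge (fun a ha => mem_cn.mpr
    ⟨hA.le ha, (mem_centralizer_iff.mp hjA a ha).symm⟩)
    (by rw [h.card_cn_inv hpq hj ho, hA.card])).symm

theorem Hyp.exists_axis (h : Hyp G) (hpq : p ≠ q) : ∃ A, Ax p A ∧ Hs p q ≤ nz(A) := by
  obtain ⟨S, hS⟩ := exists_isSyl Nat.prime_two (Hs p q)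
  have hcS : Nat.card S = 2 ^ 6 :=
    hS.card_eq (c := 15) Nat.prime_two (by rw [h.card_Hs hpq]; norm_num) (by norm_num)
  obtain ⟨A, hA, hSA⟩ : ∃ A, Ax p A ∧ S ≤ nz(A) := by
    by_cases hU : ∀ a ∈ p.1, ∀ b ∈ p.1, a * b = b * a
    · obtain ⟨t, htS, ht, hc⟩ := exists_center_orderOf Nat.prime_two hS.isPGroup (by
        rintro rfl; simp at hcS)
      refine ⟨cn p t, ⟨cn_le, h.card_cn_inv hpq (hS.1 htS) ht, fun a ha u hu => hU a (cn_le ha) u hu,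
        fun u hu v hv => ?_⟩, fun s hs => ?_⟩
      · rw [hU u hu v hv, mul_inv_cancel_right, mul_inv_cancel]; exact one_mem _
      · rw [← conj_smul_eq_iff, cn_conj (hS.1 hs).1, mem_centralizer_singleton_iff.mp (hc hs),
          mul_inv_cancel_right]
    · have hU' : Heis p.1 := ⟨h.card_sylow p, hU⟩
      exact ⟨zc p.1, ⟨zc_le _, hU'.card_zc, fun a ha u hu =>
        (mem_centralizer_iff.mp (le_cz_zc _ hu) a ha), hU'.card_zc_and.2⟩,
        fun s hs => mem_nz_zc (mem_normalizer_sylow (hS.1 hs))⟩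
  refine ⟨A, hA, fun g hg => ?_⟩
  have hK : 32 ≤ Nat.card (cz(A) ⊓ S : Subgroup G) := by
    have h1 := card_eq_relIndex_mul cz(A) S
    have h2 := relIndex_cz_dvd p31 hA.card hSA
    have h3 := Nat.dvd_gcd (hcS ▸ Dvd.intro _ h1.symm : _ ∣ 2 ^ 6) h2
    have h4 := Nat.le_of_dvd (by norm_num) h3
    norm_num at h4
    rw [hcS] at h1
    by_contra hlt
    have := Nat.mul_le_mul h4 (Nat.le_of_lt_succ (not_le.mp hlt : _ < 31 + 1))
    omega
  obtain ⟨K, hKdef⟩ : ∃ K, K = cz(A) ⊓ S := ⟨_, rfl⟩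
  rw [← hKdef] at hK
  have hKH : K ≤ Hs p q := hKdef ▸ inf_le_right.trans hS.1
  have hgK : MulAut.conj g • K ≤ Hs p q := fun x hx => by
    have := mul_mem (mul_mem hg (hKH (mem_conj_smul.mp hx))) (inv_mem hg)
    simpa [mul_assoc] using this
  have hne := inf_ne_bot_of_card hKH hgK (by
    rw [card_conj_smul, h.card_Hs hpq]
    exact lt_of_lt_of_le (by norm_num) (Nat.mul_le_mul hK hK))
  obtain ⟨τ, ⟨hτK, hτg⟩, hτ⟩ := exists_orderOf_of_ne_bot Nat.prime_two
    (hS.isPGroup.to_le (inf_le_left.trans (hKdef ▸ inf_le_right))) hne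
  have h1 := h.cn_eq hpq hA (hKH hτK) hτ (hKdef ▸ hτK : τ ∈ cz(A) ⊓ S).1
  replace hτg := mem_conj_smul.mp hτg
  have h2 := h.cn_eq hpq hA (hKH hτg) (by simpa [hτ] using orderOf_conj g⁻¹ τ)
    (hKdef ▸ hτg : _ ∈ cz(A) ⊓ S).1
  rw [← conj_smul_eq_iff]
  nth_rw 1 [← h2]
  rw [cn_conj hg.1, ← h1]
  congr 1
  group

end AxisExists

section TwoByTwo
open Matrix

theorem trace_eq_zero_of_iter : ∀ τ : ZMod 31, (fun x : ZMod 31 × ZMod 31 =>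
    (x.1 * x.1 * τ + 2 * x.1 * x.2, x.1 * x.1 + x.2 * x.2))^[5] (1, 0) = (0, 1) → τ = 0 := by
  decide +kernel
theorem sq_ne_neg_one : ∀ c : ZMod 31, c * c ≠ -1 := by decide +kernel

theorem mat_sq (M : Matrix (Fin 2) (Fin 2) (ZMod 31)) (hd : M.det = -1) :
    M * M = M.trace • M + 1 := by
  rw [det_fin_two] at hd
  ext i j
  fin_cases i <;> fin_cases j <;> simp [Matrix.mul_apply, Fin.sum_univ_two, trace_fin_two] <;>
    first | ring1 | linear_combination -hd

theorem sq_eq_one_of_det {M : Matrix (Fin 2) (Fin 2) (ZMod 31)} (hd : M.det = -1)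
    (h : M ^ 32 = 1) : M ^ 2 = 1 := by
  have h1 : ∀ n : ℕ, M ^ 2 ^ n = ((fun x : ZMod 31 × ZMod 31 =>
      (x.1 * x.1 * M.trace + 2 * x.1 * x.2, x.1 * x.1 + x.2 * x.2))^[n] (1, 0)).1 • M
      + ((fun x : ZMod 31 × ZMod 31 =>
      (x.1 * x.1 * M.trace + 2 * x.1 * x.2, x.1 * x.1 + x.2 * x.2))^[n] (1, 0)).2 • 1 := fun n => by
    induction n with
    | zero => simp
    | succ n ih =>
      rw [pow_succ, pow_mul, sq, ih, Function.iterate_succ_apply']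
      simp only [mul_add, add_mul, smul_mul_assoc, mul_smul_comm, mat_sq M hd, one_mul, mul_one]
      module
  rw [sq, mat_sq M hd]
  suffices M.trace = 0 by rw [this]; simp
  refine trace_eq_zero_of_iter _ ?_
  have h2 := (h1 5).symm.trans h
  generalize (fun x : ZMod 31 × ZMod 31 =>
    (x.1 * x.1 * M.trace + 2 * x.1 * x.2, x.1 * x.1 + x.2 * x.2))^[5] (1, 0) = z at h2
  have : Fact (Nat.Prime 31) := ⟨by norm_num⟩
  obtain ⟨z1, z2⟩ := z
  by_cases hz : z1 = 0
  · have h3 := congrFun (congrFun h2 0) 0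
    simp [hz] at h3
    rw [hz, h3]
  exfalso
  have h3 := congrFun (congrFun h2 0) 1
  have h4 := congrFun (congrFun h2 1) 0
  have h5 := congrFun (congrFun h2 0) 0
  have h6 := congrFun (congrFun h2 1) 1
  simp [hz] at h3 h4 h5 h6
  rw [det_fin_two, h3, h4] at hd
  have h7 : M 0 0 = M 1 1 := mul_left_cancel₀ hz (by linear_combination h5 - h6)
  rw [h7] at hd
  exact sq_ne_neg_one (M 1 1) (by linear_combination hd)

theorem det_of_sq {M : Matrix (Fin 2) (Fin 2) (ZMod 31)} (h : M * M = 1) (h1 : M ≠ 1)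
    (h2 : M ≠ -1) : M.det = -1 := by
  have : Fact (Nat.Prime 31) := ⟨by norm_num⟩
  have e := fun i j => congrFun (congrFun h i) j
  have e0 := e 0 0; have e1 := e 0 1; have e2 := e 1 0; have e3 := e 1 1
  simp [Matrix.mul_apply, Fin.sum_univ_two] at e0 e1 e2 e3
  rw [det_fin_two]
  by_cases ht : M 0 0 + M 1 1 = 0
  · linear_combination M 0 0 * ht - e0
  · have hb : M 0 1 = 0 := mul_left_cancel₀ ht (by linear_combination e1)
    have hc : M 1 0 = 0 := mul_left_cancel₀ ht (by linear_combination e2)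
    have hd : M 0 0 = M 1 1 := by
      have : (M 0 0 + M 1 1) * (M 0 0 - M 1 1) = 0 := by linear_combination e0 - e3
      rcases mul_eq_zero.mp this with h | h
      · exact absurd h ht
      · exact sub_eq_zero.mp h
    rw [hc, zero_mul, zero_add] at e3
    rcases mul_self_eq_one_iff.mp e3 with h4 | h4
    · refine absurd ?_ h1
      ext i j; fin_cases i <;> fin_cases j <;> simp [hb, hc, hd, h4]
    · refine absurd ?_ h2
      ext i j; fin_cases i <;> fin_cases j <;> simp [hb, hc, hd, h4]
end TwoByTwo

section UniqueInvolution

variable {G : Type*} [Group G] [Finite G] {p q r : Sylow 31 G} {g u v j k t s : G} {A : Subgroup G}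

theorem Ax.mul_pow (hA : Ax p A) (hu : u ∈ p.1) (hv : v ∈ p.1) (n : ℕ) :
    ∃ c ∈ A, (u * v) ^ n = c * (u ^ n * v ^ n) := by
  induction n with
  | zero => exact ⟨1, one_mem _, by simp⟩
  | succ n ih =>
    obtain ⟨c, hc, e⟩ := ih
    have hvn := p.1.pow_mem hv n
    have hcom := hA.comm _ hvn _ hu
    refine ⟨c * _, mul_mem hc hcom, ?_⟩
    have h1 := hA.cen _ hcom _ (p.1.pow_mem hu n)
    calc (u * v) ^ (n + 1) = c * (u ^ n * (v ^ n * u * (v ^ n)⁻¹ * u⁻¹)) * u * v ^ n * v := by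
          rw [pow_succ, e]; group
      _ = _ := by rw [← h1, pow_succ, pow_succ]; simp only [mul_assoc]

/-- A point stabilizer's axis `A` together with an involution `t` of a two-point stabilizer having
that axis. -/
structure Base (p q : Sylow 31 G) (A : Subgroup G) (t : G) : Prop where
  ne : p ≠ q
  ax : Ax p A
  nz : Hs p q ≤ nz(A)
  mem : t ∈ Hs p q
  ord : orderOf t = 2
  cn : cn p t = A

theorem Hyp.card_inf_cz (h : Hyp G) (hpq : p ≠ q) (hA : Ax p A) (hH : Hs p q ≤ nz(A)) :
    ∃ d, d ∣ 30 ∧ Nat.card (cz(A) ⊓ Hs p q : Subgroup G) = 32 * d := by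
  have h1 := card_eq_relIndex_mul cz(A) (Hs p q)
  obtain ⟨d, hd⟩ := relIndex_cz_dvd p31 hA.card hH
  rw [h.card_Hs hpq] at h1
  refine ⟨d, Dvd.intro_left _ hd.symm, ?_⟩
  have h0 : 0 < cz(A).relIndex (Hs p q) := Nat.pos_of_ne_zero (by rintro e; rw [e] at hd; omega)
  refine Nat.eq_of_mul_eq_mul_left h0 (h1.symm.trans ?_)
  rw [mul_left_comm, ← hd]
  norm_num

theorem Hyp.exists_base (h : Hyp G) (hpq : p ≠ q) : ∃ A t, Base p q A t := by
  obtain ⟨A, hA, hH⟩ := h.exists_axis hpq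
  obtain ⟨d, -, hd⟩ := h.card_inf_cz hpq hA hH
  obtain ⟨t, ht, ho⟩ := exists_mem_orderOf Nat.prime_two (C := cz(A) ⊓ Hs p q) (by omega)
  exact ⟨A, t, hpq, hA, hH, ht.2, ho, h.cn_eq hpq hA ht.2 ho ht.1⟩

namespace Base

variable (B : Base p q A t)
include B

theorem cz_eq (h : Hyp G) (hj : j ∈ Hs p q) (ho : orderOf j = 2) (hjA : j ∈ cz(A)) : j = t :=
  h.inv_inj B.ne B.ax hj ho (h.cn_eq B.ne B.ax hj ho hjA) B.mem B.ord B.cn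

theorem mem_cz : t ∈ cz(A) := mem_centralizer_iff.mpr fun a ha =>
  ((mem_cn.mp (B.cn ▸ ha : a ∈ OD.cn p t)).2).symm

theorem conj_mem (hg : g ∈ Hs p q) {a : G} (ha : a ∈ A) : g * a * g⁻¹ ∈ A :=
  (mem_normalizer_iff.mp (B.nz hg) a).mp ha

theorem conj_mem_cz (hg : g ∈ Hs p q) (hj : j ∈ cz(A)) : g * j * g⁻¹ ∈ cz(A) := by
  refine mem_centralizer_iff.mpr fun a ha => ?_
  have h1 := mem_centralizer_iff.mp hj _ (B.conj_mem (inv_mem hg) ha)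
  calc a * (g * j * g⁻¹) = g * (g⁻¹ * a * g⁻¹⁻¹ * j) * g⁻¹ := by group
    _ = _ := by rw [h1]; group

theorem central (h : Hyp G) (hg : g ∈ Hs p q) : g * t = t * g :=
  mul_inv_eq_iff_eq_mul.mp (B.cz_eq h (mul_mem (mul_mem hg B.mem) (inv_mem hg))
    ((orderOf_conj g t).trans B.ord) (B.conj_mem_cz hg B.mem_cz))

theorem sq : t * t = 1 := mul_self_of_orderOf B.ord

theorem inv : t⁻¹ = t := inv_of_orderOf B.ord

theorem inverts (hu : u ∈ p.1) : t * u * t * u ∈ A := B.ax.inverts B.mem B.ord B.cn hu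

theorem conj_sylow (hg : g ∈ Hs p q) (hu : u ∈ p.1) : g * u * g⁻¹ ∈ p.1 := smul_mem_sylow hg.1 hu

/-- Involutions other than `t` invert `A`. -/
theorem inverts_ax (h : Hyp G) (hj : j ∈ Hs p q) (ho : orderOf j = 2) (hne : j ≠ t) :
    ∀ a ∈ A, j * a * j = a⁻¹ := by
  refine inverts_of_fpf (mul_self_of_orderOf ho) (B.nz hj) fun a ha hja => ?_
  by_contra ha1
  refine hne (B.cz_eq h hj ho (mem_centralizer_iff.mpr fun b hb => ?_))
  have : (⟨b, hb⟩ : A) ∈ zpowers (⟨a, ha⟩ : A) := by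
    haveI : Fact (Nat.Prime 31) := ⟨p31⟩
    exact mem_zpowers_of_prime_card (p := 31) B.ax.card fun e => ha1 (congrArg Subtype.val e)
  obtain ⟨n, hn⟩ := mem_zpowers_iff.mp this
  have hb' : b = a ^ n := by simpa using (congrArg Subtype.val hn).symm
  rw [hb']
  exact ((Commute.zpow_right (hja : Commute j a) n).symm)

/-- No involution acts trivially modulo `A`. -/
theorem not_trivial (h : Hyp G) (hj : j ∈ Hs p q) (ho : orderOf j = 2) :
    ∃ u ∈ p.1, j * u * j⁻¹ * u⁻¹ ∉ A := by
  by_contra! hall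
  have hji := inv_of_orderOf ho
  by_cases hne : j = t
  · have := h.eq_one_of_trivial B.ne B.ax hj (fun a ha => by
      rw [hne]; exact (mem_centralizer_iff.mp B.mem_cz a ha).symm) hall
    rw [this] at ho
    simp at ho
  have hinv := B.inverts_ax h hj ho hne
  have h1 : ∀ u ∈ p.1, ∃ a ∈ A, a * u ∈ OD.cn p j := fun u hu => by
    have hb := hall u hu
    obtain ⟨b, hbd⟩ : ∃ b, b = j * u * j⁻¹ * u⁻¹ := ⟨_, rfl⟩
    rw [← hbd] at hb
    have ha := A.pow_mem hb 16
    refine ⟨b ^ 16, ha, mem_cn.mpr ⟨mul_mem (B.ax.le ha) hu, ?_⟩⟩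
    have h32 : b ^ 16 * b ^ 16 = b := by
      rw [← pow_add, show 16 + 16 = 31 + 1 from rfl, pow_succ, B.ax.pow hb, one_mul]
    have hbu : j * u * j⁻¹ = b * u := by rw [hbd]; group
    have hc := hinv _ ha
    generalize b ^ 16 = c at *
    calc j * (c * u) = (j * c * j) * (j⁻¹ * u * j) * j⁻¹ := by group
      _ = c⁻¹ * (j * u * j⁻¹) * j := by rw [hc, hji]
      _ = c * u * j := by rw [hbu, ← h32]; group
  have h2 := Nat.card_le_card_of_surjective
    (fun z : A × OD.cn p j => (⟨z.1⁻¹ * z.2, mul_mem (inv_mem (B.ax.le z.1.2)) (cn_le z.2.2)⟩ : p.1))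
    fun u => by
      obtain ⟨a, ha, hc⟩ := h1 u u.2
      exact ⟨(⟨a, ha⟩, ⟨_, hc⟩), Subtype.ext (by simp)⟩
  rw [Nat.card_prod, B.ax.card, h.card_cn_inv B.ne hj ho, h.card_sylow p] at h2
  norm_num at h2

end Base

/-- Coordinates on the quotient of a Sylow subgroup by the axis `A`, with the matrices of the
action of the two-point stabilizer. -/
structure Rep (p q : Sylow 31 G) (A : Subgroup G) (E : G → Fin 2 → ZMod 31)
    (ρ : G → Matrix (Fin 2) (Fin 2) (ZMod 31)) : Prop where
  surj : ∀ v, ∃ u ∈ p.1, E u = v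
  add : ∀ u ∈ p.1, ∀ v ∈ p.1, E (u * v) = E u + E v
  ker : ∀ u ∈ p.1, E u = 0 ↔ u ∈ A
  act : ∀ g ∈ Hs p q, ∀ u ∈ p.1, E (g * u * g⁻¹) = (ρ g).mulVec (E u)

theorem Base.exists_rep (B : Base p q A t) (h : Hyp G) (hexp : ∀ u ∈ p.1, u ^ 31 ∈ A) :
    ∃ E ρ, Rep p q A E ρ := by
  let N := A.subgroupOf p.1
  haveI hN : N.Normal := ⟨fun n hn g => by
    rw [mem_subgroupOf] at hn ⊢
    have := B.ax.cen _ hn g g.2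
    simpa [← this] using hn⟩
  have hmk : ∀ u v : p.1, (u : p.1 ⧸ N) = v ↔ (u : G)⁻¹ * v ∈ A := fun u v => QuotientGroup.eq
  obtain ⟨E₀, -, hadd, -⟩ := exists_coord (V := p.1 ⧸ N) (fun a b => by
      induction a using QuotientGroup.induction_on
      induction b using QuotientGroup.induction_on
      rename_i a b
      rw [← QuotientGroup.mk_mul, ← QuotientGroup.mk_mul, hmk]
      simpa [mul_assoc] using B.ax.comm _ (inv_mem b.2) _ (inv_mem a.2)) (fun a => by
      induction a using QuotientGroup.induction_on
      rename_i a
      rw [← QuotientGroup.mk_pow, QuotientGroup.eq_one_iff]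
      exact hexp a a.2) (by
      have h1 := card_eq_card_quotient_mul_card_subgroup N
      rw [Nat.card_congr (subgroupOfEquivOfLe B.ax.le).toEquiv, B.ax.card, h.card_sylow p] at h1
      omega)
  have h0 : E₀ 1 = 0 := by simpa using hadd 1 1
  classical
  let E : G → Fin 2 → ZMod 31 := fun u => if hu : u ∈ p.1 then E₀ (⟨u, hu⟩ : p.1) else 0
  have hE : ∀ u (hu : u ∈ p.1), E u = E₀ (⟨u, hu⟩ : p.1) := fun u hu => dif_pos hu
  have hs : ∀ v, ∃ u ∈ p.1, E u = v := fun v => by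
    obtain ⟨u, hu⟩ := QuotientGroup.mk_surjective (E₀.symm v)
    exact ⟨u, u.2, by rw [hE _ u.2, hu, Equiv.apply_symm_apply]⟩
  have ha : ∀ u ∈ p.1, ∀ v ∈ p.1, E (u * v) = E u + E v := fun u hu v hv => by
    rw [hE _ (mul_mem hu hv), hE u hu, hE v hv, ← hadd]
    rfl
  have hk : ∀ u ∈ p.1, E u = 0 ↔ u ∈ A := fun u hu => by
    rw [hE u hu, ← h0, E₀.injective.eq_iff, QuotientGroup.eq_one_iff]
    rfl
  have hinj : ∀ u ∈ p.1, ∀ v ∈ p.1, E u = E v → u * v⁻¹ ∈ A := fun u hu v hv e => by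
    rw [← hk _ (mul_mem hu (inv_mem hv))]
    have := ha _ (mul_mem hu (inv_mem hv)) v hv
    rw [inv_mul_cancel_right, e] at this
    simpa using this
  choose σ hσp hσ using hs
  have hM : ∀ g : G, ∃ M : Matrix (Fin 2) (Fin 2) (ZMod 31), g ∈ Hs p q → ∀ u ∈ p.1,
      E (g * u * g⁻¹) = M.mulVec (E u) := fun g => by
    by_cases hg : g ∈ Hs p q
    · have hwd : ∀ u ∈ p.1, ∀ v ∈ p.1, E u = E v → E (g * u * g⁻¹) = E (g * v * g⁻¹) :=
        fun u hu v hv e => by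
          have h1 := (hk _ (B.ax.le (B.conj_mem hg (hinj u hu v hv e)))).mpr
            (B.conj_mem hg (hinj u hu v hv e))
          have h2 := ha _ (B.ax.le (B.conj_mem hg (hinj u hu v hv e))) _ (B.conj_sylow hg hv)
          rw [h1, zero_add] at h2
          rw [← h2]
          congr 1
          group
      let f : (Fin 2 → ZMod 31) →+ (Fin 2 → ZMod 31) := AddMonoidHom.mk' (fun v => E (g * σ v * g⁻¹))
        fun v w => by
          rw [← ha _ (B.conj_sylow hg (hσp _)) _ (B.conj_sylow hg (hσp _)),
            hwd _ (hσp _) _ (mul_mem (hσp v) (hσp w)) (by rw [ha _ (hσp _) _ (hσp _), hσ, hσ, hσ])]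
          congr 1
          group
      refine ⟨LinearMap.toMatrix' (f.toZModLinearMap 31), fun _ u hu => ?_⟩
      rw [LinearMap.toMatrix'_mulVec]
      exact hwd u hu _ (hσp _) (hσ _).symm
    · exact ⟨0, fun h => absurd h hg⟩
  choose ρ hρ using hM
  exact ⟨E, ρ, ⟨fun v => ⟨σ v, hσp v, hσ v⟩, ha, hk, fun g hg u hu => hρ g hg u hu⟩⟩

namespace Rep

variable {E : G → Fin 2 → ZMod 31} {ρ : G → Matrix (Fin 2) (Fin 2) (ZMod 31)} (R : Rep p q A E ρ)
  (B : Base p q A t)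
include R

theorem ext_mat (hg : g ∈ Hs p q) {M : Matrix (Fin 2) (Fin 2) (ZMod 31)}
    (hM : ∀ u ∈ p.1, E (g * u * g⁻¹) = M.mulVec (E u)) : ρ g = M := by
  refine Matrix.toLin'.injective (LinearMap.ext fun v => ?_)
  obtain ⟨u, hu, rfl⟩ := R.surj v
  rw [Matrix.toLin'_apply, Matrix.toLin'_apply, ← R.act g hg u hu, hM u hu]

theorem one : ρ 1 = 1 := R.ext_mat (one_mem _) fun u _ => by simp

include B

theorem mul (hg : g ∈ Hs p q) (hj : j ∈ Hs p q) : ρ (g * j) = ρ g * ρ j :=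
  R.ext_mat (mul_mem hg hj) fun u hu => by
    rw [← Matrix.mulVec_mulVec, ← R.act j hj u hu, ← R.act g hg _ (B.conj_sylow hj hu)]
    congr 1
    group

theorem pow (hg : g ∈ Hs p q) (n : ℕ) : ρ (g ^ n) = ρ g ^ n := by
  induction n with
  | zero => simpa using R.one
  | succ n ih => rw [pow_succ, R.mul B ((Hs p q).pow_mem hg n) hg, ih, pow_succ]

theorem neg (hu : u ∈ p.1) : E u⁻¹ = -E u := by
  have h1 := R.add _ (inv_mem hu) u hu
  rw [inv_mul_cancel, (R.ker 1 (one_mem _)).mpr (one_mem _)] at h1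
  exact (neg_eq_of_add_eq_zero_left h1.symm).symm

theorem eq_one_iff (hg : g ∈ Hs p q) : ρ g = 1 ↔ ∀ u ∈ p.1, g * u * g⁻¹ * u⁻¹ ∈ A := by
  refine ⟨fun e u hu => ?_, fun hg' => R.ext_mat hg fun u hu => ?_⟩
  · rw [← R.ker _ (mul_mem (B.conj_sylow hg hu) (inv_mem hu)),
      R.add _ (B.conj_sylow hg hu) _ (inv_mem hu), R.neg B hu, R.act g hg u hu, e]
    simp
  · have h1 := (R.ker _ (B.ax.le (hg' u hu))).mpr (hg' u hu)
    rw [R.add _ (B.conj_sylow hg hu) _ (inv_mem hu), R.neg B hu] at h1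
    rw [Matrix.one_mulVec]
    exact add_neg_eq_zero.mp h1

theorem map_t : ρ t = -1 := R.ext_mat B.mem fun u hu => by
  have h1 := (R.ker _ (B.ax.le (B.inverts hu))).mpr (B.inverts hu)
  have h2 := B.conj_sylow B.mem hu
  rw [B.inv] at h2 ⊢
  rw [R.add _ h2 _ hu] at h1
  rw [Matrix.neg_mulVec, Matrix.one_mulVec]
  exact eq_neg_of_add_eq_zero_left h1

theorem eq_one (h : Hyp G) (hg : g ∈ Hs p q) (hgA : g ∈ cz(A)) (e : ρ g = 1) : g = 1 :=
  h.eq_one_of_trivial B.ne B.ax hg (fun a ha => (mem_centralizer_iff.mp hgA a ha).symm)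
    ((R.eq_one_iff B hg).mp e)

end Rep

namespace Base

variable (B : Base p q A t)
include B

theorem pow_mem_of_nontrivial (h : Hyp G) (hs : s ∈ Hs p q) (hn : ∃ u ∈ p.1, s * u * s⁻¹ * u⁻¹ ∉ A)
    {w : G} (hw : w ∈ p.1) (hsw : s * w * s⁻¹ * w⁻¹ ∈ A) : w ^ 31 ∈ A := by
  let P : Subgroup G :=
    { carrier := {u | u ∈ p.1 ∧ s * u * s⁻¹ * u⁻¹ ∈ A}
      one_mem' := ⟨one_mem _, by simp⟩
      mul_mem' := fun {a b} ha hb => ⟨mul_mem ha.1 hb.1, by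
        have h1 := mul_mem ha.2 hb.2
        have h2 := B.ax.cen _ hb.2 a ha.1
        have : s * (a * b) * s⁻¹ * (a * b)⁻¹
          = s * a * s⁻¹ * a⁻¹ * (a * (s * b * s⁻¹ * b⁻¹)) * a⁻¹ := by group
        rwa [this, ← h2, ← mul_assoc, mul_inv_cancel_right]⟩
      inv_mem' := fun {a} ha => ⟨inv_mem ha.1, by
        have h1 := inv_mem ha.2
        have h2 := B.ax.cen _ h1 a⁻¹ (inv_mem ha.1)
        have : s * a⁻¹ * s⁻¹ * a⁻¹⁻¹ = a⁻¹ * (s * a * s⁻¹ * a⁻¹)⁻¹ * a := by group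
        rwa [this, ← h2, inv_mul_cancel_right]⟩ }
  have hPp : P ≤ p.1 := fun x hx => hx.1
  have hAP : A ≤ P := fun a ha => ⟨B.ax.le ha, mul_mem (B.conj_mem hs ha) (inv_mem ha)⟩
  haveI hN : (A.subgroupOf P).Normal := ⟨fun n hn g => by
    rw [mem_subgroupOf] at hn ⊢
    have := B.ax.cen _ hn g (hPp g.2)
    simpa [← this] using hn⟩
  have h1 := card_eq_relIndex_mul A P
  rw [inf_eq_left.mpr hAP, B.ax.card] at h1
  have h2 : A.relIndex P ∣ 31 := by
    rcases card_cases (h.card_sylow p) hPp with e | e | e | e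
    · omega
    · exact ⟨31, by omega⟩
    · exact ⟨1, by omega⟩
    · obtain ⟨u, hu, hu'⟩ := hn
      have := Subgroup.eq_of_le_of_card_ge hPp (by rw [e, h.card_sylow])
      exact absurd (this ▸ hu : u ∈ P).2 hu'
  obtain ⟨d, hd⟩ := h2
  have h3 := (A.subgroupOf P).pow_index_mem (⟨w, hw, hsw⟩ : P)
  have h4 : w ^ A.relIndex P ∈ A := h3
  rw [hd, pow_mul]
  exact A.pow_mem h4 d

theorem not_commute (h : Hyp G) (hy : orderOf g = 3 ∨ orderOf g = 5) (hg : g ∈ cz(A)) : False := by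
  obtain ⟨a, ha, hao⟩ := exists_mem_orderOf p31 (C := A) (by rw [B.ax.card])
  rw [h.fpf hy (B.ax.le ha) (mem_centralizer_iff.mp hg a ha).symm] at hao
  simp at hao

theorem card_K (h : Hyp G) : Nat.card (cz(A) ⊓ Hs p q : Subgroup G) = 32 ∨
    Nat.card (cz(A) ⊓ Hs p q : Subgroup G) = 64 := by
  obtain ⟨d, hd, e⟩ := h.card_inf_cz B.ne B.ax B.nz
  have h3 : ¬ 3 ∣ d := fun hd3 => by
    obtain ⟨y, hy, ho⟩ := exists_mem_orderOf p3 (C := cz(A) ⊓ Hs p q) (e ▸ hd3.mul_left 32)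
    exact B.not_commute h (Or.inl ho) hy.1
  have h5 : ¬ 5 ∣ d := fun hd5 => by
    obtain ⟨y, hy, ho⟩ := exists_mem_orderOf p5 (C := cz(A) ⊓ Hs p q) (e ▸ hd5.mul_left 32)
    exact B.not_commute h (Or.inr ho) hy.1
  have hle := Nat.le_of_dvd (by norm_num) hd
  interval_cases d <;> omega

theorem le_nz_K : Hs p q ≤ nz(cz(A) ⊓ Hs p q) := fun _ hg => mem_normalizer_of_forall fun _ hk =>
  ⟨B.conj_mem_cz hg hk.1, mul_mem (mul_mem hg hk.2) ((Hs p q).inv_mem hg)⟩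

theorem mul_invol (h : Hyp G) (hj : j ∈ Hs p q) (ho : orderOf j = 2) (hne : j ≠ t) :
    orderOf (t * j) = 2 := by
  refine orderOf_eq_prime ?_ fun e => hne ?_
  · rw [pow_two, mul_assoc, ← mul_assoc j, B.central h hj, ← mul_assoc, ← mul_assoc, B.sq, one_mul,
      mul_self_of_orderOf ho]
  · rw [eq_inv_of_mul_eq_one_right e, B.inv]

theorem pow_mem (h : Hyp G) (hj : j ∈ Hs p q) (ho : orderOf j = 2) (hne : j ≠ t) (hu : u ∈ p.1) :
    u ^ 31 ∈ A := by
  have ho' := B.mul_invol h hj ho hne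
  have hjj := mul_self_of_orderOf ho
  have hji := inv_of_orderOf ho
  obtain ⟨v, hvd⟩ : ∃ v, v = j * u * j := ⟨_, rfl⟩
  have hv : v ∈ p.1 := by simpa [hji, hvd] using B.conj_sylow hj hu
  have hjv : j * v * j = u := by
    rw [hvd]
    calc j * (j * u * j) * j = j * j * u * (j * j) := by group
      _ = u := by rw [hjj]; simp
  have e1 : (u * v) ^ 31 ∈ A := B.pow_mem_of_nontrivial h hj (B.not_trivial h hj ho) (mul_mem hu hv) (by
    have : j * (u * v) * j⁻¹ * (u * v)⁻¹ = v * u * v⁻¹ * u⁻¹ := by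
      calc j * (u * v) * j⁻¹ * (u * v)⁻¹ = (j * u * j) * (j⁻¹ * v * j⁻¹) * v⁻¹ * u⁻¹ := by group
        _ = _ := by rw [hji, hjv, ← hvd]
    rw [this]
    exact B.ax.comm _ hv _ hu)
  have e2 : (u * v⁻¹) ^ 31 ∈ A := B.pow_mem_of_nontrivial h (mul_mem B.mem hj)
    (B.not_trivial h (mul_mem B.mem hj) ho') (mul_mem hu (inv_mem hv)) (by
      have : t * j * (u * v⁻¹) * (t * j)⁻¹ * (u * v⁻¹)⁻¹ = t * (v * u⁻¹) * t * (v * u⁻¹) := by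
        calc _ = t * ((j * u * j⁻¹) * (j * v * j⁻¹)⁻¹) * t⁻¹ * (v * u⁻¹) := by group
          _ = _ := by rw [hji, hjv, ← hvd, B.inv]
      rw [this]
      exact B.inverts (mul_mem hv (inv_mem hu)))
  obtain ⟨c, hc, hc'⟩ := B.ax.mul_pow hu hv 31
  obtain ⟨d, hd, hd'⟩ := B.ax.mul_pow hu (inv_mem hv) 31
  have e3 : u ^ 31 * v ^ 31 ∈ A := by
    rw [hc'] at e1; exact (A.mul_mem_cancel_left hc).mp e1
  have e4 : u ^ 31 * v⁻¹ ^ 31 ∈ A := by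
    rw [hd'] at e2; exact (A.mul_mem_cancel_left hd).mp e2
  have e5 : u ^ 62 ∈ A := by
    have h1 := mul_mem e3 e4
    have h2 := B.ax.cen _ e4 _ (p.1.pow_mem hv 31)
    rw [mul_assoc, ← h2, inv_pow, inv_mul_cancel_right, ← pow_add] at h1
    exact h1
  have h3 : u ^ 29791 = 1 := h.pow_mem hu
  have h4 := A.pow_mem e5 481
  rwa [← pow_mul, show 62 * 481 = 29791 + 31 from rfl, pow_add, h3, one_mul] at h4

/-- A two-point stabilizer has a unique involution. -/
theorem uniq (h : Hyp G) (hj : j ∈ Hs p q) (ho : orderOf j = 2) : j = t := by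
  by_contra hne
  obtain ⟨E, ρ, R⟩ := B.exists_rep h fun u hu => B.pow_mem h hj ho hne hu
  obtain ⟨K, hKd⟩ : ∃ K, K = cz(A) ⊓ Hs p q := ⟨_, rfl⟩
  have hK : ∀ k ∈ K, k ∈ cz(A) ∧ k ∈ Hs p q := fun k hk => by rw [hKd] at hk; exact hk
  have hjK : j ∉ K := fun hk => hne (B.cz_eq h hj ho (hK j hk).1)
  have hjj := mul_self_of_orderOf ho
  have hji := inv_of_orderOf ho
  have hconj : ∀ k ∈ K, j * k * j ∈ K := fun k hk => by
    have h1 := B.conj_mem_cz hj (hK k hk).1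
    rw [hji] at h1
    rw [hKd]
    exact ⟨h1, mul_mem (mul_mem hj (hK k hk).2) hj⟩
  have hcard : Nat.card K = 32 := by
    rw [hKd]
    refine (B.card_K h).resolve_right fun e => ?_
    rw [← hKd] at e
    have hS : IsSyl 2 K (Hs p q) := isSyl_of_card (a := 6) (c := 15) Nat.prime_two
      (fun x hx => (hK x hx).2) (by rw [e]; rfl) (by rw [h.card_Hs B.ne]; rfl) (by norm_num)
    refine hjK (hS.le_of_normal Nat.prime_two (hKd ▸ B.le_nz_K) (zpowers_le.mpr hj) ?_
      (mem_zpowers j))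
    exact IsPGroup.of_card (n := 1) (by rw [Nat.card_zpowers, ho]; rfl)
  have hpow : ∀ k ∈ K, k ^ 32 = 1 := fun k hk => hcard ▸ pow_natCard_of_mem hk
  have hdet : (ρ j).det = -1 := by
    refine det_of_sq (by rw [← R.mul B hj hj, hjj, R.one]) (fun e => ?_) fun e => ?_
    · obtain ⟨u, hu, hu'⟩ := B.not_trivial h hj ho
      exact hu' ((R.eq_one_iff B hj).mp e u hu)
    · obtain ⟨u, hu, hu'⟩ := B.not_trivial h (mul_mem B.mem hj) (B.mul_invol h hj ho hne)
      refine hu' ((R.eq_one_iff B (mul_mem B.mem hj)).mp ?_ u hu)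
      rw [R.mul B B.mem hj, R.map_t B, e]
      simp
  have hdk : ∀ k ∈ K, (ρ k).det = 1 := fun k hk => by
    have h1 : ρ k ^ 32 = 1 := by rw [← R.pow B (hK k hk).2, hpow k hk, R.one]
    have h2 : (ρ k).det ^ 32 = 1 := by rw [← Matrix.det_pow, h1, Matrix.det_one]
    rcases (by decide +kernel : ∀ x : ZMod 31, x ^ 32 = 1 → x = 1 ∨ x = -1) _ h2 with e | e
    · exact e
    · have h3 := sq_eq_one_of_det e h1
      rw [← R.pow B (hK k hk).2] at h3
      have h4 := R.eq_one B h ((Hs p q).pow_mem (hK k hk).2 2) (cz(A).pow_mem (hK k hk).1 2) h3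
      by_cases hk1 : k = 1
      · rw [hk1, R.one, Matrix.det_one]
      · rw [B.cz_eq h (hK k hk).2 (orderOf_eq_prime h4 hk1) (hK k hk).1, R.map_t B]
        simp [Matrix.det_fin_two]
  have hinv : ∀ k ∈ K, orderOf (k * j) = 2 := fun k hk => by
    have hx : k * j ∈ Hs p q := mul_mem (hK k hk).2 hj
    have hx2 : (k * j) ^ 2 ∈ K := by
      have := mul_mem hk (hconj k hk)
      rwa [pow_two, mul_assoc k j, ← mul_assoc j]
    have hx64 : (k * j) ^ 64 = 1 := by
      rw [show 64 = 2 * 32 from rfl, pow_mul, hpow _ hx2]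
    have hx32 : (k * j) ^ 32 = 1 := by
      by_contra hx32
      have ho64 : orderOf ((k * j) ^ 2) = 32 :=
        orderOf_eq_prime_pow (p := 2) (n := 4) (by rwa [← pow_mul]) (by rwa [← pow_mul])
      have hz : K = zpowers ((k * j) ^ 2) := by
        refine (Subgroup.eq_of_le_of_card_ge (zpowers_le.mpr hx2) ?_).symm
        rw [Nat.card_zpowers, ho64, hcard]
      obtain ⟨n, hn⟩ := mem_zpowers_iff.mp (hz ▸ hk : k ∈ zpowers _)
      have hc : Commute k (k * j) := by
        have := ((Commute.refl (k * j)).pow_left 2).zpow_left n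
        rwa [hn] at this
      refine hx32 ?_
      have h1 : j = k⁻¹ * (k * j) := by group
      have h2 := hc.inv_left.mul_pow 32
      rwa [← h1, inv_pow, hpow k hk, inv_one, one_mul, show 32 = 2 * 16 from rfl, pow_mul, pow_two,
        hjj, one_pow, eq_comm] at h2
    have h1 := sq_eq_one_of_det (M := ρ (k * j)) (by
      rw [R.mul B (hK k hk).2 hj, Matrix.det_mul, hdk k hk, hdet, one_mul]) (by
      rw [← R.pow B hx, hx32, R.one])
    rw [← R.pow B hx] at h1
    refine orderOf_eq_prime (R.eq_one B h (hK _ hx2).2 (hK _ hx2).1 h1) fun e => hjK ?_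
    rw [eq_inv_of_mul_eq_one_right e]
    exact inv_mem hk
  have h33 : (insert t ((· * j) '' (K : Set G))).ncard = 33 := by
    rw [Set.ncard_insert_of_notMem, Set.ncard_image_of_injective _ (mul_left_injective j),
      ← Nat.card_coe_set_eq, SetLike.coe_sort_coe, hcard]
    rintro ⟨k, hk, e⟩
    refine hjK ?_
    have : j = k⁻¹ * t := by rw [← e]; group
    rw [this, hKd]
    exact mul_mem (inv_mem (hKd ▸ hk)) ⟨B.mem_cz, B.mem⟩
  have h32 := Set.ncard_le_ncard (s := insert t ((· * j) '' (K : Set G)))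
    (t := {j : G | j ∈ Hs p q ∧ orderOf j = 2}) (by
      rintro x (rfl | ⟨k, hk, rfl⟩)
      · exact ⟨B.mem, B.ord⟩
      · exact ⟨mul_mem (hK k hk).2 hj, hinv k hk⟩) (Set.toFinite _)
  have := h.ncard_inv_le B.ne
  omega

end Base

end UniqueInvolution

section Rotation

variable {G : Type*} [Group G] [Finite G] {p q r : Sylow 31 G} {g t j k y z : G}

theorem dvd_of_semireg {α : Type*} [Finite α] [MulAction G α] {C : Subgroup G} {S : Set α}
    (hS : ∀ g ∈ C, ∀ x ∈ S, g • x ∈ S) (hf : ∀ g ∈ C, ∀ x ∈ S, g • x = x → g = 1) :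
    Nat.card C ∣ S.ncard := by
  rw [← Nat.card_coe_set_eq]
  refine dvd_card_of_dvd_orbit (G := C) (fun g x hx => hS g g.2 x hx) fun x hx => ?_
  rw [show MulAction.stabilizer C x = ⊥ from ?_, index_bot]
  exact (eq_bot_iff_forall _).mpr fun g hg => Subtype.ext (hf g g.2 x hx hg)

theorem dvd_moved {α : Type*} [Finite α] [MulAction G α] {l : ℕ} (hl : l.Prime)
    (hy : orderOf y = l) {S : Set α} (hS : ∀ x ∈ S, y • x ∈ S) :
    l ∣ {x | x ∈ S ∧ y • x ≠ x}.ncard := by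
  haveI := Fact.mk hl
  have key : ∀ n : ℕ, ∀ x ∈ S, y ^ n • x ∈ S := fun n => by
    induction n with
    | zero => simp
    | succ n ih => intro x hx; rw [pow_succ', mul_smul]; exact hS _ (ih x hx)
  rw [← hy, ← Nat.card_zpowers]
  refine dvd_of_semireg (fun g hg x hx => ?_) fun g hg x hx e => ?_
  · obtain ⟨n, rfl⟩ := mem_powers_iff_mem_zpowers.mpr hg
    refine ⟨key n x hx.1, fun e => hx.2 ?_⟩
    rw [← mul_smul, ← pow_succ', pow_succ, mul_smul] at e
    exact smul_left_cancel _ e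
  · by_contra hne
    have h1 : y ∈ zpowers (⟨g, hg⟩ : zpowers y).1 := by
      have := mem_zpowers_of_prime_card (G := zpowers y) (p := l) (by rw [Nat.card_zpowers, hy])
        (g := ⟨g, hg⟩) (g' := ⟨y, mem_zpowers y⟩) fun e => hne (congrArg Subtype.val e)
      obtain ⟨n, hn⟩ := this
      exact ⟨n, congrArg Subtype.val hn⟩
    exact hx.2 ((zpowers_le (H := MulAction.stabilizer G x)).mpr e h1)

theorem Hyp.exists_inv (h : Hyp G) (hpq : p ≠ q) : ∃ t ∈ Hs p q, orderOf t = 2 ∧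
    (Fx t).ncard = 32 ∧ ∀ j ∈ Hs p q, orderOf j = 2 → j = t := by
  obtain ⟨A, t, B⟩ := h.exists_base hpq
  exact ⟨t, B.mem, B.ord, by rw [h.ncard_Fx hpq B.mem, B.cn, B.ax.card],
    fun j hj ho => B.uniq h hj ho⟩

theorem Hyp.inv_eq (h : Hyp G) (hpq : p ≠ q) (hj : j ∈ Hs p q) (ho : orderOf j = 2)
    (hk : k ∈ Hs p q) (ho' : orderOf k = 2) : j = k := by
  obtain ⟨t, -, -, -, ht⟩ := h.exists_inv hpq
  rw [ht j hj ho, ht k hk ho']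

theorem Hyp.comm_inv (h : Hyp G) (hpq : p ≠ q) (hj : j ∈ Hs p q) (ho : orderOf j = 2)
    (hg : g ∈ Hs p q) : g * j = j * g := by
  have := h.inv_eq hpq (mul_mem (mul_mem hg hj) ((Hs p q).inv_mem hg))
    ((orderOf_conj g j).trans ho) hj ho
  rwa [mul_inv_eq_iff_eq_mul] at this

/-- The triple is fixed by an involution. -/
def Col (p q r : Sylow 31 G) : Prop := ∃ j : G, orderOf j = 2 ∧ j • p = p ∧ j • q = q ∧ j • r = r

theorem Col.smul (g : G) (hc : Col p q r) : Col (g • p) (g • q) (g • r) := by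
  obtain ⟨j, h0, h1, h2, h3⟩ := hc
  exact ⟨g * j * g⁻¹, (orderOf_conj g j).trans h0, by simp [mul_smul, h1], by simp [mul_smul, h2],
    by simp [mul_smul, h3]⟩

theorem col_smul (g : G) : Col (g • p) (g • q) (g • r) ↔ Col p q r :=
  ⟨fun hc => by simpa using hc.smul g⁻¹, fun hc => hc.smul g⟩

theorem Hyp.col_self (h : Hyp G) (p q : Sylow 31 G) : Col p q q := by
  by_cases e : p = q
  · obtain ⟨x, hx⟩ : ∃ x : Sylow 31 G, q ≠ x := by
      haveI : Nontrivial (Sylow 31 G) := Finite.one_lt_card_iff_nontrivial.mp (by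
        rw [h.card_points]; norm_num)
      obtain ⟨x, hx⟩ := exists_ne q
      exact ⟨x, hx.symm⟩
    obtain ⟨t, ht, ho, -⟩ := h.exists_inv hx
    exact ⟨t, ho, by rw [e]; exact ht.1, ht.1, ht.1⟩
  · obtain ⟨t, ht, ho, -⟩ := h.exists_inv e
    exact ⟨t, ho, ht.1, ht.2, ht.2⟩

theorem Hyp.not_col_iff (h : Hyp G) (hpq : p ≠ q) (ht : t ∈ Hs p q) (ho : orderOf t = 2) :
    Col p q r ↔ t • r = r :=
  ⟨fun ⟨_, h0, h1, h2, h3⟩ => h.inv_eq hpq ⟨h1, h2⟩ h0 ht ho ▸ h3, fun e => ⟨t, ho, ht.1, ht.2, e⟩⟩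

theorem col_rot (hc : Col p q r) : Col q r p :=
  let ⟨j, h0, h1, h2, h3⟩ := hc; ⟨j, h0, h2, h3, h1⟩

theorem col_swap (hc : Col p q r) : Col q p r :=
  let ⟨j, h0, h1, h2, h3⟩ := hc; ⟨j, h0, h2, h1, h3⟩

theorem Hyp.ne_of_not_col (h : Hyp G) (hc : ¬ Col p q r) : p ≠ q ∧ p ≠ r ∧ q ≠ r := by
  refine ⟨?_, ?_, ?_⟩ <;> rintro rfl
  · exact hc (col_rot (h.col_self r p))
  · exact hc (col_swap (h.col_self q p))
  · exact hc (h.col_self p q)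

theorem Hyp.eq_one_of_fix3 (h : Hyp G) (hc : ¬ Col p q r) (h1 : g • p = p) (h2 : g • q = q)
    (h3 : g • r = r) : g = 1 := by
  by_contra hne
  obtain ⟨hpq, hpr, hqr⟩ := h.ne_of_not_col hc
  obtain ⟨l, hl, hd⟩ := Nat.exists_prime_and_dvd (mt orderOf_eq_one_iff.mp hne)
  have h960 : l ∣ 960 := by
    rw [← h.card_Hs hpq]
    exact hd.trans (Subgroup.orderOf_dvd_natCard _ (mem_Hs.mpr ⟨h1, h2⟩))
  obtain ⟨n, hn⟩ : ∃ n, orderOf (g ^ n) = l :=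
    ⟨orderOf g / l, orderOf_pow_orderOf_div (orderOf_pos g).ne' hd⟩
  have hf : ∀ x : Sylow 31 G, g • x = x → g ^ n • x = x := fun x hx =>
    (MulAction.stabilizer G x).pow_mem hx n
  have hl' : l = 2 ∨ l = 3 ∨ l = 5 := by
    rw [show 960 = 2 ^ 6 * (3 * 5) by norm_num, hl.dvd_mul, hl.dvd_mul] at h960
    rcases h960 with e | e | e
    · exact .inl ((Nat.prime_dvd_prime_iff_eq hl Nat.prime_two).mp (hl.dvd_of_dvd_pow e))
    · exact .inr (.inl ((Nat.prime_dvd_prime_iff_eq hl p3).mp e))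
    · exact .inr (.inr ((Nat.prime_dvd_prime_iff_eq hl p5).mp e))
  rcases hl' with rfl | hl'
  · exact hc ⟨_, hn, hf p h1, hf q h2, hf r h3⟩
  · rcases h.fix_of_odd (hn ▸ hl') hpq ⟨hf p h1, hf q h2⟩ (hf r h3) with e | e
    · exact hpr e.symm
    · exact hqr e.symm

theorem Hyp.Fx_odd (h : Hyp G) (hpq : p ≠ q) (hy : orderOf y = 3) (hm : y ∈ Hs p q) :
    Fx y = {p, q} := by
  ext r
  refine ⟨h.fix_of_odd (.inl hy) hpq hm, ?_⟩
  rintro (rfl | rfl)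
  · exact hm.1
  · exact hm.2

theorem smul_three (hy : orderOf y = 3) (r : Sylow 31 G) : y • y • y • r = r := by
  rw [← mul_smul, ← mul_smul, mul_assoc, ← pow_three, ← hy, pow_orderOf_eq_one, one_smul]

theorem Hyp.col_orbit_iff (h : Hyp G) (hpq : p ≠ q) (hy : orderOf y = 3) (hm : y ∈ Hs p q)
    (ht : t ∈ Hs p q) (ho : orderOf t = 2) : Col r (y • r) (y • y • r) ↔ t • r = r := by
  have hyt := h.comm_inv hpq ht ho hm
  have hstep : ∀ x : Sylow 31 G, t • x = x → t • y • x = y • x := fun x hx => by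
    rw [← mul_smul, ← hyt, mul_smul, hx]
  constructor
  · rintro ⟨j, h0, h1, h2, h3⟩
    by_cases hr : y • r = r
    · rcases h.fix_of_odd (.inl hy) hpq hm hr with rfl | rfl
      exacts [ht.1, ht.2]
    have hy3 := smul_three hy r
    have hc : y * j * y⁻¹ = j := by
      refine h.inv_eq (fun e => hr (smul_left_cancel y e).symm) (p := y • r) (q := y • y • r)
        (smul_mem_Hs (mem_Hs.mpr ⟨h1, h2⟩) y) ((orderOf_conj y j).trans h0) ⟨h2, h3⟩ h0
    rw [mul_inv_eq_iff_eq_mul] at hc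
    have h32 : (Fx j).ncard = 32 := by
      obtain ⟨t', ht', -, h32, hu⟩ := h.exists_inv (Ne.symm hr)
      rw [hu j ⟨h1, h2⟩ h0, h32]
    have hdv := dvd_moved p3 hy (S := Fx j) fun x hx => by
      rw [mem_Fx, ← mul_smul, ← hc, mul_smul, mem_Fx.mp hx]
    have hsub : p ∈ Fx j ∧ q ∈ Fx j := by
      have h1 := Set.ncard_inter_add_ncard_sdiff_eq_ncard (Fx j) (Fx y)
      rw [show Fx j \ Fx y = {x | x ∈ Fx j ∧ y • x ≠ x} from rfl, h32] at h1
      have h2 : Fx j ∩ Fx y ⊆ {p, q} := h.Fx_odd hpq hy hm ▸ Set.inter_subset_right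
      have h3 := Set.ncard_le_ncard h2 (Set.toFinite _)
      rw [Set.ncard_pair hpq] at h3
      have h4 := Set.eq_of_subset_of_ncard_le h2 (by rw [Set.ncard_pair hpq]; omega) (Set.toFinite _)
      have h5 : {p, q} ⊆ Fx j := h4 ▸ Set.inter_subset_left
      exact ⟨h5 (.inl rfl), h5 (.inr rfl)⟩
    rw [← h.inv_eq hpq hsub h0 ht ho, h1]
  · exact fun e => ⟨t, ho, e, hstep _ e, hstep _ (hstep _ e)⟩

theorem conj_mem_three : ∀ x ∈ {x : G | orderOf x = 3}, ∀ g : G, g * x * g⁻¹ ∈ {x : G | orderOf x = 3} :=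
  fun x hx g => (orderOf_conj g x).trans hx

theorem Hyp.rot_count (h : Hyp G) (hpq : p ≠ q) :
    {y : G | orderOf y = 3 ∧ y ∈ Hs p q}.ncard = 2 ∧
    ∀ r, ¬ Col p q r → ∃ y : G, orderOf y = 3 ∧ y • p = q ∧ y • q = r := by
  obtain ⟨t, ht, ho, h32, -⟩ := h.exists_inv hpq
  have h1 := double_count (X := Sylow 31 G) (fun a b a' b' => h.exists_pair) conj_mem_three
    (r := fun x a b => a ∈ Fx x ∧ b ∈ Fx x) (a := 2)
    (fun x a b g hx => by simpa [mem_Fx_conj] using hx)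
    (fun x hx => by
      obtain ⟨a, b, hab, hm⟩ := h.exists_fix (.inl hx)
      rw [ncard_pairs, h.Fx_odd hab hx hm, Set.ncard_pair hab]) hpq
  have h2 := double_count (X := Sylow 31 G) (fun a b a' b' => h.exists_pair) conj_mem_three
    (r := fun x a b => x • a = b ∧ ¬ Col a (x • a) (x • x • a)) (a := 29760)
    (fun x a b g hx => by
      refine ⟨by simp [mul_smul, hx.1], fun hc => hx.2 ?_⟩
      rw [← col_smul g]
      simpa [mul_smul] using hc)
    (fun x hx => by
      refine (ncard_graph (fun y => x • y) fun a => ¬ Col a (x • a) (x • x • a)).trans ?_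
      obtain ⟨a, b, hab, hm⟩ := h.exists_fix (.inl hx)
      obtain ⟨j, hj, hjo, hj32, -⟩ := h.exists_inv hab
      have := Set.ncard_add_ncard_compl (Fx j)
      rw [h.card_points, hj32] at this
      rw [show {z : Sylow 31 G | x • z ≠ z ∧ ¬ Col z (x • z) (x • x • z)} = (Fx j)ᶜ from ?_]
      · omega
      ext z
      simp only [Set.mem_ofPred_eq, Set.mem_compl_iff, mem_Fx, h.col_orbit_iff hab hx hm hj hjo]
      refine ⟨fun hz => hz.2, fun hz => ⟨fun e => ?_, hz⟩⟩
      rcases h.fix_of_odd (.inl hx) hab hm e with rfl | rfl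
      exacts [hz hj.1, hz hj.2]) hpq
  have e1 : {x : G | x ∈ {x : G | orderOf x = 3} ∧ (p ∈ Fx x ∧ q ∈ Fx x)}
    = {y : G | orderOf y = 3 ∧ y ∈ Hs p q} := rfl
  rw [e1, h.card_points] at h1
  rw [h.card_points] at h2
  obtain ⟨M, hM⟩ : ∃ M, M = {x : G | x ∈ {x : G | orderOf x = 3} ∧
    (x • p = q ∧ ¬ Col p (x • p) (x • x • p))} := ⟨_, rfl⟩
  rw [← hM] at h2
  have h3 : 2 ≤ {y : G | orderOf y = 3 ∧ y ∈ Hs p q}.ncard := by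
    obtain ⟨y, hy, hyo⟩ := exists_mem_orderOf p3 (C := Hs p q) (by rw [h.card_Hs hpq]; norm_num)
    have hne : y ≠ y⁻¹ := fun e => by
      have := orderOf_dvd_of_pow_eq_one (show y ^ 2 = 1 by rw [sq]; nth_rw 2 [e]; simp)
      rw [hyo] at this; norm_num at this
    rw [← Set.ncard_pair hne]
    refine Set.ncard_le_ncard ?_ (Set.toFinite _)
    rintro x (rfl | rfl)
    · exact ⟨hyo, hy⟩
    · exact ⟨by rw [orderOf_inv, hyo], (Hs p q).inv_mem hy⟩
  have hmaps : ∀ y ∈ M, y • q ∈ (Fx t)ᶜ := fun y hy => by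
    rw [hM] at hy
    rw [Set.mem_compl_iff, mem_Fx, ← h.not_col_iff hpq ht ho]
    have := hy.2.2
    rwa [hy.2.1] at this
  have hinj : Set.InjOn (fun y : G => y • q) M := fun y hy z hz e => by
    have e : y • q = z • q := e
    rw [hM] at hy hz
    have hc := hy.2.2
    rw [hy.2.1] at hc
    have h3 : ∀ x : G, orderOf x = 3 → x • p = q → x • x • q = p := fun x hx hxp => by
      rw [← hxp, smul_three hx]
    have hyr := h3 y hy.1 hy.2.1
    have hzr := h3 z hz.1 hz.2.1
    have := h.eq_one_of_fix3 hc (g := z⁻¹ * y)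
      (by rw [mul_smul, hy.2.1, ← hz.2.1, inv_smul_smul]) (by rw [mul_smul, e, inv_smul_smul])
      (by rw [mul_smul, hyr, inv_smul_eq_iff, e, hzr])
    exact (inv_mul_eq_one.mp this).symm
  have h4 := Set.ncard_le_ncard_of_injOn _ hmaps hinj (Set.toFinite _)
  have h5 := Set.ncard_add_ncard_compl (Fx t)
  rw [h.card_points, h32] at h5
  have h6 : M.ncard = 29760 ∧ {y : G | orderOf y = 3 ∧ y ∈ Hs p q}.ncard = 2 := by omega
  refine ⟨h6.2, fun r hr => ?_⟩
  have h7 : (fun y : G => y • q) '' M = (Fx t)ᶜ :=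
    Set.eq_of_subset_of_ncard_le (Set.image_subset_iff.mpr hmaps) (by
      rw [hinj.ncard_image]; omega) (Set.toFinite _)
  have h8 : r ∈ (Fx t)ᶜ := fun hx => hr ((h.not_col_iff hpq ht ho).mpr hx)
  rw [← h7] at h8
  obtain ⟨y, hy, e⟩ := h8
  rw [hM] at hy
  exact ⟨y, hy.1, hy.2.1, e⟩

/-- Every triple not fixed by an involution is rotated. -/
theorem Hyp.exists_rot (h : Hyp G) (hc : ¬ Col p q r) :
    ∃ y : G, y • p = q ∧ y • q = r ∧ y • r = p := by
  obtain ⟨y, hy, h1, h2⟩ := (h.rot_count (h.ne_of_not_col hc).1).2 r hc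
  refine ⟨y, h1, h2, ?_⟩
  rw [← h2, ← h1, smul_three hy]

end Rotation

section Inverted

variable {G : Type*} [Group G] [Finite G] {p q r : Sylow 31 G} {g u v j t w : G} {A : Subgroup G}

/-- The elements of `p` inverted by `t`. -/
def Iv (p : Sylow 31 G) (t : G) : Set G := {u | u ∈ p.1 ∧ t * u * t = u⁻¹}

theorem Hyp.eq_one_of_sq (h : Hyp G) (hu : u ∈ p.1) (e : u * u = 1) : u = 1 := by
  have := h.pow_mem hu
  rwa [show 31 ^ 3 = 2 * 14895 + 1 from rfl, pow_succ, pow_mul, sq, e, one_pow, one_mul] at this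

namespace Base

variable (B : Base p q A t)
include B

theorem t_conj (hu : u ∈ p.1) : t * u * t ∈ p.1 := by
  simpa [B.inv] using B.conj_sylow B.mem hu

theorem mem_ax (hu : u ∈ p.1) (hc : t * u = u * t) : u ∈ A := B.cn ▸ mem_cn.mpr ⟨hu, hc⟩

theorem comm_ax {a : G} (ha : a ∈ A) : t * a = a * t := (mem_cn.mp (B.cn ▸ ha : a ∈ OD.cn p t)).2

theorem mul_t_mem (hu : u ∈ p.1) : u * (t * u⁻¹ * t) ∈ Iv p t :=
  ⟨mul_mem hu (B.t_conj (inv_mem hu)), by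
    rw [show t * (u * (t * u⁻¹ * t)) * t = t * u * t * u⁻¹ * (t * t) by group, B.sq, mul_inv_rev]
    simp only [mul_inv_rev, inv_inv, B.inv]; group⟩

theorem exists_mem_Iv (h : Hyp G) : ∃ u ∈ Iv p t, u ≠ 1 := by
  obtain ⟨u, hu, hA⟩ : ∃ u ∈ p.1, u ∉ A := by
    by_contra! hc
    have := card_dvd_of_le (show p.1 ≤ A from hc)
    rw [h.card_sylow p, B.ax.card] at this
    norm_num at this
  refine ⟨_, B.mul_t_mem hu, fun e => hA (B.mem_ax hu ?_)⟩
  rw [mul_eq_one_iff_eq_inv] at e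
  simp only [mul_inv_rev, inv_inv, B.inv] at e
  nth_rw 2 [e]
  simp only [mul_assoc, B.sq, mul_one]

theorem Iv_ax (hu : u ∈ Iv p t) (ha : u ∈ A) : u = 1 := by
  refine B.ax.eq_one_of_sq ha ?_
  have := hu.2
  rw [B.comm_ax ha, mul_assoc, B.sq, mul_one] at this
  nth_rw 2 [this]; simp

theorem Iv_conj (h : Hyp G) (hg : g ∈ Hs p q) (hu : u ∈ Iv p t) : g * u * g⁻¹ ∈ Iv p t := by
  refine ⟨B.conj_sylow hg hu.1, ?_⟩
  have h1 := B.central h hg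
  calc t * (g * u * g⁻¹) * t = (t * g) * u * (g⁻¹ * t) := by group
    _ = (g * t) * u * (t * g⁻¹) := by
      rw [h1, B.central h ((Hs p q).inv_mem hg)]
    _ = g * (t * u * t) * g⁻¹ := by group
    _ = _ := by rw [hu.2]; group

theorem not_col (h : Hyp G) (hu : u ∈ Iv p t) (hne : u ≠ 1) : ¬ Col p q (u • q) := by
  rw [h.not_col_iff B.ne B.mem B.ord, h.fix_iff B.ne B.mem hu.1]
  exact fun e => hne (B.Iv_ax hu (B.mem_ax hu.1 e))

theorem eq_one_of_conj (h : Hyp G) (hu : u ∈ Iv p t) (hne : u ≠ 1) (hg : g ∈ Hs p q)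
    (e : g * u = u * g) : g = 1 :=
  h.eq_one_of_fix3 (B.not_col h hu hne) hg.1 hg.2 ((h.fix_iff B.ne hg hu.1).mpr e)

theorem ncard_Iv_le (h : Hyp G) : (Iv p t).ncard ≤ 961 := by
  have h1 : ((A : Set G) ×ˢ Iv p t).ncard ≤ (p.1 : Set G).ncard := by
    refine Set.ncard_le_ncard_of_injOn (fun x => x.2 * x.1)
      (fun x hx => mul_mem hx.2.1 (B.ax.le hx.1)) (fun x hx y hy e => ?_) (Set.toFinite _)
    have e : x.2 * x.1 = y.2 * y.1 := e
    have h2 : y.2⁻¹ * x.2 ∈ A := by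
      rw [show y.2⁻¹ * x.2 = y.1 * x.1⁻¹ from by
        rw [eq_mul_inv_iff_mul_eq, mul_assoc, e, inv_mul_cancel_left]]
      exact mul_mem hy.1 (inv_mem hx.1)
    have h3 : y.2⁻¹ * x.2 = 1 := by
      obtain ⟨c, hc⟩ : ∃ c, c = y.2⁻¹ * x.2 := ⟨_, rfl⟩
      rw [← hc] at h2 ⊢
      refine B.ax.eq_one_of_sq h2 ?_
      have hx2 := hx.2.2
      rw [show x.2 = y.2 * c by rw [hc]; group] at hx2
      have h5 : t * (y.2 * c) * t = y.2⁻¹ * c := by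
        rw [← hy.2.2, mul_assoc, mul_assoc, ← B.comm_ax h2]; group
      rw [h5, ← B.ax.cen c h2 _ hy.2.1, mul_inv_rev] at hx2
      nth_rw 2 [mul_left_cancel hx2]
      exact mul_inv_cancel c
    have e2 : x.2 = y.2 := (inv_mul_eq_one.mp h3).symm
    rw [e2] at e
    exact Prod.ext (mul_left_cancel e) e2
  rw [Set.ncard_prod, ← Nat.card_coe_set_eq (A : Set G), ← Nat.card_coe_set_eq (p.1 : Set G),
    SetLike.coe_sort_coe, SetLike.coe_sort_coe, B.ax.card, h.card_sylow] at h1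
  omega

theorem ncard_Iv (h : Hyp G) (hu : u ∈ Iv p t) (hne : u ≠ 1) :
    (fun g : G => g * u * g⁻¹) '' (Hs p q) = Iv p t \ {1} ∧ (Iv p t).ncard = 961 := by
  have hinj : Set.InjOn (fun g : G => g * u * g⁻¹) (Hs p q) := fun a ha b hb e => by
    have e : a * u * a⁻¹ = b * u * b⁻¹ := e
    have := B.eq_one_of_conj h hu hne ((Hs p q).mul_mem ((Hs p q).inv_mem hb) ha) (by
      rw [show b⁻¹ * a * u = b⁻¹ * (a * u * a⁻¹) * a by group, e]; group)
    exact (inv_mul_eq_one.mp this).symm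
  have h1 : (fun g : G => g * u * g⁻¹) '' (Hs p q) ⊆ Iv p t \ {1} := by
    rintro _ ⟨g, hg, rfl⟩
    exact ⟨B.Iv_conj h hg hu, by simpa using hne⟩
  have h2 : ((fun g : G => g * u * g⁻¹) '' (Hs p q)).ncard = 960 := by
    rw [hinj.ncard_image, ← Nat.card_coe_set_eq (Hs p q : Set G), SetLike.coe_sort_coe,
      h.card_Hs B.ne]
  have h3 := Set.ncard_sdiff_singleton_add_one (s := Iv p t) (a := 1) ⟨one_mem _, by simp [B.sq]⟩
    (Set.toFinite _)
  have h4 := B.ncard_Iv_le h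
  have h5 := Set.ncard_le_ncard h1 (Set.toFinite _)
  exact ⟨Set.eq_of_subset_of_ncard_le h1 (by omega) (Set.toFinite _), by omega⟩

/-- The two-point stabilizer is transitive on the nontrivial inverted elements. -/
theorem exists_conj (h : Hyp G) (hu : u ∈ Iv p t) (hne : u ≠ 1) (hv : v ∈ Iv p t) (hv1 : v ≠ 1) :
    ∃ g ∈ Hs p q, g * u * g⁻¹ = v := by
  have h2 : v ∈ Iv p t \ {1} := ⟨hv, hv1⟩
  rw [← (B.ncard_Iv h hu hne).1] at h2
  exact h2

end Base

theorem Hyp.ncard_Fx_of_fix (h : Hyp G) (ho : orderOf j = 2) (hj : j • p = p) :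
    (Fx j).ncard = 32 := by
  obtain ⟨q, hq, hpq⟩ : ∃ q ∈ Fx j, p ≠ q := by
    by_contra! hc
    have h1 : Fx j = {p} := Set.eq_singleton_iff_unique_mem.mpr ⟨hj, fun x hx => (hc x hx).symm⟩
    have h2 := dvd_moved Nat.prime_two ho (S := (Set.univ : Set (Sylow 31 G))) fun x _ => trivial
    have h3 := Set.ncard_add_ncard_compl (Fx j)
    rw [h.card_points, h1, Set.ncard_singleton, ← h1] at h3
    rw [show {x | x ∈ (Set.univ : Set (Sylow 31 G)) ∧ j • x ≠ x} = (Fx j)ᶜ by ext; simp [mem_Fx]] at h2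
    omega
  obtain ⟨t, -, -, h32, hu⟩ := h.exists_inv hpq
  rwa [hu j ⟨hj, hq⟩ ho]

/-- A base with an involution `w` swapping `p` and `q`. -/
structure Conf (p q : Sylow 31 G) (A : Subgroup G) (t u w : G) : Prop where
  base : Base p q A t
  mem : u ∈ Iv p t
  ne : u ≠ 1
  wp : w • p = q
  wq : w • q = p
  wu : w • u • q = u • q
  ord : orderOf w = 2

theorem Iv_sq (hu : u ∈ Iv p t) : u * t * (u * t) = 1 := by
  rw [show u * t * (u * t) = u * (t * u * t) by group, hu.2, mul_inv_cancel]

theorem Base.exists_conf (B : Base p q A t) (h : Hyp G) (hu : u ∈ Iv p t) (hne : u ≠ 1) :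
    ∃ w, Conf p q A t u w := by
  obtain ⟨y, h1, h2, h3⟩ := h.exists_rot (B.not_col h hu hne)
  have h0 : u • q ≠ q := fun e => hne (h.eq_one_of_fix B.ne hu.1 e)
  have ho : orderOf (u * t) = 2 := orderOf_eq_prime (by rw [_root_.sq, Iv_sq hu]) fun e => h0 (by
    have : (u * t) • q = u • q := by rw [mul_smul, B.mem.2]
    rw [← this, e, one_smul])
  have e1 : (u * t) • p = p := by rw [mul_smul, B.mem.1, smul_of_mem hu.1]
  have e2 : (u * t) • q = u • q := by rw [mul_smul, B.mem.2]
  have e3 : (u * t) • u • q = q := by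
    nth_rw 1 [← e2]; rw [← mul_smul, Iv_sq hu, one_smul]
  have hy1 : y⁻¹ • q = p := by rw [← h1, inv_smul_smul]
  have hy2 : y⁻¹ • u • q = q := by nth_rw 1 [← h2]; rw [inv_smul_smul]
  have hy3 : y⁻¹ • p = u • q := by nth_rw 1 [← h3]; rw [inv_smul_smul]
  refine ⟨y⁻¹ * (u * t) * y, B, hu, hne, ?_, ?_, ?_, ?_⟩
  · rw [mul_smul, mul_smul, h1, e2, hy2]
  · rw [mul_smul, mul_smul, h2, e3, hy1]
  · rw [mul_smul, mul_smul, h3, e1, hy3]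
  · have := orderOf_conj y⁻¹ (u * t)
    rwa [inv_inv, ho] at this

namespace Conf

variable (C : Conf p q A t u w)
include C

theorem sq : w * w = 1 := mul_self_of_orderOf C.ord

theorem inv : w⁻¹ = w := inv_of_orderOf C.ord

theorem conj_mem (hg : g ∈ Hs p q) : w * g * w ∈ Hs p q := by
  have := smul_mem_Hs hg w
  rwa [C.inv, C.wp, C.wq, Hs_comm] at this

theorem comm (h : Hyp G) : w * t = t * w := by
  have := h.inv_eq C.base.ne (C.conj_mem C.base.mem) (by
    have := orderOf_conj w t
    rwa [C.inv, C.base.ord] at this) C.base.mem C.base.ord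
  rw [← mul_inv_eq_iff_eq_mul, C.inv, this]

theorem braid (h : Hyp G) : (u * t * w) ^ 3 = 1 := by
  have e1 : (u * t * w) • p = u • q := by
    rw [mul_smul, mul_smul, C.wp, (mem_Hs.mp C.base.mem).2]
  have e2 : (u * t * w) • q = p := by
    rw [mul_smul, mul_smul, C.wq, (mem_Hs.mp C.base.mem).1, smul_of_mem C.mem.1]
  have e3 : (u * t * w) • u • q = q := by
    rw [mul_smul, C.wu, ← mul_smul, show u * t * u = u * (t * u * t) * t⁻¹ by group, C.mem.2,
      mul_inv_cancel, one_mul, C.base.inv, C.base.mem.2]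
  refine h.eq_one_of_fix3 (C.base.not_col h C.mem C.ne) ?_ ?_ ?_ <;>
    simp only [pow_three, mul_smul _ (_ * _), e1, e2, e3]

theorem fix_disjoint (h : Hyp G) (hr : w • r = r) (htr : t • r = r) : False := by
  have h32 := h.ncard_Fx_of_fix C.ord hr
  have hd := dvd_moved Nat.prime_two C.base.ord (S := Fx w) fun x hx => by
    rw [mem_Fx, ← mul_smul, C.comm h, mul_smul, mem_Fx.mp hx]
  have h1 := Set.ncard_inter_add_ncard_sdiff_eq_ncard (Fx w) (Fx t)
  rw [show Fx w \ Fx t = {x | x ∈ Fx w ∧ t • x ≠ x} from rfl, h32] at h1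
  have h2 : Fx w ∩ Fx t = {r} := Set.eq_singleton_iff_unique_mem.mpr ⟨⟨hr, htr⟩, fun x hx => by
    by_contra hne
    have := h.inv_eq hne ⟨hx.1, hr⟩ C.ord ⟨hx.2, htr⟩ C.base.ord
    exact C.base.ne ((this ▸ C.base.mem.1 : w • p = p).symm.trans C.wp)⟩
  rw [h2, Set.ncard_singleton] at h1
  omega

theorem exists_of_fix (h : Hyp G) (hr : w • r = r) : ∃ g ∈ Hs p q, w * g = g * w ∧ g • u • q = r := by
  have hc : ¬ Col p q r := fun e =>
    C.fix_disjoint h hr ((h.not_col_iff C.base.ne C.base.mem C.base.ord).mp e)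
  obtain ⟨y, h1, h2, h3⟩ := h.exists_rot hc
  obtain ⟨v, hv, e⟩ := h.exists_smul_eq C.base.ne (h.ne_of_not_col hc).2.1
  have hy1 : y⁻¹ • q = p := by rw [← h1, inv_smul_smul]
  have hy2 : y⁻¹ • r = q := by rw [← h2, inv_smul_smul]
  have hy3 : y⁻¹ • p = r := by nth_rw 1 [← h3]; rw [inv_smul_smul]
  obtain ⟨s, hs⟩ : ∃ s, s = v⁻¹ * (y * w * y⁻¹) := ⟨_, rfl⟩
  have hsm : s ∈ Hs p q := by
    refine mem_Hs.mpr ⟨?_, ?_⟩ <;> rw [hs]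
    · rw [mul_smul, mul_smul, mul_smul, hy3, hr, h3, inv_smul_eq_iff, smul_of_mem hv]
    · rw [mul_smul, mul_smul, mul_smul, hy1, C.wp, h2, inv_smul_eq_iff, e]
  have hvs : v * s * (v * s) = 1 := by
    rw [hs, mul_inv_cancel_left, show y * w * y⁻¹ * (y * w * y⁻¹) = y * (w * w) * y⁻¹ by group, C.sq]
    group
  have hss : s * s = 1 := by
    refine h.eq_one_of_fix C.base.ne (p := p) ?_ ((Hs p q).mul_mem hsm hsm).2
    have : s * s = (v * (s * v * s⁻¹))⁻¹ * (v * s * (v * s)) := by group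
    rw [this, hvs, mul_one]
    exact inv_mem (mul_mem hv (C.base.conj_sylow hsm hv))
  have hrq : v • q ≠ q := fun e' => (h.ne_of_not_col hc).2.2 (e'.symm.trans e)
  have hst : s = t := by
    refine C.base.uniq h hsm (orderOf_eq_prime (by rw [_root_.sq, hss]) fun e1 => hrq ?_)
    rw [e1, mul_one] at hvs
    rw [h.eq_one_of_sq hv hvs, one_smul]
  rw [hst] at hvs
  have hvI : v ∈ Iv p t := ⟨hv, eq_inv_of_mul_eq_one_right (by rw [← hvs]; group)⟩
  obtain ⟨g, hg, hgv⟩ := C.base.exists_conj h C.mem C.ne hvI fun e1 => hrq (by rw [e1, one_smul])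
  have hgr : g • u • q = r := by
    rw [← e, ← hgv, mul_smul, mul_smul, inv_smul_eq_iff.mpr (mem_Hs.mp hg).2.symm]
  have hwg : g * w * g⁻¹ * w⁻¹ = 1 := by
    have e1 : g⁻¹ • r = u • q := by rw [inv_smul_eq_iff, hgr]
    have e2 : g⁻¹ • p = p := ((Hs p q).inv_mem hg).1
    have e3 : g⁻¹ • q = q := ((Hs p q).inv_mem hg).2
    refine h.eq_one_of_fix3 hc ?_ ?_ ?_ <;> rw [C.inv]
    · simp only [mul_smul, C.wp, e3, C.wq, (mem_Hs.mp hg).1]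
    · simp only [mul_smul, C.wq, e2, C.wp, (mem_Hs.mp hg).2]
    · simp only [mul_smul, hr, e1, C.wu, hgr]
  refine ⟨g, hg, ?_, hgr⟩
  rw [mul_inv_eq_one, mul_inv_eq_iff_eq_mul] at hwg
  exact hwg.symm

theorem card_cent (h : Hyp G) : Nat.card (Hs p q ⊓ centralizer {w} : Subgroup G) = 32 := by
  rw [← h.ncard_Fx_of_fix C.ord C.wu, ← SetLike.coe_sort_coe, Nat.card_coe_set_eq]
  refine Set.ncard_congr (fun g _ => g • u • q) (fun g hg => ?_) (fun a b ha hb e => ?_) fun r hr => ?_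
  · rw [mem_Fx, ← mul_smul, ← (mem_centralizer_singleton_iff.mp hg.2), mul_smul, C.wu]
  · have := C.base.eq_one_of_conj h C.mem C.ne ((Hs p q).mul_mem ((Hs p q).inv_mem hb.1) ha.1)
      ((h.fix_iff C.base.ne ((Hs p q).mul_mem ((Hs p q).inv_mem hb.1) ha.1) C.mem.1).mp (by
        rw [mul_smul, e, inv_smul_smul]))
    exact (inv_mul_eq_one.mp this).symm
  · obtain ⟨g, hg, hw, e⟩ := C.exists_of_fix h hr
    exact ⟨g, ⟨hg, mem_centralizer_singleton_iff.mpr hw.symm⟩, e⟩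

/-- The Sylow 31-subgroups are not abelian. -/
theorem not_abelian (h : Hyp G) (hc : ∀ u ∈ p.1, ∀ v ∈ p.1, u * v = v * u) : False := by
  let M : Subgroup G :=
    { carrier := Iv p t
      one_mem' := ⟨one_mem _, by simp [C.base.sq]⟩
      mul_mem' := fun {a b} ha hb => ⟨mul_mem ha.1 hb.1, by
        rw [mul_inv_rev, hc _ (inv_mem hb.1) _ (inv_mem ha.1), ← ha.2, ← hb.2]
        calc t * (a * b) * t = t * a * (1 * b) * t := by group
          _ = _ := by rw [← C.base.sq]; group⟩
      inv_mem' := fun {a} ha => ⟨inv_mem ha.1, by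
        have := congrArg (·⁻¹) ha.2
        simpa [C.base.inv, mul_assoc] using this⟩ }
  have hM : ∀ x, x ∈ M ↔ x ∈ Iv p t := fun _ => Iff.rfl
  obtain ⟨L, hL⟩ : ∃ L, L = M ⊔ zpowers w := ⟨_, rfl⟩
  obtain ⟨Y, hY⟩ : ∃ Y : Set (Sylow 31 G), Y = insert p ((fun x : G => x • q) '' M) := ⟨_, rfl⟩
  have hwM : ∀ x ∈ M, x ≠ 1 → ∃ x' ∈ M, w • x • q = x' • q := fun x hx hx1 => by
    obtain ⟨g, hg, rfl⟩ := C.base.exists_conj h C.mem C.ne hx hx1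
    have hg' := C.conj_mem hg
    refine ⟨_, C.base.Iv_conj h hg' C.mem, ?_⟩
    simp only [mul_smul, mul_inv_rev, C.inv, inv_smul_eq_iff.mpr (mem_Hs.mp hg).2.symm,
      C.wq, C.wp, inv_smul_eq_iff.mpr (mem_Hs.mp hg).1.symm, C.wu]
  have hstab : L ≤ MulAction.stabilizer G Y := by
    rw [hL, sup_le_iff, zpowers_le]
    have key : ∀ g : G, (∀ y ∈ Y, g • y ∈ Y) → g ∈ MulAction.stabilizer G Y := fun g hg => by
      refine MulAction.mem_stabilizer_iff.mpr (Set.eq_of_subset_of_ncard_le ?_ ?_ (Set.toFinite _))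
      · rintro _ ⟨y, hy, rfl⟩; exact hg y hy
      · rw [Set.ncard_smul_set]
    refine ⟨fun x hx => key x ?_, key w ?_⟩ <;> rw [hY]
    · rintro _ (rfl | ⟨z, hz, rfl⟩)
      · exact .inl (smul_of_mem hx.1)
      · exact .inr ⟨x * z, M.mul_mem hx hz, mul_smul _ _ _⟩
    · rintro _ (rfl | ⟨z, hz, rfl⟩)
      · exact .inr ⟨1, M.one_mem, by simp [C.wp]⟩
      · by_cases h1 : z = 1
        · left; simp [h1, C.wq]
        · obtain ⟨x, hx, e⟩ := hwM z hz h1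
          exact .inr ⟨x, hx, e.symm⟩
  have hw : w ∈ L := hL ▸ mem_sup_right (mem_zpowers w)
  have horb : MulAction.orbit L p = Y := by
    refine subset_antisymm ?_ ?_
    · rintro _ ⟨g, rfl⟩
      have := MulAction.mem_stabilizer_iff.mp (hstab g.2)
      rw [← this]
      exact Set.smul_mem_smul_set (hY ▸ .inl rfl)
    · rw [hY]
      rintro _ (rfl | ⟨z, hz, rfl⟩)
      · exact MulAction.mem_orbit_self _
      · refine ⟨⟨z * w, L.mul_mem (hL ▸ mem_sup_left hz) hw⟩, ?_⟩
        change (z * w) • p = z • q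
        rw [mul_smul, C.wp]
  have hinj : Set.InjOn (fun x : G => x • q) (M : Set G) := fun x hx y hy e => by
    have := h.eq_one_of_fix C.base.ne (p.1.mul_mem (p.1.inv_mem hy.1) hx.1) (by
      rw [mul_smul]; exact inv_smul_eq_iff.mpr e)
    exact (inv_mul_eq_one.mp this).symm
  have hcM : (M : Set G).ncard = 961 := (C.base.ncard_Iv h C.mem C.ne).2
  have hcY : Y.ncard = 962 := by
    rw [hY, Set.ncard_insert_of_notMem, hinj.ncard_image, hcM]
    rintro ⟨x, hx, e⟩
    have e : x • q = p := e
    rw [← smul_of_mem hx.1] at e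
    exact C.base.ne (smul_left_cancel _ e).symm
  have h1 := MulAction.index_stabilizer L p
  rw [horb, hcY] at h1
  have h2 : 962 ∣ Nat.card G := by
    rw [← h1]
    exact (index_dvd_card _).trans (card_subgroup_dvd_card L)
  rw [h.card] at h2
  norm_num at h2

end Conf

end Inverted

section TwoTransitive

variable {Γ X : Type*} [Group Γ] [Finite Γ] [Finite X] [MulAction Γ X] {p q : X} {S : Subgroup Γ}

theorem card_of_two_trans
    (htr : ∀ p q p' q' : X, p ≠ q → p' ≠ q' → ∃ g : Γ, g • p = p' ∧ g • q = q') (hpq : p ≠ q) :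
    Nat.card Γ = Nat.card X * (Nat.card X - 1) *
      Nat.card (MulAction.stabilizer Γ p ⊓ MulAction.stabilizer Γ q : Subgroup Γ) := by
  have h1 := MulAction.index_stabilizer Γ (p, q)
  rw [show MulAction.stabilizer Γ (p, q) = MulAction.stabilizer Γ p ⊓ MulAction.stabilizer Γ q by
    ext; simp [MulAction.mem_stabilizer_iff, mem_inf],
    show MulAction.orbit Γ (p, q) = {z : X × X | z.1 ≠ z.2 ∧ (z.1 ∈ Set.univ ∧ z.2 ∈ Set.univ)} from ?_,
    ncard_pairs, Set.ncard_univ] at h1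
  · rw [← h1, mul_comm, card_mul_index]
  · ext ⟨a, b⟩
    simp only [Set.mem_ofPred_eq, Set.mem_univ, and_true, MulAction.mem_orbit_iff, Prod.smul_mk,
      Prod.mk.injEq]
    refine ⟨?_, fun hab => htr p q a b hpq hab⟩
    rintro ⟨g, rfl, rfl⟩ e
    exact hpq (smul_left_cancel g e)

/-- In a doubly transitive group of degree 32 with two-point stabilizers of order 15, a Sylow
2-subgroup has more than one involution. -/
theorem not_uniq_inv
    (htr : ∀ p q p' q' : X, p ≠ q → p' ≠ q' → ∃ g : Γ, g • p = p' ∧ g • q = q') (hX : Nat.card X = 32)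
    (hpq : p ≠ q)
    (hst : Nat.card (MulAction.stabilizer Γ p ⊓ MulAction.stabilizer Γ q : Subgroup Γ) = 15)
    (hS : Nat.card S = 32) (hu : ∀ a ∈ S, ∀ b ∈ S, orderOf a = 2 → orderOf b = 2 → a = b) :
    False := by
  have hΓ := card_of_two_trans htr hpq
  rw [hX, hst] at hΓ
  haveI := Fact.mk Nat.prime_two
  obtain ⟨T, hT⟩ : ∃ T : Set Γ, T = {x | orderOf x = 2} := ⟨_, rfl⟩
  have hT2 : ∀ x, x ∈ T ↔ orderOf x = 2 := fun x => by rw [hT]; rfl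
  have hsw : ∀ x ∈ T, ∀ a : X, x • x • a = a := fun x hx a => by
    rw [← mul_smul, mul_self_of_orderOf ((hT2 x).mp hx), one_smul]
  have hcj : ∀ x ∈ T, ∀ g : Γ, g * x * g⁻¹ ∈ T := fun x hx g => by
    rw [hT2] at hx ⊢
    exact (orderOf_injective (MulAut.conj g).toMonoidHom (MulAut.conj g).injective x).trans hx
  have hfree : ∀ x ∈ T, ∀ a : X, x • a ≠ a := fun x hx a ha => by
    have h1 := dvd_moved Nat.prime_two ((hT2 x).mp hx) (S := (Set.univ : Set X))
      fun _ _ => trivial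
    obtain ⟨F, hF⟩ : ∃ F : Set X, F = {x' | x' ∈ (Set.univ : Set X) ∧ x • x' ≠ x'} := ⟨_, rfl⟩
    rw [← hF] at h1
    have h2 := Set.ncard_add_ncard_compl F
    obtain ⟨b, hb, hba⟩ : ∃ b ∈ Fᶜ, b ≠ a := by
      by_contra! hc
      have : Fᶜ = {a} := Set.eq_singleton_iff_unique_mem.mpr ⟨by rw [hF]; simpa using ha, hc⟩
      rw [this, Set.ncard_singleton, hX] at h2
      omega
    have hb : x • b = b := by rw [hF] at hb; simpa using hb
    obtain ⟨g, rfl, rfl⟩ := htr p q a b hpq hba.symm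
    have h3 := hcj x hx g⁻¹
    rw [hT2] at h3
    have h4 := Subgroup.orderOf_dvd_natCard (MulAction.stabilizer Γ p ⊓ MulAction.stabilizer Γ q)
      (x := g⁻¹ * x * g⁻¹⁻¹) ⟨by simp [MulAction.mem_stabilizer_iff, mul_smul, ha],
        by simp [MulAction.mem_stabilizer_iff, mul_smul, hb]⟩
    rw [hst, h3] at h4
    norm_num at h4
  have hcount := double_count htr hcj (r := fun x a b => x • a = b ∧ True) (a := 32)
    (fun x a b g hx => by simpa [mul_smul] using hx)
    (fun x hx => by
      refine (ncard_graph (fun y => x • y) fun _ => True).trans ?_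
      rw [show {y : X | x • y ≠ y ∧ True} = Set.univ by
        ext y; simpa using hfree x hx y, Set.ncard_univ, hX]) hpq
  have hn : {x | x ∈ T ∧ (x • p = q ∧ True)}.ncard ≤ 15 := by
    rcases Set.eq_empty_or_nonempty {x | x ∈ T ∧ (x • p = q ∧ True)} with he | ⟨x₀, hx₀⟩
    · rw [he]; simp
    · have hswap : ∀ x : Γ, x ∈ T ∧ (x • p = q ∧ True) → x • q = p := fun x hx => by
        rw [← hx.2.1, hsw x hx.1]
      rw [← hst, ← SetLike.coe_sort_coe, Nat.card_coe_set_eq]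
      refine Set.ncard_le_ncard_of_injOn (fun x => x₀ * x) (fun x hx => ⟨?_, ?_⟩)
        (fun x _ y _ e => mul_left_cancel e) (Set.toFinite _)
      · change (x₀ * x) • p = p; rw [mul_smul, hx.2.1, hswap x₀ hx₀]
      · change (x₀ * x) • q = q; rw [mul_smul, hswap x hx, hx₀.2.1]
  obtain ⟨s, hs, hso⟩ := exists_mem_orderOf Nat.prime_two (C := S) (by rw [hS]; norm_num)
  have hsT : s ∈ T := (hT2 s).mpr hso
  have hV : ∀ x ∈ T, x * s = s * x → x = s := fun x hx hxs => by
    have hP : IsPGroup 2 (zpowers x ⊔ zpowers s : Subgroup Γ) :=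
      (isPGroup_zpowers ((hT2 x).mp hx)).to_sup_of_normal_right' (isPGroup_zpowers hso)
        (zpowers_le.mpr (centralizer_le_normalizer' _ (mem_centralizer_iff.mpr (by
          rintro _ ⟨n, rfl⟩
          exact ((show Commute x s from hxs).zpow_right n).eq.symm))))
    obtain ⟨Q, hQ⟩ := hP.exists_le_sylow
    let S' : Sylow 2 Γ := Sylow.ofCard S (by
      rw [hS, hΓ, show 32 * (32 - 1) * 15 = 2 ^ 5 * 465 by norm_num, Nat.factorization_mul
        (by norm_num) (by norm_num), Nat.prime_two.factorization_pow, Finsupp.add_apply,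
        Nat.factorization_eq_zero_of_not_dvd (by norm_num)]
      simp)
    obtain ⟨g, hg⟩ := MulAction.exists_smul_eq Γ Q S'
    have hm : ∀ y ∈ (zpowers x ⊔ zpowers s : Subgroup Γ), g * y * g⁻¹ ∈ S := fun y hy => by
      have : g * y * g⁻¹ ∈ (g • Q).1 := by
        rw [Sylow.coe_subgroup_smul, mem_conj_smul]
        simpa [mul_assoc] using hQ hy
      rw [hg] at this
      exact this
    have h1 := hcj x hx g
    have h2 := hcj s hsT g
    rw [hT2] at h1 h2
    have := hu _ (hm x (mem_sup_left (mem_zpowers x))) _ (hm s (mem_sup_right (mem_zpowers s))) h1 h2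
    simpa using this
  have hS2 : ∀ a ∈ S, a ≠ 1 → ∃ n : ℕ, a ^ n = s := fun a ha ha1 => by
    have h1 : orderOf a ∣ 2 ^ 5 := by
      simpa [hS] using S.orderOf_dvd_natCard ha
    have h2 : 2 ∣ orderOf a := by
      obtain ⟨k, -, hk⟩ := (Nat.dvd_prime_pow Nat.prime_two).mp h1
      rcases k with _ | k
      · exact absurd (orderOf_eq_one_iff.mp (by simpa using hk)) ha1
      · exact hk ▸ dvd_pow_self 2 k.succ_ne_zero
    exact ⟨_, hu _ (S.pow_mem ha _) _ hs (orderOf_pow_orderOf_div (orderOf_pos a).ne' h2) hso⟩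
  have hd : Nat.card (S.map (ConjAct.toConjAct (G := Γ)).toMonoidHom) ∣ (T \ {s}).ncard := by
    have hcs : ∀ a ∈ S, a * s * a⁻¹ = s := fun a ha =>
      hu _ (S.mul_mem (S.mul_mem ha hs) (S.inv_mem ha)) _ hs
        ((orderOf_injective (MulAut.conj a).toMonoidHom (MulAut.conj a).injective s).trans hso) hso
    haveI : Finite (ConjAct Γ) := ‹Finite Γ›
    refine dvd_of_semireg ?_ ?_
    · rintro _ ⟨a, ha, rfl⟩ x hx
      refine ⟨hcj x hx.1 a, fun e => hx.2 ?_⟩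
      have e : a * x * a⁻¹ = s := e
      rw [← hcs a ha] at e
      exact mul_left_cancel (mul_right_cancel e)
    · rintro _ ⟨a, ha, rfl⟩ x hx e
      have e : a * x * a⁻¹ = x := e
      by_contra ha1
      obtain ⟨n, hn⟩ := hS2 a ha fun e1 => ha1 (by rw [e1, map_one])
      refine hx.2 (hV x hx.1 ?_)
      rw [← hn]
      exact ((show Commute a x from mul_inv_eq_iff_eq_mul.mp e).pow_left n).eq.symm
  rw [Subgroup.card_map_of_injective (ConjAct.toConjAct (G := Γ)).injective, hS] at hd
  have h1 := Set.ncard_sdiff_singleton_add_one hsT (Set.toFinite _)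
  rw [hX] at hcount
  omega

end TwoTransitive

section Kernel

variable {G : Type*} [Group G] [Finite G]

instance fixAction (w : G) : MulAction (centralizer {w} : Subgroup G) (Fx w) where
  smul c y := ⟨(c : G) • (y : Sylow 31 G), by
    rw [mem_Fx, ← mul_smul, ← mem_centralizer_singleton_iff.mp c.2, mul_smul, mem_Fx.mp y.2]⟩
  one_smul y := Subtype.ext (one_smul G y.1)
  mul_smul a b y := Subtype.ext (mul_smul (a : G) b y.1)

theorem fixAction_coe (w : G) (c : centralizer {w}) (y : Fx w) :
    ((c • y : Fx w) : Sylow 31 G) = (c : G) • (y : Sylow 31 G) := rfl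

theorem Hyp.exists_base32 (h : Hyp G) : ∃ (p q : Sylow 31 G) (A : Subgroup G) (t : G),
    Base p q A t ∧ Nat.card (cz(A) ⊓ Hs p q : Subgroup G) = 32 := by
  haveI : Nontrivial (Sylow 31 G) := Finite.one_lt_card_iff_nontrivial.mp (by
    rw [h.card_points]; norm_num)
  obtain ⟨p, q, hpq⟩ := exists_pair_ne (Sylow 31 G)
  obtain ⟨A₀, t, B₀⟩ := h.exists_base hpq
  obtain ⟨u, hu, hu1⟩ := B₀.exists_mem_Iv h
  obtain ⟨w, C⟩ := B₀.exists_conf h hu hu1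
  have h32 := h.ncard_Fx_of_fix C.ord C.wu
  haveI : Nontrivial (Fx w) := Finite.one_lt_card_iff_nontrivial.mp (by
    rw [Nat.card_coe_set_eq, h32]; norm_num)
  obtain ⟨⟨a, ha⟩, ⟨b, hb⟩, hab'⟩ := exists_pair_ne (Fx w)
  have hab : a ≠ b := fun e => hab' (Subtype.ext e)
  obtain ⟨A, w', B⟩ := h.exists_base hab
  obtain rfl := h.inv_eq hab B.mem B.ord ⟨ha, hb⟩ C.ord
  refine ⟨a, b, A, w', B, (B.card_K h).resolve_right fun h64 => ?_⟩
  obtain ⟨φ, hφ⟩ : ∃ φ, φ = MulAction.toPermHom (centralizer {w'} : Subgroup G) (Fx w') := ⟨_, rfl⟩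
  have hφ1 : ∀ c (y : Fx w'), φ c y = c • y := fun c y => by rw [hφ]; rfl
  have htr : ∀ a b a' b' : Fx w', a ≠ b → a' ≠ b' → ∃ c : centralizer {w'}, c • a = a' ∧ c • b = b' :=
    fun a b a' b' hab hab' => by
      obtain ⟨g, e1, e2⟩ := h.exists_pair (fun e => hab (Subtype.ext e)) fun e => hab' (Subtype.ext e)
      have hm := smul_mem_Hs (mem_Hs.mpr ⟨a.2, b.2⟩) g
      rw [e1, e2] at hm
      have := h.inv_eq (fun e => hab' (Subtype.ext e)) hm ((orderOf_conj g w').trans B.ord)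
        ⟨a'.2, b'.2⟩ B.ord
      exact ⟨⟨g, mem_centralizer_singleton_iff.mpr (mul_inv_eq_iff_eq_mul.mp this)⟩,
        Subtype.ext e1, Subtype.ext e2⟩
  have hfix : ∀ c : centralizer {w'}, (c : G) ∈ Hs a b → (φ c = 1 ↔ (c : G) ∈ cz(A)) := fun c hc => by
    constructor
    · refine fun e => mem_centralizer_iff.mpr fun x hx => ?_
      refine ((h.fix_iff B.ne hc (B.ax.le hx)).mp ?_).symm
      have hy : x • b ∈ Fx w' := (h.fix_iff B.ne B.mem (B.ax.le hx)).mpr (B.comm_ax hx)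
      have := congrArg (fun σ : Equiv.Perm (Fx w') => (σ ⟨x • b, hy⟩ : Fx w').1) e
      simpa [hφ1, fixAction_coe] using this
    · intro e
      refine Equiv.ext fun ⟨y, hy⟩ => Subtype.ext ?_
      rw [hφ1, fixAction_coe]
      change (c : G) • y = y
      by_cases hya : a = y
      · rw [← hya]; exact hc.1
      obtain ⟨x, hx, rfl⟩ := h.exists_smul_eq B.ne hya
      have := B.mem_ax hx ((h.fix_iff B.ne B.mem hx).mp hy)
      exact (h.fix_iff B.ne hc hx).mpr (mem_centralizer_iff.mp e x this).symm
  have hHc : Hs a b ≤ centralizer {w'} := fun g hg =>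
    mem_centralizer_singleton_iff.mpr (B.central h hg)
  have hcard : Nat.card ((φ.comp (inclusion hHc)).range) = 15 := by
    have hk : (φ.comp (inclusion hHc)).ker = (cz(A) ⊓ Hs a b).subgroupOf (Hs a b) := by
      ext g
      rw [MonoidHom.mem_ker, MonoidHom.comp_apply, hfix _ g.2, mem_subgroupOf, mem_inf]
      exact ⟨fun e => ⟨e, g.2⟩, fun e => e.1⟩
    have h2 := card_mul_index (φ.comp (inclusion hHc)).ker
    rw [index_ker, hk, Nat.card_congr (subgroupOfEquivOfLe inf_le_right).toEquiv, h64,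
      h.card_Hs B.ne] at h2
    omega
  have hle : Hs p q ⊓ centralizer {w'} ≤ centralizer {w'} := inf_le_right
  obtain ⟨ψ, hψ⟩ : ∃ ψ, ψ = φ.rangeRestrict.comp (inclusion hle) := ⟨_, rfl⟩
  have hψ1 : ∀ s, (ψ s).1 = φ (inclusion hle s) := fun s => by rw [hψ]; rfl
  have hinj : Function.Injective ψ := (injective_iff_map_eq_one ψ).mpr fun s hs => by
    have e := congrArg Subtype.val hs
    rw [hψ1] at e
    have := congrArg (fun σ : Equiv.Perm (Fx w') => (σ ⟨u • q, C.wu⟩ : Fx w').1) e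
    refine Subtype.ext (h.eq_one_of_fix3 (C.base.not_col h C.mem C.ne) (mem_Hs.mp s.2.1).1
      (mem_Hs.mp s.2.1).2 ?_)
    simpa [hφ1, fixAction_coe] using this
  refine not_uniq_inv (Γ := φ.range) (X := Fx w') (p := ⟨a, ha⟩) (q := ⟨b, hb⟩)
    (S := ψ.range)
    (fun a b a' b' hab hab' => ?_) (by rw [Nat.card_coe_set_eq, h32]) hab' ?_ ?_ ?_
  · obtain ⟨c, e1, e2⟩ := htr a b a' b' hab hab'
    exact ⟨⟨φ c, c, rfl⟩, (hφ1 c a).trans e1, (hφ1 c b).trans e2⟩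
  · rw [← hcard, ← card_map_of_injective φ.range.subtype_injective]
    refine congrArg (fun L : Subgroup (Equiv.Perm (Fx w')) => Nat.card L) (Subgroup.ext fun σ => ?_)
    constructor
    · rintro ⟨⟨_, c, rfl⟩, ⟨e1, e2⟩, rfl⟩
      have e1 : φ c ⟨a, ha⟩ = ⟨a, ha⟩ := e1
      have e2 : φ c ⟨b, hb⟩ = ⟨b, hb⟩ := e2
      rw [hφ1] at e1 e2
      exact ⟨⟨c, mem_Hs.mpr ⟨congrArg Subtype.val e1, congrArg Subtype.val e2⟩⟩, rfl⟩
    · rintro ⟨c, rfl⟩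
      exact ⟨⟨_, _, rfl⟩, ⟨(hφ1 _ _).trans (Subtype.ext (mem_Hs.mp c.2).1),
        (hφ1 _ _).trans (Subtype.ext (mem_Hs.mp c.2).2)⟩, rfl⟩
  · rw [← Nat.card_congr (MonoidHom.ofInjective hinj).toEquiv, C.card_cent h]
  · rintro _ ⟨x, rfl⟩ _ ⟨y, rfl⟩ hx hy
    rw [orderOf_injective ψ hinj, ← orderOf_coe] at hx hy
    exact congrArg ψ (Subtype.ext (h.inv_eq C.base.ne x.2.1 hx y.2.1 hy))

end Kernel

section Coordinates

variable {G : Type*} [Group G] [Finite G] {p q r : Sylow 31 G} {g u v j k t s : G} {A : Subgroup G}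

theorem Ax.exists_param (hA : Ax p A) : ∃ z : ZMod 31 → G, (∀ x y, z (x + y) = z x * z y) ∧
    Function.Injective z ∧ ∀ a, a ∈ A ↔ ∃ x, z x = a := by
  obtain ⟨ζ, hζ, ho⟩ := exists_mem_orderOf p31 (C := A) (by rw [hA.card])
  refine ⟨fun x => ζ ^ x.val, fun x y => ?_, fun x y e => ?_, fun a => ⟨fun ha => ?_, ?_⟩⟩
  · change ζ ^ (x + y).val = _
    rw [ZMod.val_add, ← pow_add, ← pow_mod_orderOf ζ (x.val + y.val), ho]
  · exact ZMod.val_injective 31 (pow_injOn_Iio_orderOf (by simpa [ho] using x.val_lt)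
      (by simpa [ho] using y.val_lt) e)
  · have hA' := eq_of_le_of_card (zpowers_le.mpr hζ) ((Nat.card_zpowers ζ).trans ho) hA.card
    rw [← hA'] at ha
    obtain ⟨n, rfl⟩ := ((isOfFinOrder_of_finite ζ).mem_powers_iff_mem_zpowers.mpr ha)
    refine ⟨n, ?_⟩
    change ζ ^ (n : ZMod 31).val = ζ ^ n
    rw [ZMod.val_natCast, ← ho, pow_mod_orderOf]
  · rintro ⟨x, rfl⟩
    exact pow_mem hζ _

/-- Coordinates on a Sylow subgroup: `z` parametrizes the axis and `s` the elements inverted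
by `t`. -/
structure Crd {V : Type*} [AddCommGroup V] (p : Sylow 31 G) (t : G) (z : ZMod 31 → G) (s : V → G)
    (β : V → V → ZMod 31) : Prop where
  z_mem : ∀ x, z x ∈ p.1
  z_add : ∀ x y, z (x + y) = z x * z y
  z_inj : Function.Injective z
  z_cen : ∀ x, ∀ u ∈ p.1, z x * u = u * z x
  z_t : ∀ x, t * z x = z x * t
  s_mem : ∀ a, s a ∈ Iv p t
  s_add : ∀ a b, s a * s b = s (a + b) * z (β a b)
  s_zero : s 0 = 1
  s_inj : ∀ a b x, s a = s b * z x → a = b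
  surj : ∀ u ∈ p.1, ∃ a x, s a * z x = u

theorem Base.iv_ext (B : Base p q A t) (hu : u ∈ Iv p t) (hv : v ∈ Iv p t) (huv : u⁻¹ * v ∈ A) :
    u = v := by
  have h1 : t * (u * (u⁻¹ * v)) * t = (t * u * t) * (u⁻¹ * v) := by
    rw [mul_assoc, mul_assoc u, ← B.comm_ax huv]; group
  rw [mul_inv_cancel_left, hv.2, hu.2] at h1
  have h2 := B.ax.cen _ huv _ (inv_mem hu.1)
  refine inv_mul_eq_one.mp (B.ax.eq_one_of_sq huv ?_)
  rw [mul_assoc, ← mul_assoc v, ← mul_assoc, show u⁻¹ * (v * u⁻¹) = u⁻¹ * v * u⁻¹ by group, h2,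
    ← h1, inv_mul_cancel]

theorem Rep.exists_crd {E : G → Fin 2 → ZMod 31} {ρ : G → Matrix (Fin 2) (Fin 2) (ZMod 31)}
    (R : Rep p q A E ρ) (B : Base p q A t) : ∃ (z : ZMod 31 → G) (s : (Fin 2 → ZMod 31) → G)
    (β : (Fin 2 → ZMod 31) → (Fin 2 → ZMod 31) → ZMod 31), Crd p t z s β ∧
    (∀ a, a ∈ A ↔ ∃ x, z x = a) ∧ ∀ v, E (s v) = v := by
  obtain ⟨z, hz, hzi, hzA⟩ := B.ax.exists_param
  have hmem : ∀ x, z x ∈ A := fun x => (hzA _).mpr ⟨x, rfl⟩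
  have hs : ∀ v, ∃ u ∈ Iv p t, E u = v := fun v => by
    obtain ⟨u, hu, e⟩ := R.surj ((16 : ZMod 31) • v)
    refine ⟨_, B.mul_t_mem hu, ?_⟩
    have h1 := R.act t B.mem _ (inv_mem hu)
    rw [B.inv, R.map_t B, R.neg B hu, e] at h1
    rw [R.add _ hu _ (B.t_conj (inv_mem hu)), h1, e, Matrix.neg_mulVec, Matrix.one_mulVec, neg_neg,
      ← add_smul, show (16 + 16 : ZMod 31) = 1 by decide, one_smul]
  choose s hs hE using hs
  have hdiff : ∀ u ∈ p.1, ∀ v ∈ p.1, E u = E v → u⁻¹ * v ∈ A := fun u hu v hv e => by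
    rw [← R.ker _ (mul_mem (inv_mem hu) hv), R.add _ (inv_mem hu) _ hv, R.neg B hu, e,
      neg_add_cancel]
  have hEz : ∀ u ∈ p.1, ∀ x, E (u * z x) = E u := fun u hu x => by
    rw [R.add _ hu _ (B.ax.le (hmem x)), (R.ker _ (B.ax.le (hmem x))).mpr (hmem x), add_zero]
  have hfac : ∀ u ∈ p.1, ∀ v, E u = v → ∃ x, u = s v * z x := fun u hu v e => by
    obtain ⟨x, hx⟩ := (hzA _).mp (hdiff (s v) (hs v).1 u hu (by rw [hE, e]))
    exact ⟨x, by rw [hx]; group⟩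
  have hβ : ∀ a b, ∃ x, s a * s b = s (a + b) * z x := fun a b =>
    hfac _ (mul_mem (hs a).1 (hs b).1) _ (by rw [R.add _ (hs a).1 _ (hs b).1, hE, hE])
  choose β hβ using hβ
  refine ⟨z, s, β, ⟨fun x => B.ax.le (hmem x), hz, hzi, fun x u hu => B.ax.cen _ (hmem x) u hu,
    fun x => B.comm_ax (hmem x), hs, hβ, ?_, fun a b x e => ?_, fun u hu => ?_⟩, hzA, hE⟩
  · exact B.Iv_ax (hs 0) ((R.ker _ (hs 0).1).mp (hE 0))
  · rw [← hE a, e, hEz _ (hs b).1, hE]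
  · obtain ⟨x, hx⟩ := hfac u hu _ rfl
    exact ⟨_, x, hx.symm⟩

namespace Crd

variable {V : Type*} [AddCommGroup V] {z : ZMod 31 → G} {s : V → G} {β : V → V → ZMod 31}
  (C : Crd p t z s β) {a b c : V}

include C

theorem z_zero : z 0 = 1 := by simpa using C.z_add 0 0

theorem z_neg (x : ZMod 31) : z (-x) = (z x)⁻¹ :=
  eq_inv_of_mul_eq_one_left (by rw [← C.z_add, neg_add_cancel, C.z_zero])

theorem z_pow (x : ZMod 31) (n : ℕ) : z x ^ n = z (n * x) := by
  induction n with
  | zero => simp [C.z_zero]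
  | succ n ih => rw [pow_succ, ih, ← C.z_add]; push_cast; ring_nf

theorem beta_neg (ht : t * t = 1) (a b : V) : β b a = -β a b := by
  have h1 := congrArg (fun x => (t * x * t)⁻¹) (C.s_add a b)
  have e : ∀ x y : G, (t * (x * y) * t)⁻¹ = (t * y * t)⁻¹ * (t * x * t)⁻¹ := fun x y => by
    rw [← mul_inv_rev, show t * x * t * (t * y * t) = t * x * (t * t) * y * t by group, ht]; group
  simp only [e, (C.s_mem _).2, inv_inv] at h1
  rw [C.z_t, mul_assoc (z _), ht, mul_one, ← C.z_neg, C.z_cen _ _ (C.s_mem _).1, C.s_add,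
    add_comm b a] at h1
  exact C.z_inj (mul_left_cancel h1)

theorem cocycle (a b c : V) : β (a + b) c + β a b = β a (b + c) + β b c := by
  have h1 := mul_assoc (s a) (s b) (s c)
  rw [C.s_add a b, C.s_add b c, mul_assoc, C.z_cen _ _ (C.s_mem _).1, ← mul_assoc, C.s_add,
    ← mul_assoc, C.s_add, add_assoc, mul_assoc, mul_assoc, ← C.z_add, ← C.z_add] at h1
  exact C.z_inj (mul_left_cancel h1)

theorem beta_add (ht : t * t = 1) (a b c : V) : β (a + b) c = β a c + β b c := by
  have h1 := C.cocycle a b c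
  have h2 := C.cocycle b a c
  have h3 := C.cocycle a c b
  have n1 := C.beta_neg ht a b
  have n2 := C.beta_neg ht b c
  have n3 := C.beta_neg ht b (a + c)
  rw [add_comm b a] at h2
  rw [add_comm c b] at h3
  refine mul_left_cancel₀ (show (2 : ZMod 31) ≠ 0 by decide) ?_
  linear_combination h1 + h2 - h3 - n1 - n2 + n3

theorem beta_add_right (ht : t * t = 1) (a b c : V) : β a (b + c) = β a b + β a c := by
  rw [C.beta_neg ht _ a, C.beta_add ht, C.beta_neg ht a b, C.beta_neg ht a c]; ring

theorem beta_self (ht : t * t = 1) (a : V) : β a a = 0 := by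
  have h1 := C.beta_neg ht a a
  refine mul_left_cancel₀ (show (2 : ZMod 31) ≠ 0 by decide) ?_
  linear_combination h1

variable [Module (ZMod 31) V]

theorem beta_smul (ht : t * t = 1) (x : ZMod 31) (a b : V) : β (x • a) b = x * β a b :=
  ZMod.map_smul (AddMonoidHom.mk' (fun a => β a b) fun a c => C.beta_add ht a c b) x a

theorem beta_det (ht : t * t = 1) (x y x' y' : ZMod 31) (a b : V) :
    β (x • a + y • b) (x' • a + y' • b) = (x * y' - y * x') * β a b := by
  have hr : ∀ (x : ZMod 31) (a b : V), β a (x • b) = x * β a b := fun x a b => by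
    rw [C.beta_neg ht _ a, C.beta_smul ht, C.beta_neg ht a b]; ring
  rw [C.beta_add ht, C.beta_add_right ht, C.beta_add_right ht]
  simp only [C.beta_smul ht, hr, C.beta_self ht]
  rw [C.beta_neg ht a b]
  ring

theorem beta_conj {φ : V → V} {n : ZMod 31} (hs : ∀ a, g * s a * g⁻¹ = s (φ a))
    (hz : ∀ x, g * z x * g⁻¹ = z (n * x)) (hφ : ∀ a b, φ (a + b) = φ a + φ b) (a b : V) :
    β (φ a) (φ b) = n * β a b := by
  have h1 := congrArg (fun x => g * x * g⁻¹) (C.s_add a b)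
  have e : ∀ x y : G, g * (x * y) * g⁻¹ = g * x * g⁻¹ * (g * y * g⁻¹) := fun x y => by group
  simp only [e] at h1
  rw [hs, hs, hs, hz, C.s_add, hφ] at h1
  exact C.z_inj (mul_left_cancel h1)

end Crd

theorem Base.exists_chi (B : Base p q A t) {V : Type*} [AddCommGroup V] {z : ZMod 31 → G}
    {s : V → G} {β : V → V → ZMod 31} (C : Crd p t z s β) (hzA : ∀ a, a ∈ A ↔ ∃ x, z x = a) :
    ∃ χ : G → ZMod 31, ∀ g ∈ Hs p q, ∀ x, g * z x * g⁻¹ = z (χ g * x) := by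
  have : ∀ g, ∃ y, g ∈ Hs p q → g * z 1 * g⁻¹ = z y := fun g => by
    by_cases hg : g ∈ Hs p q
    · obtain ⟨y, hy⟩ := (hzA _).mp (B.conj_mem hg ((hzA _).mpr ⟨1, rfl⟩))
      exact ⟨y, fun _ => hy.symm⟩
    · exact ⟨0, fun hg' => absurd hg' hg⟩
  choose χ hχ using this
  refine ⟨χ, fun g hg x => ?_⟩
  have h1 := C.z_pow 1 x.val
  rw [mul_one, ZMod.natCast_zmod_val] at h1
  rw [← h1, ← conj_pow, hχ g hg, C.z_pow, ZMod.natCast_zmod_val, mul_comm]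

theorem Base.pow_eq_one (B : Base p q A t) (h : Hyp G) (hu : u ∈ Iv p t) : u ^ 31 = 1 := by
  by_contra hne
  have hu1 : u ≠ 1 := fun e => hne (by rw [e, one_pow])
  have hm : u ^ 31 ∈ Iv p t := ⟨p.1.pow_mem hu.1 _, by
    have := conj_pow (a := t) (b := u) (i := 31)
    rw [B.inv, hu.2] at this
    rw [← this, inv_pow]⟩
  obtain ⟨g, -, hg⟩ := B.exists_conj h hu hu1 hm hne
  have h1 := orderOf_conj g u
  rw [hg] at h1
  have h2 : 31 ∣ orderOf u := by
    obtain ⟨n, -, hn⟩ := (Nat.dvd_prime_pow p31).mp (show orderOf u ∣ 31 ^ 3 from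
      (Subgroup.orderOf_dvd_natCard p.1 hu.1).trans (h.card_sylow p).dvd)
    rcases n with _ | n
    · exact absurd (orderOf_eq_one_iff.mp hn) hu1
    · exact hn ▸ Dvd.intro_left _ rfl
  rw [orderOf_pow_of_dvd (by norm_num) h2] at h1
  have := orderOf_pos u
  omega

theorem Base.exists_rep' (B : Base p q A t) (h : Hyp G) : ∃ E ρ, Rep p q A E ρ := by
  refine B.exists_rep h fun u hu => ?_
  have h1 : (t * u * t * u)⁻¹ ∈ A := inv_mem (B.inverts hu)
  have h2 := B.pow_eq_one h (B.mul_t_mem hu)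
  have h3 := pow_natCard_of_mem h1
  rw [B.ax.card] at h3
  have e : u * (t * u⁻¹ * t) = u * u * (t * u * t * u)⁻¹ := by
    simp only [mul_inv_rev, B.inv]; group
  rw [e, Commute.mul_pow (B.ax.cen _ h1 _ (mul_mem hu hu)).symm, h3, mul_one,
    (Commute.refl u).mul_pow] at h2
  rw [h.eq_one_of_sq (p.1.pow_mem hu 31) h2]
  exact one_mem _

end Coordinates

section CentralElement

variable {G : Type*} [Group G] [Finite G] {p q r : Sylow 31 G} {g u v j k t w : G} {A : Subgroup G}
  {z : ZMod 31 → G} {s : (Fin 2 → ZMod 31) → G} {β : (Fin 2 → ZMod 31) → (Fin 2 → ZMod 31) → ZMod 31}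

theorem pow_sixty_four : ∀ c : ZMod 31, c ^ 64 = 1 → c = 1 ∨ c = -1 := by decide +kernel

theorem pow_fifteen : ∀ c : ZMod 31, c ≠ 0 → c ^ 15 = 1 ∨ c ^ 15 = -1 := by decide +kernel

theorem vec_eq (v : Fin 2 → ZMod 31) : v 0 • ![1, 0] + v 1 • ![0, 1] = v := by
  ext i; fin_cases i <;> simp

theorem Conf.exists_data (C : Conf p q A t u w) (h : Hyp G) :
    ∃ (E : G → Fin 2 → ZMod 31) (ρ : G → Matrix (Fin 2) (Fin 2) (ZMod 31)) (z : ZMod 31 → G)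
      (s : (Fin 2 → ZMod 31) → G) (β : (Fin 2 → ZMod 31) → (Fin 2 → ZMod 31) → ZMod 31)
      (χ : G → ZMod 31), Rep p q A E ρ ∧ Crd p t z s β ∧ (∀ a, a ∈ A ↔ ∃ x, z x = a) ∧
      (∀ g ∈ Hs p q, ∀ v, g * s v * g⁻¹ = s ((ρ g).mulVec v)) ∧
      (∀ g ∈ Hs p q, ∀ x, g * z x * g⁻¹ = z (χ g * x)) ∧
      (∀ g ∈ Hs p q, (ρ g).det = χ g) ∧ β ![1, 0] ![0, 1] ≠ 0 := by
  have B := C.base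
  obtain ⟨E, ρ, R⟩ := B.exists_rep' h
  obtain ⟨z, s, β, D, hzA, hE⟩ := R.exists_crd B
  obtain ⟨χ, hχ⟩ := B.exists_chi D hzA
  have hs : ∀ g ∈ Hs p q, ∀ v, g * s v * g⁻¹ = s ((ρ g).mulVec v) := fun g hg v => by
    have h1 := B.Iv_conj h hg (D.s_mem v)
    have h2 := D.s_mem ((ρ g).mulVec v)
    refine B.iv_ext h1 h2 ?_
    rw [← R.ker _ (mul_mem (inv_mem h1.1) h2.1), R.add _ (inv_mem h1.1) _ h2.1, R.neg B h1.1,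
      R.act g hg _ (D.s_mem v).1, hE, hE, neg_add_cancel]
  have h0 : β ![1, 0] ![0, 1] ≠ 0 := fun h0 => by
    have hβ : ∀ a b, β a b = 0 := fun a b => by
      rw [← vec_eq a, ← vec_eq b, D.beta_det B.sq, h0, mul_zero]
    refine C.not_abelian h fun u hu v hv => ?_
    obtain ⟨a, x, rfl⟩ := D.surj u hu
    obtain ⟨b, y, rfl⟩ := D.surj v hv
    have h1 : Commute (s a) (s b) := by
      rw [Commute, SemiconjBy, D.s_add, D.s_add, hβ, hβ, add_comm]
    have hz : ∀ x, ∀ u ∈ p.1, Commute u (z x) := fun x u hu => (D.z_cen x u hu).symm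
    exact (h1.mul_right (hz y _ (D.s_mem a).1)).mul_left
      ((hz x _ (D.s_mem b).1).symm.mul_right (hz y _ (D.z_mem x)))
  refine ⟨E, ρ, z, s, β, χ, R, D, hzA, hs, hχ, fun g hg => ?_, h0⟩
  have h1 := D.beta_conj (hs g hg) (hχ g hg) (Matrix.mulVec_add _) ![1, 0] ![0, 1]
  rw [← vec_eq ((ρ g).mulVec ![1, 0]), ← vec_eq ((ρ g).mulVec ![0, 1]), D.beta_det B.sq] at h1
  have h2 := mul_right_cancel₀ h0 h1
  rw [← h2, Matrix.det_fin_two]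
  simp [Matrix.mulVec, dotProduct, Fin.sum_univ_two]
  ring

theorem Crd.chi_ne (D : Crd p t z s β) {n : ZMod 31} (hn : ∀ x, g * z x * g⁻¹ = z (n * x)) :
    n ≠ 0 := fun e => by
  have h1 := hn 1
  rw [e, zero_mul, D.z_zero, conj_eq_one_iff] at h1
  exact one_ne_zero (D.z_inj (h1.trans D.z_zero.symm))

theorem Crd.chi_mul (D : Crd p t z s β) {χ : G → ZMod 31}
    (hχ : ∀ g ∈ Hs p q, ∀ x, g * z x * g⁻¹ = z (χ g * x)) (hg : g ∈ Hs p q) (hj : j ∈ Hs p q) :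
    χ (g * j) = χ g * χ j := by
  have h1 := hχ _ (mul_mem hg hj) 1
  rw [show g * j * z 1 * (g * j)⁻¹ = g * (j * z 1 * j⁻¹) * g⁻¹ by group, hχ j hj, hχ g hg] at h1
  simpa using (D.z_inj h1).symm

theorem Crd.chi_iff (D : Crd p t z s β) (hzA : ∀ a, a ∈ A ↔ ∃ x, z x = a) {χ : G → ZMod 31}
    (hχ : ∀ g ∈ Hs p q, ∀ x, g * z x * g⁻¹ = z (χ g * x)) (hg : g ∈ Hs p q) :
    χ g = 1 ↔ g ∈ cz(A) := by
  refine ⟨fun e => mem_centralizer_iff.mpr fun a ha => ?_, fun e => ?_⟩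
  · obtain ⟨x, rfl⟩ := (hzA a).mp ha
    have := hχ g hg x
    rw [e, one_mul] at this
    exact (mul_inv_eq_iff_eq_mul.mp this).symm
  · have h1 := hχ g hg 1
    rw [← mem_centralizer_iff.mp e _ ((hzA _).mpr ⟨1, rfl⟩), mul_inv_cancel_right] at h1
    simpa using (D.z_inj h1).symm

theorem Conf.exists_sqrt (C : Conf p q A t u w) (h : Hyp G)
    (hK : Nat.card (cz(A) ⊓ Hs p q : Subgroup G) = 32) :
    ∃ k ∈ Hs p q, k * k = t ∧ ∀ g ∈ Hs p q, g * k = k * g := by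
  have B := C.base
  obtain ⟨E, ρ, z, s, β, χ, R, D, hzA, hs, hχ, hdet, h0⟩ := C.exists_data h
  haveI := Fact.mk Nat.prime_two
  have hχ0 := fun g (hg : g ∈ Hs p q) => D.chi_ne (hχ g hg)
  have hχm := fun g (hg : g ∈ Hs p q) j (hj : j ∈ Hs p q) => D.chi_mul hχ hg hj
  have hχcz := fun g (hg : g ∈ Hs p q) => D.chi_iff hzA hχ hg
  have hχp : ∀ g ∈ Hs p q, ∀ n : ℕ, χ (g ^ n) = χ g ^ n := fun g hg n => by
    induction n with
    | zero => exact mul_left_cancel₀ (hχ0 1 (one_mem _)) (by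
        rw [← hχm 1 (one_mem _) _ (pow_mem hg 0)]; simp)
    | succ n ih => rw [pow_succ, hχm _ (pow_mem hg n) g hg, ih, pow_succ]
  obtain ⟨T, hT, hTH⟩ : ∃ T : Subgroup G, Nat.card T = 64 ∧ T ≤ Hs p q := by
    obtain ⟨T, hT⟩ := Sylow.exists_subgroup_card_pow_prime (G := Hs p q) 2 (n := 6)
      (by rw [h.card_Hs B.ne]; norm_num)
    exact ⟨T.map (Hs p q).subtype,
      (card_map_of_injective (Hs p q).subtype_injective).trans hT, map_subtype_le T⟩
  obtain ⟨x, hxT, hxK⟩ : ∃ x ∈ T, x ∉ cz(A) := by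
    by_contra! hc
    have := Nat.le_of_dvd (by norm_num) (hK ▸ card_dvd_of_le (le_inf hc hTH))
    omega
  have hx := hTH hxT
  have hx64 : x ^ 64 = 1 := by rw [← hT]; exact pow_natCard_of_mem hxT
  have hχx : χ x = -1 := by
    refine (pow_sixty_four _ ?_).resolve_left fun e => hxK ((hχcz x hx).mp e)
    rw [← hχp x hx, hx64, hχcz 1 (one_mem _)]
    exact one_mem _
  have hxx : x ^ 2 ∈ cz(A) := by
    rw [← hχcz _ (pow_mem hx 2), hχp x hx, hχx]; ring
  have hx32 : x ^ 32 = t := by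
    refine B.uniq h (pow_mem hx 32) (orderOf_eq_prime (by rw [← pow_mul, hx64]) fun e => ?_)
    have h1 := sq_eq_one_of_det ((hdet x hx).trans hχx) (by rw [← R.pow B hx, e, R.one])
    rw [← R.pow B hx] at h1
    refine hxK ?_
    rw [B.uniq h hx (orderOf_eq_prime (R.eq_one B h (pow_mem hx 2) hxx h1) fun e1 =>
      hxK (e1 ▸ one_mem _))]
    exact B.mem_cz
  have ho : orderOf x = 2 ^ 6 := orderOf_eq_prime_pow (by
    norm_num
    rw [hx32]
    exact fun e => by simpa [e] using B.ord) hx64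
  have hKx : zpowers (x ^ 2) = cz(A) ⊓ Hs p q :=
    eq_of_le_of_card (zpowers_le.mpr ⟨hxx, pow_mem hx 2⟩) (by
      rw [Nat.card_zpowers, orderOf_pow_of_dvd (by norm_num) (by rw [ho]; norm_num), ho]; norm_num) hK
  have hcomm : ∀ y ∈ cz(A) ⊓ Hs p q, Commute y x := fun y hy => by
    rw [← hKx] at hy
    obtain ⟨n, rfl⟩ := mem_zpowers_iff.mp hy
    exact ((Commute.refl x).pow_left 2).zpow_left n
  have hkH : x ^ 16 ∈ Hs p q := pow_mem hx 16
  have hkk : x ^ 16 * x ^ 16 = t := by rw [← pow_add, hx32]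
  have hkK : x ^ 16 ∈ cz(A) := by
    rw [show x ^ 16 = (x ^ 2) ^ 8 by rw [← pow_mul]]; exact pow_mem hxx 8
  refine ⟨x ^ 16, hkH, hkk, fun g hg => ?_⟩
  obtain ⟨k, hk⟩ : ∃ k, k = x ^ 16 := ⟨_, rfl⟩
  rw [← hk] at hkH hkk hkK ⊢
  have hkx : ∀ y, Commute y x → Commute y k := fun y hy => hk ▸ hy.pow_right 16
  have h2 : g * k * g⁻¹ = k ∨ g * k * g⁻¹ = t * k := by
    obtain ⟨y, hy⟩ : ∃ y, y = g * k * g⁻¹ := ⟨_, rfl⟩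
    have hyK : y ∈ cz(A) ⊓ Hs p q := hy ▸ ⟨B.conj_mem_cz hg hkK,
      mul_mem (mul_mem hg hkH) ((Hs p q).inv_mem hg)⟩
    have hc := hkx y (hcomm y hyK)
    have hyy : y * y = t := by
      rw [hy, show g * k * g⁻¹ * (g * k * g⁻¹) = g * (k * k) * g⁻¹ by group, hkk, B.central h hg]
      group
    rw [← hy]
    by_cases e : y * k⁻¹ = 1
    · exact .inl (mul_inv_eq_one.mp e)
    · refine .inr (mul_inv_eq_iff_eq_mul.mp (B.uniq h (mul_mem hyK.2 ((Hs p q).inv_mem hkH))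
        (orderOf_eq_prime ?_ e)))
      rw [hc.inv_right.mul_pow, inv_pow, pow_two, pow_two, hyy, hkk, mul_inv_cancel]
  have hg2 : Commute (g * g) k := by
    refine mul_inv_eq_iff_eq_mul.mp ?_
    rw [show g * g * k * (g * g)⁻¹ = g * (g * k * g⁻¹) * g⁻¹ by group]
    rcases h2 with e | e
    · rw [e, e]
    · rw [e, ← mul_assoc, B.central h hg, mul_assoc t, mul_assoc t, e, ← mul_assoc, B.sq, one_mul]
  have hg15 : Commute (g ^ 15) k := by
    have hg' : g ^ 15 ∈ Hs p q := pow_mem hg 15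
    rcases pow_fifteen _ (hχ0 g hg) with e | e
    · exact hkx _ (hcomm _ ⟨(hχcz _ hg').mp (by rw [hχp g hg, e]), hg'⟩)
    · have h3 : g ^ 15 * x ∈ cz(A) ⊓ Hs p q :=
        ⟨(hχcz _ (mul_mem hg' hx)).mp (by rw [hχm _ hg' x hx, hχp g hg, e, hχx]; ring),
          mul_mem hg' hx⟩
      have h4 := (hkx _ (hcomm _ h3)).mul_left (hkx x (Commute.refl x)).inv_left
      rwa [mul_inv_cancel_right] at h4
  have h5 := hg15.mul_left (hg2.pow_left 7).inv_left
  rw [show g ^ 15 * ((g * g) ^ 7)⁻¹ = g by rw [← pow_two, ← pow_mul]; group] at h5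
  exact h5.eq

end CentralElement

section Quad

open QuadraticAlgebra

/-- The field with `961` elements, obtained by adjoining a square root `ω` of `-1`. -/
abbrev Quad := QuadraticAlgebra (ZMod 31) (-1) 0

instance : Fact (∀ r : ZMod 31, r ^ 2 ≠ -1 + 0 * r) := ⟨by decide⟩

instance : Finite Quad := Finite.of_equiv _ (equivProd (-1 : ZMod 31) 0).symm

theorem card_quad : Nat.card Quad = 961 := by
  rw [Nat.card_congr (equivProd (-1 : ZMod 31) 0), Nat.card_prod, Nat.card_zmod]

theorem norm_ne {a : Quad} (ha : a ≠ 0) : norm a ≠ 0 := mt norm_eq_zero_iff_eq_zero.mp ha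

theorem star_ne {a : Quad} (ha : a ≠ 0) : star a ≠ 0 := mt star_eq_zero.mp ha

theorem pow_thirty_one (a : Quad) : a ^ 31 = star a := by
  have : CharP Quad 31 := charP_of_injective_algebraMap (algebraMap (ZMod 31) Quad).injective 31
  have h1 : a = algebraMap (ZMod 31) Quad a.re + algebraMap (ZMod 31) Quad a.im * ω := by
    ext <;> simp
  have h2 : (ω : Quad) ^ (2 * 15 + 1) = -ω := by
    rw [pow_succ, pow_mul, sq, omega_mul_omega_eq_mk]; decide
  rw [h1, add_pow_char, mul_pow, ← map_pow, ← map_pow, ZMod.pow_card, ZMod.pow_card,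
    show (ω : Quad) ^ 31 = -ω from h2]
  ext <;> simp

theorem pow_units (a : Quad) (ha : a ≠ 0) : a ^ 929 = (star a)⁻¹ := by
  have := Fintype.ofFinite Quad
  have h1 := FiniteField.pow_card_sub_one_eq_one a ha
  rw [← Nat.card_eq_fintype_card, card_quad] at h1
  refine eq_inv_of_mul_eq_one_left ?_
  rw [← pow_thirty_one, ← pow_add]
  exact h1

theorem exponent_eq : ∀ m < 960, (m * m % 960 = 1 ∧ 30 * m % 960 = 30) →
    (320 * m % 960 ≠ 320 ∧ 192 * m % 960 ≠ 192 ∧ 15 * m % 960 ≠ 15) → m = 929 := by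
  decide +kernel

variable {G : Type*} [Group G] [Finite G] {p q r : Sylow 31 G} {g j k t w : G} {A : Subgroup G}
  {m : ZMod 31} {z : ZMod 31 → G} {u d : Quad → G}

/-- Coordinates over the quadratic field on a Sylow subgroup and on a two-point stabilizer. -/
structure Co (p q : Sylow 31 G) (m : ZMod 31) (z : ZMod 31 → G) (u d : Quad → G) : Prop where
  ne : p ≠ q
  m_ne : m ≠ 0
  z_mem : ∀ x, z x ∈ p.1
  u_mem : ∀ a, u a ∈ p.1
  z_add : ∀ x y, z (x + y) = z x * z y
  z_inj : Function.Injective z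
  zu : ∀ x a, z x * u a = u a * z x
  u_add : ∀ a b, u a * u b = u (a + b) * z (m * (a.re * b.im - a.im * b.re))
  u_inj : ∀ a b x, u a = u b * z x → a = b
  surj : ∀ g ∈ p.1, ∃ a x, u a * z x = g
  d_mem : ∀ a, a ≠ 0 → d a ∈ Hs p q
  d_surj : ∀ g ∈ Hs p q, ∃ a, a ≠ 0 ∧ d a = g
  d_mul : ∀ a b, a ≠ 0 → b ≠ 0 → d (a * b) = d a * d b
  du : ∀ a b, a ≠ 0 → d a * u b = u (a * b) * d a
  dz : ∀ a x, a ≠ 0 → d a * z x = z (norm a * x) * d a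

theorem Conf.exists_co {u₀ : G} (C : Conf p q A t u₀ w) (h : Hyp G)
    (hK : Nat.card (cz(A) ⊓ Hs p q : Subgroup G) = 32) :
    ∃ m z u d, Co p q m z u d ∧ u 1 = u₀ ∧ d (-1) = t := by
  have B := C.base
  obtain ⟨E, ρ, z, s, β, χ, R, D, hzA, hs, hχ, hdet, h0⟩ := C.exists_data h
  obtain ⟨k, hk, hkk, hkc⟩ := C.exists_sqrt h hK
  obtain ⟨v₀, x, hv⟩ := D.surj u₀ C.mem.1
  have hv₀ : s v₀ = u₀ := B.iv_ext (D.s_mem v₀) C.mem (by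
    rw [← hv, inv_mul_cancel_left]; exact (hzA _).mpr ⟨x, rfl⟩)
  have hv0 : v₀ ≠ 0 := fun e => C.ne (by rw [← hv₀, e, D.s_zero])
  have s_inj : ∀ {a b}, s a = s b → a = b := fun {a b} e => D.s_inj a b 0 (by
    rw [D.z_zero, mul_one, e])
  let M : Quad →ₐ[ZMod 31] Matrix (Fin 2) (Fin 2) (ZMod 31) := QuadraticAlgebra.lift ⟨ρ k, by
    rw [← R.mul B hk hk, hkk, R.map_t B, zero_smul, add_zero, neg_smul, one_smul]⟩
  have hM : ∀ a, M a = a.re • 1 + a.im • ρ k := fun a => rfl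
  let L : Quad →+ (Fin 2 → ZMod 31) :=
    { toFun := fun a => (M a).mulVec v₀
      map_zero' := by simp
      map_add' := fun a b => by rw [map_add, Matrix.add_mulVec] }
  have hL : ∀ a, L a = (M a).mulVec v₀ := fun a => rfl
  have hL1 : L 1 = v₀ := by rw [hL, map_one, Matrix.one_mulVec]
  have hLi : Function.Injective L := (injective_iff_map_eq_zero L).mpr fun a ha => by
    by_contra hne
    rw [hL] at ha
    apply hv0
    rw [← hL1, hL, ← inv_mul_cancel₀ hne, map_mul, ← Matrix.mulVec_mulVec, ha, Matrix.mulVec_zero]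
  have hLs : Function.Surjective L := (hLi.bijective_of_nat_card_le (by
    rw [card_quad]; simp)).2
  have hLf : ∀ a, L a = a.re • v₀ + a.im • (ρ k).mulVec v₀ := fun a => by
    rw [hL, hM, Matrix.add_mulVec, Matrix.smul_mulVec, Matrix.smul_mulVec, Matrix.one_mulVec]
  have hβ : ∀ a b, β (L a) (L b) = β v₀ ((ρ k).mulVec v₀) * (a.re * b.im - a.im * b.re) := fun a b => by
    rw [hLf, hLf, D.beta_det B.sq]; ring
  have hact : ∀ g ∈ Hs p q, ∀ a, g * s v₀ * g⁻¹ = s (L a) → ∀ b, (ρ g).mulVec (L b) = L (a * b) :=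
    fun g hg a e b => by
      rw [hs g hg] at e
      have hc : ρ g * M b = M b * ρ g := by
        rw [hM, mul_add, add_mul, mul_smul_comm, smul_mul_assoc, mul_smul_comm, smul_mul_assoc,
          ← R.mul B hg hk, ← R.mul B hk hg, hkc g hg, mul_one, one_mul]
      rw [hL, hL, Matrix.mulVec_mulVec, hc, ← Matrix.mulVec_mulVec, s_inj e, hL,
        Matrix.mulVec_mulVec, ← map_mul, mul_comm b]
  have hm : β v₀ ((ρ k).mulVec v₀) ≠ 0 := fun e => h0 (by
    obtain ⟨a, ha⟩ := hLs ![1, 0]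
    obtain ⟨b, hb⟩ := hLs ![0, 1]
    rw [← ha, ← hb, hβ, e, zero_mul])
  have hd : ∀ a : Quad, ∃ g, a ≠ 0 → g ∈ Hs p q ∧ g * s v₀ * g⁻¹ = s (L a) := fun a => by
    by_cases ha : a = 0
    · exact ⟨1, fun h => (h ha).elim⟩
    · obtain ⟨g, hg, e⟩ := B.exists_conj h C.mem C.ne (D.s_mem (L a)) fun e =>
        ha (hLi (by rw [map_zero]; exact s_inj (e.trans D.s_zero.symm)))
      exact ⟨g, fun _ => ⟨hg, by rw [hv₀, e]⟩⟩
  choose d hd using hd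
  have huniq : ∀ g ∈ Hs p q, ∀ a, a ≠ 0 → g * s v₀ * g⁻¹ = s (L a) → d a = g := fun g hg a ha e => by
    have h1 := B.eq_one_of_conj h C.mem C.ne (mul_mem (inv_mem hg) (hd a ha).1) (by
      rw [← mul_inv_eq_iff_eq_mul, ← hv₀]
      rw [show g⁻¹ * d a * s v₀ * (g⁻¹ * d a)⁻¹ = g⁻¹ * (d a * s v₀ * (d a)⁻¹) * g by group,
        (hd a ha).2, ← e]
      group)
    exact (inv_mul_eq_one.mp h1).symm
  refine ⟨β v₀ ((ρ k).mulVec v₀), z, fun a => s (L a), d, ⟨B.ne, hm, D.z_mem,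
    fun a => (D.s_mem _).1, D.z_add, D.z_inj, fun x a => D.z_cen x _ (D.s_mem _).1,
    fun a b => ?_, fun a b x e => hLi (D.s_inj _ _ x e), fun g hg => ?_, fun a ha => (hd a ha).1,
    fun g hg => ?_, fun a b ha hb => ?_, fun a b ha => ?_, fun a x ha => ?_⟩, ?_, ?_⟩
  · rw [← hβ, map_add]; exact D.s_add _ _
  · obtain ⟨v, x, rfl⟩ := D.surj g hg
    obtain ⟨a, rfl⟩ := hLs v
    exact ⟨a, x, rfl⟩
  · obtain ⟨a, ha⟩ := hLs ((ρ g).mulVec v₀)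
    have h1 : g * s v₀ * g⁻¹ = s (L a) := by rw [hs g hg, ha]
    have hne : a ≠ 0 := fun e => C.ne (by
      rw [e, map_zero, D.s_zero, conj_eq_one_iff] at h1
      rw [← hv₀, h1])
    exact ⟨a, hne, huniq g hg a hne h1⟩
  · refine huniq _ (mul_mem (hd a ha).1 (hd b hb).1) _ (mul_ne_zero ha hb) ?_
    rw [show d a * d b * s v₀ * (d a * d b)⁻¹ = d a * (d b * s v₀ * (d b)⁻¹) * (d a)⁻¹ by group,
      (hd b hb).2, hs _ (hd a ha).1, hact _ (hd a ha).1 a (hd a ha).2]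
  · rw [← mul_inv_eq_iff_eq_mul]
    rw [hs _ (hd a ha).1, hact _ (hd a ha).1 a (hd a ha).2]
  · rw [← mul_inv_eq_iff_eq_mul, hχ _ (hd a ha).1]
    have h1 := D.beta_conj (hs _ (hd a ha).1) (hχ _ (hd a ha).1) (Matrix.mulVec_add _) (L 1) (L ω)
    rw [hact _ (hd a ha).1 a (hd a ha).2, hact _ (hd a ha).1 a (hd a ha).2, hβ, hβ] at h1
    simp only [mul_one, re_mul, im_mul, omega_re, omega_im, re_one, im_one] at h1
    rw [show χ (d a) = norm a from mul_left_cancel₀ hm (by rw [norm_def]; linear_combination -h1)]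
  · change s (L 1) = u₀
    rw [hL1, hv₀]
  · refine huniq t B.mem _ (neg_ne_zero.mpr one_ne_zero) ?_
    rw [hs t B.mem, R.map_t B, map_neg, hL1, Matrix.neg_mulVec, Matrix.one_mulVec]

theorem Co.d_one (D : Co p q m z u d) : d 1 = 1 := by
  simpa using D.d_mul 1 1 one_ne_zero one_ne_zero

theorem Co.d_pow (D : Co p q m z u d) {a : Quad} (ha : a ≠ 0) (n : ℕ) : d (a ^ n) = d a ^ n := by
  induction n with
  | zero => simpa using D.d_one
  | succ n ih => rw [pow_succ, D.d_mul _ _ (pow_ne_zero n ha) ha, ih, pow_succ]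

theorem conj_sq (hw : w * w = 1) (g : G) : w * (w * g * w) * w = g := by
  rw [show w * (w * g * w) * w = w * w * g * (w * w) by group, hw]; group

theorem conj_pow_sq (hw : w * w = 1) (g : G) (n : ℕ) : (w * g * w) ^ n = w * g ^ n * w := by
  have := inv_eq_of_mul_eq_one_left hw
  rw [show w * g * w = w * g * w⁻¹ by rw [this], conj_pow, this]

/-- Coordinates together with an involution swapping the two base points. -/
structure Cw (p q : Sylow 31 G) (m : ZMod 31) (z : ZMod 31 → G) (u d : Quad → G) (w : G) :
    Prop extends Co p q m z u d where
  ww : w * w = 1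
  wp : w • p = q
  wq : w • q = p
  wu : w • u 1 • q = u 1 • q
  braid : (u 1 * d (-1) * w) ^ 3 = 1
  wd : ∀ a, a ≠ 0 → w * d a = d (star a)⁻¹ * w

theorem Conf.exists_cw {u₀ : G} (C : Conf p q A t u₀ w) (h : Hyp G)
    (hK : Nat.card (cz(A) ⊓ Hs p q : Subgroup G) = 32) :
    ∃ m z u d, Cw p q m z u d w := by
  obtain ⟨m, z, u, d, D, hu, ht⟩ := C.exists_co h hK
  refine ⟨m, z, u, d, D, C.sq, C.wp, C.wq, by rw [hu, C.wu], by rw [hu, ht, C.braid h],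
    fun a ha => ?_⟩
  have hww := C.sq
  obtain ⟨γ, hγ⟩ := IsCyclic.exists_generator (α := Quadˣ)
  have hγ0 : (γ : Quad) ≠ 0 := γ.ne_zero
  obtain ⟨g, hg⟩ : ∃ g, g = d γ := ⟨_, rfl⟩
  have hgen : ∀ a : Quad, a ≠ 0 → ∃ n : ℕ, a = γ ^ n ∧ d a = g ^ n := fun a ha => by
    obtain ⟨n, hn⟩ := mem_powers_iff_mem_zpowers.mpr (hγ (Units.mk0 a ha))
    have : a = γ ^ n := by
      have := congrArg Units.val hn
      simpa using this.symm
    exact ⟨n, this, by rw [this, D.d_pow hγ0, hg]⟩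
  have hgH : g ∈ Hs p q := hg ▸ D.d_mem _ hγ0
  have hgenH : ∀ j ∈ Hs p q, ∃ n : ℕ, g ^ n = j := fun j hj => by
    obtain ⟨a, ha, rfl⟩ := D.d_surj j hj
    obtain ⟨n, -, h1⟩ := hgen a ha
    exact ⟨n, h1.symm⟩
  have ho : orderOf g = 960 := by
    have : zpowers g = Hs p q := le_antisymm (zpowers_le.mpr hgH) fun j hj => by
      obtain ⟨n, rfl⟩ := hgenH j hj
      exact npow_mem_zpowers g n
    rw [← Nat.card_zpowers, this, h.card_Hs D.ne]
  obtain ⟨n, hn⟩ := hgenH _ (C.conj_mem hgH)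
  obtain ⟨e, he, hn⟩ : ∃ e < 960, g ^ e = w * g * w :=
    ⟨n % 960, Nat.mod_lt _ (by norm_num), by rw [← ho, pow_mod_orderOf, hn]⟩
  have hfix : ∀ n, n * e % 960 = n % 960 ↔ w * g ^ n = g ^ n * w := fun n => by
    have h1 := pow_eq_pow_iff_modEq (x := g) (n := n * e) (m := n)
    rw [ho, mul_comm n e, pow_mul, hn, conj_pow_sq hww] at h1
    rw [mul_comm n e]
    refine h1.symm.trans ⟨fun h2 => ?_, fun h2 => ?_⟩
    · nth_rw 2 [← h2]
      rw [mul_assoc _ w w, hww, mul_one]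
    · rw [h2, mul_assoc, hww, mul_one]
  have hdiv : ∀ n, w * g ^ n = g ^ n * w → 30 ∣ n := fun n e => by
    have h1 := pow_natCard_of_mem (A := Hs p q ⊓ centralizer {w}) (v := g ^ n)
      ⟨(Hs p q).pow_mem hgH n, mem_centralizer_singleton_iff.mpr e.symm⟩
    rw [C.card_cent h, ← pow_mul] at h1
    have := ho ▸ orderOf_dvd_of_pow_eq_one h1
    omega
  have h30 : w * g ^ 30 = g ^ 30 * w := by
    have h1 : Hs p q ⊓ centralizer {w} = zpowers (g ^ 30) :=
      eq_of_le_of_card (fun j hj => by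
        obtain ⟨n, rfl⟩ := hgenH j hj.1
        obtain ⟨l, rfl⟩ := hdiv n (mem_centralizer_singleton_iff.mp hj.2).symm
        rw [pow_mul]; exact npow_mem_zpowers _ l) (C.card_cent h) (by
        rw [Nat.card_zpowers, orderOf_pow_of_dvd (by norm_num) (by rw [ho]; norm_num), ho])
    have h2 : g ^ 30 ∈ Hs p q ⊓ centralizer {w} := h1 ▸ mem_zpowers _
    exact (mem_centralizer_singleton_iff.mp h2.2).symm
  have hno : ∀ n, ¬ 30 ∣ n → n * e % 960 ≠ n % 960 := fun n hn e =>
    hn (hdiv n ((hfix n).mp e))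
  have h929 := exponent_eq e he ⟨by
    have h1 : g ^ (e * e) = g ^ 1 := by
      rw [pow_mul, hn, conj_pow_sq hww, hn, conj_sq hww, pow_one]
    rw [pow_eq_pow_iff_modEq, ho] at h1
    exact h1, (hfix 30).mpr h30⟩ ⟨hno 320 (by norm_num), hno 192 (by norm_num),
    hno 15 (by norm_num)⟩
  obtain ⟨n, rfl, h1⟩ := hgen a ha
  rw [← pow_units _ ha, D.d_pow ha, h1, ← pow_mul, mul_comm n, pow_mul, ← h929, hn,
    conj_pow_sq hww, mul_assoc _ w w, hww, mul_one]

/-- The point with coordinates `a` and `x`. -/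
def pt (q : Sylow 31 G) (z : ZMod 31 → G) (u : Quad → G) (a : Quad) (x : ZMod 31) : Sylow 31 G :=
  u a • z x • q

namespace Co

variable (D : Co p q m z u d)
include D

theorem z_zero : z 0 = 1 := by simpa using D.z_add 0 0

theorem z_neg (x : ZMod 31) : z (-x) = (z x)⁻¹ :=
  eq_inv_of_mul_eq_one_left (by rw [← D.z_add, neg_add_cancel, D.z_zero])

theorem u_zero : u 0 = 1 := by simpa [D.z_zero] using D.u_add 0 0

theorem pt_zero : pt q z u 0 0 = q := by rw [pt, D.u_zero, D.z_zero, one_smul, one_smul]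

theorem z_pt (y : ZMod 31) (a : Quad) (x : ZMod 31) : z y • pt q z u a x = pt q z u a (y + x) := by
  rw [pt, pt, smul_smul, D.zu, mul_smul, D.z_add, mul_smul (z y)]

theorem u_pt (b a : Quad) (x : ZMod 31) : u b • pt q z u a x =
    pt q z u (b + a) (m * (b.re * a.im - b.im * a.re) + x) := by
  rw [pt, pt, smul_smul, D.u_add, mul_smul, smul_smul (z _), D.z_add]

theorem d_smul {c : Quad} (hc : c ≠ 0) : d c • p = p ∧ d c • q = q := mem_Hs.mp (D.d_mem c hc)

theorem d_pt {c : Quad} (hc : c ≠ 0) (a : Quad) (x : ZMod 31) :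
    d c • pt q z u a x = pt q z u (c * a) (norm c * x) := by
  rw [pt, pt, smul_smul, D.du _ _ hc, mul_smul, smul_smul (d c), D.dz _ _ hc, mul_smul,
    (D.d_smul hc).2]

theorem pt_ne (a : Quad) (x : ZMod 31) : pt q z u a x ≠ p := fun e => by
  rw [pt, smul_smul, ← eq_inv_smul_iff,
    smul_of_mem (inv_mem (mul_mem (D.u_mem a) (D.z_mem x)))] at e
  exact D.ne e.symm

theorem pt_inj (h : Hyp G) {a b : Quad} {x y : ZMod 31} (e : pt q z u a x = pt q z u b y) :
    a = b ∧ x = y := by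
  rw [pt, pt, smul_smul, smul_smul, ← inv_smul_eq_iff, smul_smul] at e
  have h1 := h.eq_one_of_fix D.ne (mul_mem (inv_mem (mul_mem (D.u_mem b) (D.z_mem y)))
    (mul_mem (D.u_mem a) (D.z_mem x))) e
  rw [inv_mul_eq_one] at h1
  have h2 := D.u_inj a b (y - x) (by rw [sub_eq_add_neg, D.z_add, D.z_neg, ← mul_assoc, h1]; group)
  rw [h2, mul_left_cancel_iff] at h1
  exact ⟨h2, (D.z_inj h1).symm⟩

theorem pt_surj (h : Hyp G) (hr : r ≠ p) : ∃ a x, pt q z u a x = r := by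
  obtain ⟨g, hg, rfl⟩ := h.exists_smul_eq D.ne hr.symm
  obtain ⟨a, x, rfl⟩ := D.surj g hg
  exact ⟨a, x, by rw [pt, smul_smul]⟩

end Co

theorem norm_star_inv {a : Quad} (ha : a ≠ 0) : norm (star a)⁻¹ = (norm a)⁻¹ :=
  eq_inv_of_mul_eq_one_left (by
    rw [← QuadraticAlgebra.norm_star a, ← map_mul, inv_mul_cancel₀ (star_ne ha), map_one])

theorem norm_surj : ∀ x : ZMod 31, x ≠ 0 → ∃ a b : ZMod 31, x = a * a + b * b := by decide +kernel

theorem exists_norm_eq {x : ZMod 31} (hx : x ≠ 0) : ∃ a : Quad, a ≠ 0 ∧ norm a = x := by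
  obtain ⟨a, b, h⟩ := norm_surj x hx
  have : norm (⟨a, b⟩ : Quad) = x := by rw [norm_def, h]; ring
  exact ⟨⟨a, b⟩, fun e => hx (by rw [← this, e, QuadraticAlgebra.norm_zero]), this⟩

namespace Cw

variable (D : Cw p q m z u d w)
include D

theorem rescale {μ : ZMod 31} (hμ : μ ≠ 0) : Cw p q (m * μ) (fun x => z (x / μ)) u d w :=
  { D with
    m_ne := mul_ne_zero D.m_ne hμ
    z_mem := fun x => D.z_mem _
    z_add := fun x y => by rw [add_div, D.z_add]
    z_inj := fun x y e => (div_left_inj' hμ).mp (D.z_inj e)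
    zu := fun x a => D.zu _ a
    u_add := fun a b => by
      rw [D.u_add]
      congr 2
      rw [mul_right_comm, mul_div_cancel_right₀ _ hμ]
    u_inj := fun a b x e => D.u_inj a b _ e
    surj := fun g hg => by
      obtain ⟨a, x, rfl⟩ := D.surj g hg
      exact ⟨a, x * μ, by rw [mul_div_cancel_right₀ _ hμ]⟩
    dz := fun a x ha => by rw [D.dz _ _ ha, mul_div_assoc] }

theorem w_smul_w (r : Sylow 31 G) : w • w • r = r := by rw [smul_smul, D.ww, one_smul]

theorem w_d {a : Quad} (ha : a ≠ 0) (r : Sylow 31 G) : w • d a • r = d (star a)⁻¹ • w • r := by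
  rw [smul_smul, D.wd a ha, mul_smul]

theorem w_pt_ne (h : Hyp G) {a : Quad} {x : ZMod 31} (hax : ¬ (a = 0 ∧ x = 0)) :
    ∃ b y, w • pt q z u a x = pt q z u b y ∧ ¬ (b = 0 ∧ y = 0) := by
  obtain ⟨b, y, e⟩ := D.pt_surj h (r := w • pt q z u a x) fun e => hax (by
    refine D.pt_inj h ?_
    rw [D.pt_zero, ← D.w_smul_w (pt q z u a x), e, D.wp])
  refine ⟨b, y, e.symm, fun e1 => D.pt_ne a x ?_⟩
  rw [e1.1, e1.2, D.pt_zero] at e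
  rw [← D.w_smul_w (pt q z u a x), ← e, D.wq]

theorem exists_axis (h : Hyp G) : ∃ c, c ≠ 0 ∧
    ∀ x, x ≠ 0 → w • pt q z u 0 x = pt q z u 0 (c / x) := by
  have hm1 : (-1 : Quad) ≠ 0 := neg_ne_zero.mpr one_ne_zero
  obtain ⟨b, c, e, hc⟩ := D.w_pt_ne h (a := 0) (x := 1) (by simp)
  have h1 : d (-1) • w • pt q z u 0 1 = d (-1) • pt q z u b c := by rw [e]
  rw [show d (-1) = d (star (-1))⁻¹ by rw [star_neg, star_one, inv_neg, inv_one], ← D.w_d hm1,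
    star_neg, star_one, inv_neg, inv_one, D.d_pt hm1, D.d_pt hm1, mul_zero, QuadraticAlgebra.norm_neg, map_one,
    one_mul, one_mul, e] at h1
  have h2 : b = 0 := by
    have := (D.pt_inj h h1).1
    have h3 : (2 : Quad) * b = 0 := by linear_combination this
    exact (mul_eq_zero.mp h3).resolve_left (by
      intro e; have := congrArg QuadraticAlgebra.re e; revert this; decide)
  subst h2
  refine ⟨c, fun e => hc ⟨rfl, e⟩, fun x hx => ?_⟩
  obtain ⟨a, ha, rfl⟩ := exists_norm_eq hx
  have h3 := D.d_pt ha 0 1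
  rw [mul_zero, mul_one] at h3
  rw [← h3, D.w_d ha, e, D.d_pt (inv_ne_zero (star_ne ha)), mul_zero]
  congr 1
  rw [norm_star_inv ha]
  field_simp

theorem exists_normal (h : Hyp G) : ∃ m z, Cw p q m z u d w ∧
    (∀ x, x ≠ 0 → z x * w * z x⁻¹ * w * z x * w = d (x • ω)) ∧
    ∀ x, x ≠ 0 → w • pt q z u 0 x = pt q z u 0 (-x⁻¹) := by
  obtain ⟨c, hc, hw⟩ := D.exists_axis h
  have hq : ∀ x, z x • q = pt q z u 0 x := fun x => by rw [pt, D.u_zero, one_smul]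
  have hp : ∀ x, z x • p = p := fun x => smul_of_mem (D.z_mem x)
  have h0 := D.pt_zero
  let R : ZMod 31 → G := fun x => z x * w * z (-(c / x)) * w * z x * w
  have hRH : ∀ x, x ≠ 0 → R x ∈ Hs p q := fun x hx => by
    have h1 := hw _ (neg_ne_zero.mpr (div_ne_zero hc hx))
    rw [show c / -(c / x) = -x by field_simp] at h1
    refine mem_Hs.mpr ⟨?_, ?_⟩
    · simp only [R, mul_smul, D.wp, hq, hw x hx, D.z_pt, neg_add_cancel, h0, D.wq, hp]
    · simp only [R, mul_smul, D.wp, D.wq, hq, D.z_pt, h1, add_neg_cancel, h0, hp]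
  obtain ⟨κ, hκ, hR1⟩ := D.d_surj _ (hRH 1 one_ne_zero)
  have hsm : ∀ {x : ZMod 31}, x ≠ 0 → x • κ ≠ 0 := fun hx => smul_ne_zero hx hκ
  have hR : ∀ x, x ≠ 0 → R x = d (x • κ) := fun x hx => by
    obtain ⟨a, ha, rfl⟩ := exists_norm_eq hx
    have ha' := inv_ne_zero (star_ne ha)
    have hwd : ∀ g, w * (d a * g) = d (star a)⁻¹ * (w * g) := fun g => by
      rw [← mul_assoc, D.wd a ha, mul_assoc]
    have hwd' : ∀ g, w * (d (star a)⁻¹ * g) = d a * (w * g) := fun g => by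
      rw [← mul_assoc, D.wd _ ha', star_inv₀, star_star, inv_inv, mul_assoc]
    have hzd : ∀ x g, d a * (z x * g) = z (norm a * x) * (d a * g) := fun x g => by
      rw [← mul_assoc, D.dz a _ ha, mul_assoc]
    have hzd' : ∀ x g, d (star a)⁻¹ * (z x * g) = z ((norm a)⁻¹ * x) * (d (star a)⁻¹ * g) :=
      fun x g => by rw [← mul_assoc, D.dz _ _ ha', mul_assoc, norm_star_inv ha]
    have hdw : d a * w = w * d (star a)⁻¹ := by
      rw [D.wd _ ha', star_inv₀, star_star, inv_inv]
    have h1 : d a * R 1 = R (norm a) * d (star a)⁻¹ := by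
      simp only [R, mul_assoc]
      rw [hzd, ← mul_assoc (d a), hdw, mul_assoc w, hzd', ← mul_assoc (d _) w, ← D.wd a ha,
        mul_assoc w, hzd, hdw, mul_one, div_one, mul_neg, div_eq_inv_mul]
    rw [← hR1, ← D.d_mul _ _ ha hκ, ← mul_inv_eq_iff_eq_mul] at h1
    rw [← h1, mul_inv_eq_iff_eq_mul, ← D.d_mul _ _ (hsm hx) ha']
    congr 1
    rw [Algebra.smul_def, algebraMap_norm_eq_mul_star]
    field_simp [star_ne ha]
  have hstar : star κ = -κ := by
    have h1 : w * (R 1)⁻¹ * w = R (-1) := by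
      have := inv_eq_of_mul_eq_one_left D.ww
      simp only [R, mul_inv_rev, ← D.z_neg, this, neg_neg, div_one, div_neg, mul_assoc]
      rw [← mul_assoc w w, D.ww, one_mul]
    have h2 : d κ * d (κ⁻¹) = 1 := by
      rw [← D.d_mul _ _ hκ (inv_ne_zero hκ), mul_inv_cancel₀ hκ, D.d_one]
    rw [← hR1, hR _ (neg_ne_zero.mpr one_ne_zero), neg_smul, one_smul, inv_eq_of_mul_eq_one_right h2,
      D.wd _ (inv_ne_zero hκ), mul_assoc, D.ww, mul_one, star_inv₀, inv_inv] at h1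
    have h3 := D.du (star κ) 1 (star_ne hκ)
    rw [h1, D.du (-κ) 1 (neg_ne_zero.mpr hκ), mul_left_inj, mul_one, mul_one] at h3
    exact (D.u_inj _ _ 0 (by rw [h3, D.z_zero, mul_one])).symm
  have hre : κ.re = 0 := by
    have h1 := congrArg QuadraticAlgebra.re hstar
    simp only [re_star, re_neg, zero_mul, add_zero] at h1
    exact mul_left_cancel₀ (show (2 : ZMod 31) ≠ 0 by decide) (by linear_combination h1)
  have hμ : κ.im ≠ 0 := fun e => hκ (by ext <;> simp [hre, e])
  have hn : norm κ * c = -1 := by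
    have h2 : (2 : ZMod 31) ≠ 0 := by decide
    have h1 : R 1 • pt q z u 0 c = pt q z u 0 (-1) := by
      have e1 := hw _ hc
      have e2 := hw _ h2
      have e3 := hw (-(c / 2)) (neg_ne_zero.mpr (div_ne_zero hc h2))
      rw [div_self hc] at e1
      rw [show c / -(c / 2) = -2 by field_simp] at e3
      simp only [R, mul_smul, e1, D.z_pt, one_add_one_eq_two, e2, div_one]
      rw [show -c + c / 2 = -(c / 2) by field_simp; ring, e3, D.z_pt]
      norm_num
    rw [← hR1, D.d_pt hκ, mul_zero] at h1
    exact (D.pt_inj h h1).2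
  rw [norm_def, hre] at hn
  refine ⟨m * κ.im, fun x => z (x / κ.im), D.rescale hμ, fun x hx => ?_, fun x hx => ?_⟩
  · have h1 := hR (x / κ.im) (div_ne_zero hx hμ)
    rw [show (x / κ.im) • κ = x • ω by ext <;> simp [hre, hμ]] at h1
    rw [← h1]
    change z (x / κ.im) * w * z (x⁻¹ / κ.im) * w * z (x / κ.im) * w = _
    rw [show x⁻¹ / κ.im = -(c / (x / κ.im)) by
      field_simp; linear_combination hn]
  · have h1 := hw (x / κ.im) (div_ne_zero hx hμ)
    rw [show c / (x / κ.im) = -x⁻¹ / κ.im by field_simp; linear_combination hn] at h1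
    exact h1

end Cw

theorem norm_one_sub (x : ZMod 31) : norm (1 - x • ω : Quad) = 1 + x * x := by
  simp [norm_def]

theorem Cw.action (D : Cw p q m z u d w) (h : Hyp G)
    (hR : ∀ x, x ≠ 0 → z x * w * z x⁻¹ * w * z x * w = d (x • ω))
    (hw : ∀ x, x ≠ 0 → w • pt q z u 0 x = pt q z u 0 (-x⁻¹)) :
    m = -2 ∧ ∀ x, w • pt q z u 1 x = pt q z u (1 - x • ω)⁻¹ (-x * norm (1 - x • ω : Quad)⁻¹) := by
  have hm1 : (-1 : Quad) ≠ 0 := neg_ne_zero.mpr one_ne_zero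
  have hx1 : ∀ x, ∃ a y, w • pt q z u 1 x = pt q z u a y := fun x => by
    obtain ⟨a, y, e, -⟩ := D.w_pt_ne h (a := 1) (x := x) (by simp)
    exact ⟨a, y, e⟩
  choose α B hα using hx1
  have hz1 : pt q z u 1 0 = u 1 • q := by rw [pt, D.z_zero, one_smul]
  have h0 : α 0 = 1 := (D.pt_inj h (by
    rw [← hα, hz1, D.wu])).1
  have h1 : ∀ x, x ≠ 0 → α x = x⁻¹ • ω * α (-x⁻¹) := fun x hx => by
    have e : z x⁻¹ • w • pt q z u 1 x = d (x⁻¹ • ω) • w • z (-x⁻¹) • pt q z u 1 0 := by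
      rw [← hR _ (inv_ne_zero hx), inv_inv]
      simp only [mul_smul, D.w_smul_w]
      rw [smul_smul (z x⁻¹) (z (-x⁻¹)), ← D.z_add, add_neg_cancel, D.z_zero, one_smul,
        hz1, D.wu, ← hz1, D.z_pt, add_zero]
    rw [D.z_pt, add_zero, hα, hα, D.z_pt, D.d_pt (smul_ne_zero (inv_ne_zero hx) (by
      intro e; simpa using congrArg QuadraticAlgebra.im e))] at e
    exact (D.pt_inj h e).1
  have h2 : ∀ x, x ≠ 0 → α x = 1 - α (-x⁻¹) ∧ B x = B (-x⁻¹) - m * (α (-x⁻¹)).im := fun x hx => by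
    have e : (u 1 * d (-1) * w) ^ 3 • pt q z u 0 x = pt q z u 0 x := by rw [D.braid, one_smul]
    simp only [pow_succ, pow_zero, one_mul, mul_smul, hw x hx, D.d_pt hm1, D.u_pt, hα,
      QuadraticAlgebra.norm_neg, map_one, mul_zero, add_zero] at e
    rw [← eq_inv_smul_iff, ← eq_inv_smul_iff, ← eq_inv_smul_iff] at e
    have hu : (u 1)⁻¹ • pt q z u 0 x = pt q z u (-1) x := by
      rw [inv_smul_eq_iff, D.u_pt]; simp
    have hd : (d (-1))⁻¹ • pt q z u (-1) x = pt q z u 1 x := by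
      rw [inv_smul_eq_iff, D.d_pt hm1]; simp
    rw [hu, hd, inv_eq_of_mul_eq_one_left D.ww, hα] at e
    have e1 := D.pt_inj h e
    simp at e1
    exact ⟨by rw [← e1.1]; ring, by rw [← e1.2]; ring⟩
  have h3 : ∀ x, α x * (1 - x • ω) = 1 := fun x => by
    by_cases hx : x = 0
    · rw [hx, h0, zero_smul, sub_zero, mul_one]
    have e1 := h1 x hx
    have e2 := (h2 x hx).1
    rw [show α (-x⁻¹) = 1 - α x by rw [e2]; ring] at e1
    rw [Algebra.smul_def, map_inv₀] at e1
    rw [Algebra.smul_def]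
    have hX : algebraMap (ZMod 31) Quad x * (algebraMap (ZMod 31) Quad x)⁻¹ = 1 :=
      mul_inv_cancel₀ (by simpa using hx)
    have hω : (ω : Quad) * ω = -1 := by rw [omega_mul_omega_eq_mk]; rfl
    linear_combination (-algebraMap (ZMod 31) Quad x * ω) * e1 - (1 - α x) * hω -
      (1 - α x) * ω * ω * hX
  have h4 : ∀ x, norm (α x) * (1 + x * x) = 1 := fun x => by
    rw [← norm_one_sub, ← map_mul, h3, map_one]
  have h5 : ∀ x, B x = -x * norm (α x) := fun x => by
    have hne : α x ≠ 0 := left_ne_zero_of_mul_eq_one (h3 x)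
    obtain ⟨y, hy⟩ : ∃ y, norm (α x) * y = B x := ⟨_, mul_div_cancel₀ _ (norm_ne hne)⟩
    have e : w • w • pt q z u 1 x = pt q z u 1 x := D.w_smul_w _
    have e1 := D.d_pt hne 1 y
    rw [mul_one, hy] at e1
    rw [hα, ← e1, D.w_d hne, hα, D.d_pt (inv_ne_zero (star_ne hne))] at e
    have e2 := (D.pt_inj h e).1
    rw [inv_mul_eq_one₀ (star_ne hne)] at e2
    have e3 := congrArg star (h3 x)
    rw [star_mul', e2, star_one] at e3
    have e4 := congrArg QuadraticAlgebra.im (mul_left_cancel₀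
      (left_ne_zero_of_mul_eq_one (h3 y)) (e3.trans (h3 y).symm))
    simp at e4
    rw [← hy, e4]; ring
  refine ⟨?_, fun x => ?_⟩
  · have e1 := (h2 1 one_ne_zero).2
    rw [h5, h5, inv_one] at e1
    have e2 := h4 1
    have e3 := h4 (-1)
    have e4 := congrArg QuadraticAlgebra.re (h3 (-1))
    have e5 := congrArg QuadraticAlgebra.im (h3 (-1))
    simp at e4 e5
    linear_combination -(2 * e1 + e2 + e3) + m * (e5 - e4)
  · rw [hα, h5, eq_inv_of_mul_eq_one_left (h3 x)]

open Classical in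
/-- The action of the involution on the points of the model. -/
noncomputable def swap : Option (Quad × ZMod 31) → Option (Quad × ZMod 31)
  | none => some (0, 0)
  | some (a, x) => if a = 0 then if x = 0 then none else some (0, -x⁻¹) else
      some ((star a)⁻¹ * (1 - ((norm a)⁻¹ * x) • ω)⁻¹,
        (norm a)⁻¹ * (-((norm a)⁻¹ * x) * norm (1 - ((norm a)⁻¹ * x) • ω : Quad)⁻¹))

/-- The generators of the model: the translations, the dilations and the involution. -/
inductive Gen : (Option (Quad × ZMod 31) → Option (Quad × ZMod 31)) → Prop
  | trans (b : Quad) (y : ZMod 31) : Gen (Option.map fun ξ =>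
      (b + ξ.1, -2 * (b.re * ξ.1.im - b.im * ξ.1.re) + (y + ξ.2)))
  | dil (c : Quad) (hc : c ≠ 0) : Gen (Option.map fun ξ => (c * ξ.1, norm c * ξ.2))
  | swap : Gen swap

/-- The model: the permutation group of the points generated by the generators. -/
def model : Subgroup (Equiv.Perm (Option (Quad × ZMod 31))) :=
  Subgroup.closure {σ | Gen σ}

theorem Hyp.exists_hom (h : Hyp G) : ∃ Φ : G →* Equiv.Perm (Option (Quad × ZMod 31)),
    Function.Injective Φ ∧ Φ.range = model := by
  obtain ⟨p, q, A, t, B, hK⟩ := h.exists_base32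
  obtain ⟨u₀, hu, hne⟩ := B.exists_mem_Iv h
  obtain ⟨w, C⟩ := B.exists_conf h hu hne
  obtain ⟨_, _, u, d, D⟩ := C.exists_cw h hK
  obtain ⟨m, z, D, hR, hw⟩ := D.exists_normal h
  obtain ⟨rfl, hα⟩ := D.action h hR hw
  let P₀ : Option (Quad × ZMod 31) → Sylow 31 G := fun ξ => ξ.elim p fun ξ => pt q z u ξ.1 ξ.2
  have hP₀ : Function.Bijective P₀ := by
    refine ⟨?_, fun r => ?_⟩
    · rintro (_ | ⟨a, x⟩) (_ | ⟨b, y⟩) e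
      · rfl
      · exact (D.pt_ne b y e.symm).elim
      · exact (D.pt_ne a x e).elim
      · obtain ⟨rfl, rfl⟩ := D.pt_inj h e
        rfl
    · by_cases hr : r = p
      · exact ⟨none, hr.symm⟩
      · obtain ⟨a, x, e⟩ := D.pt_surj h hr
        exact ⟨some (a, x), e⟩
  obtain ⟨P, hP⟩ : ∃ P : Option (Quad × ZMod 31) ≃ Sylow 31 G, ∀ ξ, P ξ = P₀ ξ :=
    ⟨Equiv.ofBijective P₀ hP₀, fun ξ => rfl⟩
  let Φ : G →* Equiv.Perm (Option (Quad × ZMod 31)) :=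
    P.symm.permCongrHom.toMonoidHom.comp (MulAction.toPermHom G (Sylow 31 G))
  have hΦ : ∀ g ξ, P (Φ g ξ) = g • P ξ := fun g ξ => P.apply_symm_apply _
  have hΦe : ∀ g (f : Option (Quad × ZMod 31) → Option (Quad × ZMod 31)),
      (∀ ξ, g • P ξ = P (f ξ)) → ⇑(Φ g) = f := fun g f e => funext fun ξ =>
    P.injective ((hΦ g ξ).trans (e ξ))
  have htr : ∀ b y, ⇑(Φ (u b * z y)) = Option.map fun ξ =>
      (b + ξ.1, -2 * (b.re * ξ.1.im - b.im * ξ.1.re) + (y + ξ.2)) := fun b y => hΦe _ _ fun ξ => by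
    rw [hP, hP]
    rcases ξ with _ | ⟨a, x⟩
    · exact smul_of_mem (mul_mem (D.u_mem b) (D.z_mem y))
    · change (u b * z y) • pt q z u a x = _
      rw [mul_smul, D.z_pt, D.u_pt]
      rfl
  have hdil : ∀ c, c ≠ 0 → ⇑(Φ (d c)) = Option.map fun ξ => (c * ξ.1, norm c * ξ.2) :=
    fun c hc => hΦe _ _ fun ξ => by
      rw [hP, hP]
      rcases ξ with _ | ⟨a, x⟩
      · exact (D.d_smul hc).1
      · exact D.d_pt hc a x
  have hsw : ⇑(Φ w) = swap := hΦe _ _ fun ξ => by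
    rw [hP, hP]
    rcases ξ with _ | ⟨a, x⟩
    · exact D.wp.trans D.pt_zero.symm
    · change w • pt q z u a x = _
      rw [swap]
      split_ifs with ha hx
      · rw [ha, hx, D.pt_zero]; exact D.wq
      · rw [ha]; exact hw x hx
      · have e := D.d_pt ha 1 ((norm a)⁻¹ * x)
        rw [mul_one, mul_inv_cancel_left₀ (norm_ne ha)] at e
        rw [← e, D.w_d ha, hα, D.d_pt (inv_ne_zero (star_ne ha)), norm_star_inv ha]
        rfl
  refine ⟨Φ, (injective_iff_map_eq_one Φ).mpr fun g hg => h.faithful fun r => ?_,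
    le_antisymm ?_ ((closure_le _).mpr fun σ hσ => ?_)⟩
  · obtain ⟨ξ, rfl⟩ := P.surjective r
    rw [← hΦ, hg]; rfl
  · have hS : ∀ g, Gen (Φ g) → g ∈ model.comap Φ :=
      fun g hg => subset_closure hg
    have hSp : ∀ g ∈ p.1, g ∈ model.comap Φ := fun g hg => by
      obtain ⟨b, y, rfl⟩ := D.surj g hg
      exact hS _ (by rw [htr]; exact .trans b y)
    have hSw : w ∈ model.comap Φ := hS _ (by rw [hsw]; exact .swap)
    have hSs : ∀ g, g • p = p → g ∈ model.comap Φ := fun g hg => by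
      obtain ⟨v, hv, hg⟩ := h.exists_decomp D.ne hg
      obtain ⟨c, hc, e⟩ := D.d_surj _ hg
      rw [← mul_inv_cancel_left v g, ← e]
      exact mul_mem (hSp v hv) (hS _ (by rw [hdil c hc]; exact .dil c hc))
    rintro _ ⟨g, rfl⟩
    change g ∈ model.comap Φ
    by_cases hg : g • p = p
    · exact hSs g hg
    · obtain ⟨v, hv, e⟩ := h.exists_smul_eq D.ne (Ne.symm hg)
      have h1 := hSs (w * v⁻¹ * g) (by rw [mul_smul, mul_smul, ← e, inv_smul_smul, D.wq])
      have h2 := mul_mem (mul_mem (hSp v hv) (inv_mem hSw)) h1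
      rwa [show v * w⁻¹ * (w * v⁻¹ * g) = g by group] at h2
  · obtain ⟨f, hf⟩ : ∃ f : Option (Quad × ZMod 31) → _, f = σ := ⟨_, rfl⟩
    have h1 : Gen f := hf ▸ hσ
    have h2 : ∀ g, ⇑(Φ g) = f → σ ∈ Φ.range := fun g e =>
      ⟨g, DFunLike.coe_injective (e.trans hf)⟩
    cases h1 with
    | trans b y => exact h2 _ (htr b y)
    | dil c hc => exact h2 _ (hdil c hc)
    | swap => exact h2 _ hsw

end Quad

theorem nonempty_mulEquiv {G H : Type*} [Group G] [Finite G] [Group H] [Finite H] (hG : Hyp G)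
    (hH : Hyp H) : Nonempty (G ≃* H) := by
  obtain ⟨Φ, hΦ, e⟩ := hG.exists_hom
  obtain ⟨Ψ, hΨ, e'⟩ := hH.exists_hom
  exact ⟨(MonoidHom.ofInjective hΦ).trans
    ((MulEquiv.subgroupCongr (e.trans e'.symm)).trans (MonoidHom.ofInjective hΨ).symm)⟩

end OD

/-- Any two finite groups of order `2^11 * 3 * 5 * 7^2 * 19 * 31^3` whose prime graphs have
vertex degrees deg 2 = 3, deg 3 = 2, deg 5 = 2, deg 7 = 1, deg 19 = 1, deg 31 = 1 are isomorphic (the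
order and degree pattern of the simple unitary group `U_3(31)`). -/
theorem od_characterization_U_3_31
    (G H : Type*) [Group G] [Finite G] [Group H] [Finite H]
    (hG : Nat.card G = 2^11 * 3 * 5 * 7^2 * 19 * 31^3)
    (hH : Nat.card H = 2^11 * 3 * 5 * 7^2 * 19 * 31^3)
    (hG2 : gkDegree G 2 = 3)
    (hG3 : gkDegree G 3 = 2)
    (hG5 : gkDegree G 5 = 2)
    (hG7 : gkDegree G 7 = 1)
    (hG19 : gkDegree G 19 = 1)
    (hG31 : gkDegree G 31 = 1)
    (hH2 : gkDegree H 2 = 3)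
    (hH3 : gkDegree H 3 = 2)
    (hH5 : gkDegree H 5 = 2)
    (hH7 : gkDegree H 7 = 1)
    (hH19 : gkDegree H 19 = 1)
    (hH31 : gkDegree H 31 = 1) :
    Nonempty (G ≃* H) :=
  OD.nonempty_mulEquiv ⟨hG, hG2, hG3, hG5, hG7, hG19, hG31⟩ ⟨hH, hH2, hH3, hH5, hH7, hH19, hH31⟩
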